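/- Let N ≥ 0, a₀ > 0 and c₀ > 0. Then there exist constants C₀ = C₀(a₀, c₀, N) > 0 and R₀ > 0 such that the following holds. Suppose V : ℝ² → ℝ satisfies |V(z)| ≤ a₀|z|^N for all z ∈ ℝ², and u : ℝ² → ℝ is a twice continuously differentiable solution of Δu − Vu = 0 on ℝ² with |u(0)| = 1 and |u(z)| ≤ exp(c₀|z|^{1+N/2}) for all z ∈ ℝ². Then for every z₀ ∈ ℝ² with |z₀| ≥ R₀, sup_{z ∈ B(z₀,1)} |u(z)| ≥ exp(−C₀ |z₀|^{1+N/2} (log|z₀|)^{3/2}). -/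

import Mathlib

/-- The Laplacian of a function `u : ℂ → ℝ`, viewing `ℂ` as `ℝ²`:
`Δu = ∂²u/∂x² + ∂²u/∂y²`. -/
noncomputable def planeLaplacian (u : ℂ → ℝ) (z : ℂ) : ℝ :=
  fderiv ℝ (fun w => fderiv ℝ u w 1) z 1
    + fderiv ℝ (fun w => fderiv ℝ u w Complex.I) z Complex.I

namespace Landis

open Complex MeasureTheory Set Filter Topology Metric

/-- Twice the Wirtinger derivative with respect to `conj z`. -/
noncomputable def db (f : ℂ → ℂ) (z : ℂ) : ℂ := fderiv ℝ f z 1 + I * fderiv ℝ f z I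

/-- The Cauchy transform, normalised as a right inverse of `db`. -/
noncomputable def cT (f : ℂ → ℂ) (z : ℂ) : ℂ := (2 * (Real.pi : ℂ))⁻¹ * ∫ ζ, f ζ / (z - ζ)

theorem integrableOn_ball_rpow (p : ℝ) (hp : p < 2) (z : ℂ) (r : ℝ) :
    IntegrableOn (fun ζ : ℂ => ‖ζ - z‖ ^ (-p)) (ball z r) := by
  have h0 : IntegrableOn (fun ζ : ℂ => ‖ζ‖ ^ (-p)) (ball 0 r) := by
    rw [integrableOn_fun_norm_addHaar (μ := volume) (f := fun x : ℝ => x ^ (-p))]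
    have : IntegrableOn (fun y : ℝ => y ^ (1 - p)) (Ioo 0 r) := by
      rcases le_or_gt r 0 with hr | hr
      · simp [Ioo_eq_empty_of_le hr]
      · rw [intervalIntegral.integrableOn_Ioo_rpow_iff hr]
        linarith
    refine this.congr_fun (fun y hy => ?_) measurableSet_Ioo
    simp only [finrank_real_complex, smul_eq_mul]
    rw [sub_eq_add_neg, Real.rpow_add hy.1]
    simp
  have := (h0.integrable_indicator measurableSet_ball).comp_sub_right z
  rw [← integrable_indicator_iff measurableSet_ball]
  refine this.congr (Eventually.of_forall fun ζ => ?_)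
  simp [indicator, dist_eq_norm]

theorem exists_integral_ball_rpow_le (p r : ℝ) :
    ∃ C > 0, ∀ z : ℂ, ∫ ζ in ball z r, ‖ζ - z‖ ^ (-p) ≤ C := by
  refine ⟨|∫ ζ in ball (0:ℂ) r, ‖ζ - 0‖ ^ (-p)| + 1, by positivity, fun z => ?_⟩
  have : ∫ ζ in ball z r, ‖ζ - z‖ ^ (-p) = ∫ ζ in ball (0:ℂ) r, ‖ζ - 0‖ ^ (-p) := by
    rw [← integral_indicator measurableSet_ball, ← integral_indicator measurableSet_ball,
      ← integral_add_right_eq_self _ z]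
    congr 1
    ext ζ
    simp [indicator, dist_eq_norm]
  rw [this]
  linarith [le_abs_self (∫ ζ in ball (0:ℂ) r, ‖ζ - 0‖ ^ (-p))]

theorem exists_radius_of_hasCompactSupport {E : Type*} [Zero E] {g : ℂ → E}
    (hg : HasCompactSupport g) (z : ℂ) :
    ∃ R > 0, ∀ w, R ≤ ‖w - z‖ → w ∉ tsupport g := by
  obtain ⟨R, hR⟩ := hg.isCompact.isBounded.subset_closedBall z
  refine ⟨|R| + 1, by positivity, fun w hw h => ?_⟩
  have := hR h
  rw [mem_closedBall, dist_eq_norm] at this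
  linarith [le_abs_self R]

theorem integrableOn_polar_of_continuous {F : ℝ × ℝ → ℂ} (hF : Continuous F) (R : ℝ)
    (h0 : ∀ p : ℝ × ℝ, R < p.1 → F p = 0) :
    IntegrableOn F (Ioi (0 : ℝ) ×ˢ Ioo (-Real.pi) Real.pi) := by
  have h1 : IntegrableOn F (Icc (0 : ℝ) R ×ˢ Icc (-Real.pi) Real.pi) :=
    hF.continuousOn.integrableOn_compact (isCompact_Icc.prod isCompact_Icc)
  refine IntegrableOn.of_forall_sdiff_eq_zero h1 (measurableSet_Ioi.prod measurableSet_Ioo) ?_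
  rintro ⟨r, θ⟩ ⟨h, h'⟩
  apply h0
  simp only [mem_prod, mem_Ioi, mem_Ioo, mem_Icc, not_and, not_le] at h h' ⊢
  by_contra hr
  have := h' ⟨h.1.le, not_lt.1 hr⟩ h.2.1.le
  linarith [h.2.2]

theorem hasDerivAt_ray {g : ℂ → ℂ} (hg : ContDiff ℝ 1 g) (z e : ℂ) (r : ℝ) :
    HasDerivAt (fun r : ℝ => g (z + r * e)) (fderiv ℝ g (z + r * e) e) r := by
  have h1 : HasDerivAt (fun r : ℝ => z + r * e) e r := by
    simpa using ((Complex.ofRealCLM.hasDerivAt (x := r)).mul_const e).const_add z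
  exact ((hg.differentiable one_ne_zero _).hasFDerivAt.comp_hasDerivAt r h1)

theorem hasDerivAt_circle {g : ℂ → ℂ} (hg : ContDiff ℝ 1 g) (z : ℂ) (r θ : ℝ) :
    HasDerivAt (fun θ : ℝ => g (z + r * exp (θ * I)))
      (r * fderiv ℝ g (z + r * exp (θ * I)) (I * exp (θ * I))) θ := by
  have h1 : HasDerivAt (fun θ : ℝ => z + r * exp (θ * I)) (r * (exp (θ * I) * I)) θ := by
    have := ((Complex.ofRealCLM.hasDerivAt (x := θ)).mul_const I).cexp
    simpa using (this.const_mul (r : ℂ)).const_add z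
  have := ((hg.differentiable one_ne_zero _).hasFDerivAt.comp_hasDerivAt θ h1)
  refine this.congr_deriv ?_
  have e := (fderiv ℝ g (z + r * exp (θ * I))).map_smul r (exp (θ * I) * I)
  rw [real_smul, real_smul] at e
  rw [e, mul_comm I]

theorem hasCompactSupport_ray {g : ℂ → ℂ} (hg : HasCompactSupport g) (z e : ℂ) (he : ‖e‖ = 1) :
    HasCompactSupport (fun r : ℝ => g (z + r * e)) := by
  obtain ⟨R, hR, h⟩ := exists_radius_of_hasCompactSupport hg z
  refine HasCompactSupport.of_support_subset_isCompact (isCompact_Icc (a := -R) (b := R)) ?_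
  intro r hr
  by_contra hc
  refine hr (image_eq_zero_of_notMem_tsupport (h _ ?_))
  rw [mem_Icc, ← abs_le, not_le] at hc
  simpa [he] using hc.le

/-- The real-linear identity expressing `db` in a rotated frame. -/
theorem clm_db_rotate (D : ℂ →L[ℝ] ℂ) (θ : ℝ) :
    (D 1 + I * D I) * (exp (θ * I))⁻¹ = D (exp (θ * I)) + I * D (I * exp (θ * I)) := by
  have e1 : exp (θ * I) = (Real.cos θ : ℝ) • (1 : ℂ) + (Real.sin θ : ℝ) • I := by
    rw [exp_mul_I]; simp
  have e2 : I * exp (θ * I) = (-Real.sin θ : ℝ) • (1 : ℂ) + (Real.cos θ : ℝ) • I := by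
    rw [exp_mul_I]; simp [mul_add]; ring_nf; simp; ring
  have e3 : (exp (θ * I))⁻¹ = Real.cos θ - Real.sin θ * I := by
    rw [← Complex.exp_neg, ← neg_mul, ← Complex.ofReal_neg, exp_mul_I]; simp; ring
  rw [e3, e2, e1]
  rw [map_add, map_add, map_smul, map_smul, map_smul, map_smul]
  simp only [real_smul]
  push_cast
  linear_combination (-(sin (θ : ℂ)) * D I) * I_sq

theorem continuous_fderiv_polar {g : ℂ → ℂ} (hg : ContDiff ℝ 1 g) (z c : ℂ) :
    Continuous fun p : ℝ × ℝ =>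
      fderiv ℝ g (z + p.1 * exp (p.2 * I)) (c * exp (p.2 * I)) := by
  have := hg.continuous_fderiv one_ne_zero
  fun_prop

theorem integral_radial_deriv {g : ℂ → ℂ} (hg : ContDiff ℝ 1 g) (hc : HasCompactSupport g)
    (z : ℂ) :
    ∫ p in Ioi (0 : ℝ) ×ˢ Ioo (-Real.pi) Real.pi,
      fderiv ℝ g (z + p.1 * exp (p.2 * I)) (1 * exp (p.2 * I)) = -(2 * Real.pi * g z) := by
  obtain ⟨R, hR, h⟩ := exists_radius_of_hasCompactSupport hc z
  have hint := integrableOn_polar_of_continuous (continuous_fderiv_polar hg z 1) R (by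
    intro p hp
    rw [fderiv_of_notMem_tsupport, zero_apply]
    refine h _ ?_
    simpa using hp.le.trans (le_abs_self _))
  rw [Measure.volume_eq_prod, ← Measure.prod_restrict, integral_prod_symm _ (by
    rwa [Measure.prod_restrict])]
  have : ∀ θ : ℝ, ∫ r in Ioi (0 : ℝ), fderiv ℝ g (z + r * exp (θ * I)) (1 * exp (θ * I))
      = - g z := by
    intro θ
    have h1 := HasCompactSupport.integral_Ioi_deriv_eq
      (f := fun r : ℝ => g (z + r * exp (θ * I)))
      (hg.comp (contDiff_const.add (ofRealCLM.contDiff.mul contDiff_const)))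
      (hasCompactSupport_ray hc z _ (by simp [Complex.norm_exp])) 0
    simp only [one_mul]
    rw [← show -g (z + (0 : ℝ) * exp (θ * I)) = -g z by simp, ← h1]
    congr 1
    ext r
    exact (hasDerivAt_ray hg z _ r).deriv.symm
  simp only [this]
  rw [integral_const]
  simp only [measureReal_restrict_apply_univ, Real.volume_real_Ioo_of_le
    (by linarith [Real.pi_pos] : -Real.pi ≤ Real.pi), real_smul]
  push_cast
  ring

theorem integral_angular_deriv {g : ℂ → ℂ} (hg : ContDiff ℝ 1 g) (hc : HasCompactSupport g)
    (z : ℂ) :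
    IntegrableOn (fun p : ℝ × ℝ =>
      fderiv ℝ g (z + p.1 * exp (p.2 * I)) (I * exp (p.2 * I)))
      (Ioi (0 : ℝ) ×ˢ Ioo (-Real.pi) Real.pi) ∧
    ∫ p in Ioi (0 : ℝ) ×ˢ Ioo (-Real.pi) Real.pi,
      fderiv ℝ g (z + p.1 * exp (p.2 * I)) (I * exp (p.2 * I)) = 0 := by
  obtain ⟨R, hR, h⟩ := exists_radius_of_hasCompactSupport hc z
  have hint := integrableOn_polar_of_continuous (continuous_fderiv_polar hg z I) R (by
    intro p hp
    rw [fderiv_of_notMem_tsupport, zero_apply]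
    refine h _ ?_
    simpa using hp.le.trans (le_abs_self _))
  refine ⟨hint, ?_⟩
  rw [Measure.volume_eq_prod, setIntegral_prod _ hint]
  rw [setIntegral_congr_fun (g := fun _ => 0) measurableSet_Ioi]
  · simp
  intro r hr
  have hr0 : (r : ℂ) ≠ 0 := by exact_mod_cast (ne_of_gt hr)
  apply mul_left_cancel₀ hr0
  simp only [mul_zero]
  rw [← integral_const_mul, ← integral_Ioc_eq_integral_Ioo,
    ← intervalIntegral.integral_of_le (by linarith [Real.pi_pos]),
    intervalIntegral.integral_eq_sub_of_hasDerivAt (f := fun θ : ℝ => g (z + r * exp (θ * I)))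
      (fun θ _ => hasDerivAt_circle hg z r θ)]
  · simp [Complex.exp_neg]
  · apply Continuous.intervalIntegrable
    have := (continuous_fderiv_polar hg z I).comp (Continuous.prodMk_right r)
    exact continuous_const.mul this

/-- The Cauchy–Pompeiu formula for compactly supported functions. -/
theorem integral_db_div {g : ℂ → ℂ} (hg : ContDiff ℝ 1 g) (hc : HasCompactSupport g) (z : ℂ) :
    ∫ ζ, db g ζ / (z - ζ) = 2 * Real.pi * g z := by
  rw [← integral_add_left_eq_self _ z, ← Complex.integral_comp_polarCoord_symm]
  have key : ∀ p ∈ polarCoord.target,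
      p.1 • (db g (z + Complex.polarCoord.symm p) / (z - (z + Complex.polarCoord.symm p))) =
      -(fderiv ℝ g (z + p.1 * exp (p.2 * I)) (1 * exp (p.2 * I)) +
        I * fderiv ℝ g (z + p.1 * exp (p.2 * I)) (I * exp (p.2 * I))) := by
    rintro ⟨r, θ⟩ hp
    have hr : (r : ℂ) ≠ 0 := by
      have : 0 < r := hp.1
      exact_mod_cast this.ne'
    have : Complex.polarCoord.symm (r, θ) = r * exp (θ * I) := by
      rw [Complex.polarCoord_symm_apply, exp_mul_I]
      simp
    rw [this, one_mul, ← clm_db_rotate, db]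
    have := Complex.exp_ne_zero (θ * I)
    simp only [real_smul]
    field_simp
    ring
  rw [setIntegral_congr_fun polarCoord.open_target.measurableSet key]
  have ht : polarCoord.target = Ioi (0 : ℝ) ×ˢ Ioo (-Real.pi) Real.pi := rfl
  obtain ⟨i1, i2⟩ := integral_angular_deriv hg hc z
  rw [ht, integral_neg]
  by_cases hi : IntegrableOn (fun p : ℝ × ℝ =>
      fderiv ℝ g (z + p.1 * exp (p.2 * I)) (1 * exp (p.2 * I)))
      (Ioi (0 : ℝ) ×ˢ Ioo (-Real.pi) Real.pi)
  · rw [integral_add hi (i1.const_mul I), integral_const_mul, i2, integral_radial_deriv hg hc]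
    ring
  · exfalso
    apply hi
    obtain ⟨R, hR, h⟩ := exists_radius_of_hasCompactSupport hc z
    exact integrableOn_polar_of_continuous (continuous_fderiv_polar hg z 1) R (by
      intro p hp
      rw [fderiv_of_notMem_tsupport, zero_apply]
      refine h _ ?_
      simpa using hp.le.trans (le_abs_self _))

theorem db_mul {f g : ℂ → ℂ} {z : ℂ} (hf : DifferentiableAt ℝ f z) (hg : DifferentiableAt ℝ g z) :
    db (fun w => f w * g w) z = db f z * g z + f z * db g z := by
  have : fderiv ℝ (fun w => f w * g w) z = f z • fderiv ℝ g z + g z • fderiv ℝ f z :=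
    fderiv_fun_mul hf hg
  rw [db, this, db, db]
  simp
  ring

theorem continuous_db {f : ℂ → ℂ} (hf : ContDiff ℝ 1 f) : Continuous (db f) := by
  have := hf.continuous_fderiv one_ne_zero
  unfold db
  fun_prop

theorem db_eq_zero_of_notMem_tsupport {f : ℂ → ℂ} {z : ℂ} (hz : z ∉ tsupport f) : db f z = 0 := by
  rw [db, fderiv_of_notMem_tsupport ℝ hz]
  simp

theorem hasCompactSupport_db {f : ℂ → ℂ} (hf : HasCompactSupport f) : HasCompactSupport (db f) :=
  HasCompactSupport.intro hf fun _ => db_eq_zero_of_notMem_tsupport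

theorem integral_mul_db {f η : ℂ → ℂ} (hf : ContDiff ℝ 1 f) (hη : ContDiff ℝ 1 η)
    (hc : HasCompactSupport η) : ∫ z, f z * db η z = -∫ z, db f z * η z := by
  have hd := hf.continuous_fderiv one_ne_zero
  have hd' := hη.continuous_fderiv one_ne_zero
  have hcd : HasCompactSupport (fderiv ℝ η) := hc.fderiv ℝ
  have i1 : ∀ v, Integrable fun z => fderiv ℝ f z v * η z := fun v =>
    (Continuous.integrable_of_hasCompactSupport (by have := hη.continuous; fun_prop)
      (hc.mul_left))
  have i2 : ∀ v, Integrable fun z => f z * fderiv ℝ η z v := fun v =>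
    (Continuous.integrable_of_hasCompactSupport (by have := hf.continuous; fun_prop)
      ((hcd.comp_left (g := fun L : ℂ →L[ℝ] ℂ => L v) (by simp)).mul_left))
  have i3 : Integrable fun z => f z * η z :=
    (hf.continuous.mul hη.continuous).integrable_of_hasCompactSupport hc.mul_left
  have key := fun v => integral_mul_fderiv_eq_neg_fderiv_mul_of_integrable (i1 v) (i2 v) i3
    (fun x _ => hf.differentiable one_ne_zero x) (fun x _ => hη.differentiable one_ne_zero x)
  have e1 : ∀ z, f z * db η z = f z * fderiv ℝ η z 1 + I * (f z * fderiv ℝ η z I) := by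
    intro z; rw [db]; ring
  have e2 : ∀ z, db f z * η z = fderiv ℝ f z 1 * η z + I * (fderiv ℝ f z I * η z) := by
    intro z; rw [db]; ring
  simp only [e1, e2]
  rw [integral_add (i2 1) ((i2 I).const_mul I), integral_add (i1 1) ((i1 I).const_mul I),
    integral_const_mul, integral_const_mul, key 1, key I]
  ring

theorem integrableOn_inv_norm_sub (x ζ : ℂ) (r : ℝ) :
    IntegrableOn (fun z : ℂ => ‖z - ζ‖⁻¹) (ball x r) := by
  have := integrableOn_ball_rpow 1 (by norm_num) ζ (r + dist x ζ)
  simp only [Real.rpow_neg_one] at this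
  refine this.mono_set (ball_subset_ball' le_rfl)

theorem exists_integral_inv_norm_sub_le (r : ℝ) :
    ∃ C > 0, ∀ x ζ : ℂ, ∫ z in ball x r, ‖z - ζ‖⁻¹ ≤ C := by
  obtain ⟨C, hC, h⟩ := exists_integral_ball_rpow_le 1 1
  simp only [Real.rpow_neg_one] at h
  refine ⟨C + volume.real (ball (0 : ℂ) r), by positivity, fun x ζ => ?_⟩
  have hi := integrableOn_inv_norm_sub ζ ζ 1
  have hi' := hi.integrable_indicator measurableSet_ball
  calc ∫ z in ball x r, ‖z - ζ‖⁻¹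
      ≤ ∫ z in ball x r, ((ball ζ 1).indicator (fun z => ‖z - ζ‖⁻¹) z + 1) := by
        refine setIntegral_mono (integrableOn_inv_norm_sub x ζ r)
          (hi'.integrableOn.add (integrableOn_const measure_ball_lt_top.ne)) fun z => ?_
        by_cases hz : z ∈ ball ζ 1
        · simp [indicator_of_mem hz]
        · rw [indicator_of_notMem hz, zero_add]
          apply inv_le_one_of_one_le₀
          simpa [dist_eq_norm] using hz
    _ = (∫ z in ball x r, (ball ζ 1).indicator (fun z => ‖z - ζ‖⁻¹) z) +
          volume.real (ball (0 : ℂ) r) := by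
        rw [integral_add hi'.integrableOn (integrableOn_const measure_ball_lt_top.ne)]
        simp [measureReal_def, Complex.volume_ball]
    _ ≤ C + volume.real (ball (0 : ℂ) r) := by
        gcongr
        refine le_trans ?_ (h ζ)
        rw [← integral_indicator (measurableSet_ball (x := ζ))]
        refine setIntegral_le_integral hi' (Eventually.of_forall fun z => ?_)
        exact indicator_nonneg (fun _ _ => by positivity) _

theorem integrable_prod_div {f : ℂ → ℂ} (hf : Integrable f) (x : ℂ) (r : ℝ) :
    Integrable (fun p : ℂ × ℂ => f p.2 / (p.1 - p.2)) ((volume.restrict (ball x r)).prod volume) := by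
  obtain ⟨C, hC, h⟩ := exists_integral_inv_norm_sub_le r
  have hm : AEStronglyMeasurable (fun p : ℂ × ℂ => f p.2 / (p.1 - p.2))
      ((volume.restrict (ball x r)).prod volume) := by
    have h1 : AEStronglyMeasurable (fun p : ℂ × ℂ => f p.2)
      ((volume.restrict (ball x r)).prod volume) := hf.aestronglyMeasurable.comp_snd
    simp only [div_eq_mul_inv]
    exact h1.mul (by fun_prop : Measurable fun p : ℂ × ℂ => (p.1 - p.2)⁻¹).aestronglyMeasurable
  rw [integrable_prod_iff' hm]
  have e : ∀ z ζ : ℂ, ‖f ζ / (z - ζ)‖ = ‖f ζ‖ * ‖z - ζ‖⁻¹ := by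
    intro z ζ; rw [norm_div, div_eq_mul_inv]
  constructor
  · refine Eventually.of_forall fun ζ => ?_
    simp only
    refine ((integrableOn_inv_norm_sub x ζ r).const_mul ‖f ζ‖).mono' ?_ ?_
    · exact (by fun_prop : Measurable fun z : ℂ => f ζ / (z - ζ)).aestronglyMeasurable
    · exact Eventually.of_forall fun z => (e z ζ).le
  · simp only [e, integral_const_mul]
    refine (hf.norm.mul_const C).mono' ?_ (Eventually.of_forall fun ζ => ?_)
    · have := hm.norm.prod_swap.integral_prod_right'
      simp only [Prod.fst_swap, Prod.snd_swap, e, integral_const_mul] at this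
      exact this
    · have h0 : 0 ≤ ∫ z in ball x r, ‖z - ζ‖⁻¹ := integral_nonneg fun _ => by positivity
      rw [Real.norm_of_nonneg (by positivity)]
      exact mul_le_mul_of_nonneg_left (h x ζ) (norm_nonneg _)

theorem ae_of_forall_ae_ball {p : ℂ → Prop}
    (h : ∀ n : ℕ, ∀ᵐ z ∂(volume.restrict (ball (0 : ℂ) n)), p z) : ∀ᵐ z, p z := by
  have := ae_restrict_iUnion_iff (μ := (volume : Measure ℂ)) (fun n : ℕ => ball (0 : ℂ) n) p |>.2 h
  rwa [iUnion_ball_nat, Measure.restrict_univ] at this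

theorem ae_integrable_div {f : ℂ → ℂ} (hf : Integrable f) :
    ∀ᵐ z : ℂ, Integrable (fun ζ => f ζ / (z - ζ)) :=
  ae_of_forall_ae_ball fun n => (integrable_prod_div hf 0 n).prod_right_ae

theorem integrableOn_cT {f : ℂ → ℂ} (hf : Integrable f) (x : ℂ) (r : ℝ) :
    IntegrableOn (cT f) (ball x r) :=
  (integrable_prod_div hf x r).integral_prod_left.const_mul _

theorem aestronglyMeasurable_cT {f : ℂ → ℂ} (hf : Integrable f) :
    AEStronglyMeasurable (cT f) := by
  have := (aestronglyMeasurable_iUnion_iff (μ := (volume : Measure ℂ)) (f := cT f)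
    (s := fun n : ℕ => ball (0 : ℂ) n)).2
    fun n => (integrableOn_cT hf 0 n).aestronglyMeasurable
  rwa [iUnion_ball_nat, Measure.restrict_univ] at this

theorem integral_cT_mul {f ξ : ℂ → ℂ} (hf : Integrable f) (hξ : Continuous ξ)
    (hc : HasCompactSupport ξ) : ∫ z, cT f z * ξ z = -∫ z, f z * cT ξ z := by
  obtain ⟨R, hR, h⟩ := exists_radius_of_hasCompactSupport hc 0
  obtain ⟨B, hB⟩ := hξ.bounded_above_of_compact_support hc
  have hi : Integrable (fun p : ℂ × ℂ => ξ p.1 * (f p.2 / (p.1 - p.2))) (volume.prod volume) := by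
    have h1 : Integrable (fun p : ℂ × ℂ => ξ p.1 * (f p.2 / (p.1 - p.2)))
        ((volume.restrict (ball 0 R)).prod volume) :=
      (integrable_prod_div hf 0 R).bdd_mul (c := B) (by fun_prop)
        (Eventually.of_forall fun p => hB p.1)
    have h2 : ((volume.restrict (ball (0:ℂ) R)).prod (volume : Measure ℂ)) =
        (volume.prod volume).restrict (ball (0:ℂ) R ×ˢ univ) := by
      rw [← Measure.prod_restrict, Measure.restrict_univ]
    rw [h2] at h1
    have h3 := IntegrableOn.of_forall_sdiff_eq_zero (t := univ) (h1 : IntegrableOn _ _ _)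
      MeasurableSet.univ ?_
    · rwa [integrableOn_univ] at h3
    · rintro ⟨z, ζ⟩ hz
      simp only [Set.mem_sdiff, mem_univ, mem_prod, true_and, and_true, mem_ball, dist_zero_right,
        not_lt] at hz
      have : ξ z = 0 := image_eq_zero_of_notMem_tsupport (h z (by simpa using hz))
      simp [this]
  have e1 : ∀ z, cT f z * ξ z = (2 * (Real.pi : ℂ))⁻¹ * ∫ ζ, ξ z * (f ζ / (z - ζ)) := by
    intro z; rw [integral_const_mul, cT]; ring
  have e2 : ∀ ζ, f ζ * cT ξ ζ = -((2 * (Real.pi : ℂ))⁻¹ * ∫ z, ξ z * (f ζ / (z - ζ))) := by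
    intro ζ
    rw [cT, ← mul_neg, ← integral_neg, mul_left_comm, ← integral_const_mul]
    congr 2
    ext z
    rw [← neg_sub z ζ]
    simp only [div_eq_mul_inv, inv_neg]
    ring
  simp only [e1, e2, integral_neg, neg_neg]
  rw [integral_const_mul, integral_const_mul]
  rw [integral_integral_swap (f := fun z ζ => ξ z * (f ζ / (z - ζ))) hi]

theorem locallyIntegrable_inv : LocallyIntegrable (fun z : ℂ => z⁻¹) := by
  intro x
  refine ⟨ball x 1, ball_mem_nhds x one_pos, ?_⟩
  refine (integrableOn_inv_norm_sub x 0 1).mono' (by fun_prop) (Eventually.of_forall fun z => ?_)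
  simp

theorem cT_eq_convolution (f : ℂ → ℂ) :
    cT f = fun z => (2 * (Real.pi : ℂ))⁻¹ *
      (convolution (fun z : ℂ => z⁻¹) f (ContinuousLinearMap.mul ℝ ℂ) volume) z := by
  ext z
  rw [cT, convolution, ← integral_sub_left_eq_self _ _ z]
  congr 2
  ext ζ
  simp [div_eq_mul_inv, mul_comm]

theorem contDiff_cT {ξ : ℂ → ℂ} (hξ : ContDiff ℝ 2 ξ) (hc : HasCompactSupport ξ) :
    ContDiff ℝ 2 (cT ξ) := by
  rw [cT_eq_convolution]
  exact contDiff_const.mul (hc.contDiff_convolution_right (n := 2) _ locallyIntegrable_inv hξ)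

theorem db_cT {ξ : ℂ → ℂ} (hξ : ContDiff ℝ 1 ξ) (hc : HasCompactSupport ξ) (z : ℂ) :
    db (cT ξ) z = ξ z := by
  have h1 := hc.hasFDerivAt_convolution_right (ContinuousLinearMap.mul ℝ ℂ)
    locallyIntegrable_inv hξ z
  have hi : ∀ v, Integrable fun t : ℂ => t⁻¹ * fderiv ℝ ξ (z - t) v := by
    intro v
    have hcd : HasCompactSupport fun w => fderiv ℝ ξ w v :=
      (hc.fderiv ℝ).comp_left (g := fun L : ℂ →L[ℝ] ℂ => L v) (by simp)
    have := (hcd.convolutionExists_right (ContinuousLinearMap.mul ℝ ℂ) locallyIntegrable_inv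
      (by have := hξ.continuous_fderiv one_ne_zero; fun_prop)) z
    exact this
  have hi2 := (hc.fderiv ℝ).convolutionExists_right
    ((ContinuousLinearMap.mul ℝ ℂ).precompR ℂ) locallyIntegrable_inv
      (hξ.continuous_fderiv one_ne_zero) z
  have h2 : ∀ v, fderiv ℝ (cT ξ) z v =
      (2 * (Real.pi : ℂ))⁻¹ * ∫ t : ℂ, t⁻¹ * fderiv ℝ ξ (z - t) v := by
    intro v
    rw [cT_eq_convolution, (h1.const_mul _).fderiv, smul_apply, smul_eq_mul,
      convolution, ContinuousLinearMap.integral_apply hi2]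
    simp
  rw [db, h2, h2, mul_left_comm, ← mul_add, ← integral_const_mul, ← integral_add (hi 1)
    ((hi I).const_mul I)]
  have := integral_db_div hξ hc z
  rw [← integral_sub_left_eq_self _ _ z] at this
  have e : ∀ a : ℂ, a⁻¹ * fderiv ℝ ξ (z - a) 1 + I * (a⁻¹ * fderiv ℝ ξ (z - a) I) =
      db ξ (z - a) / (z - (z - a)) := by
    intro a
    rw [db, sub_sub_cancel]
    ring
  have hpi : (2 * (Real.pi : ℂ)) ≠ 0 := by simp [Real.pi_ne_zero]
  simp only [e]
  rw [this]
  field_simp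

/-- `F` has weak `db`-derivative `f`. -/
def WeakDb (F f : ℂ → ℂ) : Prop :=
  ∀ η : ℂ → ℂ, ContDiff ℝ 2 η → HasCompactSupport η → ∫ z, F z * db η z = -∫ z, f z * η z

theorem exists_cutoff_of_isCompact {K : Set ℂ} (hK : IsCompact K) :
    ∃ χ : ℂ → ℝ, ContDiff ℝ 2 χ ∧ HasCompactSupport χ ∧ ∀ z ∈ K, χ =ᶠ[𝓝 z] 1 := by
  obtain ⟨R, hR⟩ := hK.isBounded.subset_ball 0
  have hlt : max R 1 < max R 1 + 1 := by linarith
  let b : ContDiffBump (0 : ℂ) := ⟨max R 1, max R 1 + 1, by positivity, hlt⟩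
  refine ⟨b, b.contDiff, b.hasCompactSupport, fun z hz => ?_⟩
  refine b.eventuallyEq_one_of_mem_ball ?_
  exact ball_subset_ball (le_max_left _ _) (hR hz)

theorem contDiff_ofReal_comp {f : ℂ → ℝ} {n : WithTop ℕ∞} (hf : ContDiff ℝ n f) :
    ContDiff ℝ n (fun z => (f z : ℂ)) := ofRealCLM.contDiff.comp hf

theorem weakDb_cT {f : ℂ → ℂ} (hf : Integrable f) : WeakDb (cT f) f := by
  intro η hη hc
  have h1 : ContDiff ℝ 1 η := hη.of_le (by norm_num)
  rw [integral_cT_mul hf (continuous_db h1) (hasCompactSupport_db hc)]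
  have hpi : (2 * (Real.pi : ℂ)) ≠ 0 := by simp [Real.pi_ne_zero]
  congr 2
  ext z
  rw [cT, integral_db_div h1 hc]
  field_simp

theorem ae_eq_cT_of_weakDb {F f : ℂ → ℂ} {K : Set ℂ} (hK : IsCompact K) (hF : Integrable F)
    (hf : Integrable f) (hFK : ∀ z ∉ K, F z = 0) (hfK : ∀ z ∉ K, f z = 0) (h : WeakDb F f) :
    F =ᵐ[volume] cT f := by
  obtain ⟨χ, hχ, hχc, hχ1⟩ := exists_cutoff_of_isCompact hK
  refine ae_eq_of_integral_contDiff_smul_eq hF.locallyIntegrable ?_ fun g hg hgc => ?_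
  · intro x
    exact ⟨ball x 1, ball_mem_nhds x one_pos, integrableOn_cT hf x 1⟩
  have hg2 : ContDiff ℝ 2 g := contDiff_infty.1 hg 2
  have hξ : ContDiff ℝ 2 (fun z => (g z : ℂ)) := contDiff_ofReal_comp hg2
  have hξ1 : ContDiff ℝ 1 (fun z => (g z : ℂ)) := hξ.of_le (by norm_num)
  have hξc : HasCompactSupport (fun z => (g z : ℂ)) := hgc.comp_left (g := fun x : ℝ => (x : ℂ)) (by simp)
  have hη : ContDiff ℝ 2 (fun z => (χ z : ℂ) * cT (fun z => (g z : ℂ)) z) :=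
    (contDiff_ofReal_comp hχ).mul (contDiff_cT hξ hξc)
  have hηc : HasCompactSupport (fun z => (χ z : ℂ) * cT (fun z => (g z : ℂ)) z) :=
    (hχc.comp_left (g := fun x : ℝ => (x : ℂ)) (by simp)).mul_right
  have key := h _ hη hηc
  have e1 : ∀ z, F z * db (fun z => (χ z : ℂ) * cT (fun z => (g z : ℂ)) z) z = g z • F z := by
    intro z
    by_cases hz : z ∈ K
    · have : (fun z => (χ z : ℂ) * cT (fun z => (g z : ℂ)) z) =ᶠ[𝓝 z]
          cT (fun z => (g z : ℂ)) := by
        filter_upwards [hχ1 z hz] with w hw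
        simp [hw]
      have hd : db (fun z => (χ z : ℂ) * cT (fun z => (g z : ℂ)) z) z = g z := by
        rw [← db_cT hξ1 hξc z]
        simp only [db, this.fderiv_eq]
      rw [hd, real_smul, mul_comm]
    · simp [hFK z hz]
  have e2 : ∀ z, f z * ((χ z : ℂ) * cT (fun z => (g z : ℂ)) z) =
      f z * cT (fun z => (g z : ℂ)) z := by
    intro z
    by_cases hz : z ∈ K
    · simp [(hχ1 z hz).eq_of_nhds]
    · simp [hfK z hz]
  simp only [e1, e2] at key
  rw [key, ← integral_cT_mul hf hξ1.continuous hξc]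
  simp only [real_smul, mul_comm]

theorem WeakDb.congr_ae {F f F' f' : ℂ → ℂ} (h : WeakDb F f) (hF : F =ᵐ[volume] F')
    (hf : f =ᵐ[volume] f') : WeakDb F' f' := by
  intro η hη hc
  have e1 : ∫ z, F' z * db η z = ∫ z, F z * db η z :=
    integral_congr_ae (hF.mono fun z hz => by simp only [hz])
  have e2 : ∫ z, f' z * η z = ∫ z, f z * η z :=
    integral_congr_ae (hf.mono fun z hz => by simp only [hz])
  rw [e1, e2, h η hη hc]

theorem norm_cT_le {A : ℂ → ℂ} {S : ℝ} {z : ℂ} (hSb : ∫ ζ, ‖A ζ / (z - ζ)‖ ≤ S) : ‖cT A z‖ ≤ S := by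
  rw [cT, norm_mul]
  have h1 : ‖(2 * (Real.pi : ℂ))⁻¹‖ ≤ 1 := by
    rw [norm_inv]
    apply inv_le_one_of_one_le₀
    simp only [norm_mul, Complex.norm_ofNat, Complex.norm_real, Real.norm_eq_abs,
      abs_of_pos Real.pi_pos]
    linarith [Real.pi_gt_three]
  calc _ ≤ 1 * ‖∫ ζ, A ζ / (z - ζ)‖ := by gcongr
    _ ≤ S := by rw [one_mul]; exact (norm_integral_le_integral_norm _).trans hSb

theorem ae_prod_ne (z : ℂ) : ∀ᵐ p : ℂ × ℂ ∂(volume.prod volume), p.1 ≠ p.2 ∧ p.1 ≠ z ∧ p.2 ≠ z := by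
  have h1 : MeasurableSet {p : ℂ × ℂ | p.1 ≠ p.2 ∧ p.1 ≠ z ∧ p.2 ≠ z} := by
    refine MeasurableSet.inter ?_ (MeasurableSet.inter ?_ ?_)
    · exact (measurableSet_eq_fun measurable_fst measurable_snd).compl
    · exact (measurableSet_eq_fun measurable_fst measurable_const).compl
    · exact (measurableSet_eq_fun measurable_snd measurable_const).compl
  rw [Measure.ae_prod_iff_ae_ae h1]
  filter_upwards [Measure.ae_ne volume z] with x hx
  filter_upwards [Measure.ae_ne volume z, Measure.ae_ne volume x] with y hy hy'
  exact ⟨hy'.symm, hx, hy⟩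

theorem cT_mul_cT {α A : ℂ → ℂ} {S : ℝ} (hα : Integrable α) (hA : Integrable A)
    (hS : ∀ z, Integrable (fun ζ => A ζ / (z - ζ))) (hSb : ∀ z, ∫ ζ, ‖A ζ / (z - ζ)‖ ≤ S) :
    ∀ᵐ z, cT α z * cT A z = cT (fun ζ => cT A ζ * α ζ + A ζ * cT α ζ) z := by
  filter_upwards [ae_integrable_div hα] with z hz
  let G : ℂ × ℂ → ℂ := fun p => α p.1 / (z - p.1) * (A p.2 / (z - p.2))
  let G1 : ℂ × ℂ → ℂ := fun p => α p.1 / (z - p.1) * (A p.2 / (p.1 - p.2))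
  let G2 : ℂ × ℂ → ℂ := fun p => A p.2 / (z - p.2) * (α p.1 / (p.2 - p.1))
  have hG : Integrable G (volume.prod volume) := hz.mul_prod (hS z)
  have hm : AEStronglyMeasurable G1 (volume.prod volume) := by
    have h1 : AEStronglyMeasurable (fun p : ℂ × ℂ => α p.1 / (z - p.1)) (volume.prod volume) :=
      hz.aestronglyMeasurable.comp_fst
    have h2 : AEStronglyMeasurable (fun p : ℂ × ℂ => A p.2) (volume.prod volume) :=
      hA.aestronglyMeasurable.comp_snd
    have h3 : AEStronglyMeasurable (fun p : ℂ × ℂ => (p.1 - p.2)⁻¹) (volume.prod volume) :=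
      (by fun_prop : Measurable fun p : ℂ × ℂ => (p.1 - p.2)⁻¹).aestronglyMeasurable
    refine (h1.mul (h2.mul h3)).congr (Eventually.of_forall fun p => ?_)
    simp [G1, div_eq_mul_inv]
  have hG1 : Integrable G1 (volume.prod volume) := by
    rw [integrable_prod_iff hm]
    refine ⟨Eventually.of_forall fun ζ => (hS ζ).const_mul (α ζ / (z - ζ)), ?_⟩
    refine (hz.norm.mul_const S).mono' hm.norm.integral_prod_right' (Eventually.of_forall fun ζ => ?_)
    simp only [G1, norm_mul, integral_const_mul]
    rw [norm_norm, Real.norm_of_nonneg (integral_nonneg fun _ => norm_nonneg _)]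
    exact mul_le_mul_of_nonneg_left (hSb ζ) (norm_nonneg _)
  have hae : ∀ᵐ p ∂((volume : Measure ℂ).prod volume), G p - G1 p = G2 p := by
    filter_upwards [ae_prod_ne z] with p hp
    have a1 : z - p.1 ≠ 0 := sub_ne_zero.2 hp.2.1.symm
    have a2 : z - p.2 ≠ 0 := sub_ne_zero.2 hp.2.2.symm
    have a3 : p.1 - p.2 ≠ 0 := sub_ne_zero.2 hp.1
    have a4 : p.2 - p.1 ≠ 0 := sub_ne_zero.2 hp.1.symm
    simp only [G, G1, G2]
    rw [← neg_sub p.1 p.2]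
    field_simp
    ring
  have hG2 : Integrable G2 (volume.prod volume) := (hG.sub hG1).congr hae
  have i0 : ∫ p, G p ∂(volume.prod volume) = (∫ ζ, α ζ / (z - ζ)) * ∫ ζ, A ζ / (z - ζ) :=
    integral_prod_mul (fun ζ => α ζ / (z - ζ)) (fun ζ => A ζ / (z - ζ))
  have i1 : ∫ p, G1 p ∂(volume.prod volume) =
      2 * Real.pi * ∫ ζ, cT A ζ * α ζ / (z - ζ) := by
    rw [integral_prod _ hG1, ← integral_const_mul]
    congr 1
    ext ζ
    simp only [G1, integral_const_mul, cT]
    have := Real.pi_ne_zero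
    field_simp
  have i2 : ∫ p, G2 p ∂(volume.prod volume) =
      2 * Real.pi * ∫ ζ, A ζ * cT α ζ / (z - ζ) := by
    rw [integral_prod_symm _ hG2, ← integral_const_mul]
    congr 1
    ext ζ
    simp only [G2, integral_const_mul, cT]
    have := Real.pi_ne_zero
    field_simp
  have j1 : Integrable fun ζ => cT A ζ * α ζ / (z - ζ) := by
    have := hG1.integral_prod_left.const_mul (2 * (Real.pi : ℂ))⁻¹
    refine this.congr (Eventually.of_forall fun ζ => ?_)
    simp only [G1, integral_const_mul, cT]
    ring
  have j2 : Integrable fun ζ => A ζ * cT α ζ / (z - ζ) := by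
    have := hG2.integral_prod_right.const_mul (2 * (Real.pi : ℂ))⁻¹
    refine this.congr (Eventually.of_forall fun ζ => ?_)
    simp only [G2, integral_const_mul, cT]
    ring
  have e : ∫ p, G p ∂(volume.prod volume) =
      (∫ p, G1 p ∂(volume.prod volume)) + ∫ p, G2 p ∂(volume.prod volume) := by
    rw [← integral_add hG1 hG2]
    refine integral_congr_ae (hae.mono fun p hp => ?_)
    simp only [← hp]
    ring
  rw [i0, i1, i2, ← mul_add, ← integral_add j1 j2] at e
  simp only [← add_div] at e
  have hpi : (2 * (Real.pi : ℂ)) ≠ 0 := by simp [Real.pi_ne_zero]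
  rw [cT, cT, cT, mul_mul_mul_comm, e]
  field_simp

theorem weakDb_cT_mul {w α A : ℂ → ℂ} {K : Set ℂ} {S : ℝ} (hK : IsCompact K)
    (hw : Integrable w) (hα : Integrable α) (hA : Integrable A)
    (hAw : Integrable fun z => A z * w z)
    (hwK : ∀ z ∉ K, w z = 0) (hαK : ∀ z ∉ K, α z = 0) (h : WeakDb w α)
    (hS : ∀ z, Integrable (fun ζ => A ζ / (z - ζ))) (hSb : ∀ z, ∫ ζ, ‖A ζ / (z - ζ)‖ ≤ S) :
    WeakDb (fun z => cT A z * w z) (fun z => cT A z * α z + A z * w z) := by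
  have h1 := ae_eq_cT_of_weakDb hK hw hα hwK hαK h
  have h2 : (fun ζ => cT A ζ * α ζ + A ζ * cT α ζ) =ᵐ[volume]
      fun z => cT A z * α z + A z * w z := by
    filter_upwards [h1] with z hz
    rw [hz]
  have h3 : Integrable fun z => cT A z * α z + A z * w z :=
    (hα.bdd_mul (aestronglyMeasurable_cT hA) (Eventually.of_forall fun z => norm_cT_le (hSb z))).add
      hAw
  refine (weakDb_cT h3).congr_ae ?_ EventuallyEq.rfl
  filter_upwards [cT_mul_cT hα hA hS hSb, h1] with z hz hz1
  have : cT (fun ζ => cT A ζ * α ζ + A ζ * cT α ζ) z = cT (fun z => cT A z * α z + A z * w z) z := by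
    rw [cT, cT]
    congr 1
    exact integral_congr_ae (h2.mono fun ζ hζ => by simp only [hζ])
  rw [← this, ← hz, hz1, mul_comm]

theorem integrable_bdd_mul_weak {f g : ℂ → ℂ} (hf : Integrable f) (hg : Continuous g)
    (hc : HasCompactSupport g) : Integrable fun z => f z * g z := by
  obtain ⟨B, hB⟩ := hg.bounded_above_of_compact_support hc
  exact hf.mul_bdd (c := B) hg.aestronglyMeasurable (Eventually.of_forall hB)

theorem WeakDb.sub_const_mul {F f G g : ℂ → ℂ} (c : ℂ) (h : WeakDb F f) (h' : WeakDb G g)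
    (hF : Integrable F) (hf : Integrable f) (hG : Integrable G) (hg : Integrable g) :
    WeakDb (fun z => F z - c * G z) (fun z => f z - c * g z) := by
  intro η hη hc
  have h1 : ContDiff ℝ 1 η := hη.of_le (by norm_num)
  have a : ∀ f : ℂ → ℂ, Integrable f → Integrable fun z => f z * db η z := fun f hf =>
    integrable_bdd_mul_weak hf (continuous_db h1) (hasCompactSupport_db hc)
  have b : ∀ f : ℂ → ℂ, Integrable f → Integrable fun z => f z * η z := fun f hf =>
    integrable_bdd_mul_weak hf hη.continuous hc
  have e1 : ∫ z, (F z - c * G z) * db η z = (∫ z, F z * db η z) - c * ∫ z, G z * db η z := by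
    rw [← integral_const_mul, ← integral_sub (a F hF) ((a G hG).const_mul c)]
    congr 1
    ext z
    ring
  have e2 : ∫ z, (f z - c * g z) * η z = (∫ z, f z * η z) - c * ∫ z, g z * η z := by
    rw [← integral_const_mul, ← integral_sub (b f hf) ((b g hg).const_mul c)]
    congr 1
    ext z
    ring
  rw [e1, e2, h η hη hc, h' η hη hc]
  ring

theorem weakDb_pow {w α A : ℂ → ℂ} {K : Set ℂ} {S : ℝ} (hK : IsCompact K)
    (hw : Integrable w) (hα : Integrable α) (hA : Integrable A)
    (hAw : Integrable fun z => A z * w z)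
    (hwK : ∀ z ∉ K, w z = 0) (hαK : ∀ z ∉ K, α z = 0) (h : WeakDb w α)
    (hS : ∀ z, Integrable (fun ζ => A ζ / (z - ζ))) (hSb : ∀ z, ∫ ζ, ‖A ζ / (z - ζ)‖ ≤ S)
    (c : ℂ) (m : ℕ) :
    WeakDb (fun z => (1 - c * cT A z) ^ (m + 1) * w z)
      (fun z => (1 - c * cT A z) ^ (m + 1) * α z -
        (m + 1) * c * ((1 - c * cT A z) ^ m * (A z * w z))) := by
  have hb : ∀ (k : ℕ) (z : ℂ), ‖(1 - c * cT A z) ^ k‖ ≤ (1 + ‖c‖ * S) ^ k := by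
    intro k z
    rw [norm_pow]
    gcongr
    refine (norm_sub_le _ _).trans ?_
    rw [norm_one, norm_mul]
    gcongr
    exact norm_cT_le (hSb z)
  have hbm : ∀ {f : ℂ → ℂ} (k : ℕ), Integrable f →
      Integrable fun z => (1 - c * cT A z) ^ k * f z := by
    intro f k hf
    refine hf.bdd_mul ?_ (Eventually.of_forall (hb k))
    exact (aestronglyMeasurable_const.sub ((aestronglyMeasurable_cT hA).const_mul c)).pow k
  have hbs : ∀ {f : ℂ → ℂ}, Integrable f → Integrable fun z => cT A z * f z := fun hf =>
    hf.bdd_mul (aestronglyMeasurable_cT hA) (Eventually.of_forall fun z => norm_cT_le (hSb z))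
  induction m with
  | zero =>
    have h1 := weakDb_cT_mul hK hw hα hA hAw hwK hαK h hS hSb
    have h2 := h.sub_const_mul c h1 hw hα (hbs hw) ((hbs hα).add hAw)
    convert h2 using 2 <;> · push_cast; ring
  | succ m ih =>
    have iw : Integrable fun z => (1 - c * cT A z) ^ (m + 1) * w z := hbm _ hw
    have iα : Integrable fun z => (1 - c * cT A z) ^ (m + 1) * α z -
        (m + 1) * c * ((1 - c * cT A z) ^ m * (A z * w z)) :=
      (hbm _ hα).sub ((hbm _ hAw).const_mul _)
    have iA : Integrable fun z => A z * ((1 - c * cT A z) ^ (m + 1) * w z) := by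
      refine (hbm (m + 1) hAw).congr (Eventually.of_forall fun z => ?_)
      simp only
      ring
    have h1 := weakDb_cT_mul hK iw iα hA iA (fun z hz => by simp [hwK z hz])
      (fun z hz => by simp [hwK z hz, hαK z hz]) ih hS hSb
    have h2 := ih.sub_const_mul c h1 iw iα (hbs iw) ((hbs iα).add iA)
    convert h2 using 2 <;> · push_cast; ring

/-- Gauge transformation: multiplying by `exp (-cT A)` removes the term `A w`. -/
theorem weakDb_exp_cT {w α A : ℂ → ℂ} {K : Set ℂ} {S : ℝ} (hK : IsCompact K)
    (hw : Integrable w) (hα : Integrable α) (hA : Integrable A)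
    (hAw : Integrable fun z => A z * w z)
    (hwK : ∀ z ∉ K, w z = 0) (hαK : ∀ z ∉ K, α z = 0) (h : WeakDb w α)
    (hS : ∀ z, Integrable (fun ζ => A ζ / (z - ζ))) (hSb : ∀ z, ∫ ζ, ‖A ζ / (z - ζ)‖ ≤ S) :
    WeakDb (fun z => exp (-cT A z) * w z) (fun z => exp (-cT A z) * (α z - A z * w z)) := by
  have hS0 : 0 ≤ S := (norm_nonneg _).trans (norm_cT_le (hSb 0))
  have hmeas := aestronglyMeasurable_cT hA
  intro η hη hc
  have h1 : ContDiff ℝ 1 η := hη.of_le (by norm_num)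
  let c : ℕ → ℂ := fun m => 1 / ((m + 1 : ℕ) : ℂ)
  have hcn : ∀ m, ‖c m‖ = 1 / ((m : ℝ) + 1) := by
    intro m
    simp only [c, norm_div, norm_one, Complex.norm_natCast]
    push_cast
    rfl
  have hb : ∀ (m k : ℕ) (z : ℂ), k ≤ m + 1 → ‖(1 - c m * cT A z) ^ k‖ ≤ Real.exp S := by
    intro m k z hk
    rw [norm_pow]
    have h2 : ‖1 - c m * cT A z‖ ≤ 1 + S / (m + 1) := by
      refine (norm_sub_le _ _).trans ?_
      rw [norm_one, norm_mul, hcn, one_div_mul_eq_div]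
      gcongr
      exact norm_cT_le (hSb z)
    calc ‖1 - c m * cT A z‖ ^ k ≤ (1 + S / (m + 1)) ^ k := by gcongr
      _ ≤ (1 + S / (m + 1)) ^ (m + 1) := by
          apply pow_le_pow_right₀ _ hk
          have : 0 ≤ S / (m + 1) := by positivity
          linarith
      _ ≤ (Real.exp (S / (m + 1))) ^ (m + 1) := by
          gcongr
          linarith [Real.add_one_le_exp (S / (m + 1))]
      _ = Real.exp S := by
          rw [← Real.exp_nat_mul]
          congr 1
          push_cast
          field_simp
  have hl1 : ∀ z, Tendsto (fun m => (1 - c m * cT A z) ^ (m + 1)) atTop (𝓝 (exp (-cT A z))) := by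
    intro z
    have := (tendsto_add_atTop_iff_nat 1).2 (Complex.tendsto_one_add_div_pow_exp (-cT A z))
    refine this.congr fun m => ?_
    congr 1
    simp only [c]
    ring
  have hc0 : Tendsto c atTop (𝓝 0) := by
    have := tendsto_one_div_add_atTop_nhds_zero_nat (𝕜 := ℂ)
    simpa [c] using this
  have hl2 : ∀ z, Tendsto (fun m => (1 - c m * cT A z) ^ m) atTop (𝓝 (exp (-cT A z))) := by
    intro z
    have hx : Tendsto (fun m => 1 - c m * cT A z) atTop (𝓝 (1 - 0 * cT A z)) :=
      tendsto_const_nhds.sub (hc0.mul_const _)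
    have := (hl1 z).div hx (by simp)
    simp only [zero_mul, sub_zero, div_one] at this
    refine this.congr' ?_
    have hne : ∀ᶠ m in atTop, 1 - c m * cT A z ≠ 0 := hx.eventually_ne (by simp)
    filter_upwards [hne] with m hm
    rw [Pi.div_apply, pow_succ, mul_div_assoc, div_self hm, mul_one]
  have key := fun m => weakDb_pow hK hw hα hA hAw hwK hαK h hS hSb (c m) m η hη hc
  have hcm : ∀ m : ℕ, ((m : ℂ) + 1) * c m = 1 := by
    intro m
    have : ((m : ℂ) + 1) ≠ 0 := by exact_mod_cast Nat.succ_ne_zero m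
    simp only [c]
    push_cast
    field_simp
  simp only [hcm, one_mul] at key
  have hmp : ∀ (m k : ℕ), AEStronglyMeasurable (fun z => (1 - c m * cT A z) ^ k) volume :=
    fun m k => (aestronglyMeasurable_const.sub (hmeas.const_mul (c m))).pow k
  have iw := integrable_bdd_mul_weak hw (continuous_db h1) (hasCompactSupport_db hc)
  have iα := integrable_bdd_mul_weak hα hη.continuous hc
  have iA := integrable_bdd_mul_weak hAw hη.continuous hc
  have L1 : Tendsto (fun m => ∫ z, (1 - c m * cT A z) ^ (m + 1) * w z * db η z) atTop
      (𝓝 (∫ z, exp (-cT A z) * w z * db η z)) := by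
    refine tendsto_integral_of_dominated_convergence (fun z => Real.exp S * ‖w z * db η z‖) ?_
      (iw.norm.const_mul _) ?_ ?_
    · intro m
      simp only [mul_assoc]
      exact (hmp m _).mul iw.aestronglyMeasurable
    · intro m
      refine Eventually.of_forall fun z => ?_
      rw [mul_assoc, norm_mul]
      gcongr
      exact hb m _ z le_rfl
    · refine Eventually.of_forall fun z => ?_
      exact ((hl1 z).mul_const _).mul_const _
  have L2 : Tendsto (fun m => ∫ z, ((1 - c m * cT A z) ^ (m + 1) * α z -
      (1 - c m * cT A z) ^ m * (A z * w z)) * η z) atTop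
      (𝓝 (∫ z, exp (-cT A z) * (α z - A z * w z) * η z)) := by
    refine tendsto_integral_of_dominated_convergence
      (fun z => Real.exp S * ‖α z * η z‖ + Real.exp S * ‖A z * w z * η z‖) ?_
      ((iα.norm.const_mul _).add (iA.norm.const_mul _)) ?_ ?_
    · intro m
      simp only [sub_mul, mul_assoc]
      simp only [mul_assoc] at iA
      exact ((hmp m _).mul iα.aestronglyMeasurable).sub ((hmp m _).mul iA.aestronglyMeasurable)
    · intro m
      refine Eventually.of_forall fun z => ?_
      rw [sub_mul, mul_assoc, mul_assoc _ (A z * w z)]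
      refine (norm_sub_le _ _).trans ?_
      rw [norm_mul ((1 - c m * cT A z) ^ (m + 1)), norm_mul ((1 - c m * cT A z) ^ m)]
      gcongr
      · exact hb m _ z le_rfl
      · exact hb m _ z (Nat.le_succ m)
    · refine Eventually.of_forall fun z => ?_
      simp only [mul_sub]
      exact (((hl1 z).mul_const _).sub ((hl2 z).mul_const _)).mul_const _
  exact tendsto_nhds_unique L1 (L2.neg.congr fun m => (key m).symm)

theorem differentiableOn_cT {f : ℂ → ℂ} {U : Set ℂ} (hf : Integrable f) (hU : IsOpen U)
    (h0 : ∀ z ∈ U, f z = 0) : DifferentiableOn ℂ (cT f) U := by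
  intro z₀ hz₀
  obtain ⟨ρ, hρ, hball⟩ := Metric.isOpen_iff.1 hU z₀ hz₀
  have hsep : ∀ z ∈ ball z₀ (ρ / 2), ∀ ζ, f ζ ≠ 0 → ρ / 2 ≤ ‖z - ζ‖ := by
    intro z hz ζ hζ
    by_contra hlt
    push Not at hlt
    refine hζ (h0 ζ (hball ?_))
    rw [mem_ball] at hz ⊢
    have : dist ζ z < ρ / 2 := by rwa [dist_comm, dist_eq_norm]
    linarith [dist_triangle ζ z z₀]
  have hm : ∀ z, AEStronglyMeasurable (fun ζ => f ζ / (z - ζ)) volume := by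
    intro z
    simp only [div_eq_mul_inv]
    exact hf.aestronglyMeasurable.mul
      (by fun_prop : Measurable fun ζ : ℂ => (z - ζ)⁻¹).aestronglyMeasurable
  have key := hasDerivAt_integral_of_dominated_loc_of_deriv_le (𝕜 := ℂ) (μ := volume)
    (F := fun z ζ => f ζ / (z - ζ)) (F' := fun z ζ => -(f ζ / (z - ζ) ^ 2)) (x₀ := z₀)
    (s := ball z₀ (ρ / 2)) (bound := fun ζ => ‖f ζ‖ * ((ρ / 2) ^ 2)⁻¹)
    (ball_mem_nhds z₀ (by positivity)) (Eventually.of_forall hm) ?_ ?_ ?_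
    (hf.norm.mul_const _) ?_
  · exact (key.2.differentiableAt.const_mul _).differentiableWithinAt
  · refine (hf.norm.mul_const (ρ / 2)⁻¹).mono' (hm z₀) (Eventually.of_forall fun ζ => ?_)
    rw [norm_div, div_eq_mul_inv]
    by_cases hζ : f ζ = 0
    · simp [hζ]
    · gcongr
      exact hsep z₀ (mem_ball_self (by positivity)) ζ hζ
  · simp only [div_eq_mul_inv]
    exact (hf.aestronglyMeasurable.mul
      (by fun_prop : Measurable fun ζ : ℂ => ((z₀ - ζ) ^ 2)⁻¹).aestronglyMeasurable).neg
  · refine Eventually.of_forall fun ζ z hz => ?_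
    rw [norm_neg, norm_div, norm_pow, div_eq_mul_inv]
    by_cases hζ : f ζ = 0
    · simp [hζ]
    · gcongr
      exact hsep z hz ζ hζ
  · refine Eventually.of_forall fun ζ z hz => ?_
    by_cases hζ : f ζ = 0
    · simpa [hζ] using hasDerivAt_const z (0 : ℂ)
    · have hne : z - ζ ≠ 0 := by
        have := hsep z hz ζ hζ
        intro h
        rw [h, norm_zero] at this
        linarith
      have := (((hasDerivAt_id z).sub_const ζ).inv hne).const_mul (f ζ)
      simp only [div_eq_mul_inv]
      refine this.congr_deriv ?_
      simp only [id]
      field_simp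

theorem integral_mul_fderiv_dir {𝕜 : Type*} [RCLike 𝕜] {f η : ℂ → 𝕜} (hf : ContDiff ℝ 1 f)
    (hη : ContDiff ℝ 1 η) (hc : HasCompactSupport η) (v : ℂ) :
    ∫ z, f z * fderiv ℝ η z v = -∫ z, fderiv ℝ f z v * η z := by
  have hd := hf.continuous_fderiv one_ne_zero
  have hd' := hη.continuous_fderiv one_ne_zero
  have hcd : HasCompactSupport (fderiv ℝ η) := hc.fderiv ℝ
  refine integral_mul_fderiv_eq_neg_fderiv_mul_of_integrable ?_ ?_ ?_
    (fun x _ => hf.differentiable one_ne_zero x) (fun x _ => hη.differentiable one_ne_zero x)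
  · exact Continuous.integrable_of_hasCompactSupport (by have := hη.continuous; fun_prop) hc.mul_left
  · exact Continuous.integrable_of_hasCompactSupport (by have := hf.continuous; fun_prop)
      ((hcd.comp_left (g := fun L : ℂ →L[ℝ] 𝕜 => L v) (by simp)).mul_left)
  · exact (hf.continuous.mul hη.continuous).integrable_of_hasCompactSupport hc.mul_left

theorem contDiff_fderiv_dir {E : Type*} [NormedAddCommGroup E] [NormedSpace ℝ E] {u : ℂ → E}
    (hu : ContDiff ℝ 2 u) (v : ℂ) : ContDiff ℝ 1 (fun z => fderiv ℝ u z v) :=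
  (hu.fderiv_right (by norm_num : (1 : WithTop ℕ∞) + 1 ≤ 2)).clm_apply contDiff_const

theorem continuous_planeLaplacian {u : ℂ → ℝ} (hu : ContDiff ℝ 2 u) :
    Continuous (planeLaplacian u) := by
  have h := fun v => (contDiff_fderiv_dir hu v).continuous_fderiv one_ne_zero
  have h1 := h 1
  have h2 := h I
  unfold planeLaplacian
  fun_prop

theorem hasDerivAt_line {E : Type*} [NormedAddCommGroup E] [NormedSpace ℝ E] {f : ℂ → E}
    (hf : ContDiff ℝ 1 f) (p v : ℂ) (t : ℝ) :
    HasDerivAt (fun t : ℝ => f (p + t * v)) (fderiv ℝ f (p + t * v) v) t := by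
  have h1 : HasDerivAt (fun r : ℝ => p + r * v) v t := by
    simpa using ((Complex.ofRealCLM.hasDerivAt (x := t)).mul_const v).const_add p
  exact ((hf.differentiable one_ne_zero _).hasFDerivAt.comp_hasDerivAt t h1)

theorem second_deriv_nonneg_of_isLocalMin {f f' : ℝ → ℝ} {a : ℝ}
    (hf : ∀ t, HasDerivAt f (f' t) t) (hf' : HasDerivAt f' a 0) (hmin : IsLocalMin f 0) : 0 ≤ a := by
  by_contra ha
  push Not at ha
  have e1 : deriv f = f' := funext fun t => (hf t).deriv
  have h0 : f' 0 = 0 := hmin.hasDerivAt_eq_zero (hf 0)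
  have hmax : IsLocalMax f 0 := isLocalMax_of_deriv_deriv_neg (by rw [e1, hf'.deriv]; exact ha)
    (by rw [e1, h0]) (hf 0).continuousAt
  have hconst : f =ᶠ[𝓝 0] fun _ => f 0 := by
    filter_upwards [hmin, hmax] with t h1 h2
    exact le_antisymm h2 h1
  have h2 : f' =ᶠ[𝓝 0] fun _ => 0 := by
    have := hconst.deriv
    rw [e1] at this
    simpa using this
  have := h2.deriv_eq
  rw [hf'.deriv] at this
  simp at this
  linarith

/-- Minimum principle in small balls for `|Δu| ≤ κ|u|`. -/
theorem nonneg_of_pos_sphere {u : ℂ → ℝ} (hu : ContDiff ℝ 2 u) {q : ℂ} {r κ : ℝ} (hr : 0 < r)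
    (hr6 : r ≤ 6) (hκ : κ ≤ 1 / 20)
    (hL : ∀ z ∈ closedBall q r, |planeLaplacian u z| ≤ κ * |u z|)
    (hpos : ∀ z ∈ sphere q r, 0 < u z) : ∀ z ∈ closedBall q r, 0 ≤ u z := by
  let g : ℂ → ℝ := fun z => 2 - (1 / 20) * (((z - q).re) ^ 2 + ((z - q).im) ^ 2)
  have hgn : ∀ z, g z = 2 - (1 / 20) * ‖z - q‖ ^ 2 := by
    intro z
    rw [← Complex.normSq_eq_norm_sq, Complex.normSq_apply]
    simp only [g]
    ring
  have hg0 : ∀ z ∈ closedBall q r, 0 < g z ∧ g z ≤ 2 := by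
    intro z hz
    rw [mem_closedBall, dist_eq_norm] at hz
    rw [hgn]
    have : ‖z - q‖ ^ 2 ≤ 6 ^ 2 := by
      gcongr
      linarith
    constructor <;> nlinarith [sq_nonneg ‖z - q‖]
  have hgc : Continuous g := by fun_prop
  obtain ⟨p, hp, hpmin⟩ := (isCompact_closedBall q r).exists_isMinOn
    ⟨q, mem_closedBall_self hr.le⟩
    (hu.continuous.continuousOn.div hgc.continuousOn fun z hz => (hg0 z hz).1.ne')
  by_contra hcon
  push Not at hcon
  obtain ⟨z₁, hz₁, hneg⟩ := hcon
  have hpv : u p / g p < 0 :=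
    lt_of_le_of_lt (hpmin hz₁) (div_neg_of_neg_of_pos hneg (hg0 z₁ hz₁).1)
  set m : ℝ := -(u p / g p) with hm
  have hm0 : 0 < m := by linarith
  have hup : u p = -m * g p := by
    rw [hm, neg_neg, div_mul_cancel₀ _ (hg0 p hp).1.ne']
  have hge : ∀ z ∈ closedBall q r, -m * g z ≤ u z := by
    intro z hz
    have : u p / g p ≤ u z / g z := hpmin hz
    rw [le_div_iff₀ (hg0 z hz).1] at this
    rw [hm, neg_neg]
    exact this
  have hpball : p ∈ ball q r := by
    rw [mem_ball]
    refine lt_of_le_of_ne hp fun h => ?_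
    have h1 := hpos p h
    have h2 := (hg0 p hp).1
    rw [hup] at h1
    nlinarith
  have hdir : ∀ v : ℂ, ‖v‖ = 1 → m * (1 / 10) ≤ fderiv ℝ (fun w => fderiv ℝ u w v) p v := by
    intro v hv
    have hv2 : v.re ^ 2 + v.im ^ 2 = 1 := by
      have := Complex.normSq_eq_norm_sq v
      rw [hv, Complex.normSq_apply] at this
      linarith
    have hline : ∀ t : ℝ, g (p + t * v) = g p - (1 / 20) *
        (2 * t * ((p - q).re * v.re + (p - q).im * v.im) + t ^ 2) := by
      intro t
      simp only [g, sub_re, add_re, mul_re, ofReal_re, ofReal_im, sub_im, add_im, mul_im]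
      linear_combination (-t ^ 2 / 20) * hv2
    have d1 : ∀ t : ℝ, HasDerivAt (fun t : ℝ => u (p + t * v) + m * g (p + t * v))
        (fderiv ℝ u (p + t * v) v + m * (- (1 / 20) *
          (2 * ((p - q).re * v.re + (p - q).im * v.im) + 2 * t))) t := by
      intro t
      refine (hasDerivAt_line (hu.of_le (by norm_num)) p v t).add (HasDerivAt.const_mul m ?_)
      simp only [hline]
      have h1 := ((hasDerivAt_id t).const_mul (2 * ((p - q).re * v.re + (p - q).im * v.im))).add
        ((hasDerivAt_id t).pow 2)
      have h2 := (h1.const_mul (1 / 20)).const_sub (g p)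
      refine (h2.congr_deriv ?_).congr_of_eventuallyEq (Eventually.of_forall fun s => ?_)
      · simp
      · simp; ring
    have d2 : HasDerivAt (fun t : ℝ => fderiv ℝ u (p + t * v) v + m * (- (1 / 20) *
          (2 * ((p - q).re * v.re + (p - q).im * v.im) + 2 * t)))
        (fderiv ℝ (fun w => fderiv ℝ u w v) p v - m * (1 / 10)) 0 := by
      have h1 := hasDerivAt_line (contDiff_fderiv_dir hu v) p v 0
      have h2 := ((((hasDerivAt_id (0 : ℝ)).const_mul 2).const_add
        (2 * ((p - q).re * v.re + (p - q).im * v.im))).const_mul (-(1 / 20 : ℝ))).const_mul m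
      refine (h1.add h2).congr_deriv ?_
      simp; ring
    have hloc : IsLocalMin (fun t : ℝ => u (p + t * v) + m * g (p + t * v)) 0 := by
      have hcont : Continuous fun t : ℝ => p + t * v := by fun_prop
      have hmem : ∀ᶠ t : ℝ in 𝓝 0, p + t * v ∈ ball q r :=
        hcont.continuousAt.eventually_mem (isOpen_ball.mem_nhds (by simpa using hpball))
      filter_upwards [hmem] with t ht
      have := hge _ (ball_subset_closedBall ht)
      simp only [ofReal_zero, zero_mul, add_zero]
      rw [hup]
      linarith
    linarith [second_deriv_nonneg_of_isLocalMin d1 d2 hloc]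
  have h1 := hdir 1 (by simp)
  have h2 := hdir I (by simp)
  have h3 := hL p hp
  have h4 : m * (1 / 5) ≤ planeLaplacian u p := by unfold planeLaplacian; linarith
  have h5 : |u p| = m * g p := by
    rw [hup, abs_mul, abs_neg, abs_of_pos hm0, abs_of_pos (hg0 p hp).1]
  have h6 := le_abs_self (planeLaplacian u p)
  have h7 : κ * |u p| ≤ 1 / 20 * (m * 2) := by
    rw [h5]
    have := (hg0 p hp).2
    have h8 := (hg0 p hp).1
    gcongr
  linarith

theorem hasDerivAt_max_zero_pow_three (x : ℝ) :
    HasDerivAt (fun x : ℝ => (max x 0) ^ 3) (3 * (max x 0) ^ 2) x := by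
  rcases lt_trichotomy x 0 with h | rfl | h
  · rw [max_eq_right h.le]
    refine ((hasDerivAt_const x (0 : ℝ)).congr_deriv (by simp)).congr_of_eventuallyEq ?_
    filter_upwards [Iio_mem_nhds h] with y hy
    rw [max_eq_right (le_of_lt hy)]
    simp
  · simp only [max_self]
    rw [hasDerivAt_iff_isLittleO_nhds_zero]
    refine Asymptotics.IsBigO.trans_isLittleO (g := fun h : ℝ => h ^ 3) ?_
      (Asymptotics.isLittleO_pow_id (by norm_num))
    refine Asymptotics.IsBigO.of_bound 1 (Eventually.of_forall fun h => ?_)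
    simp only [zero_add, max_self, smul_eq_mul, norm_pow, one_mul, Real.norm_eq_abs]
    simp only [ne_eq, OfNat.ofNat_ne_zero, not_false_eq_true, zero_pow, mul_zero, sub_zero]
    have h1 : |max h 0| ≤ |h| := by
      rcases le_total h 0 with h0 | h0
      · simp [max_eq_right h0]
      · rw [max_eq_left h0]
    simpa [abs_pow] using pow_le_pow_left₀ (abs_nonneg _) h1 3
  · rw [max_eq_left h.le]
    refine ((hasDerivAt_pow 3 x).congr_deriv (by norm_num)).congr_of_eventuallyEq ?_
    filter_upwards [Ioi_mem_nhds h] with y hy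
    rw [max_eq_left (le_of_lt hy)]

/-- The weight `(1 - |ζ|²)₊`. -/
noncomputable def bumpBase (ζ : ℂ) : ℝ := max (1 - (ζ.re ^ 2 + ζ.im ^ 2)) 0

theorem bumpBase_eq (ζ : ℂ) : bumpBase ζ = max (1 - ‖ζ‖ ^ 2) 0 := by
  rw [bumpBase, ← Complex.normSq_eq_norm_sq, Complex.normSq_apply]
  ring_nf

theorem bumpBase_nonneg (ζ : ℂ) : 0 ≤ bumpBase ζ := le_max_right _ _

theorem bumpBase_le_one (ζ : ℂ) : bumpBase ζ ≤ 1 := by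
  rw [bumpBase_eq]
  exact max_le (by nlinarith [sq_nonneg ‖ζ‖]) zero_le_one

theorem continuous_bumpBase : Continuous bumpBase := by
  unfold bumpBase
  fun_prop

theorem bumpBase_eq_zero {ζ : ℂ} (h : ζ ∉ ball (0 : ℂ) 1) : bumpBase ζ = 0 := by
  rw [mem_ball_zero_iff, not_lt] at h
  rw [bumpBase_eq]
  exact max_eq_right (by nlinarith)

theorem hasCompactSupport_bumpBase_pow {n : ℕ} (hn : n ≠ 0) :
    HasCompactSupport fun ζ => bumpBase ζ ^ n := by
  refine HasCompactSupport.intro (isCompact_closedBall (0 : ℂ) 1) fun ζ hζ => ?_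
  rw [bumpBase_eq_zero fun h => hζ (ball_subset_closedBall h), zero_pow hn]

theorem hasFDerivAt_bump_cube (ζ : ℂ) : HasFDerivAt (fun ζ => bumpBase ζ ^ 3)
    ((3 * bumpBase ζ ^ 2) • (-((2 * ζ.re) • reCLM + (2 * ζ.im) • imCLM))) ζ := by
  have h1 : HasFDerivAt (fun ζ : ℂ => 1 - (ζ.re ^ 2 + ζ.im ^ 2))
      (-((2 * ζ.re) • reCLM + (2 * ζ.im) • imCLM)) ζ := by
    have := ((reCLM.hasFDerivAt (x := ζ)).pow 2).add ((imCLM.hasFDerivAt (x := ζ)).pow 2)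
    refine (this.const_sub 1).congr_fderiv ?_
    simp
  exact (hasDerivAt_max_zero_pow_three _).comp_hasFDerivAt ζ h1

theorem contDiff_bump_cube : ContDiff ℝ 1 fun ζ => bumpBase ζ ^ 3 := by
  rw [contDiff_one_iff_fderiv]
  refine ⟨fun ζ => (hasFDerivAt_bump_cube ζ).differentiableAt, ?_⟩
  rw [funext fun ζ => (hasFDerivAt_bump_cube ζ).fderiv]
  have := continuous_bumpBase
  fun_prop

theorem integral_bump_sq_pos : 0 < ∫ ζ, bumpBase ζ ^ 2 := by
  refine Continuous.integral_pos_of_hasCompactSupport_nonneg_nonzero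
    (continuous_bumpBase.pow 2) (hasCompactSupport_bumpBase_pow two_ne_zero)
    (fun ζ => by positivity) (x := 0) ?_
  simp [bumpBase]

/-- The weighted average of `u` over the ball of radius `r` about `x`. -/
noncomputable def avg (u : ℂ → ℝ) (x : ℂ) (r : ℝ) : ℝ := ∫ ζ, u (x + r * ζ) * bumpBase ζ ^ 2

theorem avg_zero (u : ℂ → ℝ) (x : ℂ) : avg u x 0 = u x * ∫ ζ, bumpBase ζ ^ 2 := by
  simp [avg, integral_const_mul]

theorem hasDerivAt_avg {u : ℂ → ℝ} (hu : ContDiff ℝ 1 u) (x : ℂ) (r : ℝ) :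
    HasDerivAt (avg u x) (∫ ζ, fderiv ℝ u (x + r * ζ) ζ * bumpBase ζ ^ 2) r := by
  have hc := hu.continuous
  have hb := continuous_bumpBase
  have hd := hu.continuous_fderiv one_ne_zero
  obtain ⟨C, hC⟩ := ((isCompact_closedBall x (|r| + 1)).image hd.norm).bddAbove
  have hC' : ∀ z ∈ closedBall x (|r| + 1), ‖fderiv ℝ u z‖ ≤ C := fun z hz => hC ⟨z, hz, rfl⟩
  refine (hasDerivAt_integral_of_dominated_loc_of_deriv_le (𝕜 := ℝ) (μ := volume)
    (F := fun (r : ℝ) ζ => u (x + r * ζ) * bumpBase ζ ^ 2)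
    (F' := fun (r : ℝ) ζ => fderiv ℝ u (x + r * ζ) ζ * bumpBase ζ ^ 2) (x₀ := r)
    (s := ball r 1) (bound := fun ζ => C * bumpBase ζ ^ 2)
    (ball_mem_nhds r one_pos) (Eventually.of_forall fun s => ?_) ?_ ?_ ?_ ?_ ?_).2
  · exact Continuous.aestronglyMeasurable (by fun_prop)
  · exact Continuous.integrable_of_hasCompactSupport (by fun_prop)
      (hasCompactSupport_bumpBase_pow two_ne_zero).mul_left
  · exact Continuous.aestronglyMeasurable (by fun_prop)
  · refine Eventually.of_forall fun ζ s hs => ?_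
    by_cases hζ : ζ ∈ ball (0 : ℂ) 1
    · rw [norm_mul, Real.norm_of_nonneg (sq_nonneg (bumpBase ζ))]
      rw [mem_ball_zero_iff] at hζ
      rw [mem_ball, Real.dist_eq] at hs
      gcongr
      refine (ContinuousLinearMap.le_opNorm _ _).trans ?_
      have h1 : |s| ≤ |r| + 1 := by
        have := abs_add_le r (s - r)
        rw [add_sub_cancel] at this
        linarith
      have h2 : ‖fderiv ℝ u (x + s * ζ)‖ ≤ C := by
        refine hC' _ ?_
        rw [mem_closedBall, dist_eq_norm, add_sub_cancel_left, norm_mul, norm_real, Real.norm_eq_abs]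
        nlinarith [abs_nonneg s, norm_nonneg ζ]
      nlinarith [norm_nonneg ζ, norm_nonneg (fderiv ℝ u (x + s * ζ))]
    · simp [bumpBase_eq_zero hζ]
  · exact (Continuous.integrable_of_hasCompactSupport (by fun_prop)
      (hasCompactSupport_bumpBase_pow two_ne_zero)).const_mul C
  · refine Eventually.of_forall fun ζ s _ => ?_
    have h1 : HasDerivAt (fun s : ℝ => x + s * ζ) ζ s := by
      simpa using ((Complex.ofRealCLM.hasDerivAt (x := s)).mul_const ζ).const_add x
    exact ((hu.differentiable one_ne_zero _).hasFDerivAt.comp_hasDerivAt s h1).mul_const _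

theorem fderiv_comp_affine {F : ℂ → ℝ} (hF : ContDiff ℝ 1 F) (x : ℂ) (r : ℝ) (ζ v : ℂ) :
    fderiv ℝ (fun ζ => F (x + r * ζ)) ζ v = r * fderiv ℝ F (x + r * ζ) v := by
  have h1 : HasFDerivAt (fun ζ : ℂ => x + r * ζ) (r • ContinuousLinearMap.id ℝ ℂ) ζ := by
    have := ((hasFDerivAt_id (𝕜 := ℝ) ζ).const_smul r).const_add x
    simpa using this
  have := (hF.differentiable one_ne_zero (x + r * ζ)).hasFDerivAt.comp ζ h1
  have h2 : fderiv ℝ (fun ζ => F (x + r * ζ)) ζ = _ := this.fderiv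
  rw [h2]
  simp

theorem clm_apply_eq (T : ℂ →L[ℝ] ℝ) (ζ : ℂ) : T ζ = ζ.re * T 1 + ζ.im * T I := by
  have h : ζ = ζ.re • (1 : ℂ) + ζ.im • I := by simp [Complex.re_add_im]
  have h2 := congrArg T h
  rwa [map_add, map_smul, map_smul, smul_eq_mul, smul_eq_mul] at h2

theorem deriv_avg_eq {u : ℂ → ℝ} (hu : ContDiff ℝ 2 u) (x : ℂ) (r : ℝ) :
    ∫ ζ, fderiv ℝ u (x + r * ζ) ζ * bumpBase ζ ^ 2 =
      r / 6 * ∫ ζ, planeLaplacian u (x + r * ζ) * bumpBase ζ ^ 3 := by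
  have hb := continuous_bumpBase
  have hcs := hasCompactSupport_bumpBase_pow (n := 3) (by norm_num)
  have key : ∀ v : ℂ, ∫ ζ, fderiv ℝ u (x + r * ζ) v * fderiv ℝ (fun ζ => bumpBase ζ ^ 3) ζ v =
      - (r * ∫ ζ, fderiv ℝ (fun w => fderiv ℝ u w v) (x + r * ζ) v * bumpBase ζ ^ 3) := by
    intro v
    have hv := contDiff_fderiv_dir hu v
    have hv' : ContDiff ℝ 1 fun ζ : ℂ => fderiv ℝ u (x + r * ζ) v := by
      have : ContDiff ℝ 1 fun ζ : ℂ => x + r * ζ := by fun_prop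
      exact hv.comp this
    rw [integral_mul_fderiv_dir hv' contDiff_bump_cube hcs v, ← integral_const_mul]
    congr 2
    ext ζ
    rw [fderiv_comp_affine hv]
    ring
  have hint : ∀ v : ℂ, Integrable fun ζ => fderiv ℝ u (x + r * ζ) v *
      fderiv ℝ (fun ζ => bumpBase ζ ^ 3) ζ v := by
    intro v
    have h1 := (contDiff_fderiv_dir hu v).continuous
    have h2 := contDiff_bump_cube.continuous_fderiv one_ne_zero
    exact Continuous.integrable_of_hasCompactSupport (by fun_prop)
      (((hcs.fderiv ℝ).comp_left (g := fun L : ℂ →L[ℝ] ℝ => L v) (by simp)).mul_left)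
  have hint2 : ∀ v : ℂ, Integrable fun ζ => fderiv ℝ (fun w => fderiv ℝ u w v) (x + r * ζ) v *
      bumpBase ζ ^ 3 := by
    intro v
    have h1 := (contDiff_fderiv_dir hu v).continuous_fderiv one_ne_zero
    exact Continuous.integrable_of_hasCompactSupport (by fun_prop) hcs.mul_left
  have e1 : ∀ ζ : ℂ, fderiv ℝ u (x + r * ζ) ζ * bumpBase ζ ^ 2 = -(1 / 6) *
      (fderiv ℝ u (x + r * ζ) 1 * fderiv ℝ (fun ζ => bumpBase ζ ^ 3) ζ 1 +
        fderiv ℝ u (x + r * ζ) I * fderiv ℝ (fun ζ => bumpBase ζ ^ 3) ζ I) := by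
    intro ζ
    rw [(hasFDerivAt_bump_cube ζ).fderiv]
    have : fderiv ℝ u (x + r * ζ) ζ = ζ.re * fderiv ℝ u (x + r * ζ) 1 +
        ζ.im * fderiv ℝ u (x + r * ζ) I := clm_apply_eq _ ζ
    rw [this]
    simp
    ring
  simp only [e1]
  rw [integral_const_mul, integral_add (hint 1) (hint I), key, key]
  simp only [planeLaplacian, add_mul]
  rw [integral_add (hint2 1) (hint2 I)]
  ring

theorem mem_ball_of_mul {x ζ : ℂ} {r ρ : ℝ} (hr : 0 ≤ r) (hρ : r ≤ ρ) (hρ0 : 0 < ρ)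
    (hζ : ζ ∈ ball (0 : ℂ) 1) : x + r * ζ ∈ ball x ρ := by
  rw [mem_ball_zero_iff] at hζ
  rw [mem_ball, dist_eq_norm, add_sub_cancel_left, norm_mul, norm_real, Real.norm_of_nonneg hr]
  nlinarith [norm_nonneg ζ]

theorem abs_deriv_avg_le {u : ℂ → ℝ} (hu : ContDiff ℝ 2 u) {x : ℂ} {ρ r : ℝ} (hr : 0 ≤ r)
    (hrρ : r ≤ ρ) (hρ0 : 0 < ρ) (hρ : ρ ≤ 2) (hpos : ∀ z ∈ ball x ρ, 0 ≤ u z)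
    (hL : ∀ z ∈ ball x ρ, |planeLaplacian u z| ≤ |u z|) :
    |∫ ζ, fderiv ℝ u (x + r * ζ) ζ * bumpBase ζ ^ 2| ≤ 1 / 3 * avg u x r := by
  have hb := continuous_bumpBase
  have hc := hu.continuous
  rw [deriv_avg_eq hu, abs_mul, abs_of_nonneg (by positivity)]
  have h1 : |∫ ζ, planeLaplacian u (x + r * ζ) * bumpBase ζ ^ 3| ≤ avg u x r := by
    rw [← Real.norm_eq_abs]
    refine norm_integral_le_of_norm_le (Continuous.integrable_of_hasCompactSupport (by fun_prop)
      (hasCompactSupport_bumpBase_pow two_ne_zero).mul_left) (Eventually.of_forall fun ζ => ?_)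
    by_cases hζ : ζ ∈ ball (0 : ℂ) 1
    · have hm := mem_ball_of_mul (x := x) hr hrρ hρ0 hζ
      have h0 := bumpBase_nonneg ζ
      have h2 := hL _ hm
      rw [abs_of_nonneg (hpos _ hm)] at h2
      rw [norm_mul, Real.norm_eq_abs, Real.norm_of_nonneg (by positivity), pow_succ _ 2]
      refine mul_le_mul h2 ?_ (by positivity) (hpos _ hm)
      exact mul_le_of_le_one_right (sq_nonneg _) (bumpBase_le_one ζ)
    · simp [bumpBase_eq_zero hζ]
  have h3 := (abs_nonneg _).trans h1
  nlinarith

theorem avg_le_and_le_avg {u : ℂ → ℝ} (hu : ContDiff ℝ 2 u) {x : ℂ} {ρ : ℝ}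
    (hρ0 : 0 < ρ) (hρ : ρ ≤ 2) (hpos : ∀ z ∈ ball x ρ, 0 ≤ u z)
    (hL : ∀ z ∈ ball x ρ, |planeLaplacian u z| ≤ |u z|) :
    avg u x ρ ≤ Real.exp 1 * avg u x 0 ∧ avg u x 0 ≤ Real.exp 1 * avg u x ρ := by
  have hA := fun r => hasDerivAt_avg (hu.of_le (by norm_num : (1 : WithTop ℕ∞) ≤ 2)) x r
  have hE : ∀ c r : ℝ, HasDerivAt (fun r => Real.exp (c * r)) (Real.exp (c * r) * c) r := by
    intro c r
    simpa using ((hasDerivAt_id r).const_mul c).exp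
  have hb := fun r (hr : r ∈ Icc (0 : ℝ) ρ) => abs_le.1 (abs_deriv_avg_le hu hr.1 hr.2 hρ0 hρ hpos hL)
  have hI : ∀ r ∈ interior (Icc (0 : ℝ) ρ), r ∈ Icc (0 : ℝ) ρ := fun r hr => interior_subset hr
  have m0 : (0 : ℝ) ∈ Icc (0 : ℝ) ρ := ⟨le_rfl, hρ0.le⟩
  have m1 : ρ ∈ Icc (0 : ℝ) ρ := ⟨hρ0.le, le_rfl⟩
  have hanti : AntitoneOn (fun r => Real.exp (-(1 / 2) * r) * avg u x r) (Icc 0 ρ) := by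
    refine antitoneOn_of_deriv_nonpos (convex_Icc 0 ρ)
      (fun r _ => ((hE _ r).mul (hA r)).continuousAt.continuousWithinAt)
      (fun r _ => ((hE _ r).mul (hA r)).differentiableAt.differentiableWithinAt) fun r hr => ?_
    have h := hb r (hI r hr)
    have hD : HasDerivAt (fun r => Real.exp (-(1 / 2) * r) * avg u x r) _ r :=
      (hE _ r).mul (hA r)
    rw [hD.deriv]
    have := Real.exp_pos (-(1 / 2) * r)
    have h3 : 0 ≤ avg u x r := by linarith
    nlinarith
  have hmono : MonotoneOn (fun r => Real.exp ((1 / 2) * r) * avg u x r) (Icc 0 ρ) := by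
    refine monotoneOn_of_deriv_nonneg (convex_Icc 0 ρ)
      (fun r _ => ((hE _ r).mul (hA r)).continuousAt.continuousWithinAt)
      (fun r _ => ((hE _ r).mul (hA r)).differentiableAt.differentiableWithinAt) fun r hr => ?_
    have h := hb r (hI r hr)
    have hD : HasDerivAt (fun r => Real.exp ((1 / 2) * r) * avg u x r) _ r :=
      (hE _ r).mul (hA r)
    rw [hD.deriv]
    have := Real.exp_pos ((1 / 2) * r)
    have h3 : 0 ≤ avg u x r := by linarith
    nlinarith
  have h1 := hanti m0 m1 hρ0.le
  have h2 := hmono m0 m1 hρ0.le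
  simp only [mul_zero, Real.exp_zero, one_mul] at h1 h2
  have p0 : 0 ≤ avg u x 0 := by have := hb 0 m0; linarith
  have p1 : 0 ≤ avg u x ρ := by have := hb ρ m1; linarith
  have e1 : Real.exp ((1 / 2) * ρ) ≤ Real.exp 1 := Real.exp_le_exp.2 (by linarith)
  constructor
  · calc avg u x ρ = Real.exp ((1 / 2) * ρ) * (Real.exp (-(1 / 2) * ρ) * avg u x ρ) := by
          rw [← mul_assoc, ← Real.exp_add]; ring_nf; simp
      _ ≤ Real.exp ((1 / 2) * ρ) * avg u x 0 := by gcongr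
      _ ≤ _ := by gcongr
  · exact h2.trans (by gcongr)

/-- Strong minimum principle. -/
theorem eq_zero_of_nonneg_of_zero {u : ℂ → ℝ} (hu : ContDiff ℝ 2 u) {x : ℂ} {ρ : ℝ}
    (hρ0 : 0 < ρ) (hρ : ρ ≤ 2) (hpos : ∀ z ∈ ball x ρ, 0 ≤ u z)
    (hL : ∀ z ∈ ball x ρ, |planeLaplacian u z| ≤ |u z|) (h0 : u x = 0) :
    ∀ z ∈ ball x ρ, u z = 0 := by
  intro z hz
  have hc := hu.continuous
  have hb := continuous_bumpBase
  have h1 := (avg_le_and_le_avg hu hρ0 hρ hpos hL).1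
  rw [avg_zero, h0, zero_mul, mul_zero] at h1
  by_contra hne
  have hn : ∀ ζ : ℂ, 0 ≤ u (x + ρ * ζ) * bumpBase ζ ^ 2 := by
    intro ζ
    by_cases hζ : ζ ∈ ball (0 : ℂ) 1
    · exact mul_nonneg (hpos _ (mem_ball_of_mul hρ0.le le_rfl hρ0 hζ)) (sq_nonneg _)
    · simp [bumpBase_eq_zero hζ]
  have hzeq : x + ρ * ((z - x) / ρ) = z := by
    rw [mul_div_cancel₀ _ (ofReal_ne_zero.2 hρ0.ne')]
    ring
  refine absurd h1 (not_le.2 (Continuous.integral_pos_of_hasCompactSupport_nonneg_nonzero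
    (by fun_prop) (hasCompactSupport_bumpBase_pow two_ne_zero).mul_left hn (x := (z - x) / ρ) ?_))
  rw [hzeq]
  refine mul_ne_zero hne (pow_ne_zero _ ?_)
  rw [bumpBase_eq]
  have : ‖(z - x) / ρ‖ < 1 := by
    rw [norm_div, norm_real, Real.norm_of_nonneg hρ0.le, div_lt_one hρ0, ← dist_eq_norm]
    exact hz
  have h4 : 0 < 1 - ‖(z - x) / ρ‖ ^ 2 := by nlinarith [norm_nonneg ((z - x) / ρ)]
  exact (lt_max_of_lt_left h4).ne'

theorem planeLaplacian_neg (u : ℂ → ℝ) (z : ℂ) :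
    planeLaplacian (fun w => -u w) z = -planeLaplacian u z := by
  simp only [planeLaplacian, fderiv_fun_neg]
  simp
  ring

theorem pos_or_neg_of_ne_zero {u : ℂ → ℝ} (hu : Continuous u) {s : Set ℂ} (hs : IsPreconnected s)
    (h : ∀ z ∈ s, u z ≠ 0) : (∀ z ∈ s, 0 < u z) ∨ (∀ z ∈ s, u z < 0) := by
  by_contra hcon
  push Not at hcon
  obtain ⟨⟨a, ha, ha'⟩, ⟨b, hb, hb'⟩⟩ := hcon
  obtain ⟨c, hc, hc'⟩ := hs.intermediate_value ha hb hu.continuousOn ⟨ha', hb'⟩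
  exact h c hc hc'

theorem exists_zero_on_sphere {u : ℂ → ℝ} (hu : ContDiff ℝ 2 u) {q : ℂ} {r : ℝ} (hr : 0 < r)
    (hr6 : r ≤ 6) (hL : ∀ z ∈ closedBall q r, |planeLaplacian u z| ≤ 1 / 20 * |u z|)
    (h0 : u q = 0) : ∃ z ∈ sphere q r, u z = 0 := by
  have main : ∀ v : ℂ → ℝ, ContDiff ℝ 2 v →
      (∀ z ∈ closedBall q r, |planeLaplacian v z| ≤ 1 / 20 * |v z|) → v q = 0 →
      ¬ ∀ z ∈ sphere q r, 0 < v z := by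
    intro v hv hL h0 hpos
    have hnn := nonneg_of_pos_sphere hv hr hr6 le_rfl hL hpos
    have hL' : ∀ z ∈ closedBall q r, |planeLaplacian v z| ≤ |v z| := fun z hz =>
      (hL z hz).trans (by linarith [abs_nonneg (v z)])
    have hsub : ball q r ⊆ interior {z | v z = 0} := by
      refine (convex_ball q r).isPreconnected.subset_left_of_subset_union isOpen_interior
        (isOpen_ne_fun hv.continuous continuous_const : IsOpen {z | v z ≠ 0}) ?_ ?_ ?_
      · rw [Set.disjoint_left]
        intro z hz hz'
        exact hz' (interior_subset (s := {z | v z = 0}) hz)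
      · intro z hz
        by_cases hvz : v z = 0
        · left
          rw [mem_ball] at hz
          have hm : 0 < min 2 (r - dist z q) := lt_min two_pos (by linarith)
          have hs : ball z (min 2 (r - dist z q)) ⊆ closedBall q r :=
            (ball_subset_ball' (by linarith [min_le_right 2 (r - dist z q)])).trans
              ball_subset_closedBall
          rw [mem_interior]
          exact ⟨_, eq_zero_of_nonneg_of_zero hv hm (min_le_left _ _)
            (fun w hw => hnn w (hs hw)) (fun w hw => hL' w (hs hw)) hvz, isOpen_ball,
            mem_ball_self hm⟩
        · exact Or.inr hvz
      · refine ⟨q, mem_ball_self hr, ?_⟩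
        have hm : 0 < min 2 r := lt_min two_pos hr
        have hs : ball q (min 2 r) ⊆ closedBall q r :=
          (ball_subset_ball (min_le_right _ _)).trans ball_subset_closedBall
        rw [mem_interior]
        exact ⟨_, eq_zero_of_nonneg_of_zero hv hm (min_le_left _ _)
          (fun w hw => hnn w (hs hw)) (fun w hw => hL' w (hs hw)) h0, isOpen_ball,
          mem_ball_self hm⟩
    have hcl : closedBall q r ⊆ {z | v z = 0} := by
      rw [← closure_ball q hr.ne']
      exact closure_minimal (hsub.trans interior_subset)
        (isClosed_eq hv.continuous continuous_const)
    have hz : q + r ∈ sphere q r := by simp [hr.le]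
    exact (hpos _ hz).ne' (hcl (sphere_subset_closedBall hz))
  by_contra hcon
  push Not at hcon
  rcases pos_or_neg_of_ne_zero hu.continuous
    (isPreconnected_sphere (by rw [Complex.rank_real_complex]; norm_num) q r) hcon with h | h
  · exact main u hu hL h0 h
  · refine main (fun z => -u z) hu.neg (fun z hz => ?_) (by simp [h0]) fun z hz => by
      linarith [h z hz]
    rw [planeLaplacian_neg, abs_neg, abs_neg]
    exact hL z hz

theorem avg_eq (u : ℂ → ℝ) (x : ℂ) {r : ℝ} (hr : 0 < r) :
    avg u x r = (r ^ 2)⁻¹ * ∫ s, u s * bumpBase ((s - x) / r) ^ 2 := by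
  have h1 := Measure.integral_comp_smul volume (fun t : ℂ => u (x + t) * bumpBase (t / r) ^ 2) r
  have h2 := integral_add_left_eq_self (μ := volume) (fun s => u s * bumpBase ((s - x) / r) ^ 2) x
  simp only [add_sub_cancel_left] at h2
  rw [h2, Complex.finrank_real_complex, abs_of_nonneg (by positivity), smul_eq_mul] at h1
  rw [← h1, avg]
  congr 1
  ext ζ
  rw [real_smul, mul_div_cancel_left₀ _ (ofReal_ne_zero.2 hr.ne')]

/-- Harnack's inequality. -/
theorem harnack : ∃ C > (0 : ℝ), ∀ u : ℂ → ℝ, ContDiff ℝ 2 u → ∀ y : ℂ,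
    (∀ z ∈ ball y 2, u z ≠ 0) → (∀ z ∈ ball y 2, |planeLaplacian u z| ≤ |u z|) →
    ∀ x ∈ closedBall y 1, |u x| ≤ C * |u y| := by
  refine ⟨Real.exp 1 * (84 * Real.exp 1), by positivity, ?_⟩
  have main : ∀ u : ℂ → ℝ, ContDiff ℝ 2 u → ∀ y : ℂ,
    (∀ z ∈ ball y 2, 0 < u z) → (∀ z ∈ ball y 2, |planeLaplacian u z| ≤ |u z|) →
    ∀ x ∈ closedBall y 1, |u x| ≤ Real.exp 1 * (84 * Real.exp 1) * |u y| := by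
    intro u hu y hpos hL x hx
    rw [mem_closedBall] at hx
    have hs : ball x (1 / 2) ⊆ ball y 2 := ball_subset_ball' (by linarith)
    have h1 := (avg_le_and_le_avg hu (x := x) (ρ := 1 / 2) (by norm_num) (by norm_num)
      (fun z hz => (hpos z (hs hz)).le) (fun z hz => hL z (hs hz))).2
    have h2 := (avg_le_and_le_avg hu (x := y) (ρ := 2) (by norm_num) le_rfl
      (fun z hz => (hpos z hz).le) hL).1
    have hb := continuous_bumpBase
    have hc := hu.continuous
    have hcs : ∀ (p : ℂ) (r : ℝ), 0 < r →
        Integrable fun s => u s * bumpBase ((s - p) / r) ^ 2 := by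
      intro p r hr
      refine Continuous.integrable_of_hasCompactSupport (by fun_prop)
        (HasCompactSupport.intro (isCompact_closedBall p r) fun s hs => ?_)
      rw [bumpBase_eq_zero, zero_pow two_ne_zero, mul_zero]
      rw [mem_ball_zero_iff, not_lt, norm_div, norm_real, Real.norm_of_nonneg hr.le,
        one_le_div hr, ← dist_eq_norm]
      rw [mem_closedBall, not_le] at hs
      exact hs.le
    have h3 : avg u x (1 / 2) ≤ 84 * avg u y 2 := by
      rw [avg_eq u x (by norm_num), avg_eq u y two_pos, ← mul_assoc, ← integral_const_mul,
        ← integral_const_mul]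
      refine integral_mono ((hcs x _ (by norm_num)).const_mul _) ((hcs y 2 two_pos).const_mul _)
        fun s => ?_
      simp only
      by_cases h : dist s x < 1 / 2
      · have hsy : ‖s - y‖ ≤ 3 / 2 := by
          rw [← dist_eq_norm]
          linarith [dist_triangle s x y]
        have hu0 : 0 < u s := hpos s (hs h)
        have hw : (7 / 16 : ℝ) ≤ bumpBase ((s - y) / (2 : ℝ)) := by
          rw [bumpBase_eq]
          refine le_max_of_le_left ?_
          rw [norm_div, norm_real]
          norm_num
          nlinarith [norm_nonneg (s - y)]
        have hw1 := bumpBase_le_one ((s - x) / ((1 / 2 : ℝ) : ℂ))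
        have hw0 := bumpBase_nonneg ((s - x) / ((1 / 2 : ℝ) : ℂ))
        have e1 : bumpBase ((s - x) / ((1 / 2 : ℝ) : ℂ)) ^ 2 ≤ 1 := pow_le_one₀ hw0 hw1
        have e2 : (7 / 16 : ℝ) ^ 2 ≤ bumpBase ((s - y) / (2 : ℝ)) ^ 2 := by gcongr
        have e3 := mul_le_mul_of_nonneg_left e1 hu0.le
        have e4 := mul_le_mul_of_nonneg_left e2 hu0.le
        norm_num at e3 e4 ⊢
        nlinarith
      · have e1 : bumpBase ((s - x) / ((1 / 2 : ℝ) : ℂ)) = 0 := by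
          apply bumpBase_eq_zero
          rw [mem_ball_zero_iff, not_lt, norm_div, norm_real, Real.norm_of_nonneg (by norm_num),
            one_le_div (by norm_num), ← dist_eq_norm]
          linarith
        rw [e1, zero_pow two_ne_zero, mul_zero, mul_zero]
        by_cases h' : s ∈ ball y 2
        · have := hpos s h'
          positivity
        · rw [bumpBase_eq_zero]
          · simp
          · rw [mem_ball_zero_iff, not_lt, norm_div, norm_real, Real.norm_of_nonneg (by norm_num),
              one_le_div (by norm_num), ← dist_eq_norm]
            rw [mem_ball, not_lt] at h'
            exact h'
    rw [avg_zero] at h1 h2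
    have hxy : x ∈ ball y 2 := by rw [mem_ball]; linarith
    rw [abs_of_pos (hpos x hxy), abs_of_pos (hpos y (mem_ball_self two_pos))]
    have hI := integral_bump_sq_pos
    refine le_of_mul_le_mul_right ?_ hI
    calc _ ≤ _ := h1
      _ ≤ Real.exp 1 * (84 * avg u y 2) := by gcongr
      _ ≤ Real.exp 1 * (84 * (Real.exp 1 * (u y * ∫ ζ, bumpBase ζ ^ 2))) := by gcongr
      _ = _ := by ring
  intro u hu y hne hL x hx
  rcases pos_or_neg_of_ne_zero hu.continuous (convex_ball y 2).isPreconnected hne with h | h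
  · exact main u hu y h hL x hx
  · have := main (fun z => -u z) hu.neg y (fun z hz => by linarith [h z hz]) (fun z hz => by
      rw [planeLaplacian_neg, abs_neg, abs_neg]
      exact hL z hz) x hx
    rwa [abs_neg, abs_neg] at this

/-- The complex gradient `u_x + i u_y`. -/
noncomputable def gr (u : ℂ → ℝ) (z : ℂ) : ℂ := fderiv ℝ u z 1 + I * fderiv ℝ u z I

theorem contDiff_gr {u : ℂ → ℝ} (hu : ContDiff ℝ 2 u) : ContDiff ℝ 1 (gr u) := by
  have h1 := contDiff_ofReal_comp (contDiff_fderiv_dir hu 1)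
  have h2 := contDiff_ofReal_comp (contDiff_fderiv_dir hu I)
  exact h1.add (contDiff_const.mul h2)

theorem db_conj_gr {u : ℂ → ℝ} (hu : ContDiff ℝ 2 u) (z : ℂ) :
    db (fun w => (starRingEnd ℂ) (gr u w)) z = planeLaplacian u z := by
  have hd : ∀ v, DifferentiableAt ℝ (fun w => fderiv ℝ u w v) z := fun v =>
    (contDiff_fderiv_dir hu v).differentiable one_ne_zero z
  have h1 : ∀ v, HasFDerivAt (fun w => ((fderiv ℝ u w v : ℝ) : ℂ))
      (ofRealCLM.comp (fderiv ℝ (fun w => fderiv ℝ u w v) z)) z := fun v =>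
    ofRealCLM.hasFDerivAt.comp z (hd v).hasFDerivAt
  have h2 : HasFDerivAt (fun w => (starRingEnd ℂ) (gr u w))
      (ofRealCLM.comp (fderiv ℝ (fun w => fderiv ℝ u w 1) z) -
        I • ofRealCLM.comp (fderiv ℝ (fun w => fderiv ℝ u w I) z)) z := by
    refine ((h1 1).sub ((h1 I).const_mul I)).congr_of_eventuallyEq
      (Eventually.of_forall fun w => ?_)
    simp [gr, sub_eq_add_neg]
  have hsymm : fderiv ℝ (fun w => fderiv ℝ u w 1) z I = fderiv ℝ (fun w => fderiv ℝ u w I) z 1 := by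
    have hs := hu.contDiffAt (x := z) |>.isSymmSndFDerivAt (by simp)
    have hdd : DifferentiableAt ℝ (fderiv ℝ u) z :=
      (hu.fderiv_right (by norm_num : (1 : WithTop ℕ∞) + 1 ≤ 2)).differentiable one_ne_zero z
    have e : ∀ v w : ℂ, fderiv ℝ (fun w => fderiv ℝ u w v) z w = fderiv ℝ (fderiv ℝ u) z w v := by
      intro v w
      rw [fderiv_clm_apply hdd (differentiableAt_const v)]
      simp
    rw [e, e]
    exact hs.eq I 1
  rw [db, h2.fderiv]
  simp only [_root_.sub_apply, ContinuousLinearMap.comp_apply, ofRealCLM_apply,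
    _root_.smul_apply, smul_eq_mul, hsymm, planeLaplacian]
  push_cast
  linear_combination (-(((fderiv ℝ (fun w => fderiv ℝ u w I) z I : ℝ)) : ℂ)) * I_mul_I

theorem db_ofReal {u : ℂ → ℝ} {z : ℂ} (hu : DifferentiableAt ℝ u z) :
    db (fun w => (u w : ℂ)) z = gr u z := by
  have h : HasFDerivAt (fun w => (u w : ℂ)) (ofRealCLM.comp (fderiv ℝ u z)) z :=
    ofRealCLM.hasFDerivAt.comp z hu.hasFDerivAt
  rw [db, h.fderiv]
  simp [gr]

/-- Interior gradient estimate. -/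
theorem gradient_bound : ∃ C > (0 : ℝ), ∀ u : ℂ → ℝ, ContDiff ℝ 2 u → ∀ (y : ℂ) (m : ℝ),
    (∀ z ∈ ball y 1, |u z| ≤ m ∧ |planeLaplacian u z| ≤ m) → ‖gr u y‖ ≤ C * m := by
  let b : ContDiffBump (0 : ℂ) := ⟨1 / 4, 1 / 2, by norm_num, by norm_num⟩
  let X : ℂ → ℂ := fun ζ => b ζ
  have hX : ContDiff ℝ 2 X := contDiff_ofReal_comp (b.contDiff (n := 2))
  have hXc : HasCompactSupport X :=
    b.hasCompactSupport.comp_left (g := fun x : ℝ => (x : ℂ)) (by simp)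
  have hX0 : ∀ ζ ∉ ball (0 : ℂ) 1, X ζ = 0 := by
    intro ζ hζ
    have : ζ ∉ Function.support b := by
      rw [b.support_eq]
      exact fun h => hζ (ball_subset_ball (by norm_num [b]) h)
    simpa [X] using this
  have hdX : ContDiff ℝ 1 (db X) :=
    (contDiff_fderiv_dir hX 1).add (contDiff_const.mul (contDiff_fderiv_dir hX I))
  have hXts : tsupport X ⊆ ball 0 1 := by
    refine (closure_minimal (fun ζ hζ => ?_) isClosed_closedBall :
      tsupport X ⊆ closedBall 0 (1 / 2)).trans (closedBall_subset_ball (by norm_num))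
    have : ζ ∈ Function.support b := by
      intro h
      exact hζ (by simp [X, h])
    rw [b.support_eq] at this
    exact ball_subset_closedBall this
  let K : ℂ → ℂ := fun ζ => db X ζ * (0 - ζ)⁻¹
  have hK0 : K =ᶠ[𝓝 0] fun _ => 0 := by
    have h1 : ∀ᶠ ζ in 𝓝 (0 : ℂ), X =ᶠ[𝓝 ζ] fun _ => 1 := by
      refine eventually_eventually_nhds.2 ?_
      filter_upwards [b.eventuallyEq_one] with ζ hζ
      simp [X, hζ]
    filter_upwards [h1] with ζ hζ
    simp [K, db, hζ.fderiv_eq]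
  have hK : ContDiff ℝ 1 K := by
    rw [contDiff_iff_contDiffAt]
    intro ζ
    by_cases hζ : ζ = 0
    · subst hζ
      exact contDiffAt_const.congr_of_eventuallyEq hK0
    · refine hdX.contDiffAt.mul (ContDiffAt.inv (by fun_prop) (by simpa using hζ))
  have hKs : ∀ ζ ∉ tsupport X, K ζ = 0 := by
    intro ζ hζ
    simp [K, db_eq_zero_of_notMem_tsupport hζ]
  have hKc : HasCompactSupport K := HasCompactSupport.intro hXc hKs
  have hKt : tsupport K ⊆ ball 0 1 := by
    refine (closure_minimal (fun ζ hζ => ?_) (isClosed_tsupport X)).trans hXts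
    by_contra h
    exact hζ (hKs ζ h)
  have hKd := hK.continuous_fderiv one_ne_zero
  have hKdc : HasCompactSupport (fderiv ℝ K) := hKc.fderiv ℝ
  have hiX : Integrable fun ζ => ‖X ζ‖ * ‖ζ‖⁻¹ := by
    have h1 := integrableOn_inv_norm_sub (x := 0) (ζ := 0) (r := 1)
    simp only [sub_zero] at h1
    have h2 : IntegrableOn (fun ζ : ℂ => ‖X ζ‖ * ‖ζ‖⁻¹) (ball 0 1) := by
      refine h1.mono' (hX.continuous.norm.aestronglyMeasurable.mul
        (by fun_prop : Measurable fun ζ : ℂ => ‖ζ‖⁻¹).aestronglyMeasurable)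
        (Eventually.of_forall fun ζ => ?_)
      rw [norm_mul, norm_norm, norm_inv, norm_norm]
      refine mul_le_of_le_one_left (by positivity) ?_
      simp only [X, norm_real, Real.norm_of_nonneg b.nonneg]
      exact b.le_one
    refine (integrableOn_iff_integrable_of_support_subset fun ζ hζ => ?_).1 h2
    by_contra h
    exact hζ (by simp [hX0 ζ h])
  have hiK : ∀ v : ℂ, Integrable fun ζ => ‖fderiv ℝ K ζ v‖ := by
    intro v
    refine Continuous.integrable_of_hasCompactSupport (by fun_prop) ?_
    exact hKdc.comp_left (g := fun T : ℂ →L[ℝ] ℂ => ‖T v‖) (by simp)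
  refine ⟨(∫ ζ, ‖X ζ‖ * ‖ζ‖⁻¹) + ((∫ ζ, ‖fderiv ℝ K ζ 1‖) + ∫ ζ, ‖fderiv ℝ K ζ I‖) + 1, ?_, ?_⟩
  · have h1 : 0 ≤ ∫ ζ, ‖X ζ‖ * ‖ζ‖⁻¹ := integral_nonneg fun ζ => by positivity
    have h2 : 0 ≤ ∫ ζ, ‖fderiv ℝ K ζ 1‖ := integral_nonneg fun ζ => by positivity
    have h3 : 0 ≤ ∫ ζ, ‖fderiv ℝ K ζ I‖ := integral_nonneg fun ζ => by positivity
    linarith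
  have main : ∀ u : ℂ → ℝ, ContDiff ℝ 2 u → ∀ m : ℝ,
      (∀ z ∈ ball (0 : ℂ) 1, |u z| ≤ m ∧ |planeLaplacian u z| ≤ m) →
      2 * Real.pi * ‖gr u 0‖ ≤
        ((∫ ζ, ‖X ζ‖ * ‖ζ‖⁻¹) + ((∫ ζ, ‖fderiv ℝ K ζ 1‖) + ∫ ζ, ‖fderiv ℝ K ζ I‖)) * m := by
    intro u hu m hm
    have hm0 : 0 ≤ m := (abs_nonneg _).trans (hm 0 (mem_ball_self one_pos)).1
    let D : ℂ → ℂ := fun w => (starRingEnd ℂ) (gr u w)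
    have hD : ContDiff ℝ 1 D := conjCLE.contDiff.comp (contDiff_gr hu)
    have hdb : ∀ ζ, db (fun w => X w * D w) ζ / (0 - ζ) =
        D ζ * K ζ + planeLaplacian u ζ * X ζ * (0 - ζ)⁻¹ := by
      intro ζ
      rw [db_mul (hX.differentiable two_ne_zero ζ) (hD.differentiable one_ne_zero ζ),
        db_conj_gr hu]
      simp only [K, div_eq_mul_inv]
      ring
    have hCP := integral_db_div (g := fun w => X w * D w) ((hX.of_le (by norm_num)).mul hD)
      hXc.mul_right 0
    have hX1 : X 0 = 1 := by simp [X, b.eventuallyEq_one.eq_of_nhds]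
    simp only [hdb, hX1, one_mul] at hCP
    have hi1 : Integrable fun ζ => D ζ * K ζ :=
      (hD.continuous.mul hK.continuous).integrable_of_hasCompactSupport hKc.mul_left
    have hb2 : ∀ ζ, ‖(planeLaplacian u ζ : ℂ) * X ζ * (0 - ζ)⁻¹‖ ≤ ‖X ζ‖ * ‖ζ‖⁻¹ * m := by
      intro ζ
      by_cases hζ : ζ ∈ ball (0 : ℂ) 1
      · rw [norm_mul, norm_mul, norm_real, norm_inv, zero_sub, norm_neg, Real.norm_eq_abs]
        have := (hm ζ hζ).2
        calc _ ≤ m * ‖X ζ‖ * ‖ζ‖⁻¹ := by gcongr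
          _ = _ := by ring
      · simp [hX0 ζ hζ]
    have hi2 : Integrable fun ζ => (planeLaplacian u ζ : ℂ) * X ζ * (0 - ζ)⁻¹ := by
      refine (hiX.mul_const m).mono' ?_ (Eventually.of_forall hb2)
      exact (((continuous_ofReal.comp (continuous_planeLaplacian hu)).mul
        hX.continuous).aestronglyMeasurable).mul
        (by fun_prop : Measurable fun ζ : ℂ => (0 - ζ)⁻¹).aestronglyMeasurable
    rw [integral_add hi1 hi2] at hCP
    have hb2' : ‖∫ ζ, (planeLaplacian u ζ : ℂ) * X ζ * (0 - ζ)⁻¹‖ ≤ (∫ ζ, ‖X ζ‖ * ‖ζ‖⁻¹) * m := by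
      rw [← integral_mul_const]
      exact norm_integral_le_of_norm_le (hiX.mul_const m) (Eventually.of_forall hb2)
    have hUc := contDiff_ofReal_comp (hu.of_le (by norm_num : (1 : WithTop ℕ∞) ≤ 2))
    have hUd : ∀ v ζ : ℂ, fderiv ℝ (fun w => (u w : ℂ)) ζ v = fderiv ℝ u ζ v := by
      intro v ζ
      have h : HasFDerivAt (fun w => (u w : ℂ)) (ofRealCLM.comp (fderiv ℝ u ζ)) ζ :=
        ofRealCLM.hasFDerivAt.comp ζ (hu.differentiable two_ne_zero ζ).hasFDerivAt
      rw [h.fderiv]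
      rfl
    have hpart : ∀ v : ℂ, ‖∫ ζ, (fderiv ℝ u ζ v : ℂ) * K ζ‖ ≤ (∫ ζ, ‖fderiv ℝ K ζ v‖) * m := by
      intro v
      have h1 := integral_mul_fderiv_dir (𝕜 := ℂ) hUc hK hKc v
      simp only [hUd] at h1
      rw [← norm_neg, ← h1, ← integral_mul_const]
      refine norm_integral_le_of_norm_le ((hiK v).mul_const m) (Eventually.of_forall fun ζ => ?_)
      by_cases hζ : ζ ∈ ball (0 : ℂ) 1
      · rw [norm_mul, norm_real, Real.norm_eq_abs, mul_comm]
        have := (hm ζ hζ).1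
        gcongr
      · have : fderiv ℝ K ζ = 0 := by
          by_contra h
          exact hζ (hKt (support_fderiv_subset ℝ h))
        simp [this]
    have hi3 : ∀ v : ℂ, Integrable fun ζ => (fderiv ℝ u ζ v : ℂ) * K ζ := by
      intro v
      have h1 := contDiff_ofReal_comp (contDiff_fderiv_dir hu v)
      exact (h1.continuous.mul hK.continuous).integrable_of_hasCompactSupport hKc.mul_left
    have hsplit : ∫ ζ, D ζ * K ζ = (∫ ζ, (fderiv ℝ u ζ 1 : ℂ) * K ζ) -
        I * ∫ ζ, (fderiv ℝ u ζ I : ℂ) * K ζ := by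
      rw [← integral_const_mul, ← integral_sub (hi3 1) ((hi3 I).const_mul I)]
      congr 1
      ext ζ
      simp [D, gr]
      ring
    have hn : ‖(2 * Real.pi : ℂ) * D 0‖ = 2 * Real.pi * ‖gr u 0‖ := by
      simp [D, Real.pi_pos.le]
    rw [← hn, ← hCP, hsplit]
    refine (norm_add_le _ _).trans ?_
    have := norm_sub_le (∫ ζ, (fderiv ℝ u ζ 1 : ℂ) * K ζ) (I * ∫ ζ, (fderiv ℝ u ζ I : ℂ) * K ζ)
    rw [norm_mul, norm_I, one_mul] at this
    linarith [hpart 1, hpart I]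
  intro u hu y m hm
  have hf : ∀ z, fderiv ℝ (fun w => u (y + w)) z = fderiv ℝ u (y + z) := fun z =>
    fderiv_comp_add_left y
  have hm0 : 0 ≤ m := (abs_nonneg _).trans (hm y (mem_ball_self one_pos)).1
  have hl : ∀ z, planeLaplacian (fun w => u (y + w)) z = planeLaplacian u (y + z) := by
    intro z
    simp only [planeLaplacian, hf]
    rw [fderiv_comp_add_left (f := fun w => fderiv ℝ u w 1) y,
      fderiv_comp_add_left (f := fun w => fderiv ℝ u w I) y]
  have hg : gr (fun w => u (y + w)) 0 = gr u y := by simp [gr, hf]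
  have h := main (fun w => u (y + w)) (hu.comp (contDiff_const.add contDiff_id)) m fun z hz => by
    rw [hl]
    exact hm _ (by simpa using hz)
  rw [hg] at h
  have hpi := Real.pi_gt_three
  nlinarith [norm_nonneg (gr u y)]

/-- Almost minimizers of a quadratic functional. -/
theorem exists_minimizing_seq {W : Type*} [AddCommGroup W] [Module ℝ W] (B : W →ₗ[ℝ] W →ₗ[ℝ] ℝ)
    (l : W →ₗ[ℝ] ℝ) (hsymm : ∀ x y, B x y = B y x) (hpos : ∀ x, 0 ≤ B x x) {C : ℝ} (hC : 0 ≤ C)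
    (hl : ∀ x, l x ^ 2 ≤ C * B x x) {κ : ℕ → ℝ} (hκ : ∀ n, 0 < κ n) :
    ∃ x : ℕ → W, (∀ n m, B (x n - x m) (x n - x m) ≤ 4 * (κ n + κ m)) ∧
      ∀ n y, (B (x n) y + l y) ^ 2 ≤ 2 * κ n * B y y := by
  let J : W → ℝ := fun x => B x x / 2 + l x
  have hlow : ∀ x, -(C / 2) ≤ J x := by
    intro x
    have h1 := hl x
    have h2 := hpos x
    have h3 : |2 * l x| ≤ |B x x + C| := by
      rw [← sq_le_sq]
      nlinarith [sq_nonneg (B x x - C)]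
    rw [abs_of_nonneg (by linarith : 0 ≤ B x x + C)] at h3
    have h4 := neg_abs_le (2 * l x)
    simp only [J]
    linarith
  have hbdd : BddBelow (range J) := ⟨-(C / 2), by rintro _ ⟨x, rfl⟩; exact hlow x⟩
  have hex : ∀ n, ∃ x, J x < sInf (range J) + κ n := by
    intro n
    obtain ⟨_, ⟨x, rfl⟩, hx⟩ := Real.lt_sInf_add_pos (range_nonempty J) (hκ n)
    exact ⟨x, hx⟩
  choose x hx using hex
  have hinf : ∀ y, sInf (range J) ≤ J y := fun y => csInf_le hbdd ⟨y, rfl⟩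
  refine ⟨x, fun n m => ?_, fun n y => ?_⟩
  · have h1 := hinf ((1 / 2 : ℝ) • (x n + x m))
    have h2 := hx n
    have h3 := hx m
    have h4 := hsymm (x n) (x m)
    simp only [J, map_smul, map_add, map_sub, LinearMap.add_apply, LinearMap.smul_apply,
      LinearMap.sub_apply, smul_eq_mul] at *
    linarith
  · have h : ∀ t : ℝ, 0 ≤ (B y y / 2) * (t * t) + (B (x n) y + l y) * t + κ n := by
      intro t
      have h1 := hinf (x n + t • y)
      have h2 := hx n
      have h4 := hsymm (x n) y
      simp only [J, map_smul, map_add, LinearMap.add_apply, LinearMap.smul_apply,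
        smul_eq_mul] at *
      rw [← h4] at h1
      nlinarith
    have := discrim_le_zero h
    rw [discrim] at this
    linarith

/-- Convergence in `L²`. -/
structure L2Tendsto {E : Type*} [NormedAddCommGroup E] (f : ℕ → ℂ → E) (F : ℂ → E) : Prop where
  memLp : ∀ n, MemLp (f n) 2
  memLp_lim : MemLp F 2
  tendsto : Tendsto (fun n => eLpNorm (f n - F) 2) atTop (𝓝 0)

namespace L2Tendsto

variable {E F : Type*} [NormedAddCommGroup E] [NormedAddCommGroup F]

theorem const {f : ℂ → E} (hf : MemLp f 2) : L2Tendsto (fun _ => f) f :=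
  ⟨fun _ => hf, hf, by simp⟩

theorem of_le {f : ℕ → ℂ → E} {f' : ℂ → E} {g : ℕ → ℂ → F} {g' : ℂ → F} (hf : L2Tendsto f f')
    {c : ℝ} (hg : ∀ n, AEStronglyMeasurable (g n)) (hg' : AEStronglyMeasurable g')
    (h : ∀ n z, ‖g n z‖ ≤ c * ‖f n z‖) (h' : ∀ z, ‖g' z‖ ≤ c * ‖f' z‖)
    (hsub : ∀ n z, ‖g n z - g' z‖ ≤ c * ‖f n z - f' z‖) : L2Tendsto g g' := by
  refine ⟨fun n => (hf.memLp n).of_le_mul (hg n) (Eventually.of_forall (h n)),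
    hf.memLp_lim.of_le_mul hg' (Eventually.of_forall h'), ?_⟩
  have ht : Tendsto (fun n => ENNReal.ofReal c * eLpNorm (f n - f') 2) atTop (𝓝 0) := by
    have := ENNReal.Tendsto.const_mul (a := ENNReal.ofReal c) hf.tendsto
      (Or.inr ENNReal.ofReal_ne_top)
    rwa [mul_zero] at this
  exact tendsto_of_tendsto_of_tendsto_of_le_of_le tendsto_const_nhds ht (fun _ => zero_le)
    fun n => eLpNorm_le_mul_eLpNorm_of_ae_le_mul (Eventually.of_forall (hsub n)) 2

theorem clm {f : ℕ → ℂ → E} {f' : ℂ → E} [NormedSpace ℝ E] [NormedSpace ℝ F]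
    (hf : L2Tendsto f f') (T : E →L[ℝ] F) :
    L2Tendsto (fun n z => T (f n z)) (fun z => T (f' z)) :=
  hf.of_le (c := ‖T‖) (fun n => T.continuous.comp_aestronglyMeasurable
      (hf.memLp n).aestronglyMeasurable)
    (T.continuous.comp_aestronglyMeasurable hf.memLp_lim.aestronglyMeasurable)
    (fun _ _ => T.le_opNorm _) (fun _ => T.le_opNorm _)
    (fun n z => by rw [← map_sub]; exact T.le_opNorm _)

theorem bdd_mul {𝕜 : Type*} [NormedField 𝕜] {f : ℕ → ℂ → 𝕜} {f' b : ℂ → 𝕜} (hf : L2Tendsto f f')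
    (hb : AEStronglyMeasurable b) {c : ℝ} (hc : ∀ z, ‖b z‖ ≤ c) :
    L2Tendsto (fun n z => b z * f n z) (fun z => b z * f' z) := by
  refine hf.of_le (c := c) (fun n => hb.mul (hf.memLp n).aestronglyMeasurable)
    (hb.mul hf.memLp_lim.aestronglyMeasurable) ?_ ?_ ?_ <;> intros
  · rw [norm_mul]
    gcongr
    exact hc _
  · rw [norm_mul]
    gcongr
    exact hc _
  · rw [← mul_sub, norm_mul]
    gcongr
    exact hc _

theorem integral_mul {𝕜 : Type*} [RCLike 𝕜] {f g : ℕ → ℂ → 𝕜} {f' g' : ℂ → 𝕜}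
    (hf : L2Tendsto f f') (hg : L2Tendsto g g') :
    Tendsto (fun n => ∫ z, f n z * g n z) atTop (𝓝 (∫ z, f' z * g' z)) := by
  refine tendsto_integral_of_L1' _ (hf.memLp_lim.integrable_mul hg.memLp_lim).aestronglyMeasurable
    (Eventually.of_forall fun n => (hf.memLp n).integrable_mul (hg.memLp n)) ?_
  have hbound : ∀ n, eLpNorm ((fun z => f n z * g n z) - fun z => f' z * g' z) 1 ≤
      eLpNorm (f n - f') 2 * (eLpNorm (g n - g') 2 + eLpNorm g' 2) +
        eLpNorm f' 2 * eLpNorm (g n - g') 2 := by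
    intro n
    have e : ((fun z => f n z * g n z) - fun z => f' z * g' z) =
        (f n - f') • g n + f' • (g n - g') := by
      ext z
      simp only [Pi.sub_apply, Pi.add_apply, Pi.mul_apply, smul_eq_mul]
      ring
    have m1 := ((hf.memLp n).sub hf.memLp_lim).aestronglyMeasurable
    have m2 := ((hg.memLp n).sub hg.memLp_lim).aestronglyMeasurable
    have hgn : eLpNorm (g n) 2 ≤ eLpNorm (g n - g') 2 + eLpNorm g' 2 := by
      have := eLpNorm_add_le m2 hg.memLp_lim.aestronglyMeasurable one_le_two
      rwa [sub_add_cancel] at this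
    rw [e]
    refine (eLpNorm_add_le (m1.smul (hg.memLp n).aestronglyMeasurable)
      (hf.memLp_lim.aestronglyMeasurable.smul m2) le_rfl).trans ?_
    gcongr
    · refine (eLpNorm_smul_le_mul_eLpNorm (p := 2) (q := 2) (r := 1)
        (hg.memLp n).aestronglyMeasurable m1).trans ?_
      gcongr
    · exact eLpNorm_smul_le_mul_eLpNorm (p := 2) (q := 2) (r := 1) m2
        hf.memLp_lim.aestronglyMeasurable
  have ht : Tendsto (fun n => eLpNorm (f n - f') 2 * (eLpNorm (g n - g') 2 + eLpNorm g' 2) +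
        eLpNorm f' 2 * eLpNorm (g n - g') 2) atTop (𝓝 (0 * (0 + eLpNorm g' 2) +
          eLpNorm f' 2 * 0)) := by
    have hfin := hg.memLp_lim.2.ne
    have hfin' := hf.memLp_lim.2.ne
    refine Tendsto.add (ENNReal.Tendsto.mul hf.tendsto ?_ (hg.tendsto.add tendsto_const_nhds) ?_)
      (ENNReal.Tendsto.const_mul hg.tendsto ?_)
    · right
      simpa using hfin
    · right
      exact ENNReal.zero_ne_top
    · right
      exact hfin'
  rw [zero_mul, mul_zero, add_zero] at ht
  exact tendsto_of_tendsto_of_tendsto_of_le_of_le tendsto_const_nhds ht (fun _ => zero_le) hbound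

end L2Tendsto

theorem sqrt_integral_eq_eLpNorm {E : Type*} [NormedAddCommGroup E] {f : ℂ → E}
    (hf : MemLp f 2) : eLpNorm f 2 = ENNReal.ofReal (√(∫ z, ‖f z‖ ^ 2)) := by
  rw [hf.eLpNorm_eq_integral_rpow_norm (by norm_num) (by norm_num)]
  simp [Real.sqrt_eq_rpow]

/-- Completeness of `L²` for fast Cauchy sequences. -/
theorem exists_L2Tendsto {E : Type*} [NormedAddCommGroup E] [CompleteSpace E] {f : ℕ → ℂ → E}
    (hf : ∀ n, MemLp (f n) 2)
    (h : ∀ N n m : ℕ, N ≤ n → N ≤ m → ∫ z, ‖f n z - f m z‖ ^ 2 < ((1 / 2 : ℝ) ^ N) ^ 2) :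
    ∃ F, L2Tendsto f F := by
  have hB : ∑' N : ℕ, ENNReal.ofReal ((1 / 2 : ℝ) ^ N) ≠ ⊤ := by
    rw [← ENNReal.ofReal_tsum_of_nonneg (fun n => by positivity) summable_geometric_two]
    exact ENNReal.ofReal_ne_top
  obtain ⟨F, hF, ht⟩ := Lp.cauchy_complete_eLpNorm one_le_two hf hB fun N n m hn hm => by
    rw [sqrt_integral_eq_eLpNorm ((hf n).sub (hf m))]
    refine (ENNReal.ofReal_lt_ofReal_iff (by positivity)).2 ?_
    rw [Real.sqrt_lt' (by positivity)]
    exact h N n m hn hm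
  exact ⟨F, hf, hF, ht⟩

theorem fderiv_eq_re_gr (u : ℂ → ℝ) (z v : ℂ) :
    fderiv ℝ u z v = ((starRingEnd ℂ) v * gr u z).re := by
  rw [clm_apply_eq (fderiv ℝ u z) v]
  simp [gr]

theorem abs_fderiv_le (u : ℂ → ℝ) (z v : ℂ) : |fderiv ℝ u z v| ≤ ‖v‖ * ‖gr u z‖ := by
  rw [fderiv_eq_re_gr]
  refine (abs_re_le_norm _).trans ?_
  rw [norm_mul, RCLike.norm_conj]

theorem continuous_gr {u : ℂ → ℝ} (hu : ContDiff ℝ 1 u) : Continuous (gr u) := by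
  have h := hu.continuous_fderiv one_ne_zero
  unfold gr
  fun_prop

theorem sq_integral_abs_le {f : ℝ → ℝ} (hf : Continuous f) :
    (∫ t in (-Real.pi)..Real.pi, |f t|) ^ 2 ≤ 2 * Real.pi * ∫ t in (-Real.pi)..Real.pi, f t ^ 2 := by
  set a := ∫ t in (-Real.pi)..Real.pi, |f t|
  have hpi := Real.pi_pos
  have h : 0 ≤ ∫ t in (-Real.pi)..Real.pi, (|f t| - a / (2 * Real.pi)) ^ 2 :=
    intervalIntegral.integral_nonneg (by linarith) fun t _ => sq_nonneg _
  have e : ∀ t, (|f t| - a / (2 * Real.pi)) ^ 2 =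
      f t ^ 2 - (2 * (a / (2 * Real.pi))) * |f t| + (a / (2 * Real.pi)) ^ 2 := by
    intro t
    rw [← sq_abs (f t)]
    ring
  simp only [e] at h
  rw [intervalIntegral.integral_add (Continuous.intervalIntegrable (by fun_prop) _ _) (by simp),
    intervalIntegral.integral_sub (Continuous.intervalIntegrable (by fun_prop) _ _)
      (Continuous.intervalIntegrable (by fun_prop) _ _), intervalIntegral.integral_const_mul] at h
  simp only [intervalIntegral.integral_const, smul_eq_mul] at h
  change 0 ≤ (∫ t in (-Real.pi)..Real.pi, f t ^ 2) - 2 * (a / (2 * Real.pi)) * a + _ at h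
  have e2 : (∫ t in (-Real.pi)..Real.pi, f t ^ 2) - 2 * (a / (2 * Real.pi)) * a +
      (Real.pi - -Real.pi) * (a / (2 * Real.pi)) ^ 2 =
      (∫ t in (-Real.pi)..Real.pi, f t ^ 2) - a ^ 2 / (2 * Real.pi) := by
    field_simp
    ring
  rw [e2] at h
  have h3 : a ^ 2 / (2 * Real.pi) ≤ ∫ t in (-Real.pi)..Real.pi, f t ^ 2 := by linarith
  rw [div_le_iff₀ (by positivity)] at h3
  linarith

theorem integral_sq_le_of_zero {f f' : ℝ → ℝ} (hf : ∀ t, HasDerivAt f (f' t) t)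
    (hf' : Continuous f') {t₀ : ℝ} (ht₀ : t₀ ∈ Icc (-Real.pi) Real.pi) (h0 : f t₀ = 0) :
    ∫ t in (-Real.pi)..Real.pi, f t ^ 2 ≤
      4 * Real.pi ^ 2 * ∫ t in (-Real.pi)..Real.pi, f' t ^ 2 := by
  have hpi := Real.pi_pos
  have hle : -Real.pi ≤ Real.pi := by linarith
  have hfc : Continuous f := continuous_iff_continuousAt.2 fun t => (hf t).continuousAt
  have hpt : ∀ t ∈ Icc (-Real.pi) Real.pi,
      f t ^ 2 ≤ 2 * Real.pi * ∫ t in (-Real.pi)..Real.pi, f' t ^ 2 := by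
    intro t ht
    refine le_trans ?_ (sq_integral_abs_le hf')
    rw [← sq_abs]
    refine pow_le_pow_left₀ (abs_nonneg _) ?_ 2
    have h1 := intervalIntegral.integral_eq_sub_of_hasDerivAt (fun t _ => hf t)
      (hf'.intervalIntegrable t₀ t)
    rw [h0, sub_zero] at h1
    rw [← h1, ← Real.norm_eq_abs]
    refine intervalIntegral.norm_integral_le_integral_norm_uIoc.trans ?_
    rw [intervalIntegral.integral_of_le hle]
    refine setIntegral_mono_set ?_ (Eventually.of_forall fun t => norm_nonneg _)
      (LE.le.eventuallyLE ?_)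
    · exact (hf'.norm.intervalIntegrable (-Real.pi) Real.pi).1
    · intro s hs
      rw [uIoc, mem_Ioc] at hs
      exact ⟨lt_of_le_of_lt (le_min ht₀.1 ht.1) hs.1, hs.2.trans (max_le ht₀.2 ht.2)⟩
  have h2 := intervalIntegral.integral_mono_on hle ((hfc.pow 2).intervalIntegrable _ _)
    (Continuous.intervalIntegrable (μ := volume) (continuous_const
      (y := 2 * Real.pi * ∫ t in (-Real.pi)..Real.pi, f' t ^ 2)) _ _) hpt
  rw [intervalIntegral.integral_const, smul_eq_mul] at h2
  calc _ ≤ _ := h2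
    _ = _ := by ring

/-- Every circle about `q` of radius less than `ρ` meets `Z`. -/
def MeetsCircles (Z : Set ℂ) (q : ℂ) (ρ : ℝ) : Prop :=
  ∀ r, 0 < r → r < ρ → ∃ z ∈ Z, dist z q = r

theorem lintegral_polar (F : ℂ → ENNReal) (hF : Measurable F) (q : ℂ) :
    ∫⁻ ζ, F ζ = ∫⁻ r in Ioi (0 : ℝ), ∫⁻ t in Ioo (-Real.pi) Real.pi,
      ENNReal.ofReal r * F (q + r * exp (t * I)) := by
  rw [← lintegral_add_left_eq_self F q, ← Complex.lintegral_comp_polarCoord_symm]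
  have e : ∀ p : ℝ × ℝ, q + Complex.polarCoord.symm p = q + p.1 * exp (p.2 * I) := by
    intro p
    rw [Complex.polarCoord_symm_apply, exp_mul_I]
    push_cast
    rfl
  simp only [e, smul_eq_mul]
  rw [polarCoord_target, Measure.volume_eq_prod, ← Measure.prod_restrict,
    lintegral_prod _ (Measurable.aemeasurable (by fun_prop))]

/-- Poincaré inequality on discs about a point all of whose small circles meet the zero set. -/
theorem circle_poincare {Z : Set ℂ} {q : ℂ} {ρ : ℝ} (hq : MeetsCircles Z q ρ) {f : ℂ → ℝ}
    (hf : ContDiff ℝ 1 f) (hZ : ∀ z ∈ Z, f z = 0) {w : ℝ → ENNReal} (hw : Measurable w) :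
    ∫⁻ ζ in ball q ρ, w ‖ζ - q‖ * ENNReal.ofReal (f ζ ^ 2) ≤
      ENNReal.ofReal (4 * Real.pi ^ 2) *
        ∫⁻ ζ in ball q ρ, w ‖ζ - q‖ * ENNReal.ofReal (‖ζ - q‖ ^ 2 * ‖gr f ζ‖ ^ 2) := by
  have hfc := hf.continuous
  have hgc := continuous_gr hf
  have m1 : Measurable fun ζ => w ‖ζ - q‖ * ENNReal.ofReal (f ζ ^ 2) :=
    (hw.comp (by fun_prop)).mul (hfc.measurable.pow_const 2).ennreal_ofReal
  have m2 : Measurable fun ζ => w ‖ζ - q‖ * ENNReal.ofReal (‖ζ - q‖ ^ 2 * ‖gr f ζ‖ ^ 2) :=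
    (hw.comp (by fun_prop)).mul (Continuous.measurable (by fun_prop)).ennreal_ofReal
  rw [← lintegral_indicator measurableSet_ball, ← lintegral_indicator measurableSet_ball,
    lintegral_polar _ (m1.indicator measurableSet_ball) q,
    lintegral_polar _ (m2.indicator measurableSet_ball) q,
    ← lintegral_const_mul' _ _ ENNReal.ofReal_ne_top]
  refine setLIntegral_mono' measurableSet_Ioi fun r hr => ?_
  have hr0 : 0 < r := hr
  have hn : ∀ t : ℝ, ‖q + r * exp (t * I) - q‖ = r := by
    intro t
    rw [add_sub_cancel_left, norm_mul, norm_exp_ofReal_mul_I, norm_real, Real.norm_of_nonneg hr0.le,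
      mul_one]
  by_cases hρ : r < ρ
  swap
  · have h0 : ∀ t : ℝ, q + r * exp (t * I) ∉ ball q ρ := by
      intro t
      rw [mem_ball, dist_eq_norm, hn]
      exact hρ
    simp [indicator_of_notMem (h0 _)]
  have h1 : ∀ t : ℝ, q + r * exp (t * I) ∈ ball q ρ := by
    intro t
    rw [mem_ball, dist_eq_norm, hn]
    exact hρ
  simp only [indicator_of_mem (h1 _), hn]
  have hpi := Real.pi_pos
  have hle : -Real.pi ≤ Real.pi := by linarith
  have hd : ∀ t : ℝ, HasDerivAt (fun t : ℝ => f (q + r * exp (t * I)))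
      (fderiv ℝ f (q + r * exp (t * I)) (r * (exp (t * I) * I))) t := by
    intro t
    have h2 : HasDerivAt (fun t : ℝ => q + r * exp (t * I)) (r * (exp (t * I) * I)) t := by
      have h3 : HasDerivAt (fun t : ℝ => (t : ℂ) * I) I t := by
        simpa using (Complex.ofRealCLM.hasDerivAt (x := t)).mul_const I
      exact (h3.cexp.const_mul (r : ℂ)).const_add q
    exact (hf.differentiable one_ne_zero _).hasFDerivAt.comp_hasDerivAt t h2
  obtain ⟨z, hz, hzr⟩ := hq r hr0 hρ
  have h0 : f (q + r * exp ((arg (z - q) : ℝ) * I)) = 0 := by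
    rw [dist_eq_norm] at hzr
    rw [← hzr, norm_mul_exp_arg_mul_I, add_sub_cancel]
    exact hZ z hz
  have hfd := hf.continuous_fderiv one_ne_zero
  have h3 := integral_sq_le_of_zero hd (by fun_prop)
    ⟨(neg_pi_lt_arg _).le, arg_le_pi _⟩ h0
  have h4 : ∫ t in (-Real.pi)..Real.pi,
      (fderiv ℝ f (q + r * exp (t * I)) (r * (exp (t * I) * I))) ^ 2 ≤
      ∫ t in (-Real.pi)..Real.pi, r ^ 2 * ‖gr f (q + r * exp (t * I))‖ ^ 2 := by
    refine intervalIntegral.integral_mono_on hle (Continuous.intervalIntegrable (by fun_prop) _ _)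
      (Continuous.intervalIntegrable (by fun_prop) _ _) fun t _ => ?_
    rw [← mul_pow, ← sq_abs]
    refine pow_le_pow_left₀ (abs_nonneg _) ((abs_fderiv_le _ _ _).trans_eq ?_) 2
    rw [norm_mul, norm_mul, norm_exp_ofReal_mul_I, norm_real, norm_I, Real.norm_of_nonneg hr0.le]
    ring
  have h5 : ∀ G : ℝ → ℝ, Continuous G → (∀ t, 0 ≤ G t) →
      ∫⁻ t in Ioo (-Real.pi) Real.pi, ENNReal.ofReal (G t) =
        ENNReal.ofReal (∫ t in (-Real.pi)..Real.pi, G t) := by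
    intro G hG hG0
    rw [intervalIntegral.integral_of_le hle, ofReal_integral_eq_lintegral_ofReal
      (hG.intervalIntegrable _ _).1 (Eventually.of_forall hG0)]
    exact setLIntegral_congr Ioo_ae_eq_Ioc
  have e : ∀ a : ℝ, ENNReal.ofReal r * (w r * ENNReal.ofReal a) =
      (ENNReal.ofReal r * w r) * ENNReal.ofReal a := fun a => (mul_assoc _ _ _).symm
  simp only [e]
  rw [lintegral_const_mul _ (Continuous.measurable (by fun_prop)).ennreal_ofReal,
    lintegral_const_mul _ (Continuous.measurable (by fun_prop)).ennreal_ofReal,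
    h5 _ (by fun_prop) (fun t => by positivity), h5 _ (by fun_prop) (fun t => by positivity),
    mul_left_comm, ← ENNReal.ofReal_mul (by positivity)]
  gcongr
  exact h3.trans (by gcongr)

theorem lintegral_lintegral_ball {F : ℂ → ENNReal} (hF : Measurable F) (r : ℝ) :
    ∫⁻ x, ∫⁻ ζ in ball x r, F ζ = volume (ball (0 : ℂ) r) * ∫⁻ ζ, F ζ := by
  have hS : MeasurableSet {p : ℂ × ℂ | dist p.2 p.1 < r} :=
    (isOpen_lt (by fun_prop) continuous_const).measurableSet
  have e1 : ∀ x, ∫⁻ ζ in ball x r, F ζ =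
      ∫⁻ ζ, {p : ℂ × ℂ | dist p.2 p.1 < r}.indicator (fun p => F p.2) (x, ζ) := by
    intro x
    rw [← lintegral_indicator measurableSet_ball]
    rfl
  simp only [e1]
  have hm : Measurable ({p : ℂ × ℂ | dist p.2 p.1 < r}.indicator (fun p => F p.2)) :=
    (hF.comp measurable_snd).indicator hS
  rw [lintegral_lintegral_swap (f := fun x ζ =>
    {p : ℂ × ℂ | dist p.2 p.1 < r}.indicator (fun p => F p.2) (x, ζ)) hm.aemeasurable]
  have e2 : ∀ ζ, ∫⁻ x, {p : ℂ × ℂ | dist p.2 p.1 < r}.indicator (fun p => F p.2) (x, ζ) =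
      volume (ball (0 : ℂ) r) * F ζ := by
    intro ζ
    have e3 : ∀ x, {p : ℂ × ℂ | dist p.2 p.1 < r}.indicator (fun p => F p.2) (x, ζ) =
        (ball ζ r).indicator (fun _ => F ζ) x := by
      intro x
      simp only [indicator, Set.mem_ofPred_eq, mem_ball]
      rw [dist_comm]
    simp only [e3]
    rw [lintegral_indicator measurableSet_ball, lintegral_const, Measure.restrict_apply_univ,
      mul_comm, Measure.addHaar_ball_center]
  simp only [e2]
  rw [lintegral_const_mul _ hF]

/-- Closed sets, containing a neighbourhood of infinity, which are capacitarily thick at unit scale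
and at all smaller scales about each of their points. -/
structure Thick (Z : Set ℂ) (R : ℝ) : Prop where
  isClosed : IsClosed Z
  outer : ∀ z, R ≤ ‖z‖ → z ∈ Z
  circles : ∀ q ∈ Z, MeetsCircles Z q 1
  disc : ∀ x, ∃ q ρ, 0 < ρ ∧ ρ ≤ 5 ∧ MeetsCircles Z q ρ ∧ ball x 1 ⊆ ball q ρ ∧
    ball q ρ ⊆ ball x 9

/-- `C¹` functions vanishing on `Z`. -/
def testSpace (Z : Set ℂ) : Submodule ℝ (ℂ → ℝ) where
  carrier := {f | ContDiff ℝ 1 f ∧ ∀ z ∈ Z, f z = 0}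
  add_mem' := fun hf hg => ⟨hf.1.add hg.1, fun z hz => by simp [hf.2 z hz, hg.2 z hz]⟩
  zero_mem' := ⟨contDiff_const, fun _ _ => rfl⟩
  smul_mem' := fun c f hf => ⟨contDiff_const.smul hf.1, fun z hz => by simp [hf.2 z hz]⟩

theorem gr_mul {a f : ℂ → ℝ} {z : ℂ} (ha : DifferentiableAt ℝ a z) (hf : DifferentiableAt ℝ f z) :
    gr (fun w => a w * f w) z = a z * gr f z + f z * gr a z := by
  simp only [gr]
  rw [fderiv_fun_mul ha hf]
  simp only [add_apply, smul_apply, smul_eq_mul, ofReal_add, ofReal_mul]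
  ring

theorem gr_add {a f : ℂ → ℝ} {z : ℂ} (ha : DifferentiableAt ℝ a z) (hf : DifferentiableAt ℝ f z) :
    gr (a + f) z = gr a z + gr f z := by
  simp only [gr]
  rw [fderiv_add ha hf]
  simp only [add_apply, ofReal_add]
  ring

theorem gr_sub {a f : ℂ → ℝ} {z : ℂ} (ha : DifferentiableAt ℝ a z) (hf : DifferentiableAt ℝ f z) :
    gr (a - f) z = gr a z - gr f z := by
  simp only [gr]
  rw [fderiv_sub ha hf]
  simp only [sub_apply, ofReal_sub]
  ring

theorem gr_smul {f : ℂ → ℝ} {z : ℂ} (c : ℝ) (hf : DifferentiableAt ℝ f z) :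
    gr (c • f) z = c * gr f z := by
  simp only [gr]
  rw [fderiv_const_smul hf]
  simp only [smul_apply, smul_eq_mul, ofReal_mul]
  ring

section
variable {Z : Set ℂ} {R : ℝ}

theorem Thick.hasCompactSupport (hZ : Thick Z R) {f : ℂ → ℝ} (hf : f ∈ testSpace Z) :
    HasCompactSupport f :=
  HasCompactSupport.intro (isCompact_closedBall (0 : ℂ) R) fun z hz => hf.2 z <| hZ.outer z <| by
    rw [mem_closedBall_zero_iff] at hz
    linarith

theorem hasCompactSupport_gr {f : ℂ → ℝ} (hf : HasCompactSupport f) : HasCompactSupport (gr f) := by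
  have h := hf.fderiv (𝕜 := ℝ)
  exact h.comp_left (g := fun T : ℂ →L[ℝ] ℝ => (T 1 : ℂ) + I * T I) (by simp)

theorem Thick.memLp (hZ : Thick Z R) {f : ℂ → ℝ} (hf : f ∈ testSpace Z) : MemLp f 2 :=
  hf.1.continuous.memLp_of_hasCompactSupport (hZ.hasCompactSupport hf)

theorem Thick.memLp_gr (hZ : Thick Z R) {f : ℂ → ℝ} (hf : f ∈ testSpace Z) : MemLp (gr f) 2 :=
  (continuous_gr hf.1).memLp_of_hasCompactSupport (hasCompactSupport_gr (hZ.hasCompactSupport hf))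

theorem mul_mem_testSpace {a f : ℂ → ℝ} (ha : ContDiff ℝ 1 a) (hf : f ∈ testSpace Z) :
    (fun z => a z * f z) ∈ testSpace Z :=
  ⟨ha.mul hf.1, fun z hz => by simp [hf.2 z hz]⟩

theorem Thick.lintegral_poincare (hZ : Thick Z R) {f : ℂ → ℝ} (hf : f ∈ testSpace Z) {ω : ℂ → ℝ}
    (hω : Continuous ω) (hω0 : ∀ z, 0 ≤ ω z) {K : ℝ} (hK0 : 0 ≤ K)
    (hK : ∀ x ζ, dist ζ x < 9 → ω ζ ≤ K * ω x) :
    ∫⁻ ζ, ENNReal.ofReal (ω ζ * f ζ ^ 2) ≤ ENNReal.ofReal (8100 * Real.pi ^ 2 * K ^ 2) *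
      ∫⁻ ζ, ENNReal.ofReal (ω ζ * ‖gr f ζ‖ ^ 2) := by
  have hfc := hf.1.continuous
  have hgc := continuous_gr hf.1
  have hpi := Real.pi_pos
  have key : ∀ x, ∫⁻ ζ in ball x 1, ENNReal.ofReal (ω ζ * f ζ ^ 2) ≤
      ENNReal.ofReal (100 * Real.pi ^ 2 * K ^ 2) *
        ∫⁻ ζ in ball x 9, ENNReal.ofReal (ω ζ * ‖gr f ζ‖ ^ 2) := by
    intro x
    obtain ⟨q, ρ, hρ0, hρ, hm, h1, h2⟩ := hZ.disc x
    have hcp := circle_poincare hm hf.1 hf.2 (w := fun _ => 1) measurable_const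
    simp only [one_mul] at hcp
    calc ∫⁻ ζ in ball x 1, ENNReal.ofReal (ω ζ * f ζ ^ 2)
        ≤ ∫⁻ ζ in ball x 1, ENNReal.ofReal (K * ω x) * ENNReal.ofReal (f ζ ^ 2) := by
          refine setLIntegral_mono' measurableSet_ball fun ζ hζ => ?_
          rw [← ENNReal.ofReal_mul (mul_nonneg hK0 (hω0 x))]
          gcongr
          exact hK x ζ (lt_trans hζ (by norm_num))
      _ = ENNReal.ofReal (K * ω x) * ∫⁻ ζ in ball x 1, ENNReal.ofReal (f ζ ^ 2) :=
          lintegral_const_mul' _ _ ENNReal.ofReal_ne_top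
      _ ≤ ENNReal.ofReal (K * ω x) * ∫⁻ ζ in ball q ρ, ENNReal.ofReal (f ζ ^ 2) := by
          gcongr
      _ ≤ ENNReal.ofReal (K * ω x) * (ENNReal.ofReal (4 * Real.pi ^ 2) *
            ∫⁻ ζ in ball q ρ, ENNReal.ofReal (‖ζ - q‖ ^ 2 * ‖gr f ζ‖ ^ 2)) := by
          gcongr
      _ = ∫⁻ ζ in ball q ρ, ENNReal.ofReal (K * ω x) * (ENNReal.ofReal (4 * Real.pi ^ 2) *
            ENNReal.ofReal (‖ζ - q‖ ^ 2 * ‖gr f ζ‖ ^ 2)) := by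
          rw [lintegral_const_mul' _ _ ENNReal.ofReal_ne_top,
            lintegral_const_mul' _ _ ENNReal.ofReal_ne_top]
      _ ≤ ∫⁻ ζ in ball q ρ, ENNReal.ofReal (100 * Real.pi ^ 2 * K ^ 2) *
            ENNReal.ofReal (ω ζ * ‖gr f ζ‖ ^ 2) := by
          refine setLIntegral_mono' measurableSet_ball fun ζ hζ => ?_
          rw [← ENNReal.ofReal_mul (by positivity), ← ENNReal.ofReal_mul (mul_nonneg hK0 (hω0 x)),
            ← ENNReal.ofReal_mul (by positivity)]
          refine ENNReal.ofReal_le_ofReal ?_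
          have h3 : ‖ζ - q‖ ^ 2 ≤ 25 := by
            rw [mem_ball, dist_eq_norm] at hζ
            nlinarith [norm_nonneg (ζ - q)]
          have h4 : ω x ≤ K * ω ζ := hK ζ x (by rw [dist_comm]; exact h2 hζ)
          calc K * ω x * (4 * Real.pi ^ 2 * (‖ζ - q‖ ^ 2 * ‖gr f ζ‖ ^ 2))
              ≤ K * (K * ω ζ) * (4 * Real.pi ^ 2 * (25 * ‖gr f ζ‖ ^ 2)) := by
                have := hω0 ζ
                gcongr
            _ = _ := by ring
      _ = ENNReal.ofReal (100 * Real.pi ^ 2 * K ^ 2) *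
            ∫⁻ ζ in ball q ρ, ENNReal.ofReal (ω ζ * ‖gr f ζ‖ ^ 2) :=
          lintegral_const_mul' _ _ ENNReal.ofReal_ne_top
      _ ≤ _ := by gcongr
  have h := lintegral_mono (μ := (volume : Measure ℂ)) key
  rw [lintegral_const_mul' _ _ ENNReal.ofReal_ne_top,
    lintegral_lintegral_ball (Continuous.measurable (by fun_prop)).ennreal_ofReal,
    lintegral_lintegral_ball (Continuous.measurable (by fun_prop)).ennreal_ofReal,
    Complex.volume_ball, Complex.volume_ball] at h
  have e : ENNReal.ofReal (8100 * Real.pi ^ 2 * K ^ 2) =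
      ENNReal.ofReal 81 * ENNReal.ofReal (100 * Real.pi ^ 2 * K ^ 2) := by
    rw [← ENNReal.ofReal_mul (by norm_num)]
    congr 1
    ring
  have e9 : ENNReal.ofReal 9 ^ 2 = ENNReal.ofReal 81 := by
    rw [← ENNReal.ofReal_pow (by norm_num)]
    norm_num
  rw [ENNReal.ofReal_one, one_pow, one_mul, e9] at h
  rw [e]
  have hpn : (NNReal.pi : ENNReal) ≠ 0 := by
    simpa using NNReal.pi_ne_zero
  refine (ENNReal.mul_le_mul_iff_right hpn ENNReal.coe_ne_top).1 (h.trans_eq ?_)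
  ring

theorem integral_le_of_lintegral_le {f h : ℂ → ℝ} {c : ℝ} (hc : 0 ≤ c) (hf0 : ∀ z, 0 ≤ f z)
    (hfm : AEStronglyMeasurable f) (hh0 : ∀ z, 0 ≤ h z) (hh : Integrable h)
    (hle : ∫⁻ z, ENNReal.ofReal (f z) ≤ ENNReal.ofReal c * ∫⁻ z, ENNReal.ofReal (h z)) :
    ∫ z, f z ≤ c * ∫ z, h z := by
  rw [integral_eq_lintegral_of_nonneg_ae (Eventually.of_forall hf0) hfm,
    ← ENNReal.toReal_ofReal hc, ← ENNReal.toReal_ofReal (integral_nonneg hh0),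
    ofReal_integral_eq_lintegral_ofReal hh (Eventually.of_forall hh0), ← ENNReal.toReal_mul]
  refine ENNReal.toReal_mono (ENNReal.mul_ne_top ENNReal.ofReal_ne_top ?_) hle
  rw [← ofReal_integral_eq_lintegral_ofReal hh (Eventually.of_forall hh0)]
  exact ENNReal.ofReal_ne_top

/-- `ψ` is a limit of test functions in the Sobolev sense, with gradient `g`. -/
def H10 (Z : Set ℂ) (ψ : ℂ → ℝ) (g : ℂ → ℂ) : Prop :=
  ∃ f : ℕ → ℂ → ℝ, (∀ n, f n ∈ testSpace Z) ∧ L2Tendsto f ψ ∧ L2Tendsto (fun n => gr (f n)) g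

theorem L2Tendsto.integral_weight_sq {f : ℕ → ℂ → ℝ} {F : ℂ → ℝ} (h : L2Tendsto f F) {a : ℂ → ℝ}
    (ha : AEStronglyMeasurable a) {c : ℝ} (hc : ∀ z, |a z| ≤ c) :
    Tendsto (fun n => ∫ z, a z * f n z ^ 2) atTop (𝓝 (∫ z, a z * F z ^ 2)) := by
  have := (h.bdd_mul ha hc).integral_mul h
  simpa only [pow_two, mul_assoc] using this

theorem L2Tendsto.norm {f : ℕ → ℂ → ℂ} {F : ℂ → ℂ} (h : L2Tendsto f F) :
    L2Tendsto (fun n z => ‖f n z‖) (fun z => ‖F z‖) :=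
  h.of_le (c := 1) (fun n => (h.memLp n).aestronglyMeasurable.norm)
    h.memLp_lim.aestronglyMeasurable.norm (fun n z => by simp) (fun z => by simp)
    (fun n z => by rw [one_mul]; exact abs_norm_sub_norm_le _ _)

theorem H10.weighted_le {ψ : ℂ → ℝ} {g : ℂ → ℂ} (h : H10 Z ψ g) {a b : ℂ → ℝ}
    (ha : AEStronglyMeasurable a) {c : ℝ} (hac : ∀ z, |a z| ≤ c)
    (hb : AEStronglyMeasurable b) {c' : ℝ} (hbc : ∀ z, |b z| ≤ c') {C : ℝ}
    (hab : ∀ f ∈ testSpace Z, ∫ z, a z * f z ^ 2 ≤ C * ∫ z, b z * ‖gr f z‖ ^ 2) :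
    ∫ z, a z * ψ z ^ 2 ≤ C * ∫ z, b z * ‖g z‖ ^ 2 := by
  obtain ⟨f, hf, h1, h2⟩ := h
  exact le_of_tendsto_of_tendsto' (h1.integral_weight_sq ha hac)
    ((h2.norm.integral_weight_sq hb hbc).const_mul C) fun n => hab _ (hf n)

theorem Thick.integrable_weight_gr (hZ : Thick Z R) {f : ℂ → ℝ} (hf : f ∈ testSpace Z) {b : ℂ → ℝ}
    (hb : AEStronglyMeasurable b) {c' : ℝ} (hbc : ∀ z, |b z| ≤ c') :
    Integrable fun z => b z * ‖gr f z‖ ^ 2 :=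
  (hZ.memLp_gr hf).norm.integrable_sq.bdd_mul hb (Eventually.of_forall hbc)

theorem Thick.poincare_of_mem (hZ : Thick Z R) {f : ℂ → ℝ} (hf : f ∈ testSpace Z) {ω : ℂ → ℝ}
    (hω : Continuous ω) (hω0 : ∀ z, 0 ≤ ω z) {c : ℝ} (hωc : ∀ z, ω z ≤ c) {K : ℝ} (hK0 : 0 ≤ K)
    (hK : ∀ x ζ, dist ζ x < 9 → ω ζ ≤ K * ω x) :
    ∫ z, ω z * f z ^ 2 ≤ 8100 * Real.pi ^ 2 * K ^ 2 * ∫ z, ω z * ‖gr f z‖ ^ 2 := by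
  have hfc := hf.1.continuous
  have hωc' : ∀ z, |ω z| ≤ c := fun z => by rw [abs_of_nonneg (hω0 z)]; exact hωc z
  exact integral_le_of_lintegral_le (by positivity)
    (fun z => mul_nonneg (hω0 z) (by positivity))
    (Continuous.aestronglyMeasurable (by fun_prop)) (fun z => mul_nonneg (hω0 z) (by positivity))
    (hZ.integrable_weight_gr hf hω.aestronglyMeasurable hωc')
    (hZ.lintegral_poincare hf hω hω0 hK0 hK)

theorem Thick.poincare (hZ : Thick Z R) {ψ : ℂ → ℝ} {g : ℂ → ℂ} (h : H10 Z ψ g) {ω : ℂ → ℝ}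
    (hω : Continuous ω) (hω0 : ∀ z, 0 ≤ ω z) {c : ℝ} (hωc : ∀ z, ω z ≤ c) {K : ℝ} (hK0 : 0 ≤ K)
    (hK : ∀ x ζ, dist ζ x < 9 → ω ζ ≤ K * ω x) :
    ∫ z, ω z * ψ z ^ 2 ≤ 8100 * Real.pi ^ 2 * K ^ 2 * ∫ z, ω z * ‖g z‖ ^ 2 := by
  have hωc' : ∀ z, |ω z| ≤ c := fun z => by rw [abs_of_nonneg (hω0 z)]; exact hωc z
  exact h.weighted_le hω.aestronglyMeasurable hωc' hω.aestronglyMeasurable hωc'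
    fun f hf => hZ.poincare_of_mem hf hω hω0 hωc hK0 hK

/-- Radially weighted Poincaré inequality about points of `Z`. -/
theorem Thick.circle_poincare (hZ : Thick Z R) {ψ : ℂ → ℝ} {g : ℂ → ℂ} (h : H10 Z ψ g) {q : ℂ}
    (hq : q ∈ Z) {w : ℝ → ℝ} (hw : Measurable w) (hw0 : ∀ r, 0 ≤ w r) (hw1 : ∀ r, 1 ≤ r → w r = 0)
    {c : ℝ} (hwc : ∀ r, 0 ≤ r → w r ≤ c) :
    ∫ z, w ‖z - q‖ * ψ z ^ 2 ≤
      4 * Real.pi ^ 2 * ∫ z, w ‖z - q‖ * ‖z - q‖ ^ 2 * ‖g z‖ ^ 2 := by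
  have m1 : Measurable fun z => w ‖z - q‖ := hw.comp (by fun_prop)
  have m2 : Measurable fun z => w ‖z - q‖ * ‖z - q‖ ^ 2 := m1.mul (by fun_prop)
  have b1 : ∀ z, |w ‖z - q‖| ≤ c := fun z => by
    rw [abs_of_nonneg (hw0 _)]
    exact hwc _ (norm_nonneg _)
  have b2 : ∀ z, |w ‖z - q‖ * ‖z - q‖ ^ 2| ≤ c := fun z => by
    rw [abs_of_nonneg (mul_nonneg (hw0 _) (by positivity))]
    rcases le_total 1 ‖z - q‖ with h1 | h1
    · rw [hw1 _ h1, zero_mul]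
      exact (hw0 0).trans (hwc 0 le_rfl)
    · calc w ‖z - q‖ * ‖z - q‖ ^ 2 ≤ w ‖z - q‖ * 1 := by
            gcongr
            · exact hw0 _
            · exact pow_le_one₀ (norm_nonneg _) h1
        _ ≤ c := by
            rw [mul_one]
            exact hwc _ (norm_nonneg _)
  refine h.weighted_le m1.aestronglyMeasurable b1 m2.aestronglyMeasurable b2 fun f hf => ?_
  have hfc := hf.1.continuous
  refine integral_le_of_lintegral_le (by positivity) (fun z => mul_nonneg (hw0 _) (by positivity))
    (m1.aestronglyMeasurable.mul (Continuous.aestronglyMeasurable (by fun_prop)))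
    (fun z => mul_nonneg (mul_nonneg (hw0 _) (by positivity)) (by positivity))
    (hZ.integrable_weight_gr hf m2.aestronglyMeasurable b2) ?_
  have hcp := Landis.circle_poincare (hZ.circles q hq) hf.1 hf.2
    (w := fun r => ENNReal.ofReal (w r)) hw.ennreal_ofReal
  have e : ∀ G : ℂ → ℝ, ∫⁻ z, ENNReal.ofReal (w ‖z - q‖ * G z) =
      ∫⁻ z in ball q 1, ENNReal.ofReal (w ‖z - q‖) * ENNReal.ofReal (G z) := by
    intro G
    rw [← lintegral_indicator measurableSet_ball]
    refine lintegral_congr fun z => ?_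
    by_cases hz : z ∈ ball q 1
    · rw [indicator_of_mem hz, ENNReal.ofReal_mul (hw0 _)]
    · rw [indicator_of_notMem hz, hw1, zero_mul, ENNReal.ofReal_zero]
      rw [mem_ball, dist_eq_norm] at hz
      linarith
  simp only [mul_assoc (w _)]
  rw [e, e]
  exact hcp
end

/-- A bounded potential of finite `L²` norm. -/
structure Potential (V : ℂ → ℝ) (ε : ℝ) : Prop where
  measurable : Measurable V
  bound : ∀ z, |V z| ≤ ε ^ 2
  memLp : MemLp V 2

/-- `φ = 1 + ψ` solves `Δφ = Vφ` off `Z`, and `ψ` vanishes on `Z`; here `g = ∇ψ`. -/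
structure WeakSol (Z : Set ℂ) (V ψ : ℂ → ℝ) (g : ℂ → ℂ) : Prop where
  h10 : H10 Z ψ g
  weak : ∀ f ∈ testSpace Z,
    (∫ z, ((starRingEnd ℂ) (g z) * gr f z).re) + ∫ z, V z * (1 + ψ z) * f z = 0

theorem integrable_mul_of_memLp {𝕜 : Type*} [RCLike 𝕜] {f h : ℂ → 𝕜} (hf : MemLp f 2)
    (hh : MemLp h 2) : Integrable fun z => f z * h z :=
  hf.integrable_mul hh

theorem sq_integral_mul_le {f h : ℂ → ℝ} (hf : MemLp f 2) (hh : MemLp h 2) :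
    (∫ z, f z * h z) ^ 2 ≤ (∫ z, f z ^ 2) * ∫ z, h z ^ 2 := by
  have i1 := hf.integrable_sq
  have i2 := hh.integrable_sq
  have i3 : Integrable fun z => f z * h z := hf.integrable_mul hh
  have key : ∀ t : ℝ, 0 ≤ (∫ z, h z ^ 2) * (t * t) + (2 * ∫ z, f z * h z) * t + ∫ z, f z ^ 2 := by
    intro t
    have h0 : 0 ≤ ∫ z, (f z + t * h z) ^ 2 := integral_nonneg fun z => sq_nonneg _
    have e : ∀ z, (f z + t * h z) ^ 2 = (f z ^ 2 + 2 * t * (f z * h z)) + t ^ 2 * h z ^ 2 :=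
      fun z => by ring
    simp only [e] at h0
    rw [integral_add (i1.fun_add (i3.const_mul _)) (i2.const_mul _), integral_add i1 (i3.const_mul _),
      integral_const_mul, integral_const_mul] at h0
    linarith
  have := discrim_le_zero key
  rw [discrim] at this
  linarith

theorem re_conj_mul_self (a : ℂ) : ((starRingEnd ℂ) a * a).re = ‖a‖ ^ 2 := by
  rw [Complex.conj_mul', ← ofReal_pow, ofReal_re]

theorem memLp_conj {g : ℂ → ℂ} (hg : MemLp g 2) : MemLp (fun z => (starRingEnd ℂ) (g z)) 2 :=
  hg.of_le (continuous_conj.comp_aestronglyMeasurable hg.aestronglyMeasurable)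
    (Eventually.of_forall fun z => by rw [RCLike.norm_conj])

theorem integrable_re_conj_mul {g h : ℂ → ℂ} (hg : MemLp g 2) (hh : MemLp h 2) :
    Integrable fun z => ((starRingEnd ℂ) (g z) * h z).re :=
  ((memLp_conj hg).integrable_mul hh).re

theorem L2Tendsto.conj {f : ℕ → ℂ → ℂ} {F : ℂ → ℂ} (h : L2Tendsto f F) :
    L2Tendsto (fun n z => (starRingEnd ℂ) (f n z)) (fun z => (starRingEnd ℂ) (F z)) :=
  h.clm (conjCLE : ℂ →L[ℝ] ℂ)

theorem L2Tendsto.integral_re {f g : ℕ → ℂ → ℂ} {f' g' : ℂ → ℂ} (hf : L2Tendsto f f')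
    (hg : L2Tendsto g g') :
    Tendsto (fun n => ∫ z, ((starRingEnd ℂ) (f n z) * g n z).re) atTop
      (𝓝 (∫ z, ((starRingEnd ℂ) (f' z) * g' z).re)) := by
  have h := (continuous_re.tendsto _).comp (hf.conj.integral_mul hg)
  have e : ∀ a b : ℂ → ℂ, MemLp a 2 → MemLp b 2 →
      (∫ z, (starRingEnd ℂ) (a z) * b z).re = ∫ z, ((starRingEnd ℂ) (a z) * b z).re :=
    fun a b ha hb => (_root_.integral_re (integrable_mul_of_memLp (memLp_conj ha) hb)).symm
  rw [e _ _ hf.memLp_lim hg.memLp_lim] at h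
  exact h.congr fun n => e _ _ (hf.memLp n) (hg.memLp n)

theorem Potential.mul_memLp {V : ℂ → ℝ} {ε : ℝ} (hV : Potential V ε) {ψ : ℂ → ℝ}
    (h : MemLp ψ 2) : MemLp (fun z => V z * ψ z) 2 :=
  h.of_le_mul (c := ε ^ 2) (hV.measurable.aestronglyMeasurable.mul h.aestronglyMeasurable)
    (Eventually.of_forall fun z => by
      rw [norm_mul]
      gcongr
      exact hV.bound z)

theorem Potential.mul_one_add_memLp {V : ℂ → ℝ} {ε : ℝ} (hV : Potential V ε) {ψ : ℂ → ℝ}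
    (h : MemLp ψ 2) : MemLp (fun z => V z * (1 + ψ z)) 2 := by
  simp only [mul_add, mul_one]
  exact hV.memLp.add (hV.mul_memLp h)

/-- The quadratic form `∫ ∇f·∇h + V f h` on test functions. -/
noncomputable def energy {Z : Set ℂ} {R : ℝ} (hZ : Thick Z R) {V : ℂ → ℝ} {ε : ℝ}
    (hV : Potential V ε) : testSpace Z →ₗ[ℝ] testSpace Z →ₗ[ℝ] ℝ :=
  have i1 : ∀ f h : testSpace Z, Integrable fun z =>
      ((starRingEnd ℂ) (gr f.1 z) * gr h.1 z).re := fun f h =>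
    integrable_re_conj_mul (hZ.memLp_gr f.2) (hZ.memLp_gr h.2)
  have i2 : ∀ f h : testSpace Z, Integrable fun z => V z * f.1 z * h.1 z := fun f h =>
    (hV.mul_memLp (hZ.memLp f.2)).integrable_mul (hZ.memLp h.2)
  have d : ∀ f : testSpace Z, Differentiable ℝ f.1 := fun f => f.2.1.differentiable one_ne_zero
  LinearMap.mk₂ ℝ (fun f h => ∫ z, (((starRingEnd ℂ) (gr f.1 z) * gr h.1 z).re +
      V z * f.1 z * h.1 z))
    (fun f f' h => by
      rw [← integral_add ((i1 f h).fun_add (i2 f h)) ((i1 f' h).fun_add (i2 f' h))]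
      refine integral_congr_ae (Eventually.of_forall fun z => ?_)
      simp only [Submodule.coe_add, gr_add (d f z) (d f' z), Pi.add_apply, map_add, add_mul, mul_add,
        add_re]
      ring)
    (fun c f h => by
      rw [← integral_smul]
      refine integral_congr_ae (Eventually.of_forall fun z => ?_)
      simp only [Submodule.coe_smul, gr_smul c (d f z), Pi.smul_apply, map_mul, conj_ofReal,
        mul_assoc, re_ofReal_mul, smul_eq_mul]
      ring)
    (fun f h h' => by
      rw [← integral_add ((i1 f h).fun_add (i2 f h)) ((i1 f h').fun_add (i2 f h'))]
      refine integral_congr_ae (Eventually.of_forall fun z => ?_)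
      simp only [Submodule.coe_add, gr_add (d h z) (d h' z), Pi.add_apply, mul_add,
        add_re]
      ring)
    (fun c f h => by
      rw [← integral_smul]
      refine integral_congr_ae (Eventually.of_forall fun z => ?_)
      simp only [Submodule.coe_smul, gr_smul c (d h z), Pi.smul_apply,
        mul_left_comm _ (c : ℂ), re_ofReal_mul, smul_eq_mul]
      ring)

section
variable {Z : Set ℂ} {R : ℝ} {V : ℂ → ℝ} {ε : ℝ}

theorem energy_apply (hZ : Thick Z R) (hV : Potential V ε) (f h : testSpace Z) :
    energy hZ hV f h = ∫ z, (((starRingEnd ℂ) (gr f.1 z) * gr h.1 z).re +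
      V z * f.1 z * h.1 z) := rfl

theorem energy_eq (hZ : Thick Z R) (hV : Potential V ε) (f h : testSpace Z) :
    energy hZ hV f h = (∫ z, ((starRingEnd ℂ) (gr f.1 z) * gr h.1 z).re) +
      ∫ z, V z * f.1 z * h.1 z := by
  rw [energy_apply, integral_add (integrable_re_conj_mul (hZ.memLp_gr f.2) (hZ.memLp_gr h.2))
    (integrable_mul_of_memLp (hV.mul_memLp (hZ.memLp f.2)) (hZ.memLp h.2))]

theorem Thick.poincare_one (hZ : Thick Z R) {f : ℂ → ℝ} (hf : f ∈ testSpace Z) :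
    ∫ z, f z ^ 2 ≤ 8100 * Real.pi ^ 2 * ∫ z, ‖gr f z‖ ^ 2 := by
  have := hZ.poincare_of_mem hf (ω := fun _ => 1) continuous_const (by simp) (c := 1) (by simp)
    (K := 1) zero_le_one (by simp)
  simpa using this

theorem half_le_energy (hZ : Thick Z R) (hV : Potential V ε)
    (hε : ε ^ 2 * (8100 * Real.pi ^ 2) ≤ 1 / 2) (f : testSpace Z) :
    1 / 2 * ∫ z, ‖gr f.1 z‖ ^ 2 ≤ energy hZ hV f f := by
  rw [energy_eq]
  simp only [re_conj_mul_self]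
  have h1 : |∫ z, V z * f.1 z * f.1 z| ≤ ε ^ 2 * ∫ z, f.1 z ^ 2 := by
    rw [← Real.norm_eq_abs, ← integral_const_mul]
    refine norm_integral_le_of_norm_le ((hZ.memLp f.2).integrable_sq.const_mul _)
      (Eventually.of_forall fun z => ?_)
    rw [mul_assoc, norm_mul, ← pow_two, norm_pow, Real.norm_eq_abs, Real.norm_eq_abs, sq_abs]
    gcongr
    exact hV.bound z
  have h2 := hZ.poincare_one f.2
  have h3 : 0 ≤ ∫ z, ‖gr f.1 z‖ ^ 2 := integral_nonneg fun z => by positivity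
  have h4 : ε ^ 2 * ∫ z, f.1 z ^ 2 ≤ 1 / 2 * ∫ z, ‖gr f.1 z‖ ^ 2 := by
    calc _ ≤ ε ^ 2 * (8100 * Real.pi ^ 2 * ∫ z, ‖gr f.1 z‖ ^ 2) := by gcongr
      _ = ε ^ 2 * (8100 * Real.pi ^ 2) * ∫ z, ‖gr f.1 z‖ ^ 2 := by ring
      _ ≤ _ := by gcongr
  have := neg_abs_le (∫ z, V z * f.1 z * f.1 z)
  linarith

theorem exists_weakSol (hZ : Thick Z R) (hV : Potential V ε)
    (hε : ε ^ 2 * (8100 * Real.pi ^ 2) ≤ 1 / 2) : ∃ ψ g, WeakSol Z V ψ g := by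
  have hpi := Real.pi_pos
  have hgr0 : ∀ f : testSpace Z, 0 ≤ ∫ z, ‖gr f.1 z‖ ^ 2 := fun f =>
    integral_nonneg fun z => by positivity
  have hhalf := half_le_energy hZ hV hε
  have hpos : ∀ f : testSpace Z, 0 ≤ energy hZ hV f f := fun f => by
    have := hhalf f
    have := hgr0 f
    linarith
  have il : ∀ f : testSpace Z, Integrable fun z => V z * f.1 z := fun f =>
    hV.memLp.integrable_mul (hZ.memLp f.2)
  let l : testSpace Z →ₗ[ℝ] ℝ :=
    { toFun := fun f => ∫ z, V z * f.1 z
      map_add' := fun f h => by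
        rw [← integral_add (il f) (il h)]
        simp [mul_add]
      map_smul' := fun c f => by
        rw [RingHom.id_apply, ← integral_smul]
        refine integral_congr_ae (Eventually.of_forall fun z => ?_)
        simp only [Submodule.coe_smul, Pi.smul_apply, smul_eq_mul]
        ring }
  have hl : ∀ f, l f ^ 2 ≤ ((∫ z, V z ^ 2) * (8100 * Real.pi ^ 2 * 2)) * energy hZ hV f f := by
    intro f
    refine (sq_integral_mul_le hV.memLp (hZ.memLp f.2)).trans ?_
    rw [mul_assoc]
    gcongr
    refine (hZ.poincare_one f.2).trans ?_
    have := hhalf f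
    have : ∫ z, ‖gr f.1 z‖ ^ 2 ≤ 2 * energy hZ hV f f := by linarith
    calc _ ≤ 8100 * Real.pi ^ 2 * (2 * energy hZ hV f f) := by gcongr
      _ = _ := by ring
  have hsymm : ∀ f h, energy hZ hV f h = energy hZ hV h f := by
    intro f h
    rw [energy_apply, energy_apply]
    refine integral_congr_ae (Eventually.of_forall fun z => ?_)
    simp only [mul_re, conj_re, conj_im]
    ring
  set D : ℝ := 17 * (1 + 8100 * Real.pi ^ 2) with hD
  have hD0 : 0 < D := by positivity
  set κ : ℕ → ℝ := fun n => (1 / 4 : ℝ) ^ n / D with hκd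
  obtain ⟨x, hx1, hx2⟩ := exists_minimizing_seq (energy hZ hV) l hsymm hpos
    (C := (∫ z, V z ^ 2) * (8100 * Real.pi ^ 2 * 2))
    (mul_nonneg (integral_nonneg fun z => by positivity) (by positivity)) hl
    (κ := κ) (fun n => by positivity)
  have hpow : ∀ N : ℕ, ((1 / 2 : ℝ) ^ N) ^ 2 = (1 / 4) ^ N := by
    intro N
    rw [← pow_mul, mul_comm, pow_mul]
    norm_num
  have hκle : ∀ N n, N ≤ n → κ n ≤ (1 / 4 : ℝ) ^ N / D := by
    intro N n h
    have := pow_le_pow_of_le_one (by norm_num : (0 : ℝ) ≤ 1 / 4) (by norm_num) h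
    simp only [hκd]
    gcongr
  have hg : ∀ N n m : ℕ, N ≤ n → N ≤ m →
      ∫ z, ‖gr (x n - x m).1 z‖ ^ 2 ≤ 16 * ((1 / 4 : ℝ) ^ N / D) := by
    intro N n m hn hm
    have h1 := hhalf (x n - x m)
    have h2 := hx1 n m
    have h3 := hκle N n hn
    have h4 := hκle N m hm
    linarith
  have d : ∀ f : testSpace Z, Differentiable ℝ f.1 := fun f => f.2.1.differentiable one_ne_zero
  have hsub : ∀ n m z, gr (x n - x m).1 z = gr (x n).1 z - gr (x m).1 z := fun n m z =>
    gr_sub (d _ z) (d _ z)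
  have hp : ∀ N : ℕ, 0 < (1 / 4 : ℝ) ^ N := fun N => by positivity
  obtain ⟨g, hg'⟩ := exists_L2Tendsto (f := fun n => gr (x n).1) (fun n => hZ.memLp_gr (x n).2)
    fun N n m hn hm => by
      simp only [← hsub]
      rw [hpow]
      refine (hg N n m hn hm).trans_lt ?_
      rw [← mul_div_assoc, div_lt_iff₀ hD0, mul_comm]
      refine mul_lt_mul_of_pos_left ?_ (hp N)
      rw [hD]
      nlinarith
  obtain ⟨ψ, hψ⟩ := exists_L2Tendsto (f := fun n => (x n).1) (fun n => hZ.memLp (x n).2)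
    fun N n m hn hm => by
      rw [hpow]
      simp only [Real.norm_eq_abs, sq_abs]
      refine (hZ.poincare_one (x n - x m).2).trans_lt ?_
      have := hg N n m hn hm
      calc _ ≤ 8100 * Real.pi ^ 2 * (16 * ((1 / 4 : ℝ) ^ N / D)) := by gcongr
        _ = (1 / 4 : ℝ) ^ N * (8100 * Real.pi ^ 2 * 16) / D := by ring
        _ < _ := by
          rw [div_lt_iff₀ hD0]
          refine mul_lt_mul_of_pos_left ?_ (hp N)
          rw [hD]
          nlinarith
  refine ⟨ψ, g, ⟨fun n => (x n).1, fun n => (x n).2, hψ, hg'⟩, fun f hf => ?_⟩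
  have hκ0 : Tendsto κ atTop (𝓝 0) := by
    have := (tendsto_pow_atTop_nhds_zero_of_lt_one (by norm_num : (0 : ℝ) ≤ 1 / 4)
      (by norm_num)).div_const D
    rwa [zero_div] at this
  have t1 : Tendsto (fun n => energy hZ hV (x n) ⟨f, hf⟩ + l ⟨f, hf⟩) atTop (𝓝 0) := by
    have h1 : Tendsto (fun n => (energy hZ hV (x n) ⟨f, hf⟩ + l ⟨f, hf⟩) ^ 2) atTop (𝓝 0) := by
      have h2 := (hκ0.const_mul 2).mul_const (energy hZ hV ⟨f, hf⟩ ⟨f, hf⟩)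
      rw [mul_zero, zero_mul] at h2
      exact tendsto_of_tendsto_of_tendsto_of_le_of_le tendsto_const_nhds h2
        (fun n => sq_nonneg _) fun n => hx2 n _
    have h3 := (Real.continuous_sqrt.tendsto 0).comp h1
    rw [Real.sqrt_zero] at h3
    rw [tendsto_zero_iff_abs_tendsto_zero]
    exact h3.congr fun n => Real.sqrt_sq_eq_abs _
  have t2 : Tendsto (fun n => energy hZ hV (x n) ⟨f, hf⟩ + l ⟨f, hf⟩) atTop
      (𝓝 ((∫ z, ((starRingEnd ℂ) (g z) * gr f z).re) + (∫ z, V z * ψ z * f z) + l ⟨f, hf⟩)) := by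
    simp only [energy_eq]
    exact ((hg'.integral_re (.const (hZ.memLp_gr hf))).add
      ((hψ.bdd_mul hV.measurable.aestronglyMeasurable hV.bound).integral_mul
        (.const (hZ.memLp hf)))).add_const _
  have h := tendsto_nhds_unique t2 t1
  rw [← h, add_assoc]
  congr 1
  change _ = _ + ∫ z, V z * f z
  rw [← integral_add (integrable_mul_of_memLp (hV.mul_memLp hψ.memLp_lim) (hZ.memLp hf)) (il ⟨f, hf⟩)]
  refine integral_congr_ae (Eventually.of_forall fun z => ?_)
  ring

/-- Testing the equation with `ω ψ`. -/
theorem WeakSol.test_weight {ψ : ℂ → ℝ} {g : ℂ → ℂ} (h : WeakSol Z V ψ g) (hV : Potential V ε)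
    {ω : ℂ → ℝ} (hω : ContDiff ℝ 1 ω) {c : ℝ} (hc : ∀ z, |ω z| ≤ c)
    (hc' : ∀ z, ‖gr ω z‖ ≤ c) :
    (∫ z, ω z * ‖g z‖ ^ 2) + (∫ z, ψ z * ((starRingEnd ℂ) (g z) * gr ω z).re) +
      ∫ z, ω z * (V z * (1 + ψ z) * ψ z) = 0 := by
  obtain ⟨f, hf, h1, h2⟩ := h.h10
  have hg := h2.memLp_lim
  have hVψ := hV.mul_one_add_memLp h1.memLp_lim
  have hωm := hω.continuous.aestronglyMeasurable (μ := volume)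
  have hgω := (continuous_gr hω).aestronglyMeasurable (μ := volume)
  have r1 : ∀ (F : ℂ → ℝ), MemLp F 2 → MemLp (fun z => (ω z : ℂ) * g z) 2 := fun _ _ =>
    hg.of_le_mul (c := c) ((continuous_ofReal.comp_aestronglyMeasurable hωm).mul
      hg.aestronglyMeasurable) (Eventually.of_forall fun z => by
        rw [norm_mul, norm_real]
        gcongr
        exact hc z)
  have r2 : MemLp (fun z => (starRingEnd ℂ) (gr ω z) * g z) 2 :=
    hg.of_le_mul (c := c) ((continuous_conj.comp_aestronglyMeasurable hgω).mul
      hg.aestronglyMeasurable) (Eventually.of_forall fun z => by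
        rw [norm_mul, RCLike.norm_conj]
        gcongr
        exact hc' z)
  have hr2 : MemLp (fun z => ((starRingEnd ℂ) (g z) * gr ω z).re) 2 := by
    refine (r2.re).ae_eq (Eventually.of_forall fun z => ?_)
    simp only [RCLike.re_to_complex, mul_re, conj_re, conj_im]
    ring
  have e : ∀ n, (∫ z, ((starRingEnd ℂ) ((ω z : ℂ) * g z) * gr (f n) z).re) +
      (∫ z, f n z * ((starRingEnd ℂ) (g z) * gr ω z).re) +
      ∫ z, (ω z * (V z * (1 + ψ z))) * f n z = 0 := by
    intro n
    rw [← h.weak _ (mul_mem_testSpace hω (hf n)), ← integral_add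
      (integrable_re_conj_mul (r1 _ h1.memLp_lim) (h2.memLp n))
      (integrable_mul_of_memLp (h1.memLp n) hr2)]
    congr 1
    · refine integral_congr_ae (Eventually.of_forall fun z => ?_)
      simp only
      rw [gr_mul (hω.differentiable one_ne_zero z) ((hf n).1.differentiable one_ne_zero z)]
      simp only [map_mul, conj_ofReal, mul_add, add_re, mul_assoc, re_ofReal_mul,
        mul_left_comm ((starRingEnd ℂ) (g z))]
    · refine integral_congr_ae (Eventually.of_forall fun z => ?_)
      ring
  have t := (((L2Tendsto.const (r1 _ h1.memLp_lim)).integral_re h2).add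
    (h1.integral_mul (.const hr2))).add
    (((L2Tendsto.const hVψ).bdd_mul hωm hc).integral_mul h1)
  have hfin := tendsto_nhds_unique t (tendsto_const_nhds.congr fun n => (e n).symm)
  rw [← hfin]
  congr 1
  · congr 1
    refine integral_congr_ae (Eventually.of_forall fun z => ?_)
    simp only [map_mul, conj_ofReal, mul_assoc, re_ofReal_mul, re_conj_mul_self]
  · refine integral_congr_ae (Eventually.of_forall fun z => ?_)
    ring
end

theorem gr_radial {F : ℝ → ℝ} {F' : ℝ} {q ζ : ℂ} (h : HasDerivAt F F' (‖ζ - q‖ ^ 2)) :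
    gr (fun w => F (‖w - q‖ ^ 2)) ζ = ((2 * F' : ℝ) : ℂ) * (ζ - q) := by
  have h1 : HasFDerivAt (fun w : ℂ => ‖w - q‖ ^ 2)
      ((2 * (ζ - q).re) • reCLM + (2 * (ζ - q).im) • imCLM) ζ := by
    have e : (fun w : ℂ => ‖w - q‖ ^ 2) =
        fun w => (reCLM w - q.re) * (reCLM w - q.re) + (imCLM w - q.im) * (imCLM w - q.im) := by
      ext w
      rw [← normSq_eq_norm_sq, normSq_apply]
      simp
    rw [e]
    have a := (reCLM.hasFDerivAt (x := ζ)).sub_const q.re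
    have b := (imCLM.hasFDerivAt (x := ζ)).sub_const q.im
    refine ((a.mul a).add (b.mul b)).congr_fderiv ?_
    ext
    simp
    ring
  have h2 := h.comp_hasFDerivAt ζ h1
  have h3 : fderiv ℝ (fun w => F (‖w - q‖ ^ 2)) ζ = _ := h2.fderiv
  simp only [gr]
  rw [h3]
  apply Complex.ext <;> (simp; ring)

theorem db_add {f h : ℂ → ℂ} {z : ℂ} (hf : DifferentiableAt ℝ f z) (hh : DifferentiableAt ℝ h z) :
    db (fun w => f w + h w) z = db f z + db h z := by
  simp only [db]
  rw [fderiv_fun_add hf hh]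
  simp only [add_apply]
  ring

theorem db_const_mul {f : ℂ → ℂ} {z : ℂ} (c : ℂ) (hf : DifferentiableAt ℝ f z) :
    db (fun w => c * f w) z = c * db f z := by
  simp only [db]
  rw [fderiv_const_mul hf]
  simp only [smul_apply, smul_eq_mul]
  ring

theorem integral_conj_gr_mul_gr {f ζ : ℂ → ℝ} (hf : ContDiff ℝ 1 f) (hζ : ContDiff ℝ 2 ζ)
    (hs : HasCompactSupport ζ) :
    ∫ z, (starRingEnd ℂ) (gr f z) * gr ζ z = -∫ z, (f z : ℂ) * (planeLaplacian ζ z : ℂ) := by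
  have hg : ContDiff ℝ 1 (gr ζ) := contDiff_gr hζ
  have hc : ContDiff ℝ 1 fun z => (starRingEnd ℂ) (gr ζ z) :=
    (conjCLE : ℂ →L[ℝ] ℂ).contDiff.comp hg
  have hcs : HasCompactSupport fun z => (starRingEnd ℂ) (gr ζ z) :=
    (hasCompactSupport_gr hs).comp_left (g := starRingEnd ℂ) (by simp)
  have hF : ContDiff ℝ 1 fun z => (f z : ℂ) := contDiff_ofReal_comp hf
  have h := integral_mul_db hF hc hcs
  have h2 : ∫ z, (starRingEnd ℂ) (gr f z) * gr ζ z =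
      (starRingEnd ℂ) (∫ z, db (fun w => (f w : ℂ)) z * (starRingEnd ℂ) (gr ζ z)) := by
    rw [← integral_conj]
    refine integral_congr_ae (Eventually.of_forall fun z => ?_)
    simp only
    rw [db_ofReal (hf.differentiable one_ne_zero z), map_mul, conj_conj]
  have h3 : ∫ z, (f z : ℂ) * (planeLaplacian ζ z : ℂ) =
      (starRingEnd ℂ) (∫ z, (f z : ℂ) * db (fun w => (starRingEnd ℂ) (gr ζ w)) z) := by
    rw [← integral_conj]
    refine integral_congr_ae (Eventually.of_forall fun z => ?_)
    simp only
    rw [db_conj_gr hζ, map_mul, conj_ofReal, conj_ofReal]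
  rw [h2, h3, h, map_neg, neg_neg]

section
variable {Z : Set ℂ} {R : ℝ} {V ψ : ℂ → ℝ} {g : ℂ → ℂ} {ε : ℝ}

theorem H10.im_integral (h : H10 Z ψ g) {ζ : ℂ → ℝ} (hζ : ContDiff ℝ 2 ζ)
    (hs : HasCompactSupport ζ) : (∫ z, (starRingEnd ℂ) (g z) * gr ζ z).im = 0 := by
  obtain ⟨f, hf, h1, h2⟩ := h
  have hm : MemLp (gr ζ) 2 := (contDiff_gr hζ).continuous.memLp_of_hasCompactSupport
    (hasCompactSupport_gr hs)
  have t := (continuous_im.tendsto _).comp (h2.conj.integral_mul (.const hm))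
  refine tendsto_nhds_unique t (tendsto_const_nhds.congr fun n => ?_)
  simp only [Function.comp]
  rw [integral_conj_gr_mul_gr (hf n).1 hζ hs]
  simp only [← ofReal_mul]
  rw [integral_complex_ofReal]
  simp

theorem H10.integral_mul_db (h : H10 Z ψ g) {η : ℂ → ℂ} (hη : ContDiff ℝ 1 η)
    (hs : HasCompactSupport η) : ∫ z, (ψ z : ℂ) * db η z = -∫ z, g z * η z := by
  obtain ⟨f, hf, h1, h2⟩ := h
  have m1 : MemLp (db η) 2 := (continuous_db hη).memLp_of_hasCompactSupport
    (hasCompactSupport_db hs)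
  have m2 : MemLp η 2 := hη.continuous.memLp_of_hasCompactSupport hs
  have t1 := (h1.clm ofRealCLM).integral_mul (.const m1)
  have t2 := (h2.integral_mul (.const m2)).neg
  refine tendsto_nhds_unique t1 (t2.congr fun n => ?_)
  have e := Landis.integral_mul_db (contDiff_ofReal_comp (hf n).1) hη hs
  simp only [ofRealCLM_apply]
  rw [e]
  congr 1
  refine integral_congr_ae (Eventually.of_forall fun z => ?_)
  simp only
  rw [db_ofReal ((hf n).1.differentiable one_ne_zero z)]

theorem WeakSol.complex_weak (h : WeakSol Z V ψ g) (hZ : Thick Z R) (hV : Potential V ε)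
    {ζ : ℂ → ℂ} (hζ : ContDiff ℝ 2 ζ) (h0 : ∀ z ∈ Z, ζ z = 0) :
    ∫ z, (starRingEnd ℂ) (g z) * db ζ z = -∫ z, ((V z * (1 + ψ z) : ℝ) : ℂ) * ζ z := by
  obtain ⟨f, hf, h1, h2⟩ := id h.h10
  have hg := h2.memLp_lim
  have hVψ := hV.mul_one_add_memLp h1.memLp_lim
  set a : ℂ → ℝ := fun z => (ζ z).re
  set b : ℂ → ℝ := fun z => (ζ z).im
  have ha : ContDiff ℝ 2 a := reCLM.contDiff.comp hζ
  have hb : ContDiff ℝ 2 b := imCLM.contDiff.comp hζ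
  have ha' : a ∈ testSpace Z := ⟨ha.of_le (by norm_num), fun z hz => by simp [a, h0 z hz]⟩
  have hb' : b ∈ testSpace Z := ⟨hb.of_le (by norm_num), fun z hz => by simp [b, h0 z hz]⟩
  have key : ∀ c : ℂ → ℝ, ContDiff ℝ 2 c → c ∈ testSpace Z →
      ∫ z, (starRingEnd ℂ) (g z) * gr c z = ((-∫ z, V z * (1 + ψ z) * c z : ℝ) : ℂ) := by
    intro c hc hc'
    apply Complex.ext
    · rw [ofReal_re, ← RCLike.re_to_complex, ← _root_.integral_re
        (integrable_mul_of_memLp (memLp_conj hg) (hZ.memLp_gr hc'))]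
      exact eq_neg_of_add_eq_zero_left (h.weak c hc')
    · rw [ofReal_im]
      exact h.h10.im_integral hc (hZ.hasCompactSupport hc')
  have e : ∀ z, (starRingEnd ℂ) (g z) * db ζ z =
      (starRingEnd ℂ) (g z) * gr a z + I * ((starRingEnd ℂ) (g z) * gr b z) := by
    intro z
    have da := ha.differentiable two_ne_zero z
    have dd := hb.differentiable two_ne_zero z
    have e1 : ζ = fun w => (a w : ℂ) + I * (b w : ℂ) := by
      ext w
      rw [mul_comm I, re_add_im]
    conv_lhs => rw [e1]
    have da' : DifferentiableAt ℝ (fun w => (a w : ℂ)) z := ofRealCLM.differentiableAt.comp z da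
    have dd' : DifferentiableAt ℝ (fun w => (b w : ℂ)) z := ofRealCLM.differentiableAt.comp z dd
    rw [db_add da' (dd'.const_mul I), db_const_mul I dd', db_ofReal da, db_ofReal dd]
    ring
  simp only [e]
  have i1 : ∀ {c : ℂ → ℝ}, c ∈ testSpace Z →
      Integrable fun z => (starRingEnd ℂ) (g z) * gr c z := fun hc =>
    integrable_mul_of_memLp (memLp_conj hg) (hZ.memLp_gr hc)
  rw [integral_add (i1 ha') ((i1 hb').const_mul I), integral_const_mul, key a ha ha',
    key b hb hb']
  have e2 : ∀ z, ((V z * (1 + ψ z) : ℝ) : ℂ) * ζ z =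
      ((V z * (1 + ψ z) * a z : ℝ) : ℂ) + I * ((V z * (1 + ψ z) * b z : ℝ) : ℂ) := by
    intro z
    conv_lhs => rw [← re_add_im (ζ z)]
    simp only [a, b]
    push_cast
    ring
  simp only [e2]
  have i2 : ∀ {c : ℂ → ℝ}, c ∈ testSpace Z → Integrable fun z => ((V z * (1 + ψ z) * c z : ℝ) : ℂ) :=
    fun hc => (integrable_mul_of_memLp hVψ (hZ.memLp hc)).ofReal
  rw [integral_add (i2 ha') ((i2 hb').const_mul I), integral_const_mul,
    integral_complex_ofReal, integral_complex_ofReal]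
  push_cast
  ring
end

/-- A positive, integrable, slowly varying weight centred at `z`. -/
noncomputable def slowWeight (c : ℝ) (z ζ : ℂ) : ℝ := ((1 + c * ‖ζ - z‖ ^ 2) ^ 2)⁻¹

section
variable {c : ℝ}

theorem slowWeight_pos (hc : 0 ≤ c) (z ζ : ℂ) : 0 < slowWeight c z ζ := by
  unfold slowWeight
  positivity

theorem slowWeight_le_one (hc : 0 ≤ c) (z ζ : ℂ) : slowWeight c z ζ ≤ 1 := by
  unfold slowWeight
  refine inv_le_one_of_one_le₀ (one_le_pow₀ ?_)
  have : 0 ≤ c * ‖ζ - z‖ ^ 2 := by positivity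
  linarith

theorem contDiff_slowWeight (hc : 0 ≤ c) (z : ℂ) : ContDiff ℝ 1 (slowWeight c z) := by
  unfold slowWeight
  refine ContDiff.inv ?_ fun ζ => by positivity
  exact (contDiff_const.add (contDiff_const.mul ((contDiff_id.sub contDiff_const).norm_sq ℝ))).pow 2

theorem norm_gr_slowWeight_le (hc : 0 ≤ c) (z ζ : ℂ) :
    ‖gr (slowWeight c z) ζ‖ ≤ 2 * √c * slowWeight c z ζ := by
  set t := ‖ζ - z‖ ^ 2 with ht
  have hp : 0 < 1 + c * t := by positivity
  have h1 : HasDerivAt (fun t : ℝ => ((1 + c * t) ^ 2)⁻¹)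
      (-(2 * (1 + c * t) * c) / ((1 + c * t) ^ 2) ^ 2) t := by
    have h2 : HasDerivAt (fun t : ℝ => 1 + c * t) c t := by
      simpa using ((hasDerivAt_id t).const_mul c).const_add 1
    have h3 : HasDerivAt (fun t : ℝ => (1 + c * t) ^ 2) (2 * (1 + c * t) * c) t := by
      simpa using h2.fun_pow 2
    exact h3.fun_inv (by positivity)
  have h4 := gr_radial h1
  change gr (slowWeight c z) ζ = _ at h4
  rw [h4, norm_mul, norm_real, Real.norm_eq_abs]
  unfold slowWeight
  rw [← ht]
  have e : |2 * (-(2 * (1 + c * t) * c) / ((1 + c * t) ^ 2) ^ 2)| =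
      4 * c / (1 + c * t) * ((1 + c * t) ^ 2)⁻¹ := by
    rw [neg_div, mul_neg, abs_neg, abs_of_nonneg (by positivity)]
    field_simp
    ring
  rw [e, mul_right_comm]
  refine mul_le_mul_of_nonneg_right ?_ (by positivity)
  rw [div_mul_eq_mul_div, div_le_iff₀ hp, ht]
  have hs := Real.sq_sqrt hc
  have h5 := mul_nonneg (Real.sqrt_nonneg c) (sq_nonneg (√c * ‖ζ - z‖ - 1))
  have h6 : 2 * √c * (1 + √c ^ 2 * ‖ζ - z‖ ^ 2) - 4 * √c ^ 2 * ‖ζ - z‖ =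
    2 * (√c * (√c * ‖ζ - z‖ - 1) ^ 2) := by ring
  rw [hs] at h6
  linarith

theorem slowWeight_le (hc : 0 ≤ c) (hc' : c ≤ 1 / 162) (z x ζ : ℂ) (h : dist ζ x < 9) :
    slowWeight c z ζ ≤ 4 * slowWeight c z x := by
  unfold slowWeight
  rw [← div_eq_mul_inv, inv_eq_one_div, div_le_div_iff₀ (by positivity) (by positivity)]
  have h1 : ‖x - z‖ ≤ ‖ζ - z‖ + 9 := by
    have : ‖x - z‖ ≤ ‖x - ζ‖ + ‖ζ - z‖ := norm_sub_le_norm_sub_add_norm_sub _ _ _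
    rw [dist_comm, dist_eq_norm] at h
    linarith
  have h2 : ‖x - z‖ ^ 2 ≤ 2 * ‖ζ - z‖ ^ 2 + 162 := by
    nlinarith [norm_nonneg (x - z), norm_nonneg (ζ - z), sq_nonneg (‖ζ - z‖ - 9)]
  have h3 : 1 + c * ‖x - z‖ ^ 2 ≤ 2 * (1 + c * ‖ζ - z‖ ^ 2) := by
    have : c * ‖x - z‖ ^ 2 ≤ c * (2 * ‖ζ - z‖ ^ 2 + 162) := by gcongr
    linarith
  calc 1 * (1 + c * ‖x - z‖ ^ 2) ^ 2 ≤ (2 * (1 + c * ‖ζ - z‖ ^ 2)) ^ 2 := by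
        rw [one_mul]
        gcongr
    _ = _ := by ring

theorem integrable_slowWeight (hc : 0 < c) (z : ℂ) : Integrable (slowWeight c z) := by
  have h0 : Integrable (slowWeight c 0) := by
    have h1 := integrable_rpow_neg_one_add_norm_sq (E := ℂ) (μ := volume) (r := 4)
      (by rw [Complex.finrank_real_complex]; norm_num)
    refine (h1.const_mul ((min 1 c) ^ 2)⁻¹).mono'
      (contDiff_slowWeight hc.le 0).continuous.aestronglyMeasurable
      (Eventually.of_forall fun ζ => ?_)
    rw [Real.norm_of_nonneg (slowWeight_pos hc.le _ _).le]
    have e : (1 + ‖ζ‖ ^ 2) ^ (-(4 : ℝ) / 2) = ((1 + ‖ζ‖ ^ 2) ^ 2)⁻¹ := by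
      rw [show (-(4 : ℝ) / 2) = -((2 : ℕ) : ℝ) by norm_num, Real.rpow_neg (by positivity),
        Real.rpow_natCast]
    rw [e, ← mul_inv, ← mul_pow]
    unfold slowWeight
    have hm : 0 < min 1 c := lt_min one_pos hc
    refine inv_anti₀ (by positivity) ?_
    rw [sub_zero]
    gcongr
    rw [mul_add, mul_one]
    gcongr
    · exact min_le_left _ _
    · exact min_le_right _ _
  have h2 := h0.comp_sub_right z
  have e : (fun t => slowWeight c 0 (t - z)) = slowWeight c z := by
    ext
    simp [slowWeight]
  rwa [e] at h2

theorem integral_slowWeight (z : ℂ) : ∫ ζ, slowWeight c z ζ = ∫ ζ, slowWeight c 0 ζ := by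
  rw [← integral_sub_right_eq_self (slowWeight c 0) z]
  simp [slowWeight]
end

/-- The corrector `ψ` of a small potential `V` relative to a thick set `Z`. -/
structure Corrector (Z : Set ℂ) (R ε : ℝ) (V ψ : ℂ → ℝ) (g : ℂ → ℂ) : Prop where
  thick : Thick Z R
  potential : Potential V ε
  sol : WeakSol Z V ψ g
  pos : 0 < ε
  small : ε ≤ 1 / 10 ^ 4

namespace Corrector
variable {Z : Set ℂ} {R ε : ℝ} {V ψ : ℂ → ℝ} {g : ℂ → ℂ}

theorem memLp_psi (h : Corrector Z R ε V ψ g) : MemLp ψ 2 := by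
  obtain ⟨f, hf, h1, h2⟩ := h.sol.h10
  exact h1.memLp_lim

theorem memLp_grad (h : Corrector Z R ε V ψ g) : MemLp g 2 := by
  obtain ⟨f, hf, h1, h2⟩ := h.sol.h10
  exact h2.memLp_lim

theorem sq_le (h : Corrector Z R ε V ψ g) : ε ^ 2 ≤ 1 / 10 ^ 8 := by
  have := pow_le_pow_left₀ h.pos.le h.small 2
  norm_num at this ⊢
  exact this

theorem integrable_weight_psi (h : Corrector Z R ε V ψ g) {ω : ℂ → ℝ}
    (hω : AEStronglyMeasurable ω) {c : ℝ} (hc : ∀ z, |ω z| ≤ c) :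
    Integrable fun z => ω z * ψ z ^ 2 :=
  h.memLp_psi.integrable_sq.bdd_mul hω (Eventually.of_forall hc)

theorem integrable_weight_grad (h : Corrector Z R ε V ψ g) {ω : ℂ → ℝ}
    (hω : AEStronglyMeasurable ω) {c : ℝ} (hc : ∀ z, |ω z| ≤ c) :
    Integrable fun z => ω z * ‖g z‖ ^ 2 :=
  h.memLp_grad.norm.integrable_sq.bdd_mul hω (Eventually.of_forall hc)

/-- Energy inequality with a weight. -/
theorem energy_le (h : Corrector Z R ε V ψ g) {ω : ℂ → ℝ} (hω : ContDiff ℝ 1 ω) {c : ℝ}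
    (hc : ∀ z, |ω z| ≤ c) (hc' : ∀ z, ‖gr ω z‖ ≤ c) {F : ℂ → ℝ} (hF : Integrable F)
    (hle : ∀ z, |ψ z| * ‖g z‖ * ‖gr ω z‖ + |ω z| * (ε ^ 2 * (|ψ z| + ψ z ^ 2)) ≤ F z) :
    ∫ z, ω z * ‖g z‖ ^ 2 ≤ ∫ z, F z := by
  have ht := h.sol.test_weight h.potential hω hc hc'
  have i0 : Integrable fun z => ψ z * ((starRingEnd ℂ) (g z) * gr ω z).re := by
    have h1 : MemLp (fun z => (starRingEnd ℂ) (g z) * gr ω z) 2 :=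
      h.memLp_grad.of_le_mul (c := c) ((continuous_conj.comp_aestronglyMeasurable
        h.memLp_grad.aestronglyMeasurable).mul (continuous_gr hω).aestronglyMeasurable)
        (Eventually.of_forall fun z => by
          rw [norm_mul, RCLike.norm_conj, mul_comm]
          gcongr
          exact hc' z)
    exact integrable_mul_of_memLp h.memLp_psi h1.re
  have i1 : Integrable fun z => ω z * (V z * (1 + ψ z) * ψ z) :=
    (integrable_mul_of_memLp (h.potential.mul_one_add_memLp h.memLp_psi) h.memLp_psi).bdd_mul
      hω.continuous.aestronglyMeasurable (Eventually.of_forall hc)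
  have e : ∫ z, ω z * ‖g z‖ ^ 2 = ∫ z, -(ψ z * ((starRingEnd ℂ) (g z) * gr ω z).re +
      ω z * (V z * (1 + ψ z) * ψ z)) := by
    rw [integral_neg, integral_add i0 i1]
    linarith
  rw [e]
  refine integral_mono (i0.fun_add i1).neg hF fun z => ?_
  refine le_trans ?_ (hle z)
  have b1 : |ψ z * ((starRingEnd ℂ) (g z) * gr ω z).re| ≤ |ψ z| * ‖g z‖ * ‖gr ω z‖ := by
    rw [abs_mul, mul_assoc]
    gcongr
    refine (abs_re_le_norm _).trans_eq ?_
    rw [norm_mul, RCLike.norm_conj]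
  have b2 : |ω z * (V z * (1 + ψ z) * ψ z)| ≤ |ω z| * (ε ^ 2 * (|ψ z| + ψ z ^ 2)) := by
    rw [abs_mul, mul_assoc (V z), abs_mul (V z)]
    gcongr
    · exact h.potential.bound z
    · rw [add_mul, one_mul, ← pow_two]
      exact (abs_add_le _ _).trans_eq (by rw [abs_pow, sq_abs])
  have := neg_abs_le (ψ z * ((starRingEnd ℂ) (g z) * gr ω z).re)
  have := neg_abs_le (ω z * (V z * (1 + ψ z) * ψ z))
  simp only
  linarith

end Corrector

/-- Local energy estimate at unit scale. -/
theorem exists_local_energy_le : ∃ C > 0, ∀ (Z : Set ℂ) (R ε : ℝ) (V ψ : ℂ → ℝ) (g : ℂ → ℂ),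
    Corrector Z R ε V ψ g → ∀ z, ∫ ζ in ball z 10, ‖g ζ‖ ^ 2 ≤ C * ε ^ 4 ∧
      ∫ ζ in ball z 10, ψ ζ ^ 2 ≤ C * ε ^ 4 := by
  have hpi := Real.pi_pos
  have hpi4 := Real.pi_le_four
  have hpi3 := Real.pi_gt_three
  set P : ℝ := 8100 * Real.pi ^ 2 * 4 ^ 2 with hP
  have hpi2 : Real.pi ^ 2 ≤ 10 := by
    have := Real.pi_lt_d2
    nlinarith
  have hP1 : 1 ≤ P := by nlinarith
  have hP2 : P ≤ 1296000 := by rw [hP]; linarith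
  set c : ℝ := 1 / (48 * P) with hc
  have hcP : c * P = 1 / 48 := by rw [hc]; field_simp
  have hc0 : 0 < c := by positivity
  have hc1 : c ≤ 1 / 162 := by
    rw [hc]
    refine one_div_le_one_div_of_le (by norm_num) ?_
    rw [hP]
    nlinarith
  set J : ℝ := ∫ ζ, slowWeight c 0 ζ with hJ
  have hJ0 : 0 ≤ J := integral_nonneg fun ζ => (slowWeight_pos hc0.le _ _).le
  refine ⟨4 * (P * (J / (2 * c) + 1)), by positivity, fun Z R ε V ψ g h z => ?_⟩
  set ω := slowWeight c z with hω
  have hω0 : ∀ ζ, 0 ≤ ω ζ := fun ζ => (slowWeight_pos hc0.le _ _).le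
  have hω1 : ∀ ζ, ω ζ ≤ 1 := slowWeight_le_one hc0.le z
  have hωa : ∀ ζ, |ω ζ| ≤ 1 := fun ζ => by rw [abs_of_nonneg (hω0 ζ)]; exact hω1 ζ
  have hωC := contDiff_slowWeight hc0.le z
  have hωm : AEStronglyMeasurable ω := hωC.continuous.aestronglyMeasurable
  have hgr := norm_gr_slowWeight_le hc0.le z
  have hsc : √c ≤ 1 / 2 := by
    rw [Real.sqrt_le_left (by norm_num)]
    linarith
  have hs2 := Real.sq_sqrt hc0.le
  have hgr1 : ∀ ζ, ‖gr ω ζ‖ ≤ 1 := fun ζ => by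
    refine (hgr ζ).trans ?_
    have := hω0 ζ
    have := hω1 ζ
    nlinarith [Real.sqrt_nonneg c]
  have ig := h.integrable_weight_grad hωm hωa
  have iψ := h.integrable_weight_psi hωm hωa
  have iω : Integrable ω := integrable_slowWeight hc0 z
  have h1 := h.energy_le hωC hωa hgr1 (F := fun ζ => (1 / 4 * (ω ζ * ‖g ζ‖ ^ 2) +
    (4 * c + c + ε ^ 2) * (ω ζ * ψ ζ ^ 2)) + ε ^ 4 / (4 * c) * ω ζ)
    (((ig.const_mul _).fun_add (iψ.const_mul _)).fun_add (iω.const_mul _)) fun ζ => by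
      have a1 : |ψ ζ| * ‖g ζ‖ * ‖gr ω ζ‖ ≤ |ψ ζ| * ‖g ζ‖ * (2 * √c * ω ζ) := by
        gcongr
        exact hgr ζ
      have a2 : |ψ ζ| * ‖g ζ‖ * (2 * √c) ≤ 1 / 4 * ‖g ζ‖ ^ 2 + 4 * c * ψ ζ ^ 2 := by
        nlinarith [sq_nonneg (1 / 2 * ‖g ζ‖ - 2 * √c * |ψ ζ|), sq_abs (ψ ζ)]
      have a3 : ε ^ 2 * |ψ ζ| ≤ c * ψ ζ ^ 2 + ε ^ 4 / (4 * c) := by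
        have : ε ^ 4 / (4 * c) = c * (ε ^ 2 / (2 * c)) ^ 2 := by field_simp; norm_num
        rw [this, ← sq_abs (ψ ζ)]
        obtain ⟨b, hb⟩ : ∃ b, b = ε ^ 2 / (2 * c) := ⟨_, rfl⟩
        have h5 : ε ^ 2 = 2 * c * b := by rw [hb]; field_simp
        rw [← hb, h5]
        nlinarith [mul_nonneg hc0.le (sq_nonneg (|ψ ζ| - b))]
      rw [abs_of_nonneg (hω0 ζ)]
      nlinarith [mul_le_mul_of_nonneg_left a2 (hω0 ζ), mul_le_mul_of_nonneg_left a3 (hω0 ζ)]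
  rw [integral_add ((ig.const_mul _).fun_add (iψ.const_mul _)) (iω.const_mul _),
    integral_add (ig.const_mul _) (iψ.const_mul _), integral_const_mul, integral_const_mul,
    integral_const_mul, hω, integral_slowWeight, ← hω, ← hJ] at h1
  have h2 := h.thick.poincare h.sol.h10 hωC.continuous hω0 hω1 (K := 4) (by norm_num)
    fun x ζ hx => slowWeight_le hc0.le hc1 z x ζ hx
  rw [← hP] at h2
  set G := ∫ ζ, ω ζ * ‖g ζ‖ ^ 2
  set Q := ∫ ζ, ω ζ * ψ ζ ^ 2
  have hG0 : 0 ≤ G := integral_nonneg fun ζ => mul_nonneg (hω0 ζ) (by positivity)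
  have h3 : (4 * c + c + ε ^ 2) * Q ≤ 1 / 4 * G := by
    have h4 : (4 * c + c + ε ^ 2) * P ≤ 1 / 4 := by
      have := h.sq_le
      have : ε ^ 2 * P ≤ 1 / 10 ^ 8 * 1296000 := by gcongr
      norm_num at this
      linarith
    calc _ ≤ (4 * c + c + ε ^ 2) * (P * G) := by gcongr
      _ = (4 * c + c + ε ^ 2) * P * G := by ring
      _ ≤ _ := by gcongr
  have h4 : ε ^ 4 / (4 * c) * J = ε ^ 4 * (J / (2 * c)) / 2 := by
    field_simp
    ring
  have hε := h.pos
  have hGle : G ≤ ε ^ 4 * (J / (2 * c)) := by linarith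
  have hωlow : ∀ ζ ∈ ball z 10, 1 ≤ 4 * ω ζ := by
    intro ζ hζ
    rw [mem_ball, dist_eq_norm] at hζ
    rw [hω, slowWeight, ← div_eq_mul_inv, le_div_iff₀ (by positivity), one_mul]
    have h5 : c * ‖ζ - z‖ ^ 2 ≤ 1 / 162 * 10 ^ 2 := by gcongr
    have h6 : 0 ≤ c * ‖ζ - z‖ ^ 2 := by positivity
    nlinarith
  have hloc : ∀ f : ℂ → ℝ, (∀ ζ, 0 ≤ f ζ) → Integrable f → Integrable (fun ζ => ω ζ * f ζ) →
      ∫ ζ in ball z 10, f ζ ≤ 4 * ∫ ζ, ω ζ * f ζ := by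
    intro f hf0 hf hωf
    calc ∫ ζ in ball z 10, f ζ ≤ ∫ ζ in ball z 10, 4 * (ω ζ * f ζ) := by
          refine setIntegral_mono_on hf.integrableOn (hωf.const_mul 4).integrableOn
            measurableSet_ball fun ζ hζ => ?_
          have := mul_le_mul_of_nonneg_right (hωlow ζ hζ) (hf0 ζ)
          linarith
      _ ≤ ∫ ζ, 4 * (ω ζ * f ζ) := setIntegral_le_integral (hωf.const_mul 4)
          (Eventually.of_forall fun ζ => by
            have := mul_nonneg (hω0 ζ) (hf0 ζ)
            simp only [Pi.zero_apply]
            linarith)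
      _ = _ := integral_const_mul _ _
  have hJc : 0 ≤ J / (2 * c) := by positivity
  constructor
  · refine (hloc _ (fun ζ => by positivity) h.memLp_grad.norm.integrable_sq ig).trans ?_
    calc 4 * G ≤ 4 * (1 * (ε ^ 4 * (J / (2 * c)))) := by linarith
      _ ≤ 4 * (P * (ε ^ 4 * (J / (2 * c) + 1))) := by gcongr; linarith
      _ = _ := by ring
  · refine (hloc _ (fun ζ => by positivity) h.memLp_psi.integrable_sq iψ).trans ?_
    calc 4 * Q ≤ 4 * (P * (ε ^ 4 * (J / (2 * c)))) := by
          have : P * G ≤ P * (ε ^ 4 * (J / (2 * c))) := by gcongr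
          linarith
      _ ≤ 4 * (P * (ε ^ 4 * (J / (2 * c) + 1))) := by gcongr; linarith
      _ = _ := by ring

/-- A smooth truncation of `‖ζ - q‖ ^ (-1/100)`, regularised at scale `η`. -/
noncomputable def poleWeight (η : ℝ) (q ζ : ℂ) : ℝ :=
  (‖ζ - q‖ ^ 2 + η ^ 2) ^ (-(1 / 200) : ℝ) * max (1 - ‖ζ - q‖ ^ 2) 0 ^ 3

section
variable {η : ℝ} (q : ℂ)

theorem poleWeight_nonneg (ζ : ℂ) : 0 ≤ poleWeight η q ζ := by
  unfold poleWeight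
  positivity

theorem poleWeight_eq (ζ : ℂ) : poleWeight η q ζ =
    (‖ζ - q‖ ^ 2 + η ^ 2) ^ (-(1 / 200) : ℝ) * bumpBase (ζ - q) ^ 3 := by
  rw [poleWeight, bumpBase_eq]

theorem contDiff_poleWeight (hη : 0 < η) : ContDiff ℝ 1 (poleWeight η q) := by
  rw [funext (poleWeight_eq q)]
  refine ContDiff.mul (ContDiff.rpow_const_of_ne ?_ fun ζ => by positivity) ?_
  · exact ((contDiff_id.sub contDiff_const).norm_sq ℝ).add contDiff_const
  · exact contDiff_bump_cube.comp (contDiff_id.sub contDiff_const)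

theorem norm_gr_poleWeight_le (hη : 0 < η) (ζ : ℂ) : ‖gr (poleWeight η q) ζ‖ ≤
    2 * ‖ζ - q‖ * ((‖ζ - q‖ ^ 2 + η ^ 2) ^ (-(1 / 200) : ℝ) *
      (1 / 200 * (‖ζ - q‖ ^ 2 + η ^ 2)⁻¹ * bumpBase (ζ - q) ^ 3 + 3 * bumpBase (ζ - q) ^ 2)) := by
  set t := ‖ζ - q‖ ^ 2 with ht
  have hp : 0 < t + η ^ 2 := by positivity
  have h1 : HasDerivAt (fun t : ℝ => (t + η ^ 2) ^ (-(1 / 200) : ℝ))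
      (1 * (-(1 / 200)) * (t + η ^ 2) ^ ((-(1 / 200) : ℝ) - 1)) t :=
    ((hasDerivAt_id t).add_const (η ^ 2)).rpow_const (Or.inl hp.ne')
  have h2 : HasDerivAt (fun t : ℝ => max (1 - t) 0 ^ 3) (3 * max (1 - t) 0 ^ 2 * (-1)) t :=
    HasDerivAt.comp t (hasDerivAt_max_zero_pow_three (1 - t))
      ((hasDerivAt_id t).const_sub 1)
  have h3 := gr_radial (q := q) (ζ := ζ) (h1.fun_mul h2)
  have h4 : (fun w => (fun t : ℝ => (t + η ^ 2) ^ (-(1 / 200) : ℝ) * max (1 - t) 0 ^ 3)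
      (‖w - q‖ ^ 2)) = poleWeight η q := rfl
  rw [h4] at h3
  rw [h3, norm_mul, norm_real, Real.norm_eq_abs, Real.rpow_sub_one hp.ne', bumpBase_eq, ← ht]
  set a := (t + η ^ 2) ^ (-(1 / 200) : ℝ)
  have ha : 0 ≤ a := Real.rpow_nonneg hp.le _
  set b := max (1 - t) 0
  have hb : 0 ≤ b := le_max_right _ _
  have e : 2 * (1 * (-(1 / 200)) * (a / (t + η ^ 2)) * b ^ 3 + a * (3 * b ^ 2 * (-1))) =
      -(2 * (a * (1 / 200 * (t + η ^ 2)⁻¹ * b ^ 3 + 3 * b ^ 2))) := by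
    rw [div_eq_mul_inv]
    ring
  rw [e, abs_neg, abs_of_nonneg (by positivity)]
  exact le_of_eq (by ring)

theorem poleWeight_eq_zero {ζ : ℂ} (h : ζ ∉ ball q 1) : poleWeight η q ζ = 0 := by
  rw [poleWeight_eq, bumpBase_eq_zero (by simpa [dist_eq_norm] using h)]
  simp

theorem hasCompactSupport_poleWeight : HasCompactSupport (poleWeight η q) :=
  HasCompactSupport.intro (isCompact_closedBall q 1) fun _ hζ =>
    poleWeight_eq_zero q fun h => hζ (ball_subset_closedBall h)

theorem exists_poleWeight_bound (hη : 0 < η) :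
    ∃ c, (∀ ζ, |poleWeight η q ζ| ≤ c) ∧ ∀ ζ, ‖gr (poleWeight η q) ζ‖ ≤ c := by
  obtain ⟨c, hc⟩ := (hasCompactSupport_poleWeight q).exists_bound_of_continuous
    (contDiff_poleWeight q hη).continuous
  obtain ⟨c', hc'⟩ := (hasCompactSupport_gr (hasCompactSupport_poleWeight (η := η) q)).exists_bound_of_continuous
    (continuous_gr (contDiff_poleWeight q hη))
  exact ⟨max c c', fun ζ => (hc ζ).trans (le_max_left _ _), fun ζ => (hc' ζ).trans (le_max_right _ _)⟩

theorem integral_poleWeight_le (hη : 0 < η) :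
    ∫ ζ, poleWeight η q ζ ≤ ∫ ζ in ball q 1, ‖ζ - q‖ ^ (-(1 / 100) : ℝ) := by
  rw [← setIntegral_eq_integral_of_forall_compl_eq_zero (s := ball q 1)
    fun ζ hζ => poleWeight_eq_zero q hζ]
  refine setIntegral_mono_ae (((contDiff_poleWeight q hη).continuous.integrable_of_hasCompactSupport
    (hasCompactSupport_poleWeight q)).integrableOn) (integrableOn_ball_rpow _ (by norm_num) _ _) ?_
  filter_upwards [Measure.ae_ne volume q] with ζ hζ
  have hs : 0 < ‖ζ - q‖ := norm_pos_iff.2 (sub_ne_zero.2 hζ)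
  have h1 : (‖ζ - q‖ ^ 2 + η ^ 2) ^ (-(1 / 200) : ℝ) ≤ ‖ζ - q‖ ^ (-(1 / 100) : ℝ) := by
    calc _ ≤ (‖ζ - q‖ ^ 2) ^ (-(1 / 200) : ℝ) :=
          Real.rpow_le_rpow_of_nonpos (by positivity) (by nlinarith) (by norm_num)
      _ = _ := by
          rw [← Real.rpow_natCast, ← Real.rpow_mul hs.le]
          norm_num
  have h2 : bumpBase (ζ - q) ^ 3 ≤ 1 := pow_le_one₀ (bumpBase_nonneg _) (bumpBase_le_one _)
  rw [poleWeight_eq]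
  calc _ ≤ ‖ζ - q‖ ^ (-(1 / 100) : ℝ) * 1 :=
        mul_le_mul h1 h2 (pow_nonneg (bumpBase_nonneg _) 3) (by positivity)
    _ = _ := mul_one _

end

namespace Corrector
variable {Z : Set ℂ} {R ε : ℝ} {V ψ : ℂ → ℝ} {g : ℂ → ℂ}

/-- Pointwise bound for the terms produced by testing with `poleWeight`. -/
theorem pole_pointwise (s t a b T ψ g ε : ℝ) (ha : 0 ≤ a) (hb : 0 ≤ b) (hb1 : b ≤ 1)
    (has : a * s ^ 2 ≤ 2) (hψ : 0 ≤ ψ) (hg : 0 ≤ g) (ht : t ≤ 2 * s * (a * (1 / 200 * T⁻¹ * b ^ 3 + 3 * b ^ 2))) :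
    ψ * g * t + a * b ^ 3 * (ε ^ 2 * (ψ + ψ ^ 2)) ≤
      (((1 / 200 + 1 / 4) * (a * b ^ 3 * g ^ 2) + 1 / 200 * (s ^ 2 * T⁻¹ ^ 2 * (a * b ^ 3) * ψ ^ 2)) +
      (72 * ψ ^ 2 + (1 / 1000 + ε ^ 2) * (a * b ^ 3 * ψ ^ 2))) + 250 * ε ^ 4 * (a * b ^ 3) := by
  have h0 : ψ * g * t ≤ ψ * g * (2 * s * (a * (1 / 200 * T⁻¹ * b ^ 3 + 3 * b ^ 2))) := by gcongr
  have h1 : 2 * (ψ * g * (s * T⁻¹)) ≤ g ^ 2 + s ^ 2 * T⁻¹ ^ 2 * ψ ^ 2 := by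
    nlinarith [sq_nonneg (g - s * T⁻¹ * ψ)]
  have h1' := mul_le_mul_of_nonneg_left h1 (show 0 ≤ 1 / 200 * (a * b ^ 3) by positivity)
  have h2 : ψ * g * (6 * s) * b ≤ 1 / 4 * b ^ 2 * g ^ 2 + 36 * s ^ 2 * ψ ^ 2 := by
    nlinarith [sq_nonneg (1 / 2 * b * g - 6 * s * ψ)]
  have h2' := mul_le_mul_of_nonneg_left h2 (show 0 ≤ a * b by positivity)
  have h3 : a * b * (36 * s ^ 2 * ψ ^ 2) ≤ 72 * ψ ^ 2 := by
    calc a * b * (36 * s ^ 2 * ψ ^ 2) = a * s ^ 2 * (36 * ψ ^ 2) * b := by ring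
      _ ≤ 2 * (36 * ψ ^ 2) * 1 := by gcongr
      _ = _ := by ring
  have h4 : ε ^ 2 * ψ ≤ 1 / 1000 * ψ ^ 2 + 250 * ε ^ 4 := by
    nlinarith [sq_nonneg (ψ - 500 * ε ^ 2)]
  have h4' := mul_le_mul_of_nonneg_left h4 (show 0 ≤ a * b ^ 3 by positivity)
  linarith


theorem exists_integrable_le_of_tendsto {μ : Measure ℂ} {G : ℕ → ℂ → ℝ} {f : ℂ → ℝ} {c : ℝ}
    (hG : ∀ n, Integrable (G n) μ) (h0 : ∀ n ζ, 0 ≤ G n ζ) (hc : ∀ n, ∫ ζ, G n ζ ∂μ ≤ c)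
    (hf0 : ∀ ζ, 0 ≤ f ζ) (h : ∀ᵐ ζ ∂μ, Tendsto (fun n => G n ζ) atTop (𝓝 (f ζ))) :
    Integrable f μ ∧ ∫ ζ, f ζ ∂μ ≤ c := by
  have hm : AEStronglyMeasurable f μ :=
    aestronglyMeasurable_of_tendsto_ae _ (fun n => (hG n).aestronglyMeasurable) h
  have hc0 : 0 ≤ c := (integral_nonneg (h0 0)).trans (hc 0)
  have h1 : ∫⁻ ζ, ENNReal.ofReal (f ζ) ∂μ ≤ ENNReal.ofReal c := by
    calc ∫⁻ ζ, ENNReal.ofReal (f ζ) ∂μ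
        = ∫⁻ ζ, liminf (fun n => ENNReal.ofReal (G n ζ)) atTop ∂μ := by
          refine lintegral_congr_ae ?_
          filter_upwards [h] with ζ hζ
          exact ((ENNReal.tendsto_ofReal hζ).liminf_eq).symm
      _ ≤ liminf (fun n => ∫⁻ ζ, ENNReal.ofReal (G n ζ) ∂μ) atTop :=
          lintegral_liminf_le' fun n => (hG n).aestronglyMeasurable.aemeasurable.ennreal_ofReal
      _ ≤ ENNReal.ofReal c := by
          refine liminf_le_of_le (by isBoundedDefault) fun b hb => ?_
          obtain ⟨n, hn⟩ := hb.exists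
          refine hn.trans ?_
          rw [← ofReal_integral_eq_lintegral_ofReal (hG n) (Eventually.of_forall (h0 n))]
          exact ENNReal.ofReal_le_ofReal (hc n)
  have hi : Integrable f μ := by
    refine ⟨hm, ?_⟩
    rw [hasFiniteIntegral_iff_ofReal (Eventually.of_forall hf0)]
    exact h1.trans_lt ENNReal.ofReal_lt_top
  refine ⟨hi, ?_⟩
  rw [← ofReal_integral_eq_lintegral_ofReal hi (Eventually.of_forall hf0)] at h1
  exact (ENNReal.ofReal_le_ofReal_iff hc0).1 h1

end Corrector

/-- Energy estimate near a point of `Z`, uniform in the regularisation. -/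
theorem exists_integral_poleWeight_le : ∃ C > 0, ∀ (Z : Set ℂ) (R ε : ℝ) (V ψ : ℂ → ℝ) (g : ℂ → ℂ),
    Corrector Z R ε V ψ g → ∀ q ∈ Z, ∀ η, 0 < η → η ≤ 1 →
      ∫ ζ, poleWeight η q ζ * ‖g ζ‖ ^ 2 ≤ C * ε ^ 4 := by
  obtain ⟨C, hC, hE⟩ := exists_local_energy_le
  obtain ⟨J, hJ, hI⟩ := exists_integral_ball_rpow_le (1 / 100) 1
  refine ⟨2 * (72 * C + 250 * J), by positivity, fun Z R ε V ψ g h q hq η hη hη1 => ?_⟩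
  obtain ⟨c, hc, hc'⟩ := exists_poleWeight_bound q hη
  have hωC := contDiff_poleWeight q hη
  have hω0 : ∀ ζ, 0 ≤ poleWeight η q ζ := fun ζ => poleWeight_nonneg q ζ
  set ω := poleWeight η q with hω
  have hωm : AEStronglyMeasurable ω := hωC.continuous.aestronglyMeasurable
  have ig := h.integrable_weight_grad hωm hc
  have iψ := h.integrable_weight_psi hωm hc
  have iω : Integrable ω := hωC.continuous.integrable_of_hasCompactSupport
    (hasCompactSupport_poleWeight q)
  set W : ℝ → ℝ := fun r => (r ^ 2 + η ^ 2) ^ (-(1 / 200) : ℝ) * max (1 - r ^ 2) 0 ^ 3 with hW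
  set W1 : ℝ → ℝ := fun r => r ^ 2 * (r ^ 2 + η ^ 2)⁻¹ ^ 2 * W r with hW1
  have hWω : ∀ ζ, W ‖ζ - q‖ = ω ζ := fun ζ => rfl
  have hW0 : ∀ r, 0 ≤ W r := fun r => by positivity
  have hWm : Measurable W := by
    have : Continuous W := by
      refine Continuous.mul (Continuous.rpow_const (by fun_prop) fun r => Or.inl (by positivity)) ?_
      fun_prop
    exact this.measurable
  have hWb : ∀ r, 1 ≤ r → W r = 0 := fun r hr => by
    have : max (1 - r ^ 2) 0 = 0 := max_eq_right (by nlinarith)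
    simp only [hW, this]
    simp
  have hWc : ∀ r, 0 ≤ r → W r ≤ c := fun r hr => by
    have h1 := hc (q + (r : ℂ))
    rw [← hWω, add_sub_cancel_left, norm_real, Real.norm_eq_abs, abs_of_nonneg hr,
      abs_of_nonneg (hW0 r)] at h1
    exact h1
  have hc0 : 0 ≤ c := (abs_nonneg _).trans (hc 0)
  have hTb : ∀ r : ℝ, r ^ 2 * (r ^ 2 + η ^ 2)⁻¹ ≤ 1 := fun r => by
    rw [← div_eq_mul_inv, div_le_one (by positivity)]
    nlinarith
  have hTi : ∀ r : ℝ, (r ^ 2 + η ^ 2)⁻¹ ≤ (η ^ 2)⁻¹ := fun r =>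
    inv_anti₀ (by positivity) (by nlinarith [sq_nonneg r])
  have hW1c : ∀ r, 0 ≤ r → W1 r ≤ (η ^ 2)⁻¹ * c := fun r hr => by
    calc W1 r = (r ^ 2 * (r ^ 2 + η ^ 2)⁻¹) * ((r ^ 2 + η ^ 2)⁻¹ * W r) := by simp only [hW1]; ring
      _ ≤ 1 * ((η ^ 2)⁻¹ * c) := mul_le_mul (hTb r)
          (mul_le_mul (hTi r) (hWc r hr) (hW0 r) (by positivity))
          (mul_nonneg (by positivity) (hW0 r)) zero_le_one
      _ = _ := one_mul _
  have hW1m : Measurable W1 := by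
    have : Continuous fun r : ℝ => r ^ 2 * (r ^ 2 + η ^ 2)⁻¹ ^ 2 := by
      refine Continuous.mul (by fun_prop) ((Continuous.inv₀ (by fun_prop) fun r => ?_).pow 2)
      positivity
    exact this.measurable.mul hWm
  have hW10 : ∀ r, 0 ≤ W1 r := fun r => mul_nonneg (by positivity) (hW0 r)
  have p0 := h.thick.circle_poincare h.sol.h10 hq hWm hW0 hWb hWc
  have p1 := h.thick.circle_poincare h.sol.h10 hq hW1m hW10
    (fun r hr => by simp only [hW1, hWb r hr, mul_zero]) hW1c
  have iψ1 : Integrable fun ζ => W1 ‖ζ - q‖ * ψ ζ ^ 2 := by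
    refine h.integrable_weight_psi (c := (η ^ 2)⁻¹ * c)
      (hW1m.comp (by fun_prop)).aestronglyMeasurable fun ζ => ?_
    rw [abs_of_nonneg (hW10 _)]
    exact hW1c _ (norm_nonneg _)
  set G := ∫ ζ, ω ζ * ‖g ζ‖ ^ 2 with hG
  have hG0 : 0 ≤ G := integral_nonneg fun ζ => mul_nonneg (hω0 ζ) (by positivity)
  have hle1 : ∀ ζ, W ‖ζ - q‖ * ‖ζ - q‖ ^ 2 ≤ ω ζ := fun ζ => by
    rcases lt_or_ge ‖ζ - q‖ 1 with h1 | h1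
    · rw [hWω]
      have : ‖ζ - q‖ ^ 2 ≤ 1 := pow_le_one₀ (norm_nonneg _) h1.le
      nlinarith [hω0 ζ]
    · rw [hWb _ h1, zero_mul]
      exact hω0 ζ
  have hle2 : ∀ ζ, W1 ‖ζ - q‖ * ‖ζ - q‖ ^ 2 ≤ ω ζ := fun ζ => by
    have h1 := hTb ‖ζ - q‖
    have h2 : 0 ≤ ‖ζ - q‖ ^ 2 * (‖ζ - q‖ ^ 2 + η ^ 2)⁻¹ := by positivity
    have h3 := pow_le_one₀ (n := 2) h2 h1
    calc W1 ‖ζ - q‖ * ‖ζ - q‖ ^ 2 =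
          (‖ζ - q‖ ^ 2 * (‖ζ - q‖ ^ 2 + η ^ 2)⁻¹) ^ 2 * ω ζ := by
            rw [← hWω]
            simp only [hW1]
            ring
      _ ≤ 1 * ω ζ := by gcongr; exact hω0 ζ
      _ = _ := one_mul _
  have hmono : ∀ w : ℂ → ℝ, (∀ ζ, 0 ≤ w ζ) → (∀ ζ, w ζ ≤ ω ζ) → ∫ ζ, w ζ * ‖g ζ‖ ^ 2 ≤ G := by
    intro w hw0 hw
    refine integral_mono_of_nonneg (Eventually.of_forall fun ζ => mul_nonneg (hw0 ζ) (by positivity)) ig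
      (Eventually.of_forall fun ζ => ?_)
    have := hw ζ
    simp only
    gcongr
  have hpi : 4 * Real.pi ^ 2 ≤ 40 := by
    have := Real.pi_lt_d2
    nlinarith [Real.pi_pos]
  have q0 : ∫ ζ, ω ζ * ψ ζ ^ 2 ≤ 40 * G := by
    refine p0.trans ?_
    gcongr
    exact hmono _ (fun ζ => mul_nonneg (hW0 _) (by positivity)) hle1
  have q1 : ∫ ζ, W1 ‖ζ - q‖ * ψ ζ ^ 2 ≤ 40 * G := by
    refine p1.trans ?_
    gcongr
    exact hmono _ (fun ζ => mul_nonneg (hW10 _) (by positivity)) hle2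
  set Q : ℂ → ℝ := (ball q 1).indicator fun ζ => ψ ζ ^ 2 with hQ
  have iQ : Integrable Q := h.memLp_psi.integrable_sq.indicator measurableSet_ball
  have hQ0 : ∫ ζ, Q ζ ≤ C * ε ^ 4 := by
    rw [hQ, integral_indicator measurableSet_ball]
    refine le_trans (setIntegral_mono_set h.memLp_psi.integrable_sq.integrableOn
      (Eventually.of_forall fun ζ => by positivity)
      (ball_subset_ball (by norm_num : (1:ℝ) ≤ 10)).eventuallyLE) (hE Z R ε V ψ g h q).2
  have key := h.energy_le hωC hc hc' (F := fun ζ =>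
    (((1 / 200 + 1 / 4) * (ω ζ * ‖g ζ‖ ^ 2) + 1 / 200 * (W1 ‖ζ - q‖ * ψ ζ ^ 2)) +
      (72 * Q ζ + (1 / 1000 + ε ^ 2) * (ω ζ * ψ ζ ^ 2))) + 250 * ε ^ 4 * ω ζ)
    ((((ig.const_mul _).fun_add (iψ1.const_mul _)).fun_add
      ((iQ.const_mul _).fun_add (iψ.const_mul _))).fun_add (iω.const_mul _)) fun ζ => by
      by_cases hζ : ζ ∈ ball q 1
      · have hs : ‖ζ - q‖ < 1 := by rwa [mem_ball, dist_eq_norm] at hζ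
        have hT : 0 < ‖ζ - q‖ ^ 2 + η ^ 2 := by positivity
        have hT2 : ‖ζ - q‖ ^ 2 + η ^ 2 ≤ 2 := by nlinarith [norm_nonneg (ζ - q)]
        have ha : 0 ≤ (‖ζ - q‖ ^ 2 + η ^ 2) ^ (-(1 / 200) : ℝ) := by positivity
        have has : (‖ζ - q‖ ^ 2 + η ^ 2) ^ (-(1 / 200) : ℝ) * ‖ζ - q‖ ^ 2 ≤ 2 := by
          calc _ ≤ (‖ζ - q‖ ^ 2 + η ^ 2) ^ (-(1 / 200) : ℝ) * (‖ζ - q‖ ^ 2 + η ^ 2) := by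
                gcongr
                nlinarith
            _ = (‖ζ - q‖ ^ 2 + η ^ 2) ^ (-(1 / 200) + 1 : ℝ) := by
                rw [Real.rpow_add_one hT.ne']
            _ ≤ 2 ^ (-(1 / 200) + 1 : ℝ) :=
                Real.rpow_le_rpow hT.le hT2 (by norm_num)
            _ ≤ 2 ^ (1 : ℝ) := Real.rpow_le_rpow_of_exponent_le (by norm_num) (by norm_num)
            _ = 2 := Real.rpow_one _
        have key := Corrector.pole_pointwise ‖ζ - q‖ ‖gr ω ζ‖ _ (bumpBase (ζ - q))
          (‖ζ - q‖ ^ 2 + η ^ 2) |ψ ζ| ‖g ζ‖ ε ha (bumpBase_nonneg _) (bumpBase_le_one _) has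
          (abs_nonneg _) (norm_nonneg _) (norm_gr_poleWeight_le q hη ζ)
        rw [← poleWeight_eq, ← hω, sq_abs] at key
        rw [abs_of_nonneg (hω0 ζ), hQ, indicator_of_mem hζ]
        refine key.trans (le_of_eq ?_)
        simp only [hW1, hWω]
      · have e1 : ω ζ = 0 := poleWeight_eq_zero q hζ
        have e2 : gr ω ζ = 0 := by
          have := norm_gr_poleWeight_le q hη ζ
          rw [bumpBase_eq_zero (by simpa [dist_eq_norm] using hζ)] at this
          simpa using this
        have : W1 ‖ζ - q‖ = 0 := by simp only [hW1, hWω, e1, mul_zero]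
        rw [e1, e2, this, hQ, indicator_of_notMem hζ]
        simp
  rw [integral_add (((ig.const_mul _).fun_add (iψ1.const_mul _)).fun_add
      ((iQ.const_mul _).fun_add (iψ.const_mul _))) (iω.const_mul _),
    integral_add ((ig.const_mul _).fun_add (iψ1.const_mul _))
      ((iQ.const_mul _).fun_add (iψ.const_mul _)),
    integral_add (ig.const_mul _) (iψ1.const_mul _), integral_add (iQ.const_mul _) (iψ.const_mul _),
    integral_const_mul, integral_const_mul, integral_const_mul, integral_const_mul,
    integral_const_mul] at key
  have hJ' : ∫ ζ, ω ζ ≤ J := (integral_poleWeight_le q hη).trans (hI q)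
  have hε2 := h.sq_le
  have k1 : (1 / 1000 + ε ^ 2) * ∫ ζ, ω ζ * ψ ζ ^ 2 ≤ (1 / 1000 + 1 / 10 ^ 8) * (40 * G) :=
    mul_le_mul (by linarith) q0
      (integral_nonneg fun ζ => mul_nonneg (hω0 ζ) (by positivity)) (by norm_num)
  have k2 : 250 * ε ^ 4 * ∫ ζ, ω ζ ≤ 250 * ε ^ 4 * J := by gcongr
  have hε4 : 0 ≤ ε ^ 4 := by positivity
  linarith

/-- Improved integrability of the gradient near points of `Z`. -/
theorem exists_integral_pole_le : ∃ C > 0, ∀ (Z : Set ℂ) (R ε : ℝ) (V ψ : ℂ → ℝ) (g : ℂ → ℂ),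
    Corrector Z R ε V ψ g → ∀ q ∈ Z,
      IntegrableOn (fun ζ => ‖ζ - q‖ ^ (-(1 / 100) : ℝ) * ‖g ζ‖ ^ 2) (ball q (1 / 2)) ∧
      ∫ ζ in ball q (1 / 2), ‖ζ - q‖ ^ (-(1 / 100) : ℝ) * ‖g ζ‖ ^ 2 ≤ C * ε ^ 4 := by
  obtain ⟨C, hC, hE⟩ := exists_integral_poleWeight_le
  refine ⟨4 * C, by positivity, fun Z R ε V ψ g h q hq => ?_⟩
  have hn0 : ∀ n : ℕ, 0 < 1 / ((n : ℝ) + 1) := fun n => Nat.one_div_pos_of_nat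
  have hn1 : ∀ n : ℕ, 1 / ((n : ℝ) + 1) ≤ 1 := fun n => by
    rw [div_le_one (by positivity)]
    linarith [(Nat.cast_nonneg n : (0 : ℝ) ≤ n)]
  have hlow : ∀ ζ ∈ ball q (1 / 2), 1 ≤ 4 * bumpBase (ζ - q) ^ 3 := fun ζ hζ => by
    rw [mem_ball, dist_eq_norm] at hζ
    have : 3 / 4 ≤ bumpBase (ζ - q) := by
      rw [bumpBase_eq]
      refine le_trans ?_ (le_max_left _ _)
      nlinarith [norm_nonneg (ζ - q)]
    have h1 := pow_le_pow_left₀ (by norm_num) this 3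
    norm_num at h1
    linarith
  have hi : ∀ n : ℕ, Integrable fun ζ => poleWeight (1 / ((n : ℝ) + 1)) q ζ * ‖g ζ‖ ^ 2 := fun n => by
    obtain ⟨c, hc, -⟩ := exists_poleWeight_bound q (hn0 n)
    exact h.integrable_weight_grad
      (contDiff_poleWeight q (hn0 n)).continuous.aestronglyMeasurable hc
  have hlew : ∀ n : ℕ, ∀ ζ ∈ ball q (1 / 2),
      (‖ζ - q‖ ^ 2 + (1 / ((n : ℝ) + 1)) ^ 2) ^ (-(1 / 200) : ℝ) * ‖g ζ‖ ^ 2 ≤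
      4 * (poleWeight (1 / ((n : ℝ) + 1)) q ζ * ‖g ζ‖ ^ 2) := fun n ζ hζ => by
    have h1 := hlow ζ hζ
    have h2 : 0 ≤ (‖ζ - q‖ ^ 2 + (1 / ((n : ℝ) + 1)) ^ 2) ^ (-(1 / 200) : ℝ) * ‖g ζ‖ ^ 2 := by
      positivity
    rw [poleWeight_eq]
    nlinarith
  have hint : ∀ n : ℕ, IntegrableOn (fun ζ =>
      (‖ζ - q‖ ^ 2 + (1 / ((n : ℝ) + 1)) ^ 2) ^ (-(1 / 200) : ℝ) * ‖g ζ‖ ^ 2) (ball q (1 / 2)) := by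
    intro n
    refine ((hi n).const_mul 4).integrableOn.mono' ?_ ?_
    · refine AEStronglyMeasurable.mul (Continuous.aestronglyMeasurable ?_)
        (h.memLp_grad.norm.integrable_sq.aestronglyMeasurable.restrict)
      refine Continuous.rpow_const (by fun_prop) fun ζ => Or.inl ?_
      have := hn0 n
      positivity
    · refine (ae_restrict_iff' measurableSet_ball).2 (Eventually.of_forall fun ζ hζ => ?_)
      rw [Real.norm_of_nonneg (by positivity)]
      exact hlew n ζ hζ
  refine Corrector.exists_integrable_le_of_tendsto hint (fun n ζ => by positivity) (fun n => ?_)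
    (fun ζ => by positivity) ?_
  · calc _ ≤ ∫ ζ in ball q (1 / 2), 4 * (poleWeight (1 / ((n : ℝ) + 1)) q ζ * ‖g ζ‖ ^ 2) :=
          setIntegral_mono_on (hint n) ((hi n).const_mul 4).integrableOn measurableSet_ball (hlew n)
      _ ≤ ∫ ζ, 4 * (poleWeight (1 / ((n : ℝ) + 1)) q ζ * ‖g ζ‖ ^ 2) :=
          setIntegral_le_integral ((hi n).const_mul 4) (Eventually.of_forall fun ζ => by
            have := mul_nonneg (poleWeight_nonneg (η := 1 / ((n : ℝ) + 1)) q ζ) (sq_nonneg ‖g ζ‖)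
            simp only [Pi.zero_apply]
            linarith)
      _ ≤ 4 * (C * ε ^ 4) := by
          rw [integral_const_mul]
          gcongr
          exact hE Z R ε V ψ g h q hq _ (hn0 n) (hn1 n)
      _ = _ := by ring
  · refine ae_restrict_of_ae ?_
    filter_upwards [Measure.ae_ne volume q] with ζ hζ
    have hs : 0 < ‖ζ - q‖ := norm_pos_iff.2 (sub_ne_zero.2 hζ)
    refine Tendsto.mul_const _ ?_
    have e : ‖ζ - q‖ ^ (-(1 / 100) : ℝ) = (‖ζ - q‖ ^ 2 + 0 ^ 2) ^ (-(1 / 200) : ℝ) := by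
      rw [zero_pow two_ne_zero, add_zero, ← Real.rpow_natCast, ← Real.rpow_mul hs.le]
      norm_num
    rw [e]
    refine Tendsto.rpow_const ?_ (Or.inl (by positivity))
    exact (tendsto_const_nhds).add (tendsto_one_div_add_atTop_nhds_zero_nat.pow 2)

theorem weakDb_cutoff {S : Set ℂ} {γ h : ℂ → ℂ} (hγ : LocallyIntegrable γ)
    (hh : LocallyIntegrable h)
    (H : ∀ ζ : ℂ → ℂ, ContDiff ℝ 2 ζ → HasCompactSupport ζ → (∀ z ∈ S, ζ z = 0) →
      ∫ z, γ z * db ζ z = -∫ z, h z * ζ z)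
    {χ : ℂ → ℂ} (hχ : ContDiff ℝ 2 χ) (hχS : ∀ z ∈ S, χ z = 0) :
    WeakDb (fun z => χ z * γ z) (fun z => χ z * h z + γ z * db χ z) := by
  intro η hη hc
  have hχ1 : ContDiff ℝ 1 χ := hχ.of_le (by norm_num)
  have hη1 : ContDiff ℝ 1 η := hη.of_le (by norm_num)
  have hI : ∀ f g : ℂ → ℂ, LocallyIntegrable f → Continuous g → HasCompactSupport g →
      Integrable fun z => f z * g z := fun f g hf hg hgc => by
    have := hf.integrable_smul_left_of_hasCompactSupport hg hgc
    refine this.congr (Eventually.of_forall fun z => ?_)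
    simp [mul_comm]
  have e0 := H (fun z => χ z * η z) (hχ.mul hη) (hc.mul_left) fun z hz => by rw [hχS z hz, zero_mul]
  have c1 : HasCompactSupport fun z => db χ z * η z := hc.mul_left
  have c2 : HasCompactSupport fun z => χ z * db η z := (hasCompactSupport_db hc).mul_left
  have c3 : HasCompactSupport fun z => χ z * η z := hc.mul_left
  have i1 : Integrable fun z => γ z * (db χ z * η z) := hI γ _ hγ ((continuous_db hχ1).mul hη.continuous) c1
  have i2 : Integrable fun z => γ z * (χ z * db η z) := hI γ _ hγ (hχ.continuous.mul (continuous_db hη1)) c2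
  have i3 : Integrable fun z => h z * (χ z * η z) := hI h _ hh (hχ.continuous.mul hη.continuous) c3
  have e1 : ∫ z, γ z * db (fun z => χ z * η z) z =
      (∫ z, γ z * (db χ z * η z)) + ∫ z, γ z * (χ z * db η z) := by
    rw [← integral_add i1 i2]
    congr 1
    ext z
    rw [db_mul (hχ.differentiable two_ne_zero z) (hη.differentiable two_ne_zero z)]
    ring
  have e2 : ∫ z, (χ z * h z + γ z * db χ z) * η z =
      (∫ z, h z * (χ z * η z)) + ∫ z, γ z * (db χ z * η z) := by
    rw [← integral_add i3 i1]
    congr 1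
    ext z
    ring
  have e3 : ∫ z, χ z * γ z * db η z = ∫ z, γ z * (χ z * db η z) := by
    congr 1
    ext z
    ring
  rw [e2, e3]
  rw [e1] at e0
  linear_combination e0

/-- Bound for the singular integral of the gradient away from the last part of the disc around
`z` that avoids `Z`. -/
theorem exists_lintegral_outer_le : ∃ C > 0, ∀ (Z : Set ℂ) (R ε : ℝ) (V ψ : ℂ → ℝ) (g : ℂ → ℂ),
    Corrector Z R ε V ψ g → ∀ z, ∫⁻ ζ in ball z 1 \ ball z (min (infDist z Z) (1 / 8) / 2),
      ENNReal.ofReal (‖g ζ‖ * ‖ζ - z‖⁻¹) ≤ ENNReal.ofReal (C * ε ^ 2) := by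
  obtain ⟨C1, hC1, hE1⟩ := exists_local_energy_le
  obtain ⟨C2, hC2, hE2⟩ := exists_integral_pole_le
  obtain ⟨C3, hC3, hE3⟩ := exists_integral_ball_rpow_le (199 / 100) (1 / 2)
  refine ⟨16 * C1 + 16 * volume.real (ball (0 : ℂ) 1) + 3 * C2 + 3 * C3, by positivity,
    fun Z R ε V ψ g h z => ?_⟩
  have hε := h.pos
  have hZne : Z.Nonempty := ⟨(R : ℂ), h.thick.outer _ (by
    rw [norm_real]; exact le_abs_self R)⟩
  obtain ⟨q, hq, hqd⟩ := h.thick.isClosed.exists_infDist_eq_dist hZne z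
  obtain ⟨i2, b2⟩ := hE2 Z R ε V ψ g h q hq
  set I1 : ℂ → ℝ := (ball q (1 / 2)).indicator fun ζ => ‖ζ - q‖ ^ (-(1 / 100) : ℝ) * ‖g ζ‖ ^ 2
  set I2 : ℂ → ℝ := (ball q (1 / 2)).indicator fun ζ => ‖ζ - q‖ ^ (-(199 / 100) : ℝ)
  have hI1 : Integrable I1 := i2.integrable_indicator measurableSet_ball
  have hI2 : Integrable I2 :=
    (integrableOn_ball_rpow _ (by norm_num) _ _).integrable_indicator measurableSet_ball
  have hI10 : ∀ ζ, 0 ≤ I1 ζ := fun ζ => indicator_nonneg (fun _ _ => by positivity) _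
  have hI20 : ∀ ζ, 0 ≤ I2 ζ := fun ζ => indicator_nonneg (fun _ _ => by positivity) _
  have sI1 : ∫ ζ in ball z 1, I1 ζ ≤ C2 * ε ^ 4 :=
    (setIntegral_le_integral hI1 (Eventually.of_forall hI10)).trans
      ((integral_indicator measurableSet_ball).trans_le b2)
  have sI2 : ∫ ζ in ball z 1, I2 ζ ≤ C3 :=
    (setIntegral_le_integral hI2 (Eventually.of_forall hI20)).trans
      ((integral_indicator measurableSet_ball).trans_le (hE3 q))
  have ig := h.memLp_grad.norm.integrable_sq
  have sg : ∫ ζ in ball z 1, ‖g ζ‖ ^ 2 ≤ C1 * ε ^ 4 :=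
    le_trans (setIntegral_mono_set ig.integrableOn (Eventually.of_forall fun ζ => by positivity)
      (ball_subset_ball (by norm_num : (1:ℝ) ≤ 10)).eventuallyLE) (hE1 Z R ε V ψ g h z).1
  set F : ℂ → ℝ := fun ζ => (16 / ε ^ 2 * ‖g ζ‖ ^ 2 + 16 * ε ^ 2) +
    (3 / ε ^ 2 * I1 ζ + 3 * ε ^ 2 * I2 ζ) with hF
  have hFi1 : IntegrableOn (fun ζ => 16 / ε ^ 2 * ‖g ζ‖ ^ 2) (ball z 1) :=
    (ig.const_mul _).integrableOn
  have hFi2 : IntegrableOn (fun _ => 16 * ε ^ 2) (ball z 1) :=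
    integrableOn_const measure_ball_lt_top.ne
  have hFi3 : IntegrableOn (fun ζ => 3 / ε ^ 2 * I1 ζ) (ball z 1) := (hI1.const_mul _).integrableOn
  have hFi4 : IntegrableOn (fun ζ => 3 * ε ^ 2 * I2 ζ) (ball z 1) := (hI2.const_mul _).integrableOn
  have hF0 : ∀ ζ, 0 ≤ F ζ := fun ζ => by
    have := hI10 ζ
    have := hI20 ζ
    positivity
  have hFI : IntegrableOn F (ball z 1) := (hFi1.fun_add hFi2).fun_add (hFi3.fun_add hFi4)
  have hFle : ∫ ζ in ball z 1, F ζ ≤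
      (16 * C1 + 16 * volume.real (ball (0 : ℂ) 1) + 3 * C2 + 3 * C3) * ε ^ 2 := by
    rw [hF, integral_add (hFi1.fun_add hFi2) (hFi3.fun_add hFi4), integral_add hFi1 hFi2,
      integral_add hFi3 hFi4, integral_const_mul, integral_const_mul, integral_const_mul, integral_const_mul,
      setIntegral_const, smul_eq_mul]
    have hv : volume.real (ball z 1) = volume.real (ball (0 : ℂ) 1) := by
      rw [Measure.real, Measure.real, Measure.addHaar_ball_center]
    rw [hv]
    have e : ∀ c C : ℝ, c / ε ^ 2 * (C * ε ^ 4) = c * C * ε ^ 2 := fun c C => by field_simp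
    have k1 : 16 / ε ^ 2 * ∫ ζ in ball z 1, ‖g ζ‖ ^ 2 ≤ 16 / ε ^ 2 * (C1 * ε ^ 4) := by gcongr
    have k3 : 3 / ε ^ 2 * ∫ ζ in ball z 1, I1 ζ ≤ 3 / ε ^ 2 * (C2 * ε ^ 4) := by gcongr
    have k4 : 3 * ε ^ 2 * ∫ ζ in ball z 1, I2 ζ ≤ 3 * ε ^ 2 * C3 := by gcongr
    rw [e] at k1 k3
    linarith
  refine le_trans ?_ (ENNReal.ofReal_le_ofReal hFle)
  rw [ofReal_integral_eq_lintegral_ofReal hFI (Eventually.of_forall hF0)]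
  refine le_trans (lintegral_mono_ae (g := fun ζ => ENNReal.ofReal (F ζ)) ?_)
    (lintegral_mono_set sdiff_subset)
  rw [ae_restrict_iff' (measurableSet_ball.diff measurableSet_ball)]
  filter_upwards [Measure.ae_ne volume q] with ζ hζq hζ
  refine ENNReal.ofReal_le_ofReal ?_
  have hn := norm_nonneg (g ζ)
  have hd1 : min (infDist z Z) (1 / 8) / 2 ≤ ‖ζ - z‖ := by
    have := hζ.2
    rwa [mem_ball, not_lt, dist_eq_norm] at this
  rcases le_or_gt (1 / 16) ‖ζ - z‖ with h1 | h1
  · have h2 : ‖ζ - z‖⁻¹ ≤ 16 := by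
      rw [inv_le_comm₀ (by linarith) (by norm_num)]
      linarith
    have h3 : ‖g ζ‖ ≤ ‖g ζ‖ ^ 2 / ε ^ 2 + ε ^ 2 := by
      have e : ‖g ζ‖ ^ 2 / ε ^ 2 = (‖g ζ‖ / ε) ^ 2 := by ring
      have e' : ‖g ζ‖ = ‖g ζ‖ / ε * ε := by field_simp
      rw [e]
      nlinarith [sq_nonneg (‖g ζ‖ / ε - ε), sq_nonneg (‖g ζ‖ / ε), sq_nonneg ε]
    calc ‖g ζ‖ * ‖ζ - z‖⁻¹ ≤ (‖g ζ‖ ^ 2 / ε ^ 2 + ε ^ 2) * 16 := by gcongr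
      _ = 16 / ε ^ 2 * ‖g ζ‖ ^ 2 + 16 * ε ^ 2 := by ring
      _ ≤ F ζ := by
          have := hI10 ζ
          have := hI20 ζ
          rw [hF]
          simp only
          have : 0 ≤ 3 / ε ^ 2 * I1 ζ + 3 * ε ^ 2 * I2 ζ := by positivity
          linarith
  · have hd : infDist z Z / 2 ≤ ‖ζ - z‖ := by
      rcases le_total (infDist z Z) (1 / 8) with h2 | h2
      · rwa [min_eq_left h2] at hd1
      · rw [min_eq_right h2] at hd1
        linarith
    rw [hqd, dist_eq_norm] at hd
    have h2 : ‖ζ - q‖ ≤ 3 * ‖ζ - z‖ := by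
      have := norm_sub_le_norm_sub_add_norm_sub ζ z q
      linarith
    have hs : 0 < ‖ζ - q‖ := norm_pos_iff.2 (sub_ne_zero.2 hζq)
    have hz : 0 < ‖ζ - z‖ := by linarith
    have hmem : ζ ∈ ball q (1 / 2) := by
      rw [mem_ball, dist_eq_norm]
      linarith
    have h3 : ‖ζ - z‖⁻¹ ≤ 3 * ‖ζ - q‖⁻¹ := by
      rw [inv_le_comm₀ hz (by positivity), mul_inv, inv_inv]
      linarith
    have h4 : ‖g ζ‖ * ‖ζ - q‖⁻¹ ≤ ‖ζ - q‖ ^ (-(1 / 100) : ℝ) * ‖g ζ‖ ^ 2 / ε ^ 2 +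
        ε ^ 2 * ‖ζ - q‖ ^ (-(199 / 100) : ℝ) := by
      set p := ‖ζ - q‖ ^ (-(1 / 200) : ℝ)
      set r := ‖ζ - q‖ ^ (-(199 / 200) : ℝ)
      have e1 : ‖ζ - q‖ ^ (-(1 / 100) : ℝ) = p ^ 2 := by
        rw [← Real.rpow_natCast, ← Real.rpow_mul hs.le]
        norm_num
      have e2 : ‖ζ - q‖ ^ (-(199 / 100) : ℝ) = r ^ 2 := by
        rw [← Real.rpow_natCast, ← Real.rpow_mul hs.le]
        norm_num
      have e3 : ‖ζ - q‖⁻¹ = p * r := by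
        rw [← Real.rpow_add hs, ← Real.rpow_neg_one]
        norm_num
      rw [e1, e2, e3]
      have e4 : p ^ 2 * ‖g ζ‖ ^ 2 / ε ^ 2 = (p * (‖g ζ‖ / ε)) ^ 2 := by ring
      have e5 : ‖g ζ‖ * (p * r) = (p * (‖g ζ‖ / ε)) * (ε * r) := by field_simp
      rw [e4, e5, ← mul_pow]
      nlinarith [sq_nonneg (p * (‖g ζ‖ / ε) - ε * r), sq_nonneg (p * (‖g ζ‖ / ε)), sq_nonneg (ε * r)]
    calc ‖g ζ‖ * ‖ζ - z‖⁻¹ ≤ ‖g ζ‖ * (3 * ‖ζ - q‖⁻¹) := by gcongr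
      _ = 3 * (‖g ζ‖ * ‖ζ - q‖⁻¹) := by ring
      _ ≤ 3 * (‖ζ - q‖ ^ (-(1 / 100) : ℝ) * ‖g ζ‖ ^ 2 / ε ^ 2 +
        ε ^ 2 * ‖ζ - q‖ ^ (-(199 / 100) : ℝ)) := by gcongr
      _ = 3 / ε ^ 2 * I1 ζ + 3 * ε ^ 2 * I2 ζ := by
          simp only [I1, I2, indicator_of_mem hmem]
          ring
      _ ≤ F ζ := by
          rw [hF]
          simp only
          have : 0 ≤ 16 / ε ^ 2 * ‖g ζ‖ ^ 2 + 16 * ε ^ 2 := by positivity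
          linarith

theorem exists_scaled_cutoff : ∃ C > 0, ∀ (z : ℂ) (d : ℝ), 0 < d → ∃ χ : ℂ → ℝ, ContDiff ℝ 2 χ ∧
    (∀ ζ, |χ ζ| ≤ 1) ∧ (∀ ζ ∈ ball z (d / 2), χ ζ = 1) ∧ (∀ ζ ∉ ball z d, χ ζ = 0) ∧
    (∀ ζ, ‖gr χ ζ‖ ≤ C / d) ∧ (∀ ζ ∈ ball z (d / 2), gr χ ζ = 0) ∧
    ∀ ζ ∉ ball z d, gr χ ζ = 0 := by
  let b : ContDiffBump (0 : ℂ) := ⟨1 / 2, 3 / 4, by norm_num, by norm_num⟩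
  have hb : ContDiff ℝ 2 b := b.contDiff
  have hb1 : ContDiff ℝ 1 b := b.contDiff
  obtain ⟨C, hC⟩ := (hasCompactSupport_gr b.hasCompactSupport).exists_bound_of_continuous
    (continuous_gr hb1)
  refine ⟨|C| + 1, by positivity, fun z d hd => ?_⟩
  have hgr : ∀ ζ, gr (fun ζ : ℂ => b (-((d⁻¹ : ℝ) : ℂ) * z + ((d⁻¹ : ℝ) : ℂ) * ζ)) ζ =
      ((d⁻¹ : ℝ) : ℂ) * gr b (-((d⁻¹ : ℝ) : ℂ) * z + ((d⁻¹ : ℝ) : ℂ) * ζ) := fun ζ => by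
    rw [gr, fderiv_comp_affine hb1, fderiv_comp_affine hb1, gr]
    push_cast
    ring
  have hn : ∀ ζ, ‖-((d⁻¹ : ℝ) : ℂ) * z + ((d⁻¹ : ℝ) : ℂ) * ζ‖ = d⁻¹ * dist ζ z := fun ζ => by
    rw [show -((d⁻¹ : ℝ) : ℂ) * z + ((d⁻¹ : ℝ) : ℂ) * ζ = ((d⁻¹ : ℝ) : ℂ) * (ζ - z) by ring,
      norm_mul, norm_real, Real.norm_of_nonneg (by positivity), dist_eq_norm]
  have h1 : ∀ ζ ∈ ball z (d / 2), -((d⁻¹ : ℝ) : ℂ) * z + ((d⁻¹ : ℝ) : ℂ) * ζ ∈ ball (0 : ℂ) (1 / 2) :=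
    fun ζ hζ => by
      rw [mem_ball_zero_iff, hn, inv_mul_lt_iff₀ hd]
      rw [mem_ball] at hζ
      linarith
  have h2 : ∀ ζ ∉ ball z d, 1 ≤ ‖-((d⁻¹ : ℝ) : ℂ) * z + ((d⁻¹ : ℝ) : ℂ) * ζ‖ :=
    fun ζ hζ => by
      rw [hn, le_inv_mul_iff₀ hd]
      rw [mem_ball, not_lt] at hζ
      linarith
  refine ⟨fun ζ => b (-((d⁻¹ : ℝ) : ℂ) * z + ((d⁻¹ : ℝ) : ℂ) * ζ), hb.comp (by fun_prop), fun ζ => ?_,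
    fun ζ hζ => ?_, fun ζ hζ => ?_, fun ζ => ?_, fun ζ hζ => ?_, fun ζ hζ => ?_⟩
  · rw [abs_of_nonneg b.nonneg]
    exact b.le_one
  · exact b.one_of_mem_closedBall (ball_subset_closedBall (h1 ζ hζ))
  · refine b.zero_of_le_dist ?_
    rw [dist_zero_right]
    exact le_trans (by norm_num [b]) (h2 ζ hζ)
  · rw [hgr, norm_mul, norm_real, Real.norm_of_nonneg (by positivity), div_eq_inv_mul]
    gcongr
    exact (hC _).trans ((le_abs_self C).trans (by linarith))
  · rw [hgr]
    have h3 : b =ᶠ[𝓝 (-((d⁻¹ : ℝ) : ℂ) * z + ((d⁻¹ : ℝ) : ℂ) * ζ)] fun _ => (1 : ℝ) :=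
      b.eventuallyEq_one_of_mem_ball (h1 ζ hζ)
    rw [gr, h3.fderiv_eq]
    simp
  · rw [hgr]
    have h3 : -((d⁻¹ : ℝ) : ℂ) * z + ((d⁻¹ : ℝ) : ℂ) * ζ ∉ tsupport b := by
      rw [b.tsupport_eq]
      intro h4
      rw [mem_closedBall_zero_iff] at h4
      have h5 : ‖-((d⁻¹ : ℝ) : ℂ) * z + ((d⁻¹ : ℝ) : ℂ) * ζ‖ ≤ 3 / 4 := h4
      linarith [h2 ζ hζ]
    rw [gr, fderiv_of_notMem_tsupport ℝ h3]
    simp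

theorem integral_ball_rpow_scale (z : ℂ) {r : ℝ} (hr : 0 < r) :
    ∫ ζ in ball z r, ‖ζ - z‖ ^ (-(3 / 2) : ℝ) =
      √r * ∫ ζ in ball (0 : ℂ) 1, ‖ζ‖ ^ (-(3 / 2) : ℝ) := by
  set f : ℂ → ℝ := (ball (0 : ℂ) 1).indicator fun ζ => ‖ζ‖ ^ (-(3 / 2) : ℝ) with hf
  have h1 := Measure.integral_comp_inv_smul_of_nonneg (volume : Measure ℂ) f hr.le
  rw [← integral_sub_right_eq_self _ z, Complex.finrank_real_complex, smul_eq_mul] at h1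
  have h2 : ∀ ζ, (ball z r).indicator (fun ζ => ‖ζ - z‖ ^ (-(3 / 2) : ℝ)) ζ =
      r ^ (-(3 / 2) : ℝ) * f (r⁻¹ • (ζ - z)) := fun ζ => by
    have hn : ‖r⁻¹ • (ζ - z)‖ = r⁻¹ * ‖ζ - z‖ := by
      rw [norm_smul, Real.norm_of_nonneg (by positivity)]
    by_cases h : ζ ∈ ball z r
    · have h' : r⁻¹ • (ζ - z) ∈ ball (0 : ℂ) 1 := by
        rw [mem_ball, dist_eq_norm] at h
        rw [mem_ball_zero_iff, hn, inv_mul_lt_iff₀ hr]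
        linarith
      rw [indicator_of_mem h, hf, indicator_of_mem h', hn, ← Real.mul_rpow hr.le (by positivity)]
      congr 1
      field_simp
    · have h' : r⁻¹ • (ζ - z) ∉ ball (0 : ℂ) 1 := by
        rw [mem_ball, dist_eq_norm, not_lt] at h
        rw [mem_ball_zero_iff, hn, not_lt, le_inv_mul_iff₀ hr]
        linarith
      rw [indicator_of_notMem h, hf, indicator_of_notMem h', mul_zero]
  rw [← integral_indicator measurableSet_ball, funext h2, integral_const_mul, h1,
    ← integral_indicator measurableSet_ball, ← hf, ← mul_assoc]
  congr 1
  rw [Real.sqrt_eq_rpow, ← Real.rpow_natCast, ← Real.rpow_add hr]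
  norm_num

theorem exists_kernel_le : ∃ C > 0, ∀ (z ξ : ℂ) (d : ℝ), 0 < ‖ξ - z‖ → ‖ξ - z‖ < d →
    ∫⁻ ζ in ball z (d / 2), ENNReal.ofReal (‖ζ - z‖⁻¹ * ‖ζ - ξ‖⁻¹) ≤
      ENNReal.ofReal (C * √(d / ‖ξ - z‖)) := by
  set J := ∫ ζ in ball (0 : ℂ) 1, ‖ζ‖ ^ (-(3 / 2) : ℝ) with hJ
  have hJ0 : 0 ≤ J := integral_nonneg fun ζ => by positivity
  refine ⟨4 * (J + 1), by positivity, fun z ξ d hρ hd => ?_⟩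
  have hd0 : 0 < d := hρ.trans hd
  set ρ := ‖ξ - z‖ with hρd
  have i1 : IntegrableOn (fun ζ => ‖ζ - z‖ ^ (-(3 / 2) : ℝ)) (ball z (2 * d)) :=
    integrableOn_ball_rpow (3 / 2) (by norm_num) z _
  have i2 : IntegrableOn (fun ζ => ‖ζ - ξ‖ ^ (-(3 / 2) : ℝ)) (ball ξ (2 * d)) :=
    integrableOn_ball_rpow (3 / 2) (by norm_num) ξ _
  have s1 : ball z (d / 2) ⊆ ball z (2 * d) := ball_subset_ball (by linarith)
  have s2 : ball z (d / 2) ⊆ ball ξ (2 * d) := by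
    refine ball_subset_ball' ?_
    rw [dist_comm, dist_eq_norm, ← hρd]
    linarith
  have iS : IntegrableOn (fun ζ => √(2 / ρ) * (‖ζ - z‖ ^ (-(3 / 2) : ℝ) + ‖ζ - ξ‖ ^ (-(3 / 2) : ℝ)))
      (ball z (d / 2)) := ((i1.mono_set s1).fun_add (i2.mono_set s2)).const_mul _
  have hle : ∫ ζ in ball z (d / 2), √(2 / ρ) *
      (‖ζ - z‖ ^ (-(3 / 2) : ℝ) + ‖ζ - ξ‖ ^ (-(3 / 2) : ℝ)) ≤ 4 * (J + 1) * √(d / ρ) := by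
    rw [integral_const_mul, integral_add (i1.mono_set s1) (i2.mono_set s2)]
    have b1 : ∫ ζ in ball z (d / 2), ‖ζ - z‖ ^ (-(3 / 2) : ℝ) ≤ √(2 * d) * J := by
      rw [hJ, ← integral_ball_rpow_scale z (by positivity : 0 < 2 * d)]
      exact setIntegral_mono_set i1 (Eventually.of_forall fun ζ => by positivity) s1.eventuallyLE
    have b2 : ∫ ζ in ball z (d / 2), ‖ζ - ξ‖ ^ (-(3 / 2) : ℝ) ≤ √(2 * d) * J := by
      rw [hJ, ← integral_ball_rpow_scale ξ (by positivity : 0 < 2 * d)]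
      exact setIntegral_mono_set i2 (Eventually.of_forall fun ζ => by positivity) s2.eventuallyLE
    calc _ ≤ √(2 / ρ) * (√(2 * d) * J + √(2 * d) * J) := by gcongr
      _ = √(2 / ρ) * √(2 * d) * (2 * J) := by ring
      _ = 2 * √(d / ρ) * (2 * J) := by
          rw [← Real.sqrt_mul (by positivity), show 2 / ρ * (2 * d) = 2 ^ 2 * (d / ρ) by ring,
            Real.sqrt_mul (by positivity), Real.sqrt_sq (by norm_num)]
      _ ≤ _ := by nlinarith [Real.sqrt_nonneg (d / ρ)]
  refine le_trans ?_ (ENNReal.ofReal_le_ofReal hle)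
  rw [ofReal_integral_eq_lintegral_ofReal iS (Eventually.of_forall fun ζ => by positivity)]
  refine lintegral_mono_ae (ae_restrict_of_ae ?_)
  filter_upwards [Measure.ae_ne volume z, Measure.ae_ne volume ξ] with ζ hz hξ
  refine ENNReal.ofReal_le_ofReal ?_
  have ha : 0 < ‖ζ - z‖ := norm_pos_iff.2 (sub_ne_zero.2 hz)
  have hb : 0 < ‖ζ - ξ‖ := norm_pos_iff.2 (sub_ne_zero.2 hξ)
  have hab : ρ ≤ ‖ζ - z‖ + ‖ζ - ξ‖ := by
    have := norm_sub_le_norm_sub_add_norm_sub ξ ζ z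
    rw [norm_sub_rev ξ ζ] at this
    linarith
  have key : ∀ a b : ℝ, 0 < a → a ≤ b → ρ ≤ a + b →
      a⁻¹ * b⁻¹ ≤ √(2 / ρ) * a ^ (-(3 / 2) : ℝ) := by
    intro a b ha hab h
    have hb : 0 < b := ha.trans_le hab
    have e1 : √(2 / ρ) = (2 / ρ) ^ (1 / 2 : ℝ) := Real.sqrt_eq_rpow _
    have h1 : b⁻¹ ≤ (2 / ρ) ^ (1 / 2 : ℝ) * a ^ (-(1 / 2) : ℝ) := by
      have h2 : b⁻¹ = (b⁻¹) ^ (1 / 2 : ℝ) * (b⁻¹) ^ (1 / 2 : ℝ) := by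
        rw [← Real.rpow_add (by positivity)]
        norm_num
      have h3 : a ^ (-(1 / 2) : ℝ) = (a⁻¹) ^ (1 / 2 : ℝ) := by
        rw [Real.inv_rpow ha.le, Real.rpow_neg ha.le]
      rw [h2, h3]
      have h4 : b⁻¹ ≤ 2 / ρ := by
        rw [inv_le_comm₀ hb (by positivity), inv_div]
        linarith
      have h5 : b⁻¹ ≤ a⁻¹ := inv_anti₀ ha hab
      gcongr
    calc a⁻¹ * b⁻¹ ≤ a⁻¹ * ((2 / ρ) ^ (1 / 2 : ℝ) * a ^ (-(1 / 2) : ℝ)) := by gcongr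
      _ = _ := by
          rw [e1, ← Real.rpow_neg_one a, mul_left_comm, ← Real.rpow_add ha]
          norm_num
  rcases le_total ‖ζ - z‖ ‖ζ - ξ‖ with h | h
  · refine (key _ _ ha h hab).trans ?_
    gcongr
    exact le_add_of_nonneg_right (by positivity)
  · rw [mul_comm ‖ζ - z‖⁻¹]
    refine (key _ _ hb h (by linarith)).trans ?_
    gcongr
    exact le_add_of_nonneg_left (by positivity)

theorem ofReal_norm_cT_le (f : ℂ → ℂ) (ζ : ℂ) :
    ENNReal.ofReal ‖cT f ζ‖ ≤ ∫⁻ ξ, ENNReal.ofReal (‖f ξ‖ * ‖ζ - ξ‖⁻¹) := by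
  rw [cT, norm_mul]
  have h1 : ‖(2 * (Real.pi : ℂ))⁻¹‖ ≤ 1 := by
    rw [norm_inv]
    apply inv_le_one_of_one_le₀
    simp only [norm_mul, Complex.norm_ofNat, Complex.norm_real, Real.norm_eq_abs,
      abs_of_pos Real.pi_pos]
    linarith [Real.pi_gt_three]
  refine (ENNReal.ofReal_le_ofReal (mul_le_of_le_one_left (norm_nonneg _) h1)).trans ?_
  rw [ofReal_norm]
  refine (enorm_integral_le_lintegral_enorm _).trans (lintegral_mono fun ξ => ?_)
  rw [← ofReal_norm, norm_div, div_eq_mul_inv]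

theorem lintegral_cT_le {f : ℂ → ℂ} (hf : AEStronglyMeasurable f) (z : ℂ) (r : ℝ) :
    ∫⁻ ζ in ball z r, ENNReal.ofReal (‖cT f ζ‖ * ‖ζ - z‖⁻¹) ≤
      ∫⁻ ξ, ENNReal.ofReal ‖f ξ‖ *
        ∫⁻ ζ in ball z r, ENNReal.ofReal (‖ζ - z‖⁻¹ * ‖ζ - ξ‖⁻¹) := by
  have m2 : AEMeasurable (fun p : ℂ × ℂ => ENNReal.ofReal (‖f p.2‖ * ‖p.1 - p.2‖⁻¹ * ‖p.1 - z‖⁻¹))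
      ((volume.restrict (ball z r)).prod volume) := by
    have a1 : AEMeasurable (fun p : ℂ × ℂ => ‖f p.2‖)
      ((volume.restrict (ball z r)).prod volume) := hf.norm.comp_snd.aemeasurable
    have a2 : Measurable (fun p : ℂ × ℂ => ‖p.1 - p.2‖⁻¹) :=
      (by fun_prop : Measurable (fun p : ℂ × ℂ => ‖p.1 - p.2‖)).inv
    have a3 : Measurable (fun p : ℂ × ℂ => ‖p.1 - z‖⁻¹) :=
      (by fun_prop : Measurable (fun p : ℂ × ℂ => ‖p.1 - z‖)).inv
    exact ((a1.mul a2.aemeasurable).mul a3.aemeasurable).ennreal_ofReal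
  calc ∫⁻ ζ in ball z r, ENNReal.ofReal (‖cT f ζ‖ * ‖ζ - z‖⁻¹)
      ≤ ∫⁻ ζ in ball z r, ∫⁻ ξ, ENNReal.ofReal (‖f ξ‖ * ‖ζ - ξ‖⁻¹ * ‖ζ - z‖⁻¹) := by
        refine lintegral_mono fun ζ => ?_
        rw [ENNReal.ofReal_mul (norm_nonneg _)]
        refine (mul_le_mul_left (ofReal_norm_cT_le f ζ) _).trans ?_
        rw [← lintegral_mul_const' _ _ ENNReal.ofReal_ne_top]
        refine lintegral_mono fun ξ => ?_
        rw [← ENNReal.ofReal_mul (by positivity)]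
    _ = ∫⁻ ξ, ∫⁻ ζ in ball z r, ENNReal.ofReal (‖f ξ‖ * ‖ζ - ξ‖⁻¹ * ‖ζ - z‖⁻¹) :=
        lintegral_lintegral_swap m2
    _ = _ := by
        refine lintegral_congr fun ξ => ?_
        rw [← lintegral_const_mul' _ _ ENNReal.ofReal_ne_top]
        refine lintegral_congr fun ζ => ?_
        rw [← ENNReal.ofReal_mul (by positivity)]
        ring_nf

theorem integrable_mul_of_locallyIntegrable {f g : ℂ → ℂ} (hf : LocallyIntegrable f)
    (hg : Continuous g) (hc : HasCompactSupport g) : Integrable fun z => f z * g z := by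
  have := hf.integrable_smul_left_of_hasCompactSupport hg hc
  refine this.congr (Eventually.of_forall fun z => ?_)
  simp [mul_comm]

theorem cutoff_ae_eq_cT {S : Set ℂ} {γ h : ℂ → ℂ} (hγ : LocallyIntegrable γ)
    (hh : LocallyIntegrable h)
    (H : ∀ ζ : ℂ → ℂ, ContDiff ℝ 2 ζ → HasCompactSupport ζ → (∀ z ∈ S, ζ z = 0) →
      ∫ z, γ z * db ζ z = -∫ z, h z * ζ z)
    {χ : ℂ → ℂ} (hχ : ContDiff ℝ 2 χ) (hχS : ∀ z ∈ S, χ z = 0) {K : Set ℂ} (hK : IsCompact K)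
    (hχK : ∀ z ∉ K, χ z = 0) :
    (fun z => χ z * γ z) =ᵐ[volume] cT fun z => χ z * h z + γ z * db χ z := by
  have hχ1 : ContDiff ℝ 1 χ := hχ.of_le (by norm_num)
  have hc : HasCompactSupport χ := HasCompactSupport.intro hK hχK
  have hts : tsupport χ ⊆ K := closure_minimal (fun z hz => by
    by_contra h1
    exact hz (hχK z h1)) hK.isClosed
  have i1 : Integrable fun z => χ z * γ z := by
    simp only [mul_comm]
    exact integrable_mul_of_locallyIntegrable hγ hχ.continuous hc
  have i2 : Integrable fun z => χ z * h z := by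
    simp only [mul_comm]
    exact integrable_mul_of_locallyIntegrable hh hχ.continuous hc
  have i3 : Integrable fun z => γ z * db χ z :=
    integrable_mul_of_locallyIntegrable hγ (continuous_db hχ1) (hasCompactSupport_db hc)
  refine ae_eq_cT_of_weakDb hK i1 (i2.fun_add i3) (fun z hz => by simp [hχK z hz])
    (fun z hz => ?_) (weakDb_cutoff hγ hh H hχ hχS)
  have : db χ z = 0 := db_eq_zero_of_notMem_tsupport fun h1 => hz (hts h1)
  simp [hχK z hz, this]

theorem exists_lintegral_inner_le : ∃ C > 0, ∀ (Z : Set ℂ) (R ε : ℝ) (V ψ : ℂ → ℝ) (g : ℂ → ℂ),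
    Corrector Z R ε V ψ g → ∀ z, ∫⁻ ζ in ball z (min (infDist z Z) (1 / 8) / 2),
      ENNReal.ofReal (‖g ζ‖ * ‖ζ - z‖⁻¹) ≤ ENNReal.ofReal (C * ε ^ 2) := by
  obtain ⟨C1, hC1, hE1⟩ := exists_local_energy_le
  obtain ⟨C2, hC2, hE2⟩ := exists_lintegral_outer_le
  obtain ⟨C3, hC3, hE3⟩ := exists_scaled_cutoff
  obtain ⟨C4, hC4, hE4⟩ := exists_kernel_le
  obtain ⟨C5, hC5, hE5⟩ := exists_integral_inv_norm_sub_le 1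
  refine ⟨C4 * (2 * volume.real (ball (0 : ℂ) 1) + 2 * C1 + C5) + 2 * C4 * C3 * C2, by positivity,
    fun Z R ε V ψ g h z => ?_⟩
  have hε := h.pos
  have hε1 : ε ≤ 1 := h.small.trans (by norm_num)
  have hZne : Z.Nonempty := ⟨(R : ℂ), h.thick.outer _ (by
    rw [norm_real]; exact le_abs_self R)⟩
  set d := min (infDist z Z) (1 / 8) with hd
  rcases le_or_gt d 0 with hd0 | hd0
  · rw [ball_eq_empty.2 (by linarith)]
    simp
  have hd8 : d ≤ 1 / 8 := min_le_right _ _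
  have hdis : ∀ q ∈ Z, q ∉ ball z d := fun q hq hb => by
    have h1 := infDist_le_dist_of_mem (x := z) hq
    have h2 : d ≤ infDist z Z := min_le_left _ _
    rw [mem_ball, dist_comm] at hb
    linarith
  obtain ⟨χ, hχ, hχ1, hχin, hχout, hgr, hgrin, hgrout⟩ := hE3 z d hd0
  have hχ1' : ContDiff ℝ 1 χ := hχ.of_le (by norm_num)
  set H : ℂ → ℂ := fun ζ => ((V ζ * (1 + ψ ζ) : ℝ) : ℂ) with hH
  have mH : MemLp H 2 := (h.potential.mul_one_add_memLp h.memLp_psi).ofReal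
  have mg := memLp_conj h.memLp_grad
  have e1 := cutoff_ae_eq_cT (S := Z) (mg.locallyIntegrable (by norm_num))
    (mH.locallyIntegrable (by norm_num))
    (fun ζ hζ _ h0 => h.sol.complex_weak h.thick h.potential hζ h0)
    (contDiff_ofReal_comp hχ) (fun q hq => by simp [hχout q (hdis q hq)])
    (isCompact_closedBall z d) (fun q hq => by
      simp [hχout q fun hb => hq (ball_subset_closedBall hb)])
  have hdb : ∀ ζ, db (fun w => (χ w : ℂ)) ζ = gr χ ζ := fun ζ =>
    db_ofReal (hχ.differentiable two_ne_zero ζ)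
  simp only [hdb] at e1
  set f : ℂ → ℂ := fun ζ => (χ ζ : ℂ) * H ζ + (starRingEnd ℂ) (g ζ) * gr χ ζ with hf
  have mf : AEStronglyMeasurable f :=
    ((continuous_ofReal.comp hχ.continuous).aestronglyMeasurable.mul mH.aestronglyMeasurable).add
      (mg.aestronglyMeasurable.mul (continuous_gr hχ1').aestronglyMeasurable)
  have e2 : ∫⁻ ζ in ball z (d / 2), ENNReal.ofReal (‖g ζ‖ * ‖ζ - z‖⁻¹) =
      ∫⁻ ζ in ball z (d / 2), ENNReal.ofReal (‖cT f ζ‖ * ‖ζ - z‖⁻¹) := by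
    refine lintegral_congr_ae ((ae_restrict_iff' measurableSet_ball).2 ?_)
    filter_upwards [e1] with ζ h1 hζ
    rw [← h1, hχin ζ hζ]
    simp
  rw [e2]
  refine (lintegral_cT_le mf z _).trans ?_
  set G : ℂ → ℝ := fun ξ => C4 * ε ^ 2 * (2 + 2 * ψ ξ ^ 2 + ‖ξ - z‖⁻¹) with hG
  have iψ : IntegrableOn (fun ξ => 2 * ψ ξ ^ 2) (ball z 1) :=
    (h.memLp_psi.integrable_sq.const_mul 2).integrableOn
  have ic : IntegrableOn (fun _ : ℂ => (2 : ℝ)) (ball z 1) :=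
    integrableOn_const measure_ball_lt_top.ne
  have iρ : IntegrableOn (fun ξ : ℂ => ‖ξ - z‖⁻¹) (ball z 1) := integrableOn_inv_norm_sub z z 1
  have iG : IntegrableOn G (ball z 1) := ((ic.fun_add iψ).fun_add iρ).const_mul _
  have hG0 : ∀ ξ, 0 ≤ G ξ := fun ξ => by positivity
  have sG : ∫ ξ in ball z 1, G ξ ≤ C4 * (2 * volume.real (ball (0 : ℂ) 1) + 2 * C1 + C5) * ε ^ 2 := by
    rw [hG, integral_const_mul, integral_add (ic.fun_add iψ) iρ, integral_add ic iψ,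
      setIntegral_const, integral_const_mul, smul_eq_mul]
    have hv : volume.real (ball z 1) = volume.real (ball (0 : ℂ) 1) := by
      rw [Measure.real, Measure.real, Measure.addHaar_ball_center]
    rw [hv]
    have s1 : ∫ ζ in ball z 1, ψ ζ ^ 2 ≤ C1 * ε ^ 4 :=
      le_trans (setIntegral_mono_set h.memLp_psi.integrable_sq.integrableOn
        (Eventually.of_forall fun ζ => by positivity)
        (ball_subset_ball (by norm_num : (1:ℝ) ≤ 10)).eventuallyLE) (hE1 Z R ε V ψ g h z).2
    have s2 : C1 * ε ^ 4 ≤ C1 := mul_le_of_le_one_right hC1.le (pow_le_one₀ hε.le hε1)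
    have s3 := hE5 z z
    calc _ ≤ C4 * ε ^ 2 * (volume.real (ball (0 : ℂ) 1) * 2 + 2 * C1 + C5) := by
          gcongr
          exact s1.trans s2
      _ = _ := by ring
  set E : Set ℂ := ball z 1 \ ball z (d / 2) with hE
  have mE : MeasurableSet E := measurableSet_ball.diff measurableSet_ball
  have key : ∀ ξ, ξ ≠ z → ENNReal.ofReal ‖f ξ‖ *
      ∫⁻ ζ in ball z (d / 2), ENNReal.ofReal (‖ζ - z‖⁻¹ * ‖ζ - ξ‖⁻¹) ≤
      (ball z 1).indicator (fun ξ => ENNReal.ofReal (G ξ)) ξ +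
      E.indicator (fun ξ => ENNReal.ofReal (2 * C4 * C3) * ENNReal.ofReal (‖g ξ‖ * ‖ξ - z‖⁻¹)) ξ := by
    intro ξ hξ
    have hρ : 0 < ‖ξ - z‖ := norm_pos_iff.2 (sub_ne_zero.2 hξ)
    by_cases hb : ξ ∈ ball z d
    · have hb1 : ξ ∈ ball z 1 := ball_subset_ball (by linarith) hb
      have hρd : ‖ξ - z‖ < d := by rwa [mem_ball, dist_eq_norm] at hb
      set ρ := ‖ξ - z‖ with hρdef
      have hs : √(d / ρ) ≤ √ρ⁻¹ := Real.sqrt_le_sqrt (by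
        rw [div_eq_mul_inv]
        exact mul_le_of_le_one_left (by positivity) (by linarith))
      have hHn : ‖H ξ‖ ≤ ε ^ 2 * (1 + |ψ ξ|) := by
        rw [hH]
        simp only [norm_real, Real.norm_eq_abs]
        rw [abs_mul]
        gcongr
        · exact h.potential.bound ξ
        · exact (abs_add_le _ _).trans (by simp)
      have hA : ‖H ξ‖ * (C4 * √(d / ρ)) ≤ G ξ := by
        calc ‖H ξ‖ * (C4 * √(d / ρ)) ≤ (ε ^ 2 * (1 + |ψ ξ|)) * (C4 * √ρ⁻¹) := by gcongr
          _ = C4 * ε ^ 2 * ((1 + |ψ ξ|) * √ρ⁻¹) := by ring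
          _ ≤ G ξ := by
            rw [hG]
            simp only
            gcongr
            have h1 : √ρ⁻¹ ^ 2 = ρ⁻¹ := Real.sq_sqrt (by positivity)
            rw [← sq_abs (ψ ξ)]
            nlinarith [h1, sq_nonneg (1 + |ψ ξ| - √ρ⁻¹), sq_nonneg (1 - |ψ ξ|), sq_nonneg (√ρ⁻¹),
              sq_nonneg (1 + |ψ ξ|)]
      have hχH : ‖(χ ξ : ℂ) * H ξ‖ ≤ ‖H ξ‖ := by
        rw [norm_mul, norm_real, Real.norm_eq_abs]
        exact mul_le_of_le_one_left (norm_nonneg _) (hχ1 ξ)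
      rw [indicator_of_mem hb1]
      refine (mul_le_mul' le_rfl (hE4 z ξ d hρ hρd)).trans ?_
      rw [← ENNReal.ofReal_mul (norm_nonneg _)]
      by_cases hi : ξ ∈ ball z (d / 2)
      · rw [indicator_of_notMem (fun h1 => h1.2 hi), add_zero]
        refine ENNReal.ofReal_le_ofReal (le_trans ?_ hA)
        gcongr
        rw [hf]
        simp only [hgrin ξ hi, mul_zero, add_zero]
        exact hχH
      · rw [indicator_of_mem (show ξ ∈ E from ⟨hb1, hi⟩), ← ENNReal.ofReal_mul (by positivity),
          ← ENNReal.ofReal_add (hG0 ξ) (by positivity)]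
        refine ENNReal.ofReal_le_ofReal ?_
        have hρ2 : d / 2 ≤ ρ := by
          rw [mem_ball, not_lt, dist_eq_norm] at hi
          exact hi
        have hs2 : √(d / ρ) ≤ 2 := by
          rw [Real.sqrt_le_left (by norm_num), div_le_iff₀ hρ]
          linarith
        have hfn : ‖f ξ‖ ≤ ‖H ξ‖ + ‖g ξ‖ * (C3 / ρ) := by
          refine (norm_add_le _ _).trans (add_le_add hχH ?_)
          rw [norm_mul, RCLike.norm_conj]
          gcongr
          refine (hgr ξ).trans ?_
          gcongr
        calc ‖f ξ‖ * (C4 * √(d / ρ)) ≤ (‖H ξ‖ + ‖g ξ‖ * (C3 / ρ)) * (C4 * √(d / ρ)) := by gcongr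
          _ = ‖H ξ‖ * (C4 * √(d / ρ)) + ‖g ξ‖ * (C3 / ρ) * (C4 * √(d / ρ)) := by ring
          _ ≤ G ξ + ‖g ξ‖ * (C3 / ρ) * (C4 * 2) := by gcongr
          _ = _ := by rw [div_eq_mul_inv]; ring
    · have : f ξ = 0 := by
        rw [hf]
        simp [hχout ξ hb, hgrout ξ hb]
      rw [this]
      simp
  calc _ ≤ ∫⁻ ξ, ((ball z 1).indicator (fun ξ => ENNReal.ofReal (G ξ)) ξ +
      E.indicator (fun ξ => ENNReal.ofReal (2 * C4 * C3) * ENNReal.ofReal (‖g ξ‖ * ‖ξ - z‖⁻¹)) ξ) := by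
        refine lintegral_mono_ae ?_
        filter_upwards [Measure.ae_ne volume z] with ξ hξ using key ξ hξ
    _ = (∫⁻ ξ in ball z 1, ENNReal.ofReal (G ξ)) + ∫⁻ ξ in E, ENNReal.ofReal (2 * C4 * C3) *
        ENNReal.ofReal (‖g ξ‖ * ‖ξ - z‖⁻¹) := by
        rw [lintegral_add_left', lintegral_indicator measurableSet_ball, lintegral_indicator mE]
        exact (aemeasurable_indicator_iff measurableSet_ball).2 iG.aemeasurable.ennreal_ofReal
    _ ≤ ENNReal.ofReal (C4 * (2 * volume.real (ball (0 : ℂ) 1) + 2 * C1 + C5) * ε ^ 2) +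
        ENNReal.ofReal (2 * C4 * C3) * ENNReal.ofReal (C2 * ε ^ 2) := by
        rw [← ofReal_integral_eq_lintegral_ofReal iG (Eventually.of_forall hG0),
          lintegral_const_mul' _ _ ENNReal.ofReal_ne_top]
        gcongr
        exact hE2 Z R ε V ψ g h z
    _ = _ := by
        rw [← ENNReal.ofReal_mul (by positivity), ← ENNReal.ofReal_add (by positivity) (by positivity)]
        congr 1
        ring

/-- The gradient of the corrector has uniformly small singular integrals over unit discs. -/
theorem exists_lintegral_grad_le : ∃ C > 0, ∀ (Z : Set ℂ) (R ε : ℝ) (V ψ : ℂ → ℝ) (g : ℂ → ℂ),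
    Corrector Z R ε V ψ g → ∀ z, ∫⁻ ζ in ball z 1,
      ENNReal.ofReal (‖g ζ‖ * ‖ζ - z‖⁻¹) ≤ ENNReal.ofReal (C * ε ^ 2) := by
  obtain ⟨C1, hC1, h1⟩ := exists_lintegral_inner_le
  obtain ⟨C2, hC2, h2⟩ := exists_lintegral_outer_le
  refine ⟨C1 + C2, by positivity, fun Z R ε V ψ g h z => ?_⟩
  rw [add_mul, ENNReal.ofReal_add (by positivity) (by positivity)]
  have hs : ball z (1 : ℝ) ⊆ ball z (min (infDist z Z) (1 / 8) / 2) ∪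
      (ball z 1 \ ball z (min (infDist z Z) (1 / 8) / 2)) := by
    rw [union_sdiff_self]
    exact subset_union_right
  exact (lintegral_mono_set hs).trans ((lintegral_union_le _ _ _).trans
    (add_le_add (h1 Z R ε V ψ g h z) (h2 Z R ε V ψ g h z)))

theorem ae_of_forall_ball {p : ℂ → Prop} {r : ℝ} (hr : 0 < r)
    (h : ∀ z, ∀ᵐ ζ, ζ ∈ ball z r → p ζ) : ∀ᵐ ζ, p ζ := by
  have h1 : ∀ᵐ ζ, ∀ n : ℕ, ζ ∈ ball (TopologicalSpace.denseSeq ℂ n) r → p ζ :=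
    ae_all_iff.2 fun n => h _
  filter_upwards [h1] with ζ hζ
  obtain ⟨n, hn⟩ := (TopologicalSpace.denseRange_denseSeq ℂ).exists_dist_lt ζ hr
  exact hζ n hn

theorem integrableOn_ball_of_memLp {f : ℂ → ℝ} (hf : MemLp f 2) (z : ℂ) (r : ℝ) :
    IntegrableOn f (ball z r) := by
  have : IsFiniteMeasure (volume.restrict (ball z r)) :=
    ⟨by rw [Measure.restrict_apply_univ]; exact measure_ball_lt_top⟩
  exact memLp_one_iff_integrable.1 ((hf.restrict _).mono_exponent (by norm_num))

namespace Corrector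
variable {Z : Set ℂ} {R ε : ℝ} {V ψ : ℂ → ℝ} {g : ℂ → ℂ}

theorem integrableOn_grad (h : Corrector Z R ε V ψ g) (z : ℂ) (r : ℝ) :
    IntegrableOn (fun ζ => ‖g ζ‖) (ball z r) :=
  integrableOn_ball_of_memLp h.memLp_grad.norm z r

end Corrector

theorem exists_setIntegral_grad_le : ∃ C > 0, ∀ (Z : Set ℂ) (R ε : ℝ) (V ψ : ℂ → ℝ) (g : ℂ → ℂ),
    Corrector Z R ε V ψ g → ∀ z, ∫ ζ in ball z 10, ‖g ζ‖ ≤ C * ε ^ 2 ∧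
      ∫ ζ in ball z 10, |ψ ζ| ≤ C * ε ^ 2 := by
  obtain ⟨C1, hC1, hE1⟩ := exists_local_energy_le
  refine ⟨C1 + volume.real (ball (0 : ℂ) 10), by positivity, fun Z R ε V ψ g h z => ?_⟩
  have hε := h.pos
  have hv : volume.real (ball z 10) = volume.real (ball (0 : ℂ) 10) := by
    rw [Measure.real, Measure.real, Measure.addHaar_ball_center]
  have key : ∀ f : ℂ → ℝ, (∀ ζ, 0 ≤ f ζ) → Integrable (fun ζ => f ζ ^ 2) →
      IntegrableOn f (ball z 10) → ∫ ζ in ball z 10, f ζ ^ 2 ≤ C1 * ε ^ 4 →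
      ∫ ζ in ball z 10, f ζ ≤ (C1 + volume.real (ball (0 : ℂ) 10)) * ε ^ 2 := by
    intro f hf hi hi1 hb
    have i1 : IntegrableOn (fun ζ => (ε ^ 2)⁻¹ * f ζ ^ 2) (ball z 10) :=
      (hi.const_mul _).integrableOn
    have i2 : IntegrableOn (fun _ : ℂ => ε ^ 2) (ball z 10) :=
      integrableOn_const measure_ball_lt_top.ne
    calc ∫ ζ in ball z 10, f ζ ≤ ∫ ζ in ball z 10, ((ε ^ 2)⁻¹ * f ζ ^ 2 + ε ^ 2) := by
          refine integral_mono hi1 (i1.fun_add i2) fun ζ => ?_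
          have e : (ε ^ 2)⁻¹ * f ζ ^ 2 = (f ζ / ε) ^ 2 := by field_simp
          have e2 : f ζ = f ζ / ε * ε := by field_simp
          simp only
          rw [e]
          nlinarith [sq_nonneg (f ζ / ε - ε), sq_nonneg (f ζ / ε), sq_nonneg ε]
      _ = (ε ^ 2)⁻¹ * (∫ ζ in ball z 10, f ζ ^ 2) + volume.real (ball (0 : ℂ) 10) * ε ^ 2 := by
          rw [integral_add i1 i2, integral_const_mul, setIntegral_const, hv, smul_eq_mul]
      _ ≤ (ε ^ 2)⁻¹ * (C1 * ε ^ 4) + volume.real (ball (0 : ℂ) 10) * ε ^ 2 := by gcongr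
      _ = _ := by field_simp
  refine ⟨key _ (fun ζ => norm_nonneg _) h.memLp_grad.norm.integrable_sq
    (h.integrableOn_grad z 10) (hE1 Z R ε V ψ g h z).1, key _ (fun ζ => abs_nonneg _) ?_ ?_ ?_⟩
  · simp only [sq_abs]
    exact h.memLp_psi.integrable_sq
  · exact integrableOn_ball_of_memLp h.memLp_psi.norm z 10
  · simp only [sq_abs]
    exact (hE1 Z R ε V ψ g h z).2

theorem exists_psi_le : ∃ C > 0, ∀ (Z : Set ℂ) (R ε : ℝ) (V ψ : ℂ → ℝ) (g : ℂ → ℂ),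
    Corrector Z R ε V ψ g → ∀ᵐ z, |ψ z| ≤ C * ε ^ 2 := by
  obtain ⟨C1, hC1, hE1⟩ := exists_setIntegral_grad_le
  obtain ⟨C2, hC2, hE2⟩ := exists_lintegral_grad_le
  obtain ⟨C3, hC3, hE3⟩ := exists_scaled_cutoff
  refine ⟨C2 + 4 * C3 * C1 + C1, by positivity, fun Z R ε V ψ g h => ?_⟩
  have hε := h.pos
  refine ae_of_forall_ball (r := 1 / 4) (by norm_num) fun z => ?_
  obtain ⟨χ, hχ, hχ1, hχin, hχout, hgr, hgrin, hgrout⟩ := hE3 z 1 one_pos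
  have hχ1' : ContDiff ℝ 1 χ := hχ.of_le (by norm_num)
  have e1 := cutoff_ae_eq_cT (S := ∅) (h.memLp_psi.ofReal.locallyIntegrable (by norm_num))
    (h.memLp_grad.locallyIntegrable (by norm_num))
    (fun ζ hζ hc _ => h.sol.h10.integral_mul_db (hζ.of_le (by norm_num)) hc)
    (contDiff_ofReal_comp hχ) (by simp)
    (isCompact_closedBall z 1) (fun q hq => by
      simp [hχout q fun hb => hq (ball_subset_closedBall hb)])
  have hdb : ∀ ζ, db (fun w => (χ w : ℂ)) ζ = gr χ ζ := fun ζ =>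
    db_ofReal (hχ.differentiable two_ne_zero ζ)
  simp only [hdb] at e1
  filter_upwards [e1] with ζ h1 hζ
  have hζ' : dist ζ z < 1 / 4 := hζ
  rw [hχin ζ (ball_subset_ball (by norm_num) hζ), ofReal_one, one_mul] at h1
  have h2 : |ψ ζ| = ‖(RCLike.ofReal (ψ ζ) : ℂ)‖ := by simp
  rw [h2, h1, ← ENNReal.ofReal_le_ofReal_iff (by positivity)]
  refine (ofReal_norm_cT_le _ ζ).trans ?_
  have i1 : AEMeasurable ((ball ζ 1).indicator fun ξ => ENNReal.ofReal (‖g ξ‖ * ‖ξ - ζ‖⁻¹)) := by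
    have a1 : AEMeasurable (fun ξ => ‖g ξ‖) := h.memLp_grad.aestronglyMeasurable.norm.aemeasurable
    have a2 : Measurable (fun ξ : ℂ => ‖ξ - ζ‖⁻¹) :=
      (by fun_prop : Measurable (fun p : ℂ => ‖p - ζ‖)).inv
    exact (a1.mul a2.aemeasurable).ennreal_ofReal.indicator measurableSet_ball
  have i2 : IntegrableOn (fun ξ => 4 * C3 * |ψ ξ|) (ball z 10) :=
    (integrableOn_ball_of_memLp h.memLp_psi.norm z 10).const_mul _
  have i3 := h.integrableOn_grad z 10
  have key : ∀ ξ, ENNReal.ofReal (‖(χ ξ : ℂ) * g ξ + (RCLike.ofReal (ψ ξ) : ℂ) * gr χ ξ‖ * ‖ζ - ξ‖⁻¹) ≤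
      (ball ζ 1).indicator (fun ξ => ENNReal.ofReal (‖g ξ‖ * ‖ξ - ζ‖⁻¹)) ξ +
      (ball z 10).indicator (fun ξ => ENNReal.ofReal (4 * C3 * |ψ ξ| + ‖g ξ‖)) ξ := by
    intro ξ
    by_cases hb : ξ ∈ ball z 1
    · have hb' : ξ ∈ ball z 10 := ball_subset_ball (by norm_num) hb
      have hA : ‖(RCLike.ofReal (ψ ξ) : ℂ) * gr χ ξ‖ * ‖ζ - ξ‖⁻¹ ≤ 4 * C3 * |ψ ξ| := by
        by_cases hi : ξ ∈ ball z (1 / 2)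
        · rw [hgrin ξ hi]
          simp only [mul_zero, norm_zero, zero_mul]
          positivity
        · rw [mem_ball, not_lt] at hi
          have h3 : 1 / 4 ≤ ‖ζ - ξ‖ := by
            rw [← dist_eq_norm]
            have := dist_triangle_left ξ z ζ
            linarith
          have h4 : ‖ζ - ξ‖⁻¹ ≤ 4 := by
            rw [inv_le_comm₀ (by linarith) (by norm_num)]
            linarith
          have h5 := hgr ξ
          rw [div_one] at h5
          rw [norm_mul]
          simp only [Complex.coe_algebraMap, norm_real, Real.norm_eq_abs]
          calc |ψ ξ| * ‖gr χ ξ‖ * ‖ζ - ξ‖⁻¹ ≤ |ψ ξ| * C3 * 4 := by gcongr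
            _ = _ := by ring
      have hB : ‖(χ ξ : ℂ) * g ξ‖ ≤ ‖g ξ‖ := by
        rw [norm_mul, norm_real, Real.norm_eq_abs]
        exact mul_le_of_le_one_left (norm_nonneg _) (hχ1 ξ)
      have hC : ‖(χ ξ : ℂ) * g ξ + (RCLike.ofReal (ψ ξ) : ℂ) * gr χ ξ‖ * ‖ζ - ξ‖⁻¹ ≤
          ‖g ξ‖ * ‖ζ - ξ‖⁻¹ + 4 * C3 * |ψ ξ| := by
        calc _ ≤ (‖(χ ξ : ℂ) * g ξ‖ + ‖(RCLike.ofReal (ψ ξ) : ℂ) * gr χ ξ‖) * ‖ζ - ξ‖⁻¹ := by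
              gcongr
              exact norm_add_le _ _
          _ = ‖(χ ξ : ℂ) * g ξ‖ * ‖ζ - ξ‖⁻¹ + ‖(RCLike.ofReal (ψ ξ) : ℂ) * gr χ ξ‖ * ‖ζ - ξ‖⁻¹ :=
              add_mul _ _ _
          _ ≤ _ := by gcongr
      rw [indicator_of_mem hb']
      by_cases hζb : ξ ∈ ball ζ 1
      · rw [indicator_of_mem hζb, ← ENNReal.ofReal_add (by positivity) (by positivity)]
        refine ENNReal.ofReal_le_ofReal (hC.trans ?_)
        rw [norm_sub_rev ζ ξ]
        linarith [norm_nonneg (g ξ)]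
      · rw [indicator_of_notMem hζb, zero_add]
        refine ENNReal.ofReal_le_ofReal (hC.trans ?_)
        rw [mem_ball, not_lt, dist_eq_norm, norm_sub_rev] at hζb
        have := mul_le_of_le_one_right (norm_nonneg (g ξ)) (inv_le_one_of_one_le₀ hζb)
        linarith
    · rw [hχout ξ hb, hgrout ξ hb]
      simp
  refine (lintegral_mono key).trans ?_
  rw [lintegral_add_left' i1, lintegral_indicator measurableSet_ball,
    lintegral_indicator measurableSet_ball,
    ← ofReal_integral_eq_lintegral_ofReal (i2.fun_add i3)
      (Eventually.of_forall fun ξ => by positivity), integral_add i2 i3, integral_const_mul]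
  have e : (C2 + 4 * C3 * C1 + C1) * ε ^ 2 = C2 * ε ^ 2 + (4 * C3 * (C1 * ε ^ 2) + C1 * ε ^ 2) := by
    ring
  obtain ⟨b1, b2⟩ := hE1 Z R ε V ψ g h z
  have b3 : 4 * C3 * (∫ ξ in ball z 10, |ψ ξ|) + ∫ ξ in ball z 10, ‖g ξ‖ ≤
      4 * C3 * (C1 * ε ^ 2) + C1 * ε ^ 2 := by gcongr
  refine (add_le_add (hE2 Z R ε V ψ g h ζ) (ENNReal.ofReal_le_ofReal b3)).trans_eq ?_
  rw [e, ← ENNReal.ofReal_add (by positivity) (by positivity)]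

/-- The conjugate of `(1 + ψ) ∇u - u g`. -/
noncomputable def nodalField (u ψ : ℂ → ℝ) (g : ℂ → ℂ) (z : ℂ) : ℂ :=
  (1 + (ψ z : ℂ)) * (starRingEnd ℂ) (gr u z) - (u z : ℂ) * (starRingEnd ℂ) (g z)

noncomputable def nodalSource (u : ℂ → ℝ) (g : ℂ → ℂ) (z : ℂ) : ℂ :=
  g z * (starRingEnd ℂ) (gr u z) - (starRingEnd ℂ) (g z) * gr u z

theorem norm_nodalSource_le {u ψ : ℂ → ℝ} {g : ℂ → ℂ} {z : ℂ} (h : |ψ z| ≤ 1 / 2) :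
    ‖nodalSource u g z‖ ≤ 4 * ‖g z‖ * ‖nodalField u ψ g z‖ := by
  have h1 : ((1 + ψ z : ℝ) : ℂ) * nodalSource u g z = g z * nodalField u ψ g z -
      (starRingEnd ℂ) (g z * nodalField u ψ g z) := by
    simp only [nodalSource, nodalField, map_mul, map_sub, map_add, map_one, conj_conj, conj_ofReal]
    push_cast
    ring
  have h2 : ‖((1 + ψ z : ℝ) : ℂ) * nodalSource u g z‖ ≤ 2 * ‖g z‖ * ‖nodalField u ψ g z‖ := by
    rw [h1]
    refine (norm_sub_le _ _).trans_eq ?_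
    rw [RCLike.norm_conj, norm_mul]
    ring
  rw [norm_mul, norm_real, Real.norm_eq_abs] at h2
  have h3 : 1 / 2 ≤ |1 + ψ z| := by
    have := neg_abs_le (ψ z)
    exact le_trans (by linarith) (le_abs_self _)
  nlinarith [norm_nonneg (nodalSource u g z)]

namespace Corrector
variable {Z P : Set ℂ} {R ε : ℝ} {V ψ u : ℂ → ℝ} {g : ℂ → ℂ}

theorem locallyIntegrable_mul_grad (h : Corrector Z R ε V ψ g) {f : ℂ → ℂ} (hf : Continuous f) :
    LocallyIntegrable fun z => f z * g z := by
  have h1 := h.memLp_grad.locallyIntegrable (μ := volume) (by norm_num)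
  rw [← locallyIntegrableOn_univ] at h1 ⊢
  exact h1.continuousOn_mul hf.continuousOn isOpen_univ.isLocallyClosed

theorem locallyIntegrable_mul_conj_grad (h : Corrector Z R ε V ψ g) {f : ℂ → ℂ}
    (hf : Continuous f) : LocallyIntegrable fun z => f z * (starRingEnd ℂ) (g z) := by
  have h1 := (memLp_conj h.memLp_grad).locallyIntegrable (μ := volume) (by norm_num)
  rw [← locallyIntegrableOn_univ] at h1 ⊢
  exact h1.continuousOn_mul hf.continuousOn isOpen_univ.isLocallyClosed

theorem locallyIntegrable_mul_psi (h : Corrector Z R ε V ψ g) {f : ℂ → ℂ} (hf : Continuous f) :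
    LocallyIntegrable fun z => f z * (ψ z : ℂ) := by
  have h1 : LocallyIntegrable fun z => (ψ z : ℂ) :=
    h.memLp_psi.ofReal.locallyIntegrable (μ := volume) (by norm_num)
  rw [← locallyIntegrableOn_univ] at h1 ⊢
  exact h1.continuousOn_mul hf.continuousOn isOpen_univ.isLocallyClosed

theorem locallyIntegrable_nodalField (h : Corrector Z R ε V ψ g) (hu : ContDiff ℝ 2 u) :
    LocallyIntegrable (nodalField u ψ g) := by
  have hc : Continuous fun z => (starRingEnd ℂ) (gr u z) :=
    continuous_conj.comp (continuous_gr (hu.of_le (by norm_num)))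
  have hcu : Continuous fun z => (u z : ℂ) := continuous_ofReal.comp hu.continuous
  refine ((hc.locallyIntegrable.add (h.locallyIntegrable_mul_psi hc)).sub
    (h.locallyIntegrable_mul_conj_grad hcu)).congr (Eventually.of_forall fun z => ?_)
  simp only [nodalField, Pi.add_apply, Pi.sub_apply]
  ring

theorem locallyIntegrable_nodalSource (h : Corrector Z R ε V ψ g) (hu : ContDiff ℝ 2 u) :
    LocallyIntegrable (nodalSource u g) := by
  have hg := continuous_gr (hu.of_le (by norm_num) : ContDiff ℝ 1 u)
  have hc : Continuous fun z => (starRingEnd ℂ) (gr u z) := continuous_conj.comp hg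
  refine ((h.locallyIntegrable_mul_grad hc).sub
    (h.locallyIntegrable_mul_conj_grad hg)).congr (Eventually.of_forall fun z => ?_)
  simp only [nodalSource, Pi.sub_apply]
  ring

theorem integral_nodalField_mul_db (h : Corrector Z R ε V ψ g) (hu : ContDiff ℝ 2 u)
    (hZP : ∀ z ∈ Z, u z = 0 ∨ z ∈ P) (hV : ∀ z ∉ P, V z * u z = planeLaplacian u z)
    {η : ℂ → ℂ} (hη : ContDiff ℝ 2 η) (hc : HasCompactSupport η) (hP : ∀ z ∈ P, η z = 0) :
    ∫ z, nodalField u ψ g z * db η z = -∫ z, nodalSource u g z * η z := by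
  have hη1 : ContDiff ℝ 1 η := hη.of_le (by norm_num)
  have hu1 : ContDiff ℝ 1 u := hu.of_le (by norm_num)
  have hgr := continuous_gr hu1
  have hcg : ContDiff ℝ 1 fun z => (starRingEnd ℂ) (gr u z) :=
    conjCLE.contDiff.comp (contDiff_gr hu)
  have huc : ContDiff ℝ 2 fun z => (u z : ℂ) := contDiff_ofReal_comp hu
  have hΔ : Continuous fun z => (planeLaplacian u z : ℂ) :=
    continuous_ofReal.comp (continuous_planeLaplacian hu)
  have hdc : HasCompactSupport (db η) := hasCompactSupport_db hc
  have cdb := continuous_db hη1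
  have e1 := integral_mul_db hcg hη1 hc
  have e2 := h.sol.h10.integral_mul_db (hcg.mul hη1) hc.mul_left
  have e3 := h.sol.complex_weak h.thick h.potential (huc.mul hη) fun z hz => by
    rcases hZP z hz with h1 | h1
    · simp [h1]
    · simp [hP z h1]
  have d1 : ∀ z, db (fun w => (starRingEnd ℂ) (gr u w) * η w) z =
      (planeLaplacian u z : ℂ) * η z + (starRingEnd ℂ) (gr u z) * db η z := fun z => by
    rw [db_mul (hcg.differentiable one_ne_zero z) (hη.differentiable two_ne_zero z), db_conj_gr hu]
  have d2 : ∀ z, db (fun w => (u w : ℂ) * η w) z = gr u z * η z + (u z : ℂ) * db η z := fun z => by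
    rw [db_mul (huc.differentiable two_ne_zero z) (hη.differentiable two_ne_zero z),
      db_ofReal (hu.differentiable two_ne_zero z)]
  simp only [db_conj_gr hu] at e1
  simp only [d1] at e2
  simp only [d2] at e3
  have hV' : ∀ z, ((V z * (1 + ψ z) : ℝ) : ℂ) * ((u z : ℂ) * η z) =
      (planeLaplacian u z : ℂ) * η z + (planeLaplacian u z : ℂ) * (ψ z : ℂ) * η z := fun z => by
    by_cases hz : z ∈ P
    · simp [hP z hz]
    · rw [← hV z hz]
      push_cast
      ring
  simp only [hV'] at e3
  have I := @integrable_mul_of_locallyIntegrable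
  have i1 : Integrable fun z => (starRingEnd ℂ) (gr u z) * db η z :=
    I hcg.continuous.locallyIntegrable cdb hdc
  have i2 : Integrable fun z => (planeLaplacian u z : ℂ) * η z :=
    I hΔ.locallyIntegrable hη.continuous hc
  have i3 : Integrable fun z => (planeLaplacian u z : ℂ) * (ψ z : ℂ) * η z :=
    I (h.locallyIntegrable_mul_psi hΔ) hη.continuous hc
  have i4 : Integrable fun z => (starRingEnd ℂ) (gr u z) * (ψ z : ℂ) * db η z :=
    I (h.locallyIntegrable_mul_psi hcg.continuous) cdb hdc
  have i5 : Integrable fun z => (u z : ℂ) * (starRingEnd ℂ) (g z) * db η z :=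
    I (h.locallyIntegrable_mul_conj_grad huc.continuous) cdb hdc
  have i6 : Integrable fun z => gr u z * (starRingEnd ℂ) (g z) * η z :=
    I (h.locallyIntegrable_mul_conj_grad hgr) hη.continuous hc
  have i7 : Integrable fun z => (starRingEnd ℂ) (gr u z) * g z * η z :=
    I (h.locallyIntegrable_mul_grad hcg.continuous) hη.continuous hc
  have a2 : ∫ z, (ψ z : ℂ) * ((planeLaplacian u z : ℂ) * η z +
      (starRingEnd ℂ) (gr u z) * db η z) =
      (∫ z, (planeLaplacian u z : ℂ) * (ψ z : ℂ) * η z) +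
      ∫ z, (starRingEnd ℂ) (gr u z) * (ψ z : ℂ) * db η z := by
    rw [← integral_add i3 i4]
    congr 1
    ext z
    ring
  have a3 : ∫ z, (starRingEnd ℂ) (g z) * (gr u z * η z + (u z : ℂ) * db η z) =
      (∫ z, gr u z * (starRingEnd ℂ) (g z) * η z) +
      ∫ z, (u z : ℂ) * (starRingEnd ℂ) (g z) * db η z := by
    rw [← integral_add i6 i5]
    congr 1
    ext z
    ring
  have a2' : ∫ z, g z * ((starRingEnd ℂ) (gr u z) * η z) =
      ∫ z, (starRingEnd ℂ) (gr u z) * g z * η z := by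
    congr 1
    ext z
    ring
  have b1 : ∫ z, nodalField u ψ g z * db η z = (∫ z, (starRingEnd ℂ) (gr u z) * db η z) +
      (∫ z, (starRingEnd ℂ) (gr u z) * (ψ z : ℂ) * db η z) -
      ∫ z, (u z : ℂ) * (starRingEnd ℂ) (g z) * db η z := by
    rw [← integral_add i1 i4, ← integral_sub (i1.fun_add i4) i5]
    congr 1
    ext z
    rw [nodalField]
    ring
  have b2 : ∫ z, nodalSource u g z * η z = (∫ z, (starRingEnd ℂ) (gr u z) * g z * η z) -
      ∫ z, gr u z * (starRingEnd ℂ) (g z) * η z := by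
    rw [← integral_sub i7 i6]
    congr 1
    ext z
    rw [nodalSource]
    ring
  rw [integral_add i2 i3, a3] at e3
  rw [a2, a2'] at e2
  rw [b1, b2]
  linear_combination e1 + e2 - e3

end Corrector

theorem lintegral_radial {F : ℝ → ENNReal} (hF : Measurable F) (q : ℂ) :
    ∫⁻ ζ, F ‖ζ - q‖ = ENNReal.ofReal (2 * Real.pi) * ∫⁻ r in Ioi (0 : ℝ), ENNReal.ofReal r * F r := by
  rw [lintegral_polar (fun ζ => F ‖ζ - q‖) (hF.comp (by fun_prop)) q, ← lintegral_const_mul' _ _ ENNReal.ofReal_ne_top]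
  refine setLIntegral_congr_fun measurableSet_Ioi fun r hr => ?_
  have e : ∀ t : ℝ, ‖q + r * exp (t * I) - q‖ = r := fun t => by
    rw [add_sub_cancel_left, norm_mul, norm_exp_ofReal_mul_I, mul_one, norm_real,
      Real.norm_of_nonneg (mem_Ioi.1 hr).le]
  simp only [e]
  rw [setLIntegral_const, Real.volume_Ioo]
  rw [mul_comm]
  congr 2
  ring

theorem lintegral_inv_ball (z : ℂ) (ρ : ℝ) :
    ∫⁻ ζ in ball z ρ, ENNReal.ofReal ‖ζ - z‖⁻¹ = ENNReal.ofReal (2 * Real.pi * ρ) := by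
  have e : ∀ ζ, (ball z ρ).indicator (fun ζ => ENNReal.ofReal ‖ζ - z‖⁻¹) ζ =
      (Iio ρ).indicator (fun r : ℝ => ENNReal.ofReal r⁻¹) ‖ζ - z‖ := fun ζ => by
    simp [indicator, mem_ball, dist_eq_norm]
  rw [← lintegral_indicator measurableSet_ball, lintegral_congr e,
    lintegral_radial ((by fun_prop : Measurable fun r : ℝ => ENNReal.ofReal r⁻¹).indicator
      measurableSet_Iio), ENNReal.ofReal_mul (p := 2 * Real.pi) (by positivity)]
  congr 1
  have e2 : ∫⁻ r in Ioi (0 : ℝ), ENNReal.ofReal r * (Iio ρ).indicator (fun r : ℝ => ENNReal.ofReal r⁻¹) r =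
      ∫⁻ r in Ioi (0 : ℝ), (Iio ρ).indicator 1 r := by
    refine setLIntegral_congr_fun measurableSet_Ioi fun r hr => ?_
    simp only [mem_Ioi] at hr
    by_cases h : r ∈ Iio ρ
    · simp only [indicator_of_mem h, Pi.one_apply]
      rw [← ENNReal.ofReal_mul hr.le, mul_inv_cancel₀ hr.ne', ENNReal.ofReal_one]
    · simp only [indicator_of_notMem h, mul_zero]
  rw [e2, lintegral_indicator_one measurableSet_Iio, Measure.restrict_apply measurableSet_Iio,
    inter_comm, Ioi_inter_Iio, Real.volume_Ioo, sub_zero]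

theorem lintegral_inv_sq_annulus (z : ℂ) {ρ : ℝ} (hρ : 1 ≤ ρ) :
    ∫⁻ ζ in ball z ρ \ ball z 1, ENNReal.ofReal (‖ζ - z‖⁻¹ ^ 2) =
      ENNReal.ofReal (2 * Real.pi * Real.log ρ) := by
  have e : ∀ ζ, (ball z ρ \ ball z 1).indicator (fun ζ => ENNReal.ofReal (‖ζ - z‖⁻¹ ^ 2)) ζ =
      (Ico 1 ρ).indicator (fun r : ℝ => ENNReal.ofReal (r⁻¹ ^ 2)) ‖ζ - z‖ := fun ζ => by
    simp [indicator, mem_ball, dist_eq_norm, and_comm]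
  rw [← lintegral_indicator (measurableSet_ball.diff measurableSet_ball), lintegral_congr e,
    lintegral_radial ((by fun_prop : Measurable fun r : ℝ => ENNReal.ofReal (r⁻¹ ^ 2)).indicator
      measurableSet_Ico), ENNReal.ofReal_mul (p := 2 * Real.pi) (by positivity)]
  congr 1
  have e2 : ∫⁻ r in Ioi (0 : ℝ), ENNReal.ofReal r *
      (Ico 1 ρ).indicator (fun r : ℝ => ENNReal.ofReal (r⁻¹ ^ 2)) r =
      ∫⁻ r in Ioi (0 : ℝ), (Ico 1 ρ).indicator (fun r : ℝ => ENNReal.ofReal r⁻¹) r := by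
    refine setLIntegral_congr_fun measurableSet_Ioi fun r hr => ?_
    simp only [mem_Ioi] at hr
    by_cases h : r ∈ Ico 1 ρ
    · simp only [indicator_of_mem h]
      rw [← ENNReal.ofReal_mul hr.le]
      congr 1
      field_simp
    · simp only [indicator_of_notMem h, mul_zero]
  have hs : Ico 1 ρ ∩ Ioi (0 : ℝ) = Ico 1 ρ := inter_eq_left.2 fun r hr => one_pos.trans_le hr.1
  rw [e2, lintegral_indicator measurableSet_Ico, Measure.restrict_restrict measurableSet_Ico, hs,
    restrict_Ico_eq_restrict_Ioc]
  have hi : IntervalIntegrable (fun x : ℝ => x⁻¹) volume 1 ρ := by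
    refine intervalIntegral.intervalIntegrable_inv (fun x hx => ?_) continuousOn_id
    rw [uIcc_of_le hρ] at hx
    exact (one_pos.trans_le hx.1).ne'
  rw [← ofReal_integral_eq_lintegral_ofReal
    ((intervalIntegrable_iff_integrableOn_Ioc_of_le hρ).1 hi), ← intervalIntegral.integral_of_le hρ,
    integral_inv_of_pos one_pos (by linarith), div_one]
  refine (ae_restrict_iff' (measurableSet_Ioc (a := (1:ℝ)) (b := ρ))).2
    (Eventually.of_forall fun x hx => ?_)
  have : (0:ℝ) < x := one_pos.trans hx.1
  simp only [Pi.zero_apply]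
  positivity

theorem lintegral_mul_kernel_le {f k : ℂ → ENNReal} (hf : AEMeasurable f) (hk : Measurable k)
    {E T : Set ℂ} (hE : MeasurableSet E) (hT : MeasurableSet T) {c b : ENNReal}
    (hkc : ∀ x ∈ E, ∀ y ∈ ball x 1, y ∈ T ∧ k x ≤ c * k y)
    (hb : ∀ y, ∫⁻ x in ball y 1, f x ≤ b) :
    ∫⁻ x in E, f x * k x ≤ c * b * ∫⁻ y in T, k y := by
  obtain ⟨f', hf', hff⟩ := hf
  have e1 : ∫⁻ x in E, f x * k x = ∫⁻ x, E.indicator (fun x => f' x * k x) x := by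
    rw [lintegral_indicator hE]
    refine lintegral_congr_ae (ae_restrict_of_ae ?_)
    filter_upwards [hff] with x hx
    rw [hx]
  have hm : Measurable (E.indicator fun x => f' x * k x) := (hf'.mul hk).indicator hE
  have hv : 1 ≤ volume (ball (0 : ℂ) 1) := by
    rw [Complex.volume_ball]
    simp only [ENNReal.ofReal_one, one_pow, one_mul, ENNReal.one_le_coe_iff]
    have := Real.pi_gt_three
    exact_mod_cast (by linarith : (1:ℝ) ≤ Real.pi)
  calc ∫⁻ x in E, f x * k x = 1 * ∫⁻ x, E.indicator (fun x => f' x * k x) x := by rw [e1, one_mul]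
    _ ≤ volume (ball (0 : ℂ) 1) * ∫⁻ x, E.indicator (fun x => f' x * k x) x := by gcongr
    _ = ∫⁻ y, ∫⁻ x in ball y 1, E.indicator (fun x => f' x * k x) x :=
        (lintegral_lintegral_ball hm 1).symm
    _ ≤ ∫⁻ y, T.indicator (fun y => c * b * k y) y := by
        refine lintegral_mono fun y => ?_
        by_cases hy : y ∈ T
        · rw [indicator_of_mem hy]
          calc _ ≤ ∫⁻ x in ball y 1, c * k y * f' x := by
                refine setLIntegral_mono' measurableSet_ball fun x hx => ?_
                by_cases hxE : x ∈ E
                · rw [indicator_of_mem hxE, mul_comm]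
                  gcongr
                  exact (hkc x hxE y (mem_ball_comm.1 hx)).2
                · rw [indicator_of_notMem hxE]
                  exact zero_le
            _ = c * k y * ∫⁻ x in ball y 1, f' x := lintegral_const_mul _ hf'
            _ ≤ c * k y * b := by
                gcongr
                refine le_trans (le_of_eq ?_) (hb y)
                refine lintegral_congr_ae (ae_restrict_of_ae ?_)
                filter_upwards [hff] with x hx
                rw [hx]
            _ = _ := by ring
        · rw [indicator_of_notMem hy, nonpos_iff_eq_zero, setLIntegral_eq_zero_iff measurableSet_ball hm]
          refine Eventually.of_forall fun x hx => indicator_of_notMem (fun hxE => hy ?_) _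
          exact (hkc x hxE y (mem_ball_comm.1 hx)).1
    _ = _ := by rw [lintegral_indicator hT, lintegral_const_mul _ hk]

theorem lintegral_inv_ball_zero_le (z : ℂ) {ρ : ℝ} (hρ : 0 < ρ) :
    ∫⁻ ζ in ball 0 ρ, ENNReal.ofReal ‖ζ - z‖⁻¹ ≤ ENNReal.ofReal (3 * Real.pi * ρ) := by
  have hs : ball (0 : ℂ) ρ ⊆ ball z ρ ∪ (ball 0 ρ \ ball z ρ) := by
    rw [union_sdiff_self]
    exact subset_union_right
  have h1 : ∫⁻ ζ in ball 0 ρ \ ball z ρ, ENNReal.ofReal ‖ζ - z‖⁻¹ ≤ ENNReal.ofReal (Real.pi * ρ) := by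
    calc _ ≤ ∫⁻ ζ in ball 0 ρ \ ball z ρ, ENNReal.ofReal ρ⁻¹ := by
          refine setLIntegral_mono' (measurableSet_ball.diff measurableSet_ball) fun ζ hζ => ?_
          refine ENNReal.ofReal_le_ofReal ?_
          have := hζ.2
          rw [mem_ball, not_lt, dist_eq_norm] at this
          gcongr
      _ ≤ ∫⁻ ζ in ball 0 ρ, ENNReal.ofReal ρ⁻¹ := lintegral_mono_set sdiff_subset
      _ = ENNReal.ofReal (Real.pi * ρ) := by
          rw [setLIntegral_const, Complex.volume_ball, ← ENNReal.ofReal_coe_nnreal,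
            ← ENNReal.ofReal_pow hρ.le, ← ENNReal.ofReal_mul (by positivity),
            ← ENNReal.ofReal_mul (by positivity)]
          congr 1
          rw [NNReal.coe_real_pi]
          field_simp
  refine (lintegral_mono_set hs).trans ((lintegral_union_le _ _ _).trans ?_)
  rw [lintegral_inv_ball]
  refine (add_le_add le_rfl h1).trans_eq ?_
  rw [← ENNReal.ofReal_add (by positivity) (by positivity)]
  congr 1
  ring

theorem Corrector.aemeasurable_grad {Z : Set ℂ} {R ε : ℝ} {V ψ : ℂ → ℝ} {g : ℂ → ℂ}
    (h : Corrector Z R ε V ψ g) : AEMeasurable fun ζ => ENNReal.ofReal ‖g ζ‖ :=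
  h.memLp_grad.aestronglyMeasurable.norm.aemeasurable.ennreal_ofReal

theorem exists_lintegral_grad_ten_le : ∃ C > 0, ∀ (Z : Set ℂ) (R ε : ℝ) (V ψ : ℂ → ℝ) (g : ℂ → ℂ),
    Corrector Z R ε V ψ g → ∀ z, ∫⁻ ζ in ball z 10, ENNReal.ofReal ‖g ζ‖ ≤
      ENNReal.ofReal (C * ε ^ 2) := by
  obtain ⟨C, hC, h1⟩ := exists_setIntegral_grad_le
  refine ⟨C, hC, fun Z R ε V ψ g h z => ?_⟩
  rw [← ofReal_integral_eq_lintegral_ofReal (h.integrableOn_grad z 10)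
    (Eventually.of_forall fun ζ => norm_nonneg _)]
  exact ENNReal.ofReal_le_ofReal (h1 Z R ε V ψ g h z).1

theorem measurable_ofReal_inv_norm (z : ℂ) : Measurable fun ζ : ℂ => ENNReal.ofReal ‖ζ - z‖⁻¹ :=
  (by fun_prop : Measurable (fun p : ℂ => ‖p - z‖)).inv.ennreal_ofReal

theorem exists_lintegral_grad_kernel_le : ∃ C > 0, ∀ (Z : Set ℂ) (R ε : ℝ) (V ψ : ℂ → ℝ) (g : ℂ → ℂ),
    Corrector Z R ε V ψ g → 1 ≤ R → ∀ z, ∫⁻ ζ in ball 0 R, ENNReal.ofReal ‖g ζ‖ *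
      ENNReal.ofReal ‖ζ - z‖⁻¹ ≤ ENNReal.ofReal (C * ε ^ 2 * R) := by
  obtain ⟨C1, hC1, h1⟩ := exists_lintegral_grad_le
  obtain ⟨C2, hC2, h2⟩ := exists_lintegral_grad_ten_le
  refine ⟨C1 + 2 * C2 * (3 * Real.pi * 2), by positivity, fun Z R ε V ψ g h hR z => ?_⟩
  have hs : ball (0 : ℂ) R ⊆ ball z 1 ∪ (ball 0 R \ ball z 1) := by
    rw [union_sdiff_self]
    exact subset_union_right
  refine (lintegral_mono_set hs).trans ((lintegral_union_le _ _ _).trans ?_)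
  have e1 : ∫⁻ ζ in ball z 1, ENNReal.ofReal ‖g ζ‖ * ENNReal.ofReal ‖ζ - z‖⁻¹ ≤
      ENNReal.ofReal (C1 * ε ^ 2 * R) := by
    simp only [← ENNReal.ofReal_mul (norm_nonneg (g _))]
    refine (h1 Z R ε V ψ g h z).trans (ENNReal.ofReal_le_ofReal ?_)
    have : 0 ≤ C1 * ε ^ 2 := by positivity
    nlinarith
  have e2 : ∫⁻ ζ in ball 0 R \ ball z 1, ENNReal.ofReal ‖g ζ‖ * ENNReal.ofReal ‖ζ - z‖⁻¹ ≤
      ENNReal.ofReal 2 * ENNReal.ofReal (C2 * ε ^ 2) *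
        ∫⁻ y in ball 0 (R + 1), ENNReal.ofReal ‖y - z‖⁻¹ := by
    refine lintegral_mul_kernel_le h.aemeasurable_grad (measurable_ofReal_inv_norm z)
      (measurableSet_ball.diff measurableSet_ball) measurableSet_ball ?_ fun y =>
      (lintegral_mono_set (ball_subset_ball (by norm_num))).trans (h2 Z R ε V ψ g h y)
    rintro x ⟨hx1, hx2⟩ y hy
    rw [mem_ball, not_lt, dist_eq_norm] at hx2
    rw [mem_ball_zero_iff] at hx1
    rw [mem_ball, dist_eq_norm] at hy
    refine ⟨?_, ?_⟩
    · rw [mem_ball_zero_iff]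
      have := norm_le_norm_add_norm_sub' y x
      linarith
    · rw [← ENNReal.ofReal_mul (by norm_num)]
      refine ENNReal.ofReal_le_ofReal ?_
      rcases eq_or_ne y z with rfl | hyz
      · rw [norm_sub_rev] at hy
        linarith
      · have h3 : 0 < ‖y - z‖ := norm_pos_iff.2 (sub_ne_zero.2 hyz)
        have h4 : ‖y - z‖ ≤ 2 * ‖x - z‖ := by
          have := norm_sub_le_norm_sub_add_norm_sub y x z
          linarith
        rw [inv_le_comm₀ (by linarith) (by positivity), mul_inv, inv_inv]
        linarith
  refine (add_le_add e1 (e2.trans (mul_le_mul_right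
    (lintegral_inv_ball_zero_le z (by linarith)) _))).trans ?_
  rw [← ENNReal.ofReal_mul (by norm_num), ← ENNReal.ofReal_mul (by positivity),
    ← ENNReal.ofReal_add (by positivity) (by positivity)]
  refine ENNReal.ofReal_le_ofReal ?_
  have h3 : 2 * (C2 * ε ^ 2) * (3 * Real.pi * (R + 1)) ≤ 2 * (C2 * ε ^ 2) * (3 * Real.pi * (2 * R)) := by
    gcongr
    linarith
  linarith

theorem exists_lintegral_grad_far_le : ∃ C > 0, ∀ (Z : Set ℂ) (R ε : ℝ) (V ψ : ℂ → ℝ) (g : ℂ → ℂ),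
    Corrector Z R ε V ψ g → 1 ≤ R → ∀ z, ‖z‖ ≤ R → ∫⁻ ζ in ball 0 R \ ball z 2,
      ENNReal.ofReal ‖g ζ‖ * ENNReal.ofReal (‖ζ - z‖⁻¹ ^ 2) ≤
      ENNReal.ofReal (C * ε ^ 2 * (1 + Real.log R)) := by
  obtain ⟨C2, hC2, h2⟩ := exists_lintegral_grad_ten_le
  refine ⟨4 * C2 * (2 * Real.pi * 2), by positivity, fun Z R ε V ψ g h hR z hz => ?_⟩
  have e2 : ∫⁻ ζ in ball 0 R \ ball z 2, ENNReal.ofReal ‖g ζ‖ * ENNReal.ofReal (‖ζ - z‖⁻¹ ^ 2) ≤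
      ENNReal.ofReal 4 * ENNReal.ofReal (C2 * ε ^ 2) *
        ∫⁻ y in ball z (2 * R + 1) \ ball z 1, ENNReal.ofReal (‖y - z‖⁻¹ ^ 2) := by
    refine lintegral_mul_kernel_le h.aemeasurable_grad
      (by fun_prop : Measurable fun ζ : ℂ => ENNReal.ofReal (‖ζ - z‖⁻¹ ^ 2))
      (measurableSet_ball.diff measurableSet_ball) (measurableSet_ball.diff measurableSet_ball) ?_
      fun y => (lintegral_mono_set (ball_subset_ball (by norm_num))).trans (h2 Z R ε V ψ g h y)
    rintro x ⟨hx1, hx2⟩ y hy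
    rw [mem_ball, not_lt, dist_eq_norm] at hx2
    rw [mem_ball_zero_iff] at hx1
    rw [mem_ball, dist_eq_norm] at hy
    have k1 := norm_sub_le_norm_sub_add_norm_sub y x z
    have k2 := norm_sub_le_norm_sub_add_norm_sub x y z
    have k3 := norm_sub_le x z
    rw [norm_sub_rev x y] at k2
    refine ⟨⟨?_, ?_⟩, ?_⟩
    · rw [mem_ball, dist_eq_norm]
      linarith
    · rw [mem_ball, dist_eq_norm]
      linarith
    · rw [← ENNReal.ofReal_mul (by norm_num)]
      refine ENNReal.ofReal_le_ofReal ?_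
      have h3 : ‖x - z‖⁻¹ ≤ 2 * ‖y - z‖⁻¹ := by
        rw [inv_le_comm₀ (by linarith) (mul_pos two_pos (inv_pos.2 (by linarith))), mul_inv, inv_inv]
        linarith
      calc ‖x - z‖⁻¹ ^ 2 ≤ (2 * ‖y - z‖⁻¹) ^ 2 := by gcongr
        _ = _ := by ring
  refine e2.trans ?_
  have hl0 := Real.log_nonneg hR
  have hl : Real.log (2 * R + 1) ≤ 2 * (1 + Real.log R) := by
    have h3 : Real.log (2 * R + 1) ≤ Real.log (3 * R) := Real.log_le_log (by linarith) (by linarith)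
    rw [Real.log_mul (by norm_num) (by linarith)] at h3
    have := Real.log_le_sub_one_of_pos (show (0:ℝ) < 3 by norm_num)
    linarith
  rw [lintegral_inv_sq_annulus z (by linarith), ← ENNReal.ofReal_mul (by norm_num),
    ← ENNReal.ofReal_mul (by positivity)]
  refine ENNReal.ofReal_le_ofReal ?_
  calc 4 * (C2 * ε ^ 2) * (2 * Real.pi * Real.log (2 * R + 1))
      ≤ 4 * (C2 * ε ^ 2) * (2 * Real.pi * (2 * (1 + Real.log R))) := by gcongr
    _ = _ := by ring

theorem norm_inv_sub_inv_le {x z ζ : ℂ} (h : ‖ζ - z‖ ≤ 1) (hx : 2 ≤ ‖x - z‖) :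
    ‖(ζ - x)⁻¹ - (z - x)⁻¹‖ ≤ 2 * ‖x - z‖⁻¹ ^ 2 := by
  have h1 : 1 / 2 * ‖x - z‖ ≤ ‖ζ - x‖ := by
    have := norm_sub_le_norm_sub_add_norm_sub x ζ z
    rw [norm_sub_rev x ζ] at this
    linarith
  have hz : 0 < ‖x - z‖ := by linarith
  have hζ : 0 < ‖ζ - x‖ := by linarith
  have hz' : z - x ≠ 0 := by rw [← norm_pos_iff, norm_sub_rev]; exact hz
  rw [inv_sub_inv (norm_pos_iff.1 hζ) hz', norm_div, norm_mul, norm_sub_rev z x]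
  have e : z - x - (ζ - x) = z - ζ := by ring
  rw [e, norm_sub_rev z ζ, div_le_iff₀ (by positivity)]
  calc ‖ζ - z‖ ≤ 1 := h
    _ = 2 * ‖x - z‖⁻¹ ^ 2 * ((1 / 2 * ‖x - z‖) * ‖x - z‖) := by field_simp
    _ ≤ _ := by gcongr

theorem exists_cT_bounds : ∃ C > 0, ∀ (Z : Set ℂ) (R ε : ℝ) (V ψ : ℂ → ℝ) (g A : ℂ → ℂ),
    Corrector Z R ε V ψ g → 1 ≤ R → AEStronglyMeasurable A → (∀ᵐ z, ‖A z‖ ≤ 4 * ‖g z‖) →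
    (∀ z, R ≤ ‖z‖ → A z = 0) →
    (∀ z, Integrable (fun ζ => A ζ / (z - ζ)) ∧ ∫ ζ, ‖A ζ / (z - ζ)‖ ≤ C * ε ^ 2 * R) ∧
    ∀ z ζ, ‖z‖ ≤ R → ‖ζ - z‖ ≤ 1 → ‖cT A ζ - cT A z‖ ≤ C * ε ^ 2 * (1 + Real.log R) := by
  obtain ⟨C1, hC1, h1⟩ := exists_lintegral_grad_kernel_le
  obtain ⟨C2, hC2, h2⟩ := exists_lintegral_grad_far_le
  obtain ⟨C3, hC3, h3⟩ := exists_lintegral_grad_le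
  obtain ⟨C4, hC4, h4⟩ := exists_lintegral_grad_ten_le
  refine ⟨4 * C1 + 4 * (2 * C3 + 2 * C4 + 2 * C2), by positivity,
    fun Z R ε V ψ g A h hR hA hAg hAR => ?_⟩
  have hlog := Real.log_nonneg hR
  have key : ∀ k : ℂ → ℝ, (∀ x, 0 ≤ k x) → ∫⁻ x, ENNReal.ofReal (‖A x‖ * k x) ≤
      ENNReal.ofReal 4 * ∫⁻ x in ball 0 R, ENNReal.ofReal ‖g x‖ * ENNReal.ofReal (k x) := by
    intro k hk
    rw [← lintegral_const_mul' _ _ ENNReal.ofReal_ne_top, ← lintegral_indicator measurableSet_ball]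
    refine lintegral_mono_ae ?_
    filter_upwards [hAg] with x hx
    by_cases hxR : x ∈ ball 0 R
    · rw [indicator_of_mem hxR, ← ENNReal.ofReal_mul (norm_nonneg _), ← ENNReal.ofReal_mul (by norm_num)]
      refine ENNReal.ofReal_le_ofReal ?_
      rw [← mul_assoc]
      exact mul_le_mul_of_nonneg_right hx (hk x)
    · rw [mem_ball_zero_iff, not_lt] at hxR
      rw [hAR x hxR]
      simp
  have hI : ∀ z, ∫⁻ ζ, ENNReal.ofReal ‖A ζ / (z - ζ)‖ ≤ ENNReal.ofReal (4 * C1 * ε ^ 2 * R) := by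
    intro z
    have := (key (fun ζ => ‖ζ - z‖⁻¹) fun x => by positivity).trans
      (mul_le_mul_right (h1 Z R ε V ψ g h hR z) _)
    rw [← ENNReal.ofReal_mul (by norm_num)] at this
    have e : 4 * (C1 * ε ^ 2 * R) = 4 * C1 * ε ^ 2 * R := by ring
    rw [e] at this
    refine le_trans (le_of_eq (lintegral_congr fun ζ => ?_)) this
    rw [norm_div, div_eq_mul_inv, norm_sub_rev]
  have hM : ∀ z, AEStronglyMeasurable fun ζ => A ζ / (z - ζ) := fun z => by
    simp only [div_eq_mul_inv]
    exact hA.mul (by fun_prop : Measurable fun ζ : ℂ => (z - ζ)⁻¹).aestronglyMeasurable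
  have hInt : ∀ z, Integrable fun ζ => A ζ / (z - ζ) := fun z => by
    refine ⟨hM z, ?_⟩
    rw [hasFiniteIntegral_iff_norm]
    exact (hI z).trans_lt ENNReal.ofReal_lt_top
  refine ⟨fun z => ⟨hInt z, ?_⟩, fun z ζ hz hζ => ?_⟩
  · have h5 := hI z
    rw [← ofReal_integral_eq_lintegral_ofReal (hInt z).norm
      (Eventually.of_forall fun ζ => norm_nonneg _)] at h5
    have h6 := (ENNReal.ofReal_le_ofReal_iff (by positivity)).1 h5
    refine h6.trans ?_
    gcongr
    have : 0 ≤ 4 * (2 * C3 + 2 * C4 + 2 * C2) := by positivity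
    linarith
  · rw [← ENNReal.ofReal_le_ofReal_iff (by positivity)]
    have e1 : cT A ζ - cT A z = (2 * (Real.pi : ℂ))⁻¹ * ∫ x, A x * ((ζ - x)⁻¹ - (z - x)⁻¹) := by
      rw [cT, cT, ← mul_sub, ← integral_sub (hInt ζ) (hInt z)]
      simp only [mul_sub, div_eq_mul_inv]
    have e2 : ENNReal.ofReal ‖cT A ζ - cT A z‖ ≤
        ∫⁻ x, ENNReal.ofReal (‖A x‖ * ‖(ζ - x)⁻¹ - (z - x)⁻¹‖) := by
      rw [e1, norm_mul]
      have h1 : ‖(2 * (Real.pi : ℂ))⁻¹‖ ≤ 1 := by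
        rw [norm_inv]
        apply inv_le_one_of_one_le₀
        simp only [norm_mul, Complex.norm_ofNat, Complex.norm_real, Real.norm_eq_abs,
          abs_of_pos Real.pi_pos]
        linarith [Real.pi_gt_three]
      refine (ENNReal.ofReal_le_ofReal (mul_le_of_le_one_left (norm_nonneg _) h1)).trans ?_
      rw [ofReal_norm]
      refine (enorm_integral_le_lintegral_enorm _).trans (lintegral_mono fun x => ?_)
      rw [← ofReal_norm, norm_mul]
    refine e2.trans ((key _ fun x => norm_nonneg _).trans ?_)
    have hs : ball (0 : ℂ) R ⊆ ball z 2 ∪ (ball 0 R \ ball z 2) := by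
      rw [union_sdiff_self]
      exact subset_union_right
    have near : ∀ w, ‖w - z‖ ≤ 1 → ∫⁻ x in ball z 2, ENNReal.ofReal ‖g x‖ *
        ENNReal.ofReal ‖x - w‖⁻¹ ≤ ENNReal.ofReal ((C3 + C4) * ε ^ 2) := by
      intro w hw
      have hs : ball z 2 ⊆ ball w 1 ∪ (ball z 10 \ ball w 1) := by
        rw [union_sdiff_self]
        exact (ball_subset_ball (by norm_num)).trans subset_union_right
      refine (lintegral_mono_set hs).trans ((lintegral_union_le _ _ _).trans ?_)
      rw [add_mul, ENNReal.ofReal_add (by positivity) (by positivity)]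
      refine add_le_add ?_ (le_trans ?_ (h4 Z R ε V ψ g h z))
      · simp only [← ENNReal.ofReal_mul (norm_nonneg (g _))]
        exact h3 Z R ε V ψ g h w
      · refine (setLIntegral_mono' (g := fun x => ENNReal.ofReal ‖g x‖)
          (measurableSet_ball.diff measurableSet_ball) fun x hx => ?_).trans
          (lintegral_mono_set sdiff_subset)
        rw [← ENNReal.ofReal_mul (norm_nonneg _)]
        refine ENNReal.ofReal_le_ofReal (mul_le_of_le_one_right (norm_nonneg _) ?_)
        have := hx.2
        rw [mem_ball, not_lt, dist_eq_norm] at this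
        exact inv_le_one_of_one_le₀ this
    have b1 : ∫⁻ x in ball z 2, ENNReal.ofReal ‖g x‖ * ENNReal.ofReal ‖(ζ - x)⁻¹ - (z - x)⁻¹‖ ≤
        ENNReal.ofReal ((C3 + C4) * ε ^ 2) + ENNReal.ofReal ((C3 + C4) * ε ^ 2) := by
      refine le_trans ?_ (add_le_add (near ζ hζ) (near z (by simp)))
      have hm : AEMeasurable (fun x => ENNReal.ofReal ‖g x‖ * ENNReal.ofReal ‖x - ζ‖⁻¹)
          (volume.restrict (ball z 2)) :=
        (h.aemeasurable_grad.mul (measurable_ofReal_inv_norm ζ).aemeasurable).restrict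
      rw [← lintegral_add_left' hm]
      refine lintegral_mono fun x => ?_
      rw [← mul_add, ← ENNReal.ofReal_add (by positivity) (by positivity)]
      gcongr
      refine (norm_sub_le _ _).trans ?_
      rw [norm_inv, norm_inv, norm_sub_rev ζ, norm_sub_rev z]
    have b2 : ∫⁻ x in ball 0 R \ ball z 2, ENNReal.ofReal ‖g x‖ *
        ENNReal.ofReal ‖(ζ - x)⁻¹ - (z - x)⁻¹‖ ≤
        ENNReal.ofReal 2 * ENNReal.ofReal (C2 * ε ^ 2 * (1 + Real.log R)) := by
      refine le_trans ?_ (mul_le_mul_right (h2 Z R ε V ψ g h hR z hz) _)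
      rw [← lintegral_const_mul' _ _ ENNReal.ofReal_ne_top]
      refine setLIntegral_mono' (measurableSet_ball.diff measurableSet_ball) fun x hx => ?_
      have := hx.2
      rw [mem_ball, not_lt, dist_eq_norm] at this
      rw [mul_left_comm, ← ENNReal.ofReal_mul (p := 2) (by norm_num)]
      gcongr
      exact norm_inv_sub_inv_le hζ this
    refine (mul_le_mul_right ((lintegral_mono_set hs).trans ((lintegral_union_le _ _ _).trans
      (add_le_add b1 b2))) _).trans ?_
    rw [← ENNReal.ofReal_add (by positivity) (by positivity), ← ENNReal.ofReal_mul (by norm_num),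
      ← ENNReal.ofReal_add (by positivity) (by positivity), ← ENNReal.ofReal_mul (by norm_num)]
    refine ENNReal.ofReal_le_ofReal ?_
    have p1 : 0 ≤ C1 * ε ^ 2 * (1 + Real.log R) := by positivity
    have p2 : 0 ≤ (C3 + C4) * ε ^ 2 * Real.log R := by positivity
    nlinarith

/-- The nodal field is, off `P`, a nonvanishing bounded factor times a holomorphic function. -/
theorem exists_holomorphic_factor : ∃ C > 0, ∀ (Z P : Set ℂ) (R ε : ℝ) (V ψ u : ℂ → ℝ) (g : ℂ → ℂ),
    Corrector Z R ε V ψ g → 1 ≤ R → C * ε ^ 2 ≤ 1 → ContDiff ℝ 2 u →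
    (∀ z ∈ Z, u z = 0 ∨ z ∈ P) → (∀ z ∉ P, V z * u z = planeLaplacian u z) →
    (∀ z, R ≤ ‖z‖ → z ∈ P) → (∀ᵐ z, |ψ z| ≤ 1 / 2) ∧ ∃ s : ℂ → ℂ, (∀ z, ‖s z‖ ≤ C * ε ^ 2 * R) ∧
      (∀ z ζ, ‖z‖ ≤ R → ‖ζ - z‖ ≤ 1 → ‖s ζ - s z‖ ≤ C * ε ^ 2 * (1 + Real.log R)) ∧
      ∀ χ : ℂ → ℂ, ContDiff ℝ 2 χ → (∀ z ∈ P, χ z = 0) → ∃ H : ℂ → ℂ,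
        (∀ᵐ z, exp (-s z) * (χ z * nodalField u ψ g z) = H z) ∧
        ∀ U, IsOpen U → (∀ z ∈ U, χ z = 1) → DifferentiableOn ℂ H U := by
  obtain ⟨C1, hC1, h1⟩ := exists_psi_le
  obtain ⟨C2, hC2, h2⟩ := exists_cT_bounds
  refine ⟨2 * C1 + C2, by positivity, fun Z P R ε V ψ u g h hR hε hu hZP hV hP => ?_⟩
  have hψ : ∀ᵐ z, |ψ z| ≤ 1 / 2 := by
    filter_upwards [h1 Z R ε V ψ g h] with z hz
    have : 0 ≤ C2 * ε ^ 2 := by positivity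
    linarith
  refine ⟨hψ, ?_⟩
  let w := nodalField u ψ g
  let B := nodalSource u g
  let A : ℂ → ℂ := (ball 0 R).indicator fun z => B z / w z
  have hw : LocallyIntegrable w := h.locallyIntegrable_nodalField hu
  have hB : LocallyIntegrable B := h.locallyIntegrable_nodalSource hu
  have hAm : AEStronglyMeasurable A :=
    ((hB.aestronglyMeasurable.aemeasurable.div hw.aestronglyMeasurable.aemeasurable).aestronglyMeasurable).indicator
      measurableSet_ball
  have hAg : ∀ᵐ z, ‖A z‖ ≤ 4 * ‖g z‖ := by
    filter_upwards [hψ] with z hz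
    refine (norm_indicator_le_norm_self _ _).trans ?_
    rw [norm_div]
    exact div_le_of_le_mul₀ (norm_nonneg _) (by positivity) (norm_nodalSource_le hz)
  have hAR : ∀ z, R ≤ ‖z‖ → A z = 0 := fun z hz =>
    indicator_of_notMem (by rw [mem_ball_zero_iff, not_lt]; exact hz) _
  have hAw : ∀ᵐ z, ‖z‖ < R → A z * w z = B z := by
    filter_upwards [hψ] with z hz hzR
    have e : A z = B z / w z := indicator_of_mem (by rwa [mem_ball_zero_iff]) _
    rw [e]
    by_cases hw0 : w z = 0
    · have := norm_nodalSource_le (u := u) (g := g) hz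
      have hw0' : nodalField u ψ g z = 0 := hw0
      rw [hw0', norm_zero, mul_zero, norm_le_zero_iff] at this
      rw [hw0, mul_zero]
      exact this.symm
    · exact div_mul_cancel₀ _ hw0
  obtain ⟨h3, h4⟩ := h2 Z R ε V ψ g A h hR hAm hAg hAR
  have hAi : Integrable A := by
    have i1 : Integrable ((ball 0 R).indicator fun z => 4 * ‖g z‖) :=
      ((integrable_indicator_iff measurableSet_ball).2 ((h.integrableOn_grad 0 R).const_mul 4))
    refine i1.mono' hAm ?_
    filter_upwards [hAg] with z hz
    by_cases hzR : z ∈ ball 0 R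
    · rwa [indicator_of_mem hzR]
    · rw [indicator_of_notMem hzR, hAR z (by rwa [mem_ball_zero_iff, not_lt] at hzR), norm_zero]
  have hlog := Real.log_nonneg hR
  have hs : ∀ z, ‖cT A z‖ ≤ C2 * ε ^ 2 * R := fun z => norm_cT_le (h3 z).2
  refine ⟨cT A, fun z => (hs z).trans ?_, fun z ζ hz hζ => (h4 z ζ hz hζ).trans ?_, fun χ hχ hχP => ?_⟩
  · gcongr
    linarith
  · gcongr
    linarith
  have hK : IsCompact (closedBall (0 : ℂ) R) := isCompact_closedBall 0 R
  have hχ1 : ContDiff ℝ 1 χ := hχ.of_le (by norm_num)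
  have hχK : ∀ z ∉ closedBall (0 : ℂ) R, χ z = 0 := fun z hz => hχP z (hP z (by
    rw [mem_closedBall_zero_iff, not_le] at hz
    exact hz.le))
  have hc : HasCompactSupport χ := HasCompactSupport.intro hK hχK
  have hts : tsupport χ ⊆ closedBall 0 R := closure_minimal (fun z hz => by
    by_contra h1
    exact hz (hχK z h1)) hK.isClosed
  have hdK : ∀ z ∉ closedBall (0 : ℂ) R, db χ z = 0 := fun z hz =>
    db_eq_zero_of_notMem_tsupport fun h1 => hz (hts h1)
  have i1 : Integrable fun z => χ z * w z :=
    (integrable_mul_of_locallyIntegrable hw hχ.continuous hc).congr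
      (Eventually.of_forall fun z => mul_comm _ _)
  have i2 : Integrable fun z => χ z * B z :=
    (integrable_mul_of_locallyIntegrable hB hχ.continuous hc).congr
      (Eventually.of_forall fun z => mul_comm _ _)
  have i3 : Integrable fun z => w z * db χ z :=
    integrable_mul_of_locallyIntegrable hw (continuous_db hχ1) (hasCompactSupport_db hc)
  have e1 : ∀ᵐ z, A z * (χ z * w z) = χ z * B z := by
    filter_upwards [hAw] with z hz
    by_cases hzR : ‖z‖ < R
    · rw [← hz hzR]
      ring
    · rw [hχP z (hP z (not_lt.1 hzR))]
      simp
  have hD := weakDb_cutoff hw hB (fun ζ hζ hζc hζP =>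
    h.integral_nodalField_mul_db hu hZP hV hζ hζc hζP) hχ hχP
  have hE := weakDb_exp_cT hK i1 (i2.fun_add i3) hAi (i2.congr (e1.mono fun z hz => hz.symm))
    (fun z hz => by simp [hχK z hz]) (fun z hz => by simp [hχK z hz, hdK z hz]) hD
    (fun z => (h3 z).1) fun z => (h3 z).2
  have hm : AEStronglyMeasurable fun z => exp (-cT A z) :=
    continuous_exp.comp_aestronglyMeasurable (aestronglyMeasurable_cT hAi).neg
  have hb : ∀ z, ‖exp (-cT A z)‖ ≤ Real.exp (C2 * ε ^ 2 * R) := fun z => by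
    rw [norm_exp]
    refine Real.exp_le_exp.2 ((re_le_norm _).trans ?_)
    rw [norm_neg]
    exact hs z
  have j1 : Integrable fun z => exp (-cT A z) * (χ z * w z) :=
    i1.bdd_mul hm (Eventually.of_forall hb)
  have j2 : Integrable fun z => exp (-cT A z) * (w z * db χ z) :=
    i3.bdd_mul hm (Eventually.of_forall hb)
  have hE' : WeakDb (fun z => exp (-cT A z) * (χ z * w z))
      fun z => exp (-cT A z) * (w z * db χ z) := by
    refine hE.congr_ae (Eventually.of_forall fun z => rfl) ?_
    filter_upwards [e1] with z hz
    rw [hz]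
    ring
  refine ⟨_, ae_eq_cT_of_weakDb hK j1 j2 (fun z hz => by simp [hχK z hz])
    (fun z hz => by simp [hdK z hz]) hE', fun U hU hU1 => differentiableOn_cT j2 hU fun z hz => ?_⟩
  have : fderiv ℝ χ z = 0 := by
    have : χ =ᶠ[𝓝 z] fun _ => 1 := Filter.eventually_of_mem (hU.mem_nhds hz) hU1
    rw [this.fderiv_eq]
    simp
  simp [db, this]

/-- Centres of discs of radius `4` without zeros of `u`. -/
def zeroFree (u : ℂ → ℝ) : Set ℂ := {x | ∀ w ∈ ball x 4, u w ≠ 0}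

theorem isClosed_zeroFree (u : ℂ → ℝ) : IsClosed (zeroFree u) := by
  refine isClosed_of_closure_subset fun x hx w hw => ?_
  rw [mem_ball] at hw
  obtain ⟨y, hy, hxy⟩ := Metric.mem_closure_iff.1 hx (4 - dist w x) (by linarith)
  exact hy w (by
    rw [mem_ball]
    linarith [dist_triangle w x y])

/-- The part of the plane removed from the nodal picture. -/
def removed (u : ℂ → ℝ) (R : ℝ) : Set ℂ := cthickening 1 (zeroFree u) ∪ {z | R ≤ ‖z‖}

theorem mem_cthickening_zeroFree {u : ℂ → ℝ} {y : ℂ} :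
    y ∈ cthickening 1 (zeroFree u) ↔ ∃ x ∈ zeroFree u, dist y x ≤ 1 := by
  rw [(isClosed_zeroFree u).cthickening_eq_biUnion_closedBall zero_le_one]
  simp

theorem isClosed_removed (u : ℂ → ℝ) (R : ℝ) : IsClosed (removed u R) :=
  isClosed_cthickening.union (isClosed_le continuous_const continuous_norm)

theorem meetsCircles_removed {u : ℂ → ℝ} {R : ℝ} (hR : 0 < R) {q : ℂ} (hq : q ∈ removed u R) :
    MeetsCircles (removed u R) q 1 := by
  intro r hr hr1
  rcases hq with hq | hq
  · obtain ⟨x, hx, hqx⟩ := mem_cthickening_zeroFree.1 hq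
    by_cases hxq : x = q
    · refine ⟨q + r, Or.inl (mem_cthickening_zeroFree.2 ⟨x, hx, ?_⟩), ?_⟩
      · simpa [hxq, abs_of_pos hr] using hr1.le
      · simp [abs_of_pos hr]
    · have hn : 0 < ‖x - q‖ := norm_pos_iff.2 (sub_ne_zero.2 hxq)
      have hne : ((‖x - q‖ : ℝ) : ℂ) ≠ 0 := by exact_mod_cast hn.ne'
      refine ⟨q + (r / ‖x - q‖ : ℝ) * (x - q),
        Or.inl (mem_cthickening_zeroFree.2 ⟨x, hx, ?_⟩), ?_⟩
      · have e : q + ((r / ‖x - q‖ : ℝ) : ℂ) * (x - q) - x =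
            ((r / ‖x - q‖ - 1 : ℝ) : ℂ) * (x - q) := by
          push_cast
          ring
        rw [dist_eq_norm, e, norm_mul, norm_real, Real.norm_eq_abs, ← abs_of_pos hn, ← abs_mul,
          abs_of_pos hn, sub_mul, div_mul_cancel₀ _ hn.ne', one_mul, abs_le]
        rw [dist_comm, dist_eq_norm] at hqx
        constructor <;> linarith
      · rw [dist_eq_norm, add_sub_cancel_left, norm_mul, norm_real, Real.norm_of_nonneg (by positivity),
          div_mul_cancel₀ _ hn.ne']
  · have hn : 0 < ‖q‖ := hR.trans_le hq
    refine ⟨q + (r / ‖q‖ : ℝ) * q, Or.inr ?_, ?_⟩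
    · have e : q + ((r / ‖q‖ : ℝ) : ℂ) * q = ((1 + r / ‖q‖ : ℝ) : ℂ) * q := by
        push_cast
        ring
      have hq' : R ≤ ‖q‖ := hq
      rw [Set.mem_ofPred_eq, e, norm_mul, norm_real, Real.norm_of_nonneg (by positivity), add_mul,
        div_mul_cancel₀ _ hn.ne']
      linarith
    · rw [dist_eq_norm, add_sub_cancel_left, norm_mul, norm_real, Real.norm_of_nonneg (by positivity),
        div_mul_cancel₀ _ hn.ne']

theorem MeetsCircles.mono {Z Z' : Set ℂ} {q : ℂ} {ρ : ℝ} (h : MeetsCircles Z q ρ) (hZ : Z ⊆ Z') :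
    MeetsCircles Z' q ρ := fun r hr hr1 => by
  obtain ⟨z, hz, hzq⟩ := h r hr hr1
  exact ⟨z, hZ hz, hzq⟩

theorem thick_zeros_union_removed {u : ℂ → ℝ} (hu : ContDiff ℝ 2 u) {R : ℝ} (hR : 9 ≤ R)
    (hL : ∀ z, ‖z‖ ≤ 2 * R → |planeLaplacian u z| ≤ 1 / 20 * |u z|) :
    Thick ({z | u z = 0} ∪ removed u R) R := by
  have hR0 : 0 < R := by linarith
  have zero : ∀ q ρ, u q = 0 → ρ ≤ 6 → ‖q‖ + ρ ≤ 2 * R →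
      MeetsCircles ({z | u z = 0} ∪ removed u R) q ρ := by
    intro q ρ hq hρ hqR r hr hrρ
    obtain ⟨z, hz, hz0⟩ := exists_zero_on_sphere hu hr (hrρ.le.trans hρ) (fun z hz => hL z (by
      rw [mem_closedBall, dist_eq_norm] at hz
      have := norm_sub_norm_le z q
      linarith)) hq
    exact ⟨z, Or.inl hz0, hz⟩
  have circ : ∀ q ∈ {z | u z = 0} ∪ removed u R,
      MeetsCircles ({z | u z = 0} ∪ removed u R) q 1 := by
    intro q hq
    by_cases hq' : q ∈ removed u R
    · exact (meetsCircles_removed hR0 hq').mono subset_union_right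
    · have h1 : ‖q‖ < R := not_le.1 fun h => hq' (Or.inr h)
      exact zero q 1 (hq.resolve_right hq') (by norm_num) (by linarith)
  refine ⟨(isClosed_eq hu.continuous continuous_const).union (isClosed_removed u R),
    fun z hz => Or.inr (Or.inr hz), circ, fun x => ?_⟩
  by_cases hx : x ∈ removed u R
  · exact ⟨x, 1, one_pos, by norm_num, circ x (Or.inr hx), subset_rfl, ball_subset_ball (by norm_num)⟩
  · have h1 : ‖x‖ < R := not_le.1 fun h => hx (Or.inr h)
    have h2 : x ∉ zeroFree u := fun h => hx (Or.inl (self_subset_cthickening _ h))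
    simp only [zeroFree, Set.mem_ofPred_eq] at h2
    push Not at h2
    obtain ⟨q, hq, hq0⟩ := h2
    rw [mem_ball] at hq
    refine ⟨q, 5, by norm_num, le_rfl, zero q 5 hq0 (by norm_num) ?_,
      ball_subset_ball' (by rw [dist_comm]; linarith), ball_subset_ball' (by linarith)⟩
    rw [dist_eq_norm] at hq
    have := norm_sub_norm_le q x
    linarith

theorem exists_corrector {u : ℂ → ℝ} (hu : ContDiff ℝ 2 u) {R ε : ℝ} (hR : 9 ≤ R) (hε : 0 < ε)
    (hε' : ε ≤ 1 / 10 ^ 4) (hL : ∀ z, ‖z‖ ≤ 2 * R → |planeLaplacian u z| ≤ ε ^ 2 * |u z|) :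
    ∃ V ψ g, Corrector ({z | u z = 0} ∪ removed u R) R ε V ψ g ∧
      ∀ z ∉ removed u R, V z * u z = planeLaplacian u z := by
  have hε2 : ε ^ 2 ≤ 1 / 10 ^ 8 := by
    calc ε ^ 2 ≤ (1 / 10 ^ 4) ^ 2 := by gcongr
      _ = 1 / 10 ^ 8 := by norm_num
  have hT : Thick ({z | u z = 0} ∪ removed u R) R :=
    thick_zeros_union_removed hu hR fun z hz => (hL z hz).trans (by
      gcongr
      linarith)
  let V : ℂ → ℝ := (ball 0 R).indicator fun z => planeLaplacian u z / u z
  have hVm : Measurable V :=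
    ((continuous_planeLaplacian hu).measurable.div hu.continuous.measurable).indicator measurableSet_ball
  have hVb : ∀ z, ‖V z‖ ≤ (ball (0 : ℂ) R).indicator (fun _ => ε ^ 2) z := by
    intro z
    by_cases hz : z ∈ ball 0 R
    · rw [indicator_of_mem hz]
      simp only [V, indicator_of_mem hz]
      rw [mem_ball_zero_iff] at hz
      rw [Real.norm_eq_abs, abs_div]
      exact div_le_of_le_mul₀ (abs_nonneg _) (by positivity) (hL z (by linarith))
    · simp [V, indicator_of_notMem hz]
  have hV : Potential V ε := by
    refine ⟨hVm, fun z => (hVb z).trans ?_, ?_⟩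
    · exact indicator_le_self' (f := fun _ => ε ^ 2) (fun _ _ => by positivity) z
    · refine MemLp.mono' (memLp_indicator_const 2 measurableSet_ball (ε ^ 2)
        (Or.inr measure_ball_lt_top.ne)) hVm.aestronglyMeasurable (Eventually.of_forall hVb)
  obtain ⟨ψ, g, hψ⟩ := exists_weakSol hT hV (by nlinarith [Real.pi_lt_four, Real.pi_pos])
  refine ⟨V, ψ, g, ⟨hT, hV, hψ, hε, hε'⟩, fun z hz => ?_⟩
  have h1 : ‖z‖ < R := not_le.1 fun h => hz (Or.inr h)
  simp only [V]
  rw [indicator_of_mem (by rwa [mem_ball_zero_iff])]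
  by_cases h0 : u z = 0
  · have := hL z (by linarith)
    rw [h0, abs_zero, mul_zero] at this
    rw [h0, mul_zero, abs_nonpos_iff.1 this]
  · exact div_mul_cancel₀ _ h0

/-- A sector of directions along which the distance to the origin decreases. -/
theorem exists_inward_sector {z : ℂ} (hz : 3 ≤ ‖z‖) : ∃ a b : ℝ, b - a = Real.pi / 6 ∧
    Ioo a b ⊆ Ioo (-Real.pi) Real.pi ∧
    ∀ t ∈ Ioo a b, ∀ r : ℝ, 0 ≤ r → r ≤ 1 → ‖z + r * exp (t * I)‖ ≤ ‖z‖ - r / 2 := by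
  have hpi := Real.pi_pos
  have h1 := neg_pi_lt_arg (-z)
  have h2 := arg_le_pi (-z)
  have key : ∀ t : ℝ, |t - arg (-z)| ≤ Real.pi / 6 → ∀ r : ℝ, 0 ≤ r → r ≤ 1 →
      ‖z + r * exp (t * I)‖ ≤ ‖z‖ - r / 2 := by
    intro t ht r hr hr1
    have hcos : (0.86 : ℝ) ≤ Real.cos (t - arg (-z)) := by
      rw [← Real.cos_abs]
      refine le_trans ?_ (Real.cos_le_cos_of_nonneg_of_le_pi (abs_nonneg _) (by linarith) ht)
      rw [Real.cos_pi_div_six]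
      have : (1.72 : ℝ) ≤ Real.sqrt 3 := Real.le_sqrt_of_sq_le (by norm_num)
      linarith
    rw [Real.cos_sub] at hcos
    have hre : ‖z‖ * Real.cos (arg (-z)) = -z.re := by
      have := norm_mul_cos_arg (-z)
      rwa [norm_neg] at this
    have him : ‖z‖ * Real.sin (arg (-z)) = -z.im := by
      have := norm_mul_sin_arg (-z)
      rwa [norm_neg] at this
    refine abs_le_of_sq_le_sq' ?_ (by linarith) |>.2
    have e : ‖z + r * exp (t * I)‖ ^ 2 = ‖z‖ ^ 2 + 2 * r * (z.re * Real.cos t + z.im * Real.sin t) +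
        r ^ 2 := by
      rw [exp_mul_I, ← ofReal_cos, ← ofReal_sin, Complex.sq_norm, Complex.sq_norm, normSq_apply, normSq_apply]
      simp
      rw [cos_ofReal_re, sin_ofReal_re]
      have := Real.sin_sq_add_cos_sq t
      linear_combination r ^ 2 * this
    have e2 : z.re * Real.cos t + z.im * Real.sin t =
        -(‖z‖ * (Real.cos t * Real.cos (arg (-z)) + Real.sin t * Real.sin (arg (-z)))) := by
      linear_combination Real.cos t * hre + Real.sin t * him
    have e3 : ‖z‖ * 0.86 ≤ ‖z‖ * (Real.cos t * Real.cos (arg (-z)) + Real.sin t * Real.sin (arg (-z))) :=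
      mul_le_mul_of_nonneg_left hcos (norm_nonneg z)
    rw [e, e2]
    nlinarith
  by_cases h : arg (-z) ≤ 0
  · refine ⟨arg (-z), arg (-z) + Real.pi / 6, by ring, Ioo_subset_Ioo h1.le (by linarith),
      fun t ht => key t ?_⟩
    rw [abs_le]
    constructor <;> linarith [ht.1, ht.2]
  · refine ⟨arg (-z) - Real.pi / 6, arg (-z), by ring, Ioo_subset_Ioo (by linarith) h2,
      fun t ht => key t ?_⟩
    rw [abs_le]
    constructor <;> linarith [ht.1, ht.2]

theorem ofReal_abs_sub_le_lintegral {u : ℂ → ℝ} (hu : ContDiff ℝ 1 u) (z : ℂ) {v : ℂ} (hv : ‖v‖ = 1) :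
    ENNReal.ofReal (|u z| - |u (z + v)|) ≤
      ∫⁻ r in Ioo (0 : ℝ) 1, ENNReal.ofReal ‖gr u (z + r * v)‖ := by
  have hc : Continuous fun r : ℝ => ‖gr u (z + r * v)‖ :=
    ((continuous_gr hu).comp (by fun_prop)).norm
  have hd : Continuous fun r : ℝ => fderiv ℝ u (z + r * v) v :=
    ((hu.continuous_fderiv one_ne_zero).comp (by fun_prop)).clm_apply continuous_const
  have h1 : ∫ r in (0 : ℝ)..1, fderiv ℝ u (z + r * v) v = u (z + v) - u z := by
    rw [intervalIntegral.integral_eq_sub_of_hasDerivAt (f := fun t : ℝ => u (z + t * v))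
      (fun t _ => hasDerivAt_line hu z v t) (hd.intervalIntegrable _ _)]
    simp
  have h2 : |u z| - |u (z + v)| ≤ ∫ r in (0 : ℝ)..1, ‖gr u (z + r * v)‖ := by
    have a1 := abs_sub_abs_le_abs_sub (u z) (u (z + v))
    rw [abs_sub_comm, ← h1] at a1
    refine a1.trans ((intervalIntegral.abs_integral_le_integral_abs zero_le_one).trans ?_)
    refine intervalIntegral.integral_mono_on zero_le_one (hd.abs.intervalIntegrable _ _)
      (hc.intervalIntegrable _ _) fun r _ => ?_
    simpa [hv] using abs_fderiv_le u (z + r * v) v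
  rw [intervalIntegral.integral_of_le zero_le_one, integral_Ioc_eq_integral_Ioo] at h2
  refine (ENNReal.ofReal_le_ofReal h2).trans_eq (ofReal_integral_eq_lintegral_ofReal ?_
    (Eventually.of_forall fun r => norm_nonneg _))
  exact (hc.integrableOn_Icc (a := 0) (b := 1)).mono_set Ioo_subset_Icc_self

theorem lintegral_exp_kernel {L : ℝ} (hL : 0 < L) (z : ℂ) :
    ∫⁻ ζ, ENNReal.ofReal (Real.exp (-(L * ‖ζ - z‖)) * ‖ζ - z‖⁻¹) =
      ENNReal.ofReal (2 * Real.pi / L) := by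
  rw [lintegral_radial (F := fun r => ENNReal.ofReal (Real.exp (-(L * r)) * r⁻¹)) (by fun_prop) z]
  have e : ∫⁻ r in Ioi (0 : ℝ), ENNReal.ofReal r * ENNReal.ofReal (Real.exp (-(L * r)) * r⁻¹) =
      ENNReal.ofReal (1 / L) := by
    have i : IntegrableOn (fun r : ℝ => Real.exp (-L * r)) (Ioi 0) := integrableOn_exp_mul_Ioi (by linarith) 0
    have h := integral_exp_mul_Ioi (a := -L) (by linarith) 0
    have h' : ∫ r in Ioi (0 : ℝ), Real.exp (-L * r) = 1 / L := by
      rw [h]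
      simp
    rw [← h', ofReal_integral_eq_lintegral_ofReal i (Eventually.of_forall fun r => (Real.exp_pos _).le)]
    refine setLIntegral_congr_fun measurableSet_Ioi fun r hr => ?_
    rw [mem_Ioi] at hr
    rw [← ENNReal.ofReal_mul hr.le, mul_left_comm, mul_inv_cancel₀ hr.ne', mul_one, neg_mul]
  rw [e, ← ENNReal.ofReal_mul (by positivity)]
  congr 1
  ring

theorem lintegral_sector_le {F : ℂ → ENNReal} (hF : Measurable F) (z : ℂ) {a b : ℝ}
    (hab : Ioo a b ⊆ Ioo (-Real.pi) Real.pi) :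
    ∫⁻ t in Ioo a b, ∫⁻ r in Ioo (0 : ℝ) 1, ENNReal.ofReal r * F (z + r * exp (t * I)) ≤
      ∫⁻ ζ, F ζ := by
  have hm : Measurable fun p : ℝ × ℝ => ENNReal.ofReal p.2 * F (z + p.2 * exp (p.1 * I)) :=
    (by fun_prop : Measurable fun p : ℝ × ℝ => ENNReal.ofReal p.2).mul (hF.comp (by fun_prop))
  rw [lintegral_lintegral_swap hm.aemeasurable, lintegral_polar F hF z]
  refine (lintegral_mono fun r => ?_).trans (lintegral_mono_set Ioo_subset_Ioi_self)
  exact lintegral_mono_set hab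

/-- A pointwise bound from gradient bounds in an inward sector. -/
theorem abs_le_of_sector {u : ℂ → ℝ} (hu : ContDiff ℝ 1 u) {z : ℂ} (hz : 3 ≤ ‖z‖)
    {g : ℂ → ℂ} {a b d L E : ℝ} (hb : 0 ≤ b) (hd : 0 ≤ d)
    (hL : 0 < L) (hE : 0 ≤ E) (h1 : ∀ ζ, ‖ζ - z‖ = 1 → ‖ζ‖ ≤ ‖z‖ - 1 / 2 → |u ζ| ≤ a)
    (h2 : ∀ᵐ ζ, ‖ζ - z‖ < 1 → ‖ζ‖ ≤ ‖z‖ - ‖ζ - z‖ / 2 →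
      ‖gr u ζ‖ ≤ Real.exp (-(L * ‖ζ - z‖)) * b + d * ‖g ζ‖)
    (h3 : ∫⁻ ζ in ball z 1, ENNReal.ofReal (‖g ζ‖ * ‖ζ - z‖⁻¹) ≤ ENNReal.ofReal E) :
    |u z| ≤ a + 12 * (b / L + d * E) := by
  have hpi := Real.pi_pos
  obtain ⟨p, q, hpq, hsub, hin⟩ := exists_inward_sector hz
  let W : Set ℂ := {ζ | ‖ζ - z‖ < 1 ∧ ‖ζ‖ ≤ ‖z‖ - ‖ζ - z‖ / 2}
  have hW : MeasurableSet W :=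
    (measurableSet_lt (by fun_prop : Measurable fun ζ : ℂ => ‖ζ - z‖) measurable_const).inter
      (measurableSet_le measurable_norm (by fun_prop : Measurable fun ζ : ℂ => ‖z‖ - ‖ζ - z‖ / 2))
  let F : ℂ → ENNReal := W.indicator fun ζ => ENNReal.ofReal (‖gr u ζ‖ * ‖ζ - z‖⁻¹)
  have hF : Measurable F :=
    ((continuous_gr hu).norm.measurable.mul
      (by fun_prop : Measurable fun ζ : ℂ => ‖ζ - z‖⁻¹)).ennreal_ofReal.indicator hW
  have up : ∫⁻ ζ, F ζ ≤ ENNReal.ofReal (2 * Real.pi / L * b + d * E) := by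
    have e1 : ∀ᵐ ζ, F ζ ≤ ENNReal.ofReal (Real.exp (-(L * ‖ζ - z‖)) * ‖ζ - z‖⁻¹) * ENNReal.ofReal b +
        (ball z 1).indicator (fun ζ => ENNReal.ofReal d * ENNReal.ofReal (‖g ζ‖ * ‖ζ - z‖⁻¹)) ζ := by
      filter_upwards [h2] with ζ hζ
      by_cases hm : ζ ∈ W
      · have hm' : ζ ∈ ball z 1 := by
          rw [mem_ball, dist_eq_norm]
          exact hm.1
        simp only [F]
        rw [indicator_of_mem hm, indicator_of_mem hm', ← ENNReal.ofReal_mul (by positivity),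
          ← ENNReal.ofReal_mul hd, ← ENNReal.ofReal_add (by positivity) (by positivity)]
        refine ENNReal.ofReal_le_ofReal ?_
        have := mul_le_mul_of_nonneg_right (hζ hm.1 hm.2) (inv_nonneg.2 (norm_nonneg (ζ - z)))
        refine this.trans_eq ?_
        ring
      · simp [F, indicator_of_notMem hm]
    refine (lintegral_mono_ae e1).trans ?_
    rw [lintegral_add_left (by fun_prop), lintegral_mul_const' _ _ ENNReal.ofReal_ne_top,
      lintegral_exp_kernel hL, lintegral_indicator measurableSet_ball,
      lintegral_const_mul' _ _ ENNReal.ofReal_ne_top, ENNReal.ofReal_add (by positivity) (by positivity),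
      ENNReal.ofReal_mul (by positivity), ENNReal.ofReal_mul hd]
    gcongr
  have low : ENNReal.ofReal (Real.pi / 6) * ENNReal.ofReal (|u z| - a) ≤ ∫⁻ ζ, F ζ := by
    refine le_trans ?_ (lintegral_sector_le hF z hsub)
    calc _ = ∫⁻ _ in Ioo p q, ENNReal.ofReal (|u z| - a) := by
          rw [lintegral_const, Measure.restrict_apply_univ, Real.volume_Ioo, hpq, mul_comm]
      _ ≤ _ := ?_
    refine setLIntegral_mono' measurableSet_Ioo fun t ht => ?_
    have hv : ‖exp (t * I)‖ = 1 := norm_exp_ofReal_mul_I t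
    have e1 : |u (z + exp (t * I))| ≤ a := by
      refine h1 _ (by simp [hv]) ?_
      simpa using hin t ht 1 zero_le_one le_rfl
    refine (ENNReal.ofReal_le_ofReal (by linarith)).trans
      ((ofReal_abs_sub_le_lintegral hu z hv).trans ?_)
    refine setLIntegral_mono' measurableSet_Ioo fun r hr => ?_
    have hr0 : 0 < r := hr.1
    have hn : ‖z + r * exp (t * I) - z‖ = r := by
      rw [add_sub_cancel_left, norm_mul, hv, mul_one, norm_real, Real.norm_of_nonneg hr0.le]
    have hm : z + r * exp (t * I) ∈ W := by
      refine ⟨by rw [hn]; exact hr.2, ?_⟩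
      rw [hn]
      exact hin t ht r hr0.le hr.2.le
    simp only [F]
    rw [indicator_of_mem hm, hn, ← ENNReal.ofReal_mul hr0.le, mul_left_comm, mul_inv_cancel₀ hr0.ne',
      mul_one]
  have h4 := low.trans up
  rw [← ENNReal.ofReal_mul (by positivity), ENNReal.ofReal_le_ofReal_iff (by positivity)] at h4
  have h5 : 2 * Real.pi / L * b = Real.pi / 6 * (12 * (b / L)) := by
    field_simp
    ring
  have h6 : d * E ≤ Real.pi / 6 * (12 * (d * E)) := by
    have : 0 ≤ d * E := by positivity
    nlinarith [Real.pi_gt_three]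
  have h7 : Real.pi / 6 * (|u z| - a) ≤ Real.pi / 6 * (12 * (b / L + d * E)) := by
    rw [h5] at h4
    linarith
  linarith [le_of_mul_le_mul_left h7 (by positivity)]

theorem norm_le_circle_lintegral {H : ℂ → ℂ} {y : ℂ} {d r : ℝ} (hH : DifferentiableOn ℂ H (ball y d))
    (hr : 0 < r) (hrd : r < d) : ENNReal.ofReal (2 * Real.pi) * ENNReal.ofReal ‖H y‖ ≤
      ∫⁻ t in Ioo (-Real.pi) Real.pi, ENNReal.ofReal ‖H (y + r * exp (t * I))‖ := by
  have hpi := Real.pi_pos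
  have h1 : Real.circleAverage H y r = H y := by
    refine DiffContOnCl.circleAverage ?_
    rw [abs_of_pos hr]
    exact hH.diffContOnCl_ball (closedBall_subset_ball hrd)
  rw [Real.circleAverage_eq_integral_add (-Real.pi)] at h1
  have h2 : ∫ t in (-Real.pi)..Real.pi, H (y + r * exp (t * I)) = (2 * Real.pi : ℝ) • H y := by
    rw [← h1, smul_smul, mul_inv_cancel₀ (by positivity), one_smul,
      intervalIntegral.integral_comp_add_right (fun t => H (circleMap y r t)), zero_add]
    congr 1
    ring
  rw [intervalIntegral.integral_of_le (by linarith), integral_Ioc_eq_integral_Ioo] at h2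
  rw [← ENNReal.ofReal_mul (by positivity), ← Real.norm_of_nonneg (by positivity : 0 ≤ 2 * Real.pi),
    ← norm_smul, ← h2, ofReal_norm]
  refine (enorm_integral_le_lintegral_enorm _).trans (le_of_eq ?_)
  simp only [ofReal_norm]

theorem norm_le_ball_lintegral {H : ℂ → ℂ} {y : ℂ} {d : ℝ} (hd : 0 < d)
    (hH : DifferentiableOn ℂ H (ball y d)) : ENNReal.ofReal (Real.pi * d ^ 2 * ‖H y‖) ≤
      ∫⁻ ζ in ball y d, ENNReal.ofReal ‖H ζ‖ := by
  have hpi := Real.pi_pos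
  have hm : Measurable ((ball y d).indicator fun ζ => ENNReal.ofReal ‖H ζ‖) := by
    classical
    rw [← Set.piecewise_eq_indicator]
    exact (ENNReal.continuous_ofReal.comp_continuousOn hH.continuousOn.norm).measurable_piecewise
      continuousOn_const measurableSet_ball
  rw [← lintegral_indicator measurableSet_ball, lintegral_polar _ hm y]
  have h1 : ∫⁻ r in Ioo 0 d, ENNReal.ofReal r * (ENNReal.ofReal (2 * Real.pi) * ENNReal.ofReal ‖H y‖) =
      ENNReal.ofReal (Real.pi * d ^ 2 * ‖H y‖) := by
    have i : IntegrableOn (fun r : ℝ => r) (Ioo 0 d) :=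
      (continuous_id.integrableOn_Icc (a := 0) (b := d)).mono_set Ioo_subset_Icc_self
    rw [lintegral_mul_const _ (by fun_prop), ← ofReal_integral_eq_lintegral_ofReal i
      ((ae_restrict_iff' measurableSet_Ioo).2 (Eventually.of_forall fun r hr => hr.1.le)),
      ← integral_Ioc_eq_integral_Ioo, ← intervalIntegral.integral_of_le hd.le, integral_id,
      zero_pow two_ne_zero, sub_zero, ← ENNReal.ofReal_mul (by positivity), ← ENNReal.ofReal_mul (by positivity)]
    congr 1
    ring
  rw [← h1]
  refine le_trans ?_ (lintegral_mono_set (Ioo_subset_Ioi_self : Ioo 0 d ⊆ Ioi 0))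
  refine setLIntegral_mono' measurableSet_Ioo fun r hr => ?_
  rw [lintegral_const_mul' _ _ ENNReal.ofReal_ne_top]
  gcongr
  refine (norm_le_circle_lintegral hH hr.1 hr.2).trans (lintegral_mono fun t => ?_)
  have : y + r * exp (t * I) ∈ ball y d := by
    rw [mem_ball, dist_eq_norm, add_sub_cancel_left, norm_mul, norm_exp_ofReal_mul_I, mul_one,
      norm_real, Real.norm_of_nonneg hr.1.le]
    exact hr.2
  rw [indicator_of_mem this]

theorem exists_zeroFree_bound : ∃ C ≥ (1 : ℝ), ∀ u : ℂ → ℝ, ContDiff ℝ 2 u → ∀ y : ℂ,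
    (∀ z ∈ ball y (12 / 5), u z ≠ 0) → (∀ z ∈ ball y (12 / 5), |planeLaplacian u z| ≤ |u z|) →
    (∀ x ∈ ball y (7 / 5), |u x| ≤ C * |u y|) ∧ ‖gr u y‖ ≤ C * |u y| := by
  obtain ⟨C1, hC1, h1⟩ := harnack
  obtain ⟨C2, hC2, h2⟩ := gradient_bound
  have hC : C1 * C1 ≤ 1 + C1 * C1 + C2 * (C1 * C1) := by
    have : 0 ≤ C2 * (C1 * C1) := by positivity
    linarith
  have hC' : C2 * (C1 * C1) ≤ 1 + C1 * C1 + C2 * (C1 * C1) := by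
    have : 0 ≤ C1 * C1 := by positivity
    linarith
  refine ⟨1 + C1 * C1 + C2 * (C1 * C1), by nlinarith [mul_pos hC1 hC1], fun u hu y h0 hL => ?_⟩
  have key : ∀ x ∈ ball y (7 / 5), |u x| ≤ C1 * C1 * |u y| := by
    intro x hx
    rw [mem_ball, dist_eq_norm] at hx
    let p := y + ((2 / 7 : ℝ) : ℂ) * (x - y)
    have e1 : ‖p - y‖ < 2 / 5 := by
      rw [add_sub_cancel_left, norm_mul, norm_real, Real.norm_of_nonneg (by norm_num)]
      linarith
    have e2 : ‖x - p‖ ≤ 1 := by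
      have : x - p = ((5 / 7 : ℝ) : ℂ) * (x - y) := by
        simp only [p]
        push_cast
        ring
      rw [this, norm_mul, norm_real, Real.norm_of_nonneg (by norm_num)]
      linarith
    have hs : ball p 2 ⊆ ball y (12 / 5) := ball_subset_ball' (by
      rw [dist_eq_norm]
      linarith)
    have a1 := h1 u hu p (fun z hz => h0 z (hs hz)) (fun z hz => hL z (hs hz)) x
      (by rwa [mem_closedBall, dist_eq_norm])
    have hs' : ball y 2 ⊆ ball y (12 / 5) := ball_subset_ball (by norm_num)
    have a2 := h1 u hu y (fun z hz => h0 z (hs' hz)) (fun z hz => hL z (hs' hz)) p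
      (by rw [mem_closedBall, dist_eq_norm]; linarith)
    calc |u x| ≤ C1 * |u p| := a1
      _ ≤ C1 * (C1 * |u y|) := by gcongr
      _ = _ := by ring
  refine ⟨fun x hx => (key x hx).trans (by gcongr), ?_⟩
  have h3 := h2 u hu y (C1 * C1 * |u y|) fun z hz => by
    have := key z (ball_subset_ball (by norm_num) hz)
    exact ⟨this, (hL z (ball_subset_ball (by norm_num) hz)).trans this⟩
  refine h3.trans ?_
  rw [← mul_assoc]
  gcongr

/-- Sup bound for the holomorphic factor of the nodal field. -/
theorem exists_holomorphic_bound : ∃ C > 0, ∀ (Z : Set ℂ) (R ε : ℝ) (V ψ u : ℂ → ℝ) (g s H : ℂ → ℂ),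
    Corrector Z R ε V ψ g → ContDiff ℝ 2 u → (∀ᵐ z, |ψ z| ≤ 1 / 2) → ∀ (y : ℂ) (m : ℝ), 0 ≤ m →
    (∀ z ∈ ball y (7 / 5), |u z| ≤ m ∧ |planeLaplacian u z| ≤ m) →
    (∀ z, ‖z - y‖ ≤ 1 → ‖s z - s y‖ ≤ 1) → DifferentiableOn ℂ H (ball y (2 / 5)) →
    (∀ᵐ z, z ∈ ball y (2 / 5) → H z = exp (-s z) * nodalField u ψ g z) →
    ‖H y‖ ≤ C * Real.exp (-(s y).re) * m := by
  obtain ⟨C1, hC1, h1⟩ := gradient_bound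
  obtain ⟨C2, hC2, h2⟩ := exists_lintegral_grad_ten_le
  refine ⟨Real.exp 1 * (3 / 2 * C1 + 4 * C2), by positivity,
    fun Z R ε V ψ u g s H h hu hψ y m hm hL hs hH hHe => ?_⟩
  have hpi := Real.pi_pos
  have key := norm_le_ball_lintegral (by norm_num) hH
  have e1 : ∀ᵐ z, z ∈ ball y (2 / 5) → ENNReal.ofReal ‖H z‖ ≤
      ENNReal.ofReal (Real.exp 1 * Real.exp (-(s y).re) * m) *
        (ENNReal.ofReal (3 / 2 * C1) + ENNReal.ofReal ‖g z‖) := by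
    filter_upwards [hψ, hHe] with z hz hze hzb
    rw [← ENNReal.ofReal_add (by positivity) (by positivity), ← ENNReal.ofReal_mul (by positivity)]
    refine ENNReal.ofReal_le_ofReal ?_
    rw [hze hzb, norm_mul, norm_exp]
    have hd : ‖z - y‖ < 2 / 5 := by rwa [mem_ball, dist_eq_norm] at hzb
    have b1 : (-s z).re ≤ 1 + -(s y).re := by
      have := (abs_re_le_norm (s z - s y)).trans (hs z (by linarith))
      rw [sub_re, abs_le] at this
      rw [neg_re]
      linarith
    have b2 : ‖nodalField u ψ g z‖ ≤ m * (3 / 2 * C1 + ‖g z‖) := by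
      have hgr := h1 u hu z m fun ζ hζ => hL ζ (ball_subset_ball' (by
        rw [dist_eq_norm]
        linarith) hζ)
      have hum := (hL z (ball_subset_ball (by norm_num) hzb)).1
      refine (norm_sub_le _ _).trans ?_
      rw [norm_mul, norm_mul, RCLike.norm_conj, RCLike.norm_conj, norm_real, Real.norm_eq_abs]
      have h3 : ‖1 + (ψ z : ℂ)‖ ≤ 3 / 2 := by
        refine (norm_add_le _ _).trans ?_
        rw [norm_one, norm_real, Real.norm_eq_abs]
        linarith
      calc _ ≤ 3 / 2 * (C1 * m) + m * ‖g z‖ := by gcongr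
        _ = _ := by ring
    calc _ ≤ Real.exp (1 + -(s y).re) * (m * (3 / 2 * C1 + ‖g z‖)) := by gcongr
      _ = _ := by
        rw [Real.exp_add]
        ring
  have e2 : ENNReal.ofReal (Real.pi * (2 / 5) ^ 2 * ‖H y‖) ≤
      ENNReal.ofReal (Real.exp 1 * Real.exp (-(s y).re) * m *
        (3 / 2 * C1 * (Real.pi * (2 / 5) ^ 2) + C2 * ε ^ 2)) := by
    refine key.trans ((lintegral_mono_ae ((ae_restrict_iff' measurableSet_ball).2 e1)).trans ?_)
    rw [lintegral_const_mul' _ _ ENNReal.ofReal_ne_top, lintegral_add_left measurable_const,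
      lintegral_const, Measure.restrict_apply_univ, Complex.volume_ball,
      ENNReal.ofReal_mul (p := Real.exp 1 * Real.exp (-(s y).re) * m) (by positivity),
      ENNReal.ofReal_add (by positivity) (by positivity)]
    refine mul_le_mul_right (add_le_add (le_of_eq ?_) ((lintegral_mono_set
      (ball_subset_ball (by norm_num))).trans (h2 Z R ε V ψ g h y))) _
    rw [ENNReal.ofReal_mul (p := 3 / 2 * C1) (by positivity), mul_comm Real.pi,
      ENNReal.ofReal_mul (p := (2 / 5) ^ 2) (by positivity), ENNReal.ofReal_pow (by norm_num)]
    congr 2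
    rw [← NNReal.coe_real_pi, ENNReal.ofReal_coe_nnreal]
  rw [ENNReal.ofReal_le_ofReal_iff (by positivity)] at e2
  have hε : ε ^ 2 ≤ 1 := by
    have := h.pos
    have := h.small
    nlinarith
  have e3 : 3 / 2 * C1 * (Real.pi * (2 / 5) ^ 2) + C2 * ε ^ 2 ≤
      Real.pi * (2 / 5) ^ 2 * (3 / 2 * C1 + 4 * C2) := by
    have : C2 * ε ^ 2 ≤ C2 * 1 := by gcongr
    nlinarith [mul_lt_mul_of_pos_left Real.pi_gt_three hC2]
  refine le_of_mul_le_mul_left (e2.trans ((mul_le_mul_of_nonneg_left e3 (by positivity)).trans_eq ?_))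
    (by positivity : 0 < Real.pi * (2 / 5) ^ 2)
  ring

theorem norm_gr_le_nodalField {u ψ : ℂ → ℝ} {g : ℂ → ℂ} {z : ℂ} (h : |ψ z| ≤ 1 / 2) :
    ‖gr u z‖ ≤ 2 * (‖nodalField u ψ g z‖ + |u z| * ‖g z‖) := by
  have h1 : (1 + (ψ z : ℂ)) * (starRingEnd ℂ) (gr u z) =
      nodalField u ψ g z + (u z : ℂ) * (starRingEnd ℂ) (g z) := by
    simp [nodalField]
  have h2 : 1 / 2 * ‖gr u z‖ ≤ ‖nodalField u ψ g z‖ + |u z| * ‖g z‖ := by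
    calc 1 / 2 * ‖gr u z‖ ≤ ‖1 + (ψ z : ℂ)‖ * ‖gr u z‖ := by
          gcongr
          have := norm_sub_norm_le (1 : ℂ) (-(ψ z : ℂ))
          rw [norm_one, norm_neg, norm_real, Real.norm_eq_abs, sub_neg_eq_add] at this
          linarith
      _ = ‖nodalField u ψ g z + (u z : ℂ) * (starRingEnd ℂ) (g z)‖ := by
          rw [← h1, norm_mul, RCLike.norm_conj]
      _ ≤ _ := by
          refine (norm_add_le _ _).trans ?_
          rw [norm_mul, RCLike.norm_conj, norm_real, Real.norm_eq_abs]
  linarith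

theorem mem_cthickening_zeros {u : ℂ → ℝ} (hu : Continuous u) {δ : ℝ} (hδ : 0 ≤ δ) {y : ℂ} :
    y ∈ cthickening δ {z | u z = 0} ↔ ∃ x, u x = 0 ∧ dist y x ≤ δ := by
  rw [(isClosed_eq hu continuous_const).cthickening_eq_biUnion_closedBall hδ]
  simp

theorem exists_cutoff_near_zeros {u : ℂ → ℝ} (hu : Continuous u) {R : ℝ} (hR : 2 < R) :
    ∃ χ : ℂ → ℂ, ContDiff ℝ 2 χ ∧ (∀ z ∈ removed u R, χ z = 0) ∧
      ∀ y, ‖y‖ ≤ R / 2 → y ∈ cthickening (12 / 5) {z | u z = 0} → ∀ z ∈ ball y (2 / 5), χ z = 1 := by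
  have hT : IsClosed (closedBall (0 : ℂ) (R / 2 + 1) ∩ cthickening (29 / 10) {z | u z = 0}) :=
    isClosed_closedBall.inter isClosed_cthickening
  have hd : Disjoint (removed u R)
      (closedBall (0 : ℂ) (R / 2 + 1) ∩ cthickening (29 / 10) {z | u z = 0}) := by
    rw [Set.disjoint_left]
    rintro z (hz | hz) ⟨h1, h2⟩
    · obtain ⟨x, hx, hzx⟩ := mem_cthickening_zeroFree.1 hz
      obtain ⟨p, hp, hzp⟩ := (mem_cthickening_zeros hu (by norm_num)).1 h2
      refine hx p ?_ hp
      rw [mem_ball]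
      have := dist_triangle p z x
      rw [dist_comm p z] at this
      linarith
    · rw [mem_closedBall_zero_iff] at h1
      have hz' : R ≤ ‖z‖ := hz
      linarith
  obtain ⟨f, hf0, hf1, -⟩ := exists_contMDiffMap_zero_one_of_isClosed (n := 2) (modelWithCornersSelf ℝ ℂ)
    (isClosed_removed u R) hT hd
  refine ⟨fun z => f z, contDiff_ofReal_comp f.contMDiff.contDiff, fun z hz => ?_,
    fun y hy hy0 z hz => ?_⟩
  · simp [hf0 hz]
  · rw [mem_ball] at hz
    have : f z = 1 := hf1 (by
      constructor
      · rw [mem_closedBall_zero_iff]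
        rw [dist_eq_norm] at hz
        have := norm_sub_norm_le z y
        linarith
      · obtain ⟨p, hp, hzp⟩ := (mem_cthickening_zeros hu (by norm_num)).1 hy0
        refine (mem_cthickening_zeros hu (by norm_num)).2 ⟨p, hp, ?_⟩
        linarith [dist_triangle z y p])
    simp [this]

/-- Near its zeros, the gradient of `u` is controlled by a holomorphic function. -/
theorem exists_holomorphic_near_zeros : ∃ δ > 0, ∃ C > 0, ∀ u : ℂ → ℝ, ContDiff ℝ 2 u → ∀ R ε : ℝ,
    10 ≤ R → 0 < ε → ε ^ 2 * (1 + Real.log R) ≤ δ →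
    (∀ z, ‖z‖ ≤ 2 * R → |planeLaplacian u z| ≤ ε ^ 2 * |u z|) → ∃ g s H : ℂ → ℂ,
    (∀ z, ‖s z‖ ≤ R) ∧ (∀ z ζ, ‖z‖ ≤ R → ‖ζ - z‖ ≤ 1 → ‖s ζ - s z‖ ≤ 1) ∧
    (∀ y, ‖y‖ ≤ R / 2 → y ∈ cthickening (12 / 5) {z | u z = 0} → DifferentiableAt ℂ H y ∧
      ∀ m, 0 ≤ m → (∀ z ∈ ball y (7 / 5), |u z| ≤ m) → ‖H y‖ ≤ C * Real.exp (-(s y).re) * m) ∧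
    (∀ᵐ y, ‖y‖ ≤ R / 2 → y ∈ cthickening (12 / 5) {z | u z = 0} →
      ‖gr u y‖ ≤ 2 * (Real.exp (s y).re * ‖H y‖ + |u y| * ‖g y‖)) ∧
    ∀ z, ∫⁻ ζ in ball z 1, ENNReal.ofReal (‖g ζ‖ * ‖ζ - z‖⁻¹) ≤ ENNReal.ofReal (C * ε ^ 2) := by
  obtain ⟨C1, hC1, h1⟩ := exists_holomorphic_factor
  obtain ⟨C2, hC2, h2⟩ := exists_holomorphic_bound
  obtain ⟨C3, hC3, h3⟩ := exists_lintegral_grad_le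
  refine ⟨min (1 / C1) (1 / 10 ^ 8), by positivity, C2 + C3, by positivity,
    fun u hu R ε hR hε hδ hL => ?_⟩
  have hlog : 0 ≤ Real.log R := Real.log_nonneg (by linarith)
  have hε2 : ε ^ 2 ≤ ε ^ 2 * (1 + Real.log R) := le_mul_of_one_le_right (by positivity) (by linarith)
  have hε3 : C1 * (ε ^ 2 * (1 + Real.log R)) ≤ 1 := by
    calc _ ≤ C1 * (1 / C1) := by
          gcongr
          exact hδ.trans (min_le_left _ _)
      _ = 1 := by field_simp
  have hε4 : ε ≤ 1 / 10 ^ 4 := by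
    refine abs_le_of_sq_le_sq' ((hε2.trans (hδ.trans (min_le_right _ _))).trans ?_) (by norm_num) |>.2
    norm_num
  have hε5 : C1 * ε ^ 2 ≤ 1 := (mul_le_mul_of_nonneg_left hε2 hC1.le).trans hε3
  have hε6 : ε ^ 2 ≤ 1 := by nlinarith
  obtain ⟨V, ψ, g, h, hV⟩ := exists_corrector hu (by linarith) hε hε4 hL
  obtain ⟨hψ, s, hs, hosc, hχ⟩ := h1 _ (removed u R) R ε V ψ u g h (by linarith) hε5 hu
    (fun z hz => hz) hV fun z hz => Or.inr hz
  obtain ⟨χ, hχ2, hχ0, hχ1⟩ := exists_cutoff_near_zeros hu.continuous (R := R) (by linarith)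
  obtain ⟨H, hH, hHU⟩ := hχ χ hχ2 hχ0
  have hosc' : ∀ z ζ, ‖z‖ ≤ R → ‖ζ - z‖ ≤ 1 → ‖s ζ - s z‖ ≤ 1 := fun z ζ hz hζ =>
    (hosc z ζ hz hζ).trans (by rwa [mul_assoc])
  refine ⟨g, s, H, fun z => (hs z).trans (mul_le_of_le_one_left (by linarith) hε5), hosc',
    fun y hy hy0 => ?_, ?_, fun z => (h3 _ R ε V ψ g h z).trans (ENNReal.ofReal_le_ofReal ?_)⟩
  · have hD := hHU (ball y (2 / 5)) isOpen_ball (hχ1 y hy hy0)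
    refine ⟨hD.differentiableAt (ball_mem_nhds y (by norm_num)), fun m hm hum => ?_⟩
    have := h2 _ R ε V ψ u g s H h hu hψ y m hm (fun z hz => ⟨hum z hz, ?_⟩)
      (fun z hz => hosc' y z (by linarith) hz) hD ?_
    · refine this.trans ?_
      gcongr
      linarith
    · have hz' : ‖z‖ ≤ 2 * R := by
        rw [mem_ball, dist_eq_norm] at hz
        have := norm_sub_norm_le z y
        linarith
      exact (hL z hz').trans ((mul_le_of_le_one_left (abs_nonneg _) hε6).trans (hum z hz))
    · filter_upwards [hH] with z hz hzb
      rw [← hz, hχ1 y hy hy0 z hzb, one_mul]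
  · filter_upwards [hψ, hH] with y hyψ hyH hy hy0
    rw [← hyH, hχ1 y hy hy0 y (mem_ball_self (by norm_num)), one_mul, norm_mul, norm_exp, ← mul_assoc,
      neg_re, ← Real.exp_add, add_neg_cancel, Real.exp_zero, one_mul]
    exact norm_gr_le_nodalField hyψ
  · gcongr
    linarith

theorem norm_pow_le_decay {z ζ : ℂ} {R ρ : ℝ} {k : ℕ} (hz : 0 < ‖z‖) (hzR : ‖z‖ ≤ R / 2)
    (hρ : 0 ≤ ρ) (h : ‖ζ‖ ≤ ‖z‖ - ρ / 2) : ‖ζ‖ ^ k ≤ ‖z‖ ^ k * Real.exp (-(k / R * ρ)) := by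
  have h1 : ‖ζ‖ ≤ ‖z‖ * Real.exp (-(ρ / R)) := by
    have h2 : ρ / R ≤ ρ / 2 / ‖z‖ := by
      rw [div_div]
      gcongr
      linarith
    have h3 := Real.add_one_le_exp (-(ρ / R))
    calc ‖ζ‖ ≤ ‖z‖ - ρ / 2 := h
      _ = ‖z‖ * (1 - ρ / 2 / ‖z‖) := by field_simp
      _ ≤ ‖z‖ * Real.exp (-(ρ / R)) := by
        gcongr
        linarith
  calc ‖ζ‖ ^ k ≤ (‖z‖ * Real.exp (-(ρ / R))) ^ k := by gcongr
    _ = _ := by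
      rw [mul_pow, ← Real.exp_nat_mul]
      congr 2
      ring

theorem norm_le_near_zeros {u : ℂ → ℝ} {H s : ℂ → ℂ} {R C1 C2 M0 δ0 ν : ℝ} {k : ℕ}
    (hR : 10 ≤ R) (hC1 : 0 < C1) (hC2 : 0 ≤ C2) (hM0 : 0 ≤ M0) (hδ0 : 0 ≤ δ0) (hν : 0 ≤ ν)
    (hH : ∀ y, ‖y‖ ≤ R / 2 → y ∈ cthickening (12 / 5) {z | u z = 0} → DifferentiableAt ℂ H y ∧
      ∀ m, 0 ≤ m → (∀ z ∈ ball y (7 / 5), |u z| ≤ m) → ‖H y‖ ≤ C1 * Real.exp (-(s y).re) * m)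
    (hs : ∀ z, ‖s z‖ ≤ R)
    (hz : ∀ y, ‖y‖ ≤ R / 2 → (∀ z ∈ ball y (12 / 5), u z ≠ 0) → ∀ x ∈ ball y (7 / 5), |u x| ≤ C2 * |u y|)
    (h0 : ∀ z ∈ ball (0 : ℂ) 5, |u z| ≤ δ0) (hM : ∀ z, ‖z‖ ≤ R → |u z| ≤ M0)
    (hq : ∀ z, 1 ≤ ‖z‖ → ‖z‖ ≤ R / 2 → |u z| ≤ ν * (‖z‖ ^ k * Real.exp (s z).re))
    {y : ℂ} (hy1 : 1 < ‖y‖) (hyR : ‖y‖ < R / 2) (hy : y ∈ thickening (12 / 5) {z | u z = 0}) :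
    ‖H y‖ ≤ C1 * (Real.exp R * (M0 * ((R / 2) ^ k)⁻¹ + δ0) + C2 * ν) * ‖y‖ ^ k := by
  let G : Set ℂ := (ball 0 (R / 2) ∩ {z | 1 < ‖z‖}) ∩ thickening (12 / 5) {z | u z = 0}
  have hGo : IsOpen G := (isOpen_ball.inter (isOpen_lt continuous_const continuous_norm)).inter
    isOpen_thickening
  have hGb : Bornology.IsBounded G := isBounded_ball.subset (inter_subset_left.trans inter_subset_left)
  have hGc : ∀ x ∈ closure G, 1 ≤ ‖x‖ ∧ ‖x‖ ≤ R / 2 ∧ x ∈ cthickening (12 / 5) {z | u z = 0} := by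
    intro x hx
    refine ⟨?_, ?_, ?_⟩
    · exact closure_minimal (fun w hw => le_of_lt hw.1.2) (isClosed_le continuous_const continuous_norm) hx
    · refine closure_minimal (fun w hw => ?_) (isClosed_le continuous_norm continuous_const) hx
      exact (mem_ball_zero_iff.1 hw.1.1).le
    · exact closure_thickening_subset_cthickening _ _ (closure_mono inter_subset_right hx)
  have hD : DiffContOnCl ℂ (fun y => H y * (y ^ k)⁻¹) G := by
    refine DifferentiableOn.diffContOnCl fun x hx => ?_
    obtain ⟨a1, a2, a3⟩ := hGc x hx
    have : x ≠ 0 := norm_pos_iff.1 (by linarith)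
    exact ((hH x a2 a3).1.mul ((differentiableAt_id.pow k).inv (pow_ne_zero k this))).differentiableWithinAt
  have hes : ∀ x, -(s x).re ≤ R := fun x =>
    (neg_le_abs _).trans ((abs_re_le_norm _).trans (hs x))
  have hRk : 0 < (R / 2) ^ k := by positivity
  have key := Complex.norm_le_of_forall_mem_frontier_norm_le hGb hD
    (C := C1 * (Real.exp R * (M0 * ((R / 2) ^ k)⁻¹ + δ0) + C2 * ν)) ?_
    (subset_closure (⟨⟨mem_ball_zero_iff.2 hyR, hy1⟩, hy⟩ : y ∈ G))
  · have hyk : 0 < ‖y‖ ^ k := by positivity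
    rwa [norm_mul, norm_inv, norm_pow, ← div_eq_mul_inv, div_le_iff₀ hyk] at key
  intro x hx
  have hxc := frontier_subset_closure hx
  obtain ⟨a1, a2, a3⟩ := hGc x hxc
  have hxG : x ∉ G := by
    rw [hGo.frontier_eq] at hx
    exact hx.2
  have hHx := (hH x a2 a3).2
  have hxk : 0 < ‖x‖ ^ k := by positivity
  have hexp := Real.exp_pos R
  rw [norm_mul, norm_inv, norm_pow, ← div_eq_mul_inv, div_le_iff₀ hxk]
  rcases a1.eq_or_lt with b1 | b1
  · rw [← b1, one_pow, mul_one]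
    calc ‖H x‖ ≤ C1 * Real.exp (-(s x).re) * δ0 := hHx δ0 hδ0 fun z hz => h0 z (by
          rw [mem_ball, dist_eq_norm] at hz
          rw [mem_ball_zero_iff]
          have := norm_sub_norm_le z x
          linarith)
      _ ≤ C1 * Real.exp R * δ0 := by
        gcongr
        exact hes x
      _ = C1 * (Real.exp R * (0 + δ0) + 0) := by ring
      _ ≤ _ := by gcongr <;> positivity
  rcases a2.eq_or_lt with b2 | b2
  · rw [b2]
    calc ‖H x‖ ≤ C1 * Real.exp (-(s x).re) * M0 := hHx M0 hM0 fun z hz => hM z (by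
          rw [mem_ball, dist_eq_norm] at hz
          have := norm_sub_norm_le z x
          linarith)
      _ ≤ C1 * Real.exp R * M0 := by
        gcongr
        exact hes x
      _ = C1 * (Real.exp R * (M0 * ((R / 2) ^ k)⁻¹ + 0) + 0) * (R / 2) ^ k := by field_simp; ring
      _ ≤ _ := by gcongr; positivity
  · have hxt : x ∉ thickening (12 / 5) {z | u z = 0} := fun h => hxG ⟨⟨mem_ball_zero_iff.2 b2, b1⟩, h⟩
    have hzf : ∀ z ∈ ball x (12 / 5), u z ≠ 0 := fun z hz hz0 => hxt
      (mem_thickening_iff.2 ⟨z, hz0, by rw [dist_comm]; exact hz⟩)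
    calc ‖H x‖ ≤ C1 * Real.exp (-(s x).re) * (C2 * |u x|) :=
          hHx _ (by positivity) (hz x a2 hzf)
      _ ≤ C1 * Real.exp (-(s x).re) * (C2 * (ν * (‖x‖ ^ k * Real.exp (s x).re))) := by
        gcongr
        exact hq x a1 a2
      _ = C1 * (C2 * ν) * ‖x‖ ^ k * (Real.exp (-(s x).re) * Real.exp (s x).re) := by ring
      _ = C1 * (0 + C2 * ν) * ‖x‖ ^ k := by
        rw [← Real.exp_add, neg_add_cancel, Real.exp_zero]
        ring
      _ ≤ _ := by gcongr; positivity

/-- One step of the bootstrap for the weighted maximum. -/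
theorem abs_le_weighted {u : ℂ → ℝ} (hu : ContDiff ℝ 1 u) {g s H : ℂ → ℂ} {R C1 C2 M ν ε : ℝ} {k : ℕ}
    (hR : 10 ≤ R) (hk : 0 < k) (hC1 : 0 < C1) (hC2 : 0 ≤ C2) (hν : 0 ≤ ν) (hM : 0 ≤ M)
    (hosc : ∀ z ζ, ‖z‖ ≤ R → ‖ζ - z‖ ≤ 1 → ‖s ζ - s z‖ ≤ 1)
    (hgr : ∀ᵐ y, ‖y‖ ≤ R / 2 → y ∈ cthickening (12 / 5) {z | u z = 0} →
      ‖gr u y‖ ≤ 2 * (Real.exp (s y).re * ‖H y‖ + |u y| * ‖g y‖))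
    (hg : ∀ z, ∫⁻ ζ in ball z 1, ENNReal.ofReal (‖g ζ‖ * ‖ζ - z‖⁻¹) ≤ ENNReal.ofReal (C1 * ε ^ 2))
    (hz : ∀ y, ‖y‖ ≤ R / 2 → (∀ z ∈ ball y (12 / 5), u z ≠ 0) → ‖gr u y‖ ≤ C2 * |u y|)
    (hH : ∀ y, 1 < ‖y‖ → ‖y‖ < R / 2 → y ∈ thickening (12 / 5) {z | u z = 0} → ‖H y‖ ≤ M * ‖y‖ ^ k)
    (hq : ∀ z, 1 ≤ ‖z‖ → ‖z‖ ≤ R / 2 → |u z| ≤ ν * (‖z‖ ^ k * Real.exp (s z).re))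
    {z : ℂ} (hz3 : 3 ≤ ‖z‖) (hzR : ‖z‖ ≤ R / 2) :
    |u z| ≤ (Real.exp 1 * (Real.exp (-(k / R)) * ν + 12 * ((2 * M + C2 * ν) / (k / R) +
      2 * ν * (C1 * ε ^ 2)))) * (‖z‖ ^ k * Real.exp (s z).re) := by
  set W := ‖z‖ ^ k * Real.exp (s z).re with hW
  have hW0 : 0 ≤ W := by positivity
  have hk' : (0 : ℝ) < k := by exact_mod_cast hk
  have hL : 0 < k / R := by positivity
  have hexp : ∀ ζ, ‖ζ - z‖ ≤ 1 → Real.exp (s ζ).re ≤ Real.exp 1 * Real.exp (s z).re := fun ζ hζ => by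
    rw [← Real.exp_add]
    gcongr
    have := (le_abs_self _).trans ((abs_re_le_norm (s ζ - s z)).trans (hosc z ζ (by linarith) hζ))
    rw [sub_re] at this
    linarith
  have hdec : ∀ ζ, ‖ζ - z‖ ≤ 1 → ‖ζ‖ ≤ ‖z‖ - ‖ζ - z‖ / 2 →
      ‖ζ‖ ^ k * Real.exp (s ζ).re ≤ Real.exp (-(k / R * ‖ζ - z‖)) * (Real.exp 1 * W) := by
    intro ζ h1 h2
    have := norm_pow_le_decay (k := k) (by linarith) hzR (norm_nonneg _) h2
    calc _ ≤ (‖z‖ ^ k * Real.exp (-(k / R * ‖ζ - z‖))) * (Real.exp 1 * Real.exp (s z).re) := by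
          gcongr
          exact hexp ζ h1
      _ = _ := by
        rw [hW]
        ring
  have hone : ∀ ζ, ‖ζ - z‖ ≤ 1 → 1 < ‖ζ‖ := fun ζ hζ => by
    have := norm_sub_norm_le z ζ
    rw [norm_sub_rev] at this
    linarith
  have huζ : ∀ ζ, ‖ζ - z‖ ≤ 1 → ‖ζ‖ ≤ ‖z‖ - ‖ζ - z‖ / 2 →
      |u ζ| ≤ Real.exp (-(k / R * ‖ζ - z‖)) * (Real.exp 1 * W * ν) := by
    intro ζ h1 h2
    have h3 := norm_nonneg (ζ - z)
    refine (hq ζ (hone ζ h1).le (by linarith)).trans ?_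
    calc _ ≤ ν * (Real.exp (-(k / R * ‖ζ - z‖)) * (Real.exp 1 * W)) :=
          mul_le_mul_of_nonneg_left (hdec ζ h1 h2) hν
      _ = _ := by ring
  have key := abs_le_of_sector hu hz3 (g := g) (a := Real.exp (-(k / R)) * (Real.exp 1 * W * ν))
    (b := Real.exp 1 * W * (2 * M + C2 * ν)) (d := Real.exp 1 * W * (2 * ν)) (L := k / R)
    (E := C1 * ε ^ 2) (by positivity) (by positivity) hL (by positivity) ?_ ?_ (hg z)
  · refine key.trans (le_of_eq ?_)
    ring
  · intro ζ h1 h2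
    have := huζ ζ h1.le (by rwa [h1])
    rwa [h1, mul_one] at this
  · have hne : ∀ᵐ ζ : ℂ, ζ ≠ z := by
      rw [ae_iff]
      simp
    filter_upwards [hgr, hne] with ζ hζ hζz h1 h2
    have h3 : 0 < ‖ζ - z‖ := norm_pos_iff.2 (sub_ne_zero.2 hζz)
    have hζR : ‖ζ‖ < R / 2 := by linarith
    have hE : Real.exp (-(k / R * ‖ζ - z‖)) ≤ 1 := Real.exp_le_one_iff.2 (by
      rw [neg_nonpos]
      positivity)
    have hu1 := huζ ζ h1.le h2
    have hd := hdec ζ h1.le h2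
    by_cases ht : ζ ∈ thickening (12 / 5) {z | u z = 0}
    · have hHζ := hH ζ (hone ζ h1.le) hζR ht
      have hu2 : |u ζ| ≤ Real.exp 1 * W * ν := hu1.trans (mul_le_of_le_one_left (by positivity) hE)
      calc ‖gr u ζ‖ ≤ 2 * (Real.exp (s ζ).re * ‖H ζ‖ + |u ζ| * ‖g ζ‖) :=
            hζ hζR.le (thickening_subset_cthickening _ _ ht)
        _ ≤ 2 * (Real.exp (s ζ).re * (M * ‖ζ‖ ^ k) + Real.exp 1 * W * ν * ‖g ζ‖) := by gcongr
        _ = 2 * M * (‖ζ‖ ^ k * Real.exp (s ζ).re) + Real.exp 1 * W * (2 * ν) * ‖g ζ‖ := by ring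
        _ ≤ (2 * M + C2 * ν) * (Real.exp (-(k / R * ‖ζ - z‖)) * (Real.exp 1 * W)) +
            Real.exp 1 * W * (2 * ν) * ‖g ζ‖ := by
          gcongr
          have : 0 ≤ C2 * ν := by positivity
          linarith
        _ = _ := by ring
    · have hzf : ∀ w ∈ ball ζ (12 / 5), u w ≠ 0 := fun w hw hw0 => ht
        (mem_thickening_iff.2 ⟨w, hw0, by rw [dist_comm]; exact hw⟩)
      calc ‖gr u ζ‖ ≤ C2 * |u ζ| := hz ζ hζR.le hzf
        _ ≤ C2 * (Real.exp (-(k / R * ‖ζ - z‖)) * (Real.exp 1 * W * ν)) := by gcongr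
        _ = Real.exp (-(k / R * ‖ζ - z‖)) * (Real.exp 1 * W * (0 + C2 * ν)) + 0 := by ring
        _ ≤ _ := by gcongr <;> positivity

/-- A three-balls type inequality for solutions of a Schrödinger equation with small potential. -/
theorem exists_annulus_bound : ∃ δ > 0, ∃ K ≥ (1 : ℝ), ∀ u : ℂ → ℝ, ContDiff ℝ 2 u → ∀ R ε : ℝ,
    10 ≤ R → 0 < ε → ε ^ 2 * (1 + Real.log R) ≤ δ →
    (∀ z, ‖z‖ ≤ 2 * R → |planeLaplacian u z| ≤ ε ^ 2 * |u z|) → ∀ k : ℕ, K * R ≤ k →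
    ∀ M0 δ0 : ℝ, (∀ z ∈ ball (0 : ℂ) 5, |u z| ≤ δ0) → (∀ z, ‖z‖ ≤ R → |u z| ≤ M0) →
    ∀ z, 1 ≤ ‖z‖ → ‖z‖ ≤ R / 2 →
      |u z| ≤ 2 * Real.exp (2 * R) * ‖z‖ ^ k * (M0 * ((R / 2) ^ k)⁻¹ + δ0) := by
  obtain ⟨δ, hδ, C1, hC1, h1⟩ := exists_holomorphic_near_zeros
  obtain ⟨C2, hC2, h2⟩ := exists_zeroFree_bound
  have hC2' : 0 < C2 := by linarith
  set T := 1 + 24 * C1 + 24 * (C1 * C2) + 12 * C2 with hT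
  have hT1 : 1 ≤ T := by
    have : 0 < C1 * C2 := by positivity
    linarith
  refine ⟨min δ (min 1 (1 / (288 * C1))), by positivity, 12 * T, by linarith,
    fun u hu R ε hR hε hεδ hL k hk M0 δ0 h0 hM => ?_⟩
  have hR0 : 0 < R := by linarith
  have hlog : 0 ≤ Real.log R := Real.log_nonneg (by linarith)
  have hε2 : ε ^ 2 ≤ ε ^ 2 * (1 + Real.log R) := le_mul_of_one_le_right (by positivity) (by linarith)
  have hε1 : ε ^ 2 ≤ 1 := hε2.trans (hεδ.trans ((min_le_right _ _).trans (min_le_left _ _)))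
  have hεC : C1 * ε ^ 2 ≤ 1 / 288 := by
    calc C1 * ε ^ 2 ≤ C1 * (1 / (288 * C1)) := by
          gcongr
          exact hε2.trans (hεδ.trans ((min_le_right _ _).trans (min_le_right _ _)))
      _ = 1 / 288 := by field_simp
  obtain ⟨g, s, H, hs, hosc, hH, hgr, hg⟩ := h1 u hu R ε hR hε (hεδ.trans (min_le_left _ _)) hL
  have hM0 : 0 ≤ M0 := (abs_nonneg _).trans (hM 0 (by simpa using hR0.le))
  have hδ0 : 0 ≤ δ0 := (abs_nonneg _).trans (h0 0 (mem_ball_self (by norm_num)))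
  have hzf : ∀ y, ‖y‖ ≤ R / 2 → (∀ z ∈ ball y (12 / 5), u z ≠ 0) →
      (∀ x ∈ ball y (7 / 5), |u x| ≤ C2 * |u y|) ∧ ‖gr u y‖ ≤ C2 * |u y| := by
    intro y hy h
    refine h2 u hu y h fun z hz => (hL z ?_).trans (mul_le_of_le_one_left (abs_nonneg _) hε1)
    rw [mem_ball, dist_eq_norm] at hz
    have := norm_sub_norm_le z y
    linarith
  have hkR : 12 * T ≤ k / R := by rwa [le_div_iff₀ hR0]
  have hL0 : 0 < k / R := by linarith
  have hk0 : 0 < k := by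
    have : (0 : ℝ) < k := by
      have : 0 < 12 * T * R := by positivity
      linarith
    exact_mod_cast this
  let A : Set ℂ := {z | 1 ≤ ‖z‖ ∧ ‖z‖ ≤ R / 2}
  let q : ℂ → ℝ := fun z => |u z| / (‖z‖ ^ k * Real.exp (s z).re)
  have hre : ∀ z, |(s z).re| ≤ R := fun z => (abs_re_le_norm _).trans (hs z)
  have hW : ∀ z ∈ A, 0 < ‖z‖ ^ k * Real.exp (s z).re := fun z hz => by
    have : 0 < ‖z‖ := by linarith [hz.1]
    positivity
  have hqm : ∀ z ∈ A, ∀ m, |u z| ≤ m → q z ≤ Real.exp R * m := by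
    intro z hz m hm
    rw [div_le_iff₀ (hW z hz)]
    have e1 : 1 ≤ ‖z‖ ^ k := one_le_pow₀ hz.1
    have e2 : 1 ≤ Real.exp R * Real.exp (s z).re := by
      rw [← Real.exp_add]
      exact Real.one_le_exp (by linarith [(abs_le.1 (hre z)).1])
    have hm0 : 0 ≤ m := (abs_nonneg _).trans hm
    calc |u z| ≤ m := hm
      _ = 1 * m * 1 := by ring
      _ ≤ (Real.exp R * Real.exp (s z).re) * m * ‖z‖ ^ k := by gcongr
      _ = _ := by ring
  have hbdd : BddAbove (q '' A) := by
    refine ⟨Real.exp R * M0, ?_⟩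
    rintro _ ⟨z, hz, rfl⟩
    exact hqm z hz M0 (hM z (by linarith [hz.2]))
  set ν := sSup (q '' A) with hνdef
  have hqν : ∀ z ∈ A, q z ≤ ν := fun z hz => le_csSup hbdd ⟨z, hz, rfl⟩
  have h1A : (1 : ℂ) ∈ A := by
    constructor
    · rw [norm_one]
    · rw [norm_one]
      linarith
  have hν : 0 ≤ ν := le_trans (by positivity) (hqν 1 h1A)
  have hq : ∀ z, 1 ≤ ‖z‖ → ‖z‖ ≤ R / 2 → |u z| ≤ ν * (‖z‖ ^ k * Real.exp (s z).re) := by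
    intro z hz1 hz2
    have := hqν z ⟨hz1, hz2⟩
    rwa [div_le_iff₀ (hW z ⟨hz1, hz2⟩)] at this
  set N0 := Real.exp R * (M0 * ((R / 2) ^ k)⁻¹ + δ0) with hN0
  have hN0' : 0 ≤ N0 := by positivity
  have hHb : ∀ y, 1 < ‖y‖ → ‖y‖ < R / 2 → y ∈ thickening (12 / 5) {z | u z = 0} →
      ‖H y‖ ≤ C1 * (N0 + C2 * ν) * ‖y‖ ^ k := fun y hy1 hy2 hy =>
    norm_le_near_zeros hR hC1 hC2'.le hM0 hδ0 hν hH hs (fun y hy h => (hzf y hy h).1)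
      h0 hM hq hy1 hy2 hy
  have hstep : ∀ z ∈ A, q z ≤ ν / 2 + N0 := by
    intro z hz
    rcases le_or_gt 3 ‖z‖ with hz3 | hz3
    · rw [div_le_iff₀ (hW z hz)]
      refine (abs_le_weighted (hu.of_le (by norm_num)) hR hk0 hC1 hC2'.le hν (by positivity) hosc hgr hg
        (fun y hy h => (hzf y hy h).2) hHb hq hz3 hz.2).trans ?_
      refine mul_le_mul_of_nonneg_right ?_ (hW z hz).le
      have e1 : Real.exp (-(k / R)) ≤ 1 / (k / R) := by
        rw [Real.exp_neg, ← one_div]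
        refine one_div_le_one_div_of_le hL0 ?_
        linarith [Real.add_one_le_exp (k / R)]
      have e2 : Real.exp 1 ≤ 3 := Real.exp_one_lt_three.le
      have e3 : Real.exp (-(k / R)) * ν + 12 * ((2 * (C1 * (N0 + C2 * ν)) + C2 * ν) / (k / R) +
          2 * ν * (C1 * ε ^ 2)) ≤ (N0 + ν) / 12 + ν / 12 := by
        have e4 : (T * (N0 + ν)) / (k / R) ≤ (N0 + ν) / 12 := by
          rw [div_le_iff₀ hL0]
          calc T * (N0 + ν) = (N0 + ν) / 12 * (12 * T) := by ring
            _ ≤ _ := by gcongr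
        have e5 : 24 * ν * (C1 * ε ^ 2) ≤ 24 * ν * (1 / 288) := by gcongr
        have e6 : Real.exp (-(k / R)) * ν + 12 * ((2 * (C1 * (N0 + C2 * ν)) + C2 * ν) / (k / R)) ≤
            (T * (N0 + ν)) / (k / R) := by
          calc _ ≤ 1 / (k / R) * ν + 12 * ((2 * (C1 * (N0 + C2 * ν)) + C2 * ν) / (k / R)) := by gcongr
            _ = (ν + 24 * C1 * N0 + 24 * (C1 * C2) * ν + 12 * C2 * ν) / (k / R) := by ring
            _ ≤ _ := by
              gcongr
              rw [hT]
              have a1 : 0 ≤ C1 * ν := by positivity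
              have a2 : 0 ≤ C1 * C2 * N0 := by positivity
              have a3 : 0 ≤ C2 * N0 := by positivity
              nlinarith
        linarith
      calc _ ≤ 3 * ((N0 + ν) / 12 + ν / 12) := by gcongr
        _ ≤ _ := by linarith
    · refine (hqm z hz δ0 (h0 z (by rw [mem_ball_zero_iff]; linarith))).trans ?_
      have : Real.exp R * δ0 ≤ N0 := by
        rw [hN0]
        gcongr
        exact le_add_of_nonneg_left (by positivity)
      linarith
  have hν2 : ν ≤ 2 * N0 := by
    have : ν ≤ ν / 2 + N0 := csSup_le ⟨_, ⟨1, h1A, rfl⟩⟩ (by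
      rintro _ ⟨z, hz, rfl⟩
      exact hstep z hz)
    linarith
  intro z hz1 hz2
  calc |u z| ≤ ν * (‖z‖ ^ k * Real.exp (s z).re) := hq z hz1 hz2
    _ ≤ (2 * N0) * (‖z‖ ^ k * Real.exp R) := by
      gcongr
      exact (le_abs_self _).trans (hre z)
    _ = _ := by
      rw [hN0, two_mul R, Real.exp_add]
      ring

theorem exists_vanishing_bound : ∃ δ > 0, ∀ c₁ : ℝ, 0 ≤ c₁ → ∃ C > 0, ∀ u : ℂ → ℝ, ContDiff ℝ 2 u →
    ∀ R ε : ℝ, 10 ≤ R → 0 < ε → ε ^ 2 * (1 + Real.log R) ≤ δ →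
    (∀ z, ‖z‖ ≤ 2 * R → |planeLaplacian u z| ≤ ε ^ 2 * |u z|) →
    (∀ z, ‖z‖ ≤ R → |u z| ≤ Real.exp (c₁ * R)) → ∀ z₁, 1 ≤ ‖z₁‖ → ‖z₁‖ ≤ R / 4 → |u z₁| = 1 →
    ∀ δ₀ : ℝ, (∀ z ∈ ball (0 : ℂ) 5, |u z| ≤ δ₀) → Real.exp (-(C * (R * Real.log R))) ≤ δ₀ := by
  obtain ⟨δ, hδ, K, hK, h⟩ := exists_annulus_bound
  refine ⟨δ, hδ, fun c₁ hc₁ => ⟨K + 2 * (3 + c₁) + 4, by positivity,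
    fun u hu R ε hR hε hεδ hL hM z₁ hz1 hzR huz δ₀ h0 => ?_⟩⟩
  set K' := K + 2 * (3 + c₁) with hK'
  have hR0 : 0 < R := by linarith
  set k := ⌈K' * R⌉₊ with hk
  have hk1 : K' * R ≤ k := Nat.le_ceil _
  have hk2 : k ≤ (K' + 1) * R := by
    have := (Nat.ceil_lt_add_one (by positivity : 0 ≤ K' * R)).le
    linarith
  have hKR : K * R ≤ k := le_trans (by gcongr; linarith) hk1
  have key := h u hu R ε hR hε hεδ hL k hKR _ δ₀ h0 hM z₁ hz1 (by linarith)
  have hδ₀ : 0 ≤ δ₀ := (abs_nonneg _).trans (h0 0 (mem_ball_self (by norm_num)))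
  have hlog : 1 ≤ Real.log R := by
    rw [Real.le_log_iff_exp_le hR0]
    linarith [Real.exp_one_lt_three]
  have e4 : 4 ≤ Real.exp R := by linarith [Real.add_one_le_exp R]
  have hfirst : 2 * Real.exp (2 * R) * ‖z₁‖ ^ k * (Real.exp (c₁ * R) * ((R / 2) ^ k)⁻¹) ≤ 1 / 2 := by
    have h1 : ‖z₁‖ ^ k * ((R / 2) ^ k)⁻¹ ≤ Real.exp (-(k / 2)) := by
      rw [← inv_pow, ← mul_pow]
      have h2 : ‖z₁‖ * (R / 2)⁻¹ ≤ Real.exp (-(1 / 2)) := by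
        have := Real.add_one_le_exp (-(1 / 2) : ℝ)
        calc ‖z₁‖ * (R / 2)⁻¹ ≤ R / 4 * (R / 2)⁻¹ := by gcongr
          _ = 1 / 2 := by field_simp; norm_num
          _ ≤ _ := by linarith
      calc _ ≤ Real.exp (-(1 / 2)) ^ k := by gcongr
        _ = _ := by
          rw [← Real.exp_nat_mul]
          congr 1
          ring
    have h3 : 4 * (Real.exp (2 * R) * (Real.exp (c₁ * R) * Real.exp (-(k / 2)))) ≤ 1 := by
      calc _ ≤ Real.exp R * (Real.exp (2 * R) * (Real.exp (c₁ * R) * Real.exp (-(k / 2)))) := by gcongr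
        _ = Real.exp (R + (2 * R + (c₁ * R + -(k / 2)))) := by simp only [Real.exp_add]
        _ ≤ 1 := by
          rw [Real.exp_le_one_iff]
          rw [hK'] at hk1
          have : 0 ≤ K * R := by positivity
          linarith
    calc _ = 2 * (Real.exp (2 * R) * (Real.exp (c₁ * R) * (‖z₁‖ ^ k * ((R / 2) ^ k)⁻¹))) := by ring
      _ ≤ 2 * (Real.exp (2 * R) * (Real.exp (c₁ * R) * Real.exp (-(k / 2)))) := by gcongr
      _ ≤ 1 / 2 := by linarith
  have hsecond : 1 / 2 ≤ 2 * Real.exp (2 * R) * ‖z₁‖ ^ k * δ₀ := by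
    rw [huz, mul_add] at key
    linarith
  have hRk : R ^ k = Real.exp (k * Real.log R) := by
    rw [Real.exp_nat_mul, Real.exp_log hR0]
  have h5 : 1 ≤ Real.exp ((K' + 4) * (R * Real.log R)) * δ₀ := by
    calc (1 : ℝ) ≤ 4 * (Real.exp (2 * R) * ‖z₁‖ ^ k * δ₀) := by linarith
      _ ≤ Real.exp R * (Real.exp (2 * R) * Real.exp (k * Real.log R) * δ₀) := by
        rw [← hRk]
        gcongr
        linarith
      _ = Real.exp (R + (2 * R + k * Real.log R)) * δ₀ := by
        simp only [Real.exp_add]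
        ring
      _ ≤ _ := by
        gcongr
        have a1 : k * Real.log R ≤ (K' + 1) * R * Real.log R := by gcongr
        have a2 : R ≤ R * Real.log R := le_mul_of_one_le_right hR0.le hlog
        linarith
  rw [Real.exp_neg, inv_le_iff_one_le_mul₀ (Real.exp_pos _), mul_comm]
  exact h5

theorem fderiv_comp_add_mul {f : ℂ → ℝ} (hf : Differentiable ℝ f) (z₀ : ℂ) (t : ℝ) (z v : ℂ) :
    fderiv ℝ (fun w => f (z₀ + t * w)) z v = t * fderiv ℝ f (z₀ + t * z) v := by
  have h1 : HasFDerivAt (fun w : ℂ => z₀ + t * w) (t • ContinuousLinearMap.id ℝ ℂ) z := by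
    have := ((hasFDerivAt_id (𝕜 := ℝ) z).const_smul t).const_add z₀
    simpa [real_smul] using this
  have h2 := (hf (z₀ + t * z)).hasFDerivAt.comp z h1
  have h3 := h2.fderiv
  simp only [Function.comp_def] at h3
  rw [h3]
  simp

theorem planeLaplacian_comp_add_mul {u : ℂ → ℝ} (hu : ContDiff ℝ 2 u) (z₀ : ℂ) (t : ℝ) (z : ℂ) :
    planeLaplacian (fun w => u (z₀ + t * w)) z = t ^ 2 * planeLaplacian u (z₀ + t * z) := by
  have hd : ∀ v : ℂ, Differentiable ℝ fun w => t * fderiv ℝ u w v := fun v =>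
    (((hu.fderiv_right (m := 1) (by norm_num)).clm_apply contDiff_const).differentiable
      (by norm_num)).const_mul t
  have hd' : ∀ v : ℂ, Differentiable ℝ fun w => fderiv ℝ u w v := fun v =>
    ((hu.fderiv_right (m := 1) (by norm_num)).clm_apply contDiff_const).differentiable (by norm_num)
  have h1 : ∀ v : ℂ, (fun w => fderiv ℝ (fun w => u (z₀ + t * w)) w v) =
      fun w => t * fderiv ℝ u (z₀ + t * w) v := fun v => funext fun w =>
    fderiv_comp_add_mul (hu.differentiable (by norm_num)) z₀ t w v
  have h2 : ∀ v : ℂ, fderiv ℝ (fun w => fderiv ℝ (fun w => u (z₀ + t * w)) w v) z v =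
      t ^ 2 * fderiv ℝ (fun w => fderiv ℝ u w v) (z₀ + t * z) v := by
    intro v
    rw [h1, fderiv_comp_add_mul (hd v), fderiv_const_mul (hd' v _)]
    simp
    ring
  rw [planeLaplacian, planeLaplacian, h2, h2]
  ring

end Landis

/-- Theorem 1.1 (Landis-type theorem for potentials with growth):
if `|V(z)| ≤ a₀|z|^N`, `Δu = Vu` on `ℝ²`, `|u(0)| = 1`, and
`|u(z)| ≤ exp(c₀|z|^{1+N/2})`, then for `|z₀| ≥ R₀`,
`sup_{B(z₀,1)} |u| ≥ exp(−C₀|z₀|^{1+N/2} (log|z₀|)^{3/2})`. -/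
theorem landis_growth (N a₀ c₀ : ℝ) (hN : 0 ≤ N) (ha₀ : 0 < a₀) (hc₀ : 0 < c₀) :
    ∃ C₀ > (0:ℝ), ∃ R₀ > (0:ℝ), ∀ (V u : ℂ → ℝ),
      (∀ z : ℂ, |V z| ≤ a₀ * ‖z‖ ^ N) →
      ContDiff ℝ 2 u →
      (∀ z : ℂ, planeLaplacian u z = V z * u z) →
      |u 0| = 1 →
      (∀ z : ℂ, |u z| ≤ Real.exp (c₀ * ‖z‖ ^ (1 + N / 2))) →
      ∀ z₀ : ℂ, R₀ ≤ ‖z₀‖ →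
        Real.exp (-(C₀ * ‖z₀‖ ^ (1 + N / 2) * (Real.log ‖z₀‖) ^ ((3:ℝ) / 2)))
          ≤ sSup ((fun z => |u z|) '' Metric.ball z₀ 1) := by
  obtain ⟨δ, hδ, h⟩ := Landis.exists_vanishing_bound
  obtain ⟨C, hC, h⟩ := h (c₀ * 5 ^ (1 + N / 2)) (by positivity)
  have hD : 0 < a₀ * 9 ^ N * (4 + N / 2) := by positivity
  obtain ⟨c, hc, hc6, hcδ⟩ : ∃ c : ℝ, 0 < c ∧ c ≤ 1 / 6 ∧ c ^ 2 * (a₀ * 9 ^ N * (4 + N / 2)) ≤ δ := by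
    refine ⟨min (1 / 6) (Real.sqrt (δ / (a₀ * 9 ^ N * (4 + N / 2)))), by positivity,
      min_le_left _ _, ?_⟩
    rw [← le_div_iff₀ hD]
    calc _ ≤ Real.sqrt (δ / (a₀ * 9 ^ N * (4 + N / 2))) ^ 2 := by
          gcongr
          exact min_le_right _ _
      _ = _ := Real.sq_sqrt (by positivity)
  refine ⟨C * (4 / c) * (4 + N / 2), by positivity, 3 + 4 / c, by positivity,
    fun V u hV hu hVu hu0 hb z₀ hz₀ => ?_⟩
  set ρ := ‖z₀‖ with hρdef
  have h4c : 0 < 4 / c := by positivity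
  have hρ3 : 3 ≤ ρ := by linarith
  have hρ0 : 0 < ρ := by linarith
  set l := Real.log ρ with hl
  have hl1 : 1 ≤ l := by
    rw [hl, Real.le_log_iff_exp_le hρ0]
    linarith [Real.exp_one_lt_three]
  have hl0 : 0 < l := by linarith
  have hp1 : 1 ≤ ρ ^ (N / 2) := Real.one_le_rpow (by linarith) (by positivity)
  have hs1 : 1 ≤ Real.sqrt l := Real.one_le_sqrt.2 hl1
  set S := ρ ^ (N / 2) * Real.sqrt l with hS
  have hS1 : 1 ≤ S := one_le_mul_of_one_le_of_one_le hp1 hs1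
  set t := c / S with ht
  have ht0 : 0 < t := by positivity
  have ht6 : t ≤ 1 / 6 := (div_le_self hc.le hS1).trans hc6
  set R := 4 * ρ / t with hR
  have htR : t * R = 4 * ρ := by
    rw [hR]
    field_simp
  have hRe : R = 4 / c * (ρ ^ (1 + N / 2) * Real.sqrt l) := by
    rw [hR, ht, hS, Real.rpow_add hρ0, Real.rpow_one]
    field_simp
  have hρR : 24 * ρ ≤ R := by
    have : 0 ≤ R := by positivity
    nlinarith
  have hR0 : 0 < R := by linarith
  have hρp : ρ ^ (1 + N / 2) ≤ R := by
    rw [hRe]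
    have : 1 ≤ 4 / c := by
      rw [le_div_iff₀ hc]
      linarith
    calc _ = 1 * (ρ ^ (1 + N / 2) * 1) := by ring
      _ ≤ _ := by gcongr
  have hlogR : 1 + Real.log R ≤ (4 + N / 2) * l := by
    have e1 : Real.log (4 / c) ≤ l := Real.log_le_log h4c (by linarith)
    have e2 : Real.log (Real.sqrt l) ≤ l := by
      have := Real.log_le_sub_one_of_pos (show 0 < Real.sqrt l by positivity)
      have : Real.sqrt l ≤ l := Real.sqrt_le_iff.2 ⟨hl0.le, by nlinarith⟩
      linarith
    rw [hRe, Real.log_mul (by positivity) (by positivity), Real.log_mul (by positivity) (by positivity),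
      Real.log_rpow hρ0, ← hl]
    linarith
  set ε := t * Real.sqrt (a₀ * (9 * ρ) ^ N) with hε
  have hε0 : 0 < ε := by positivity
  have hε2 : ε ^ 2 = t ^ 2 * (a₀ * (9 * ρ) ^ N) := by
    rw [hε, mul_pow, Real.sq_sqrt (by positivity)]
  have hε3 : ε ^ 2 * l = c ^ 2 * (a₀ * 9 ^ N) := by
    have e1 : (ρ ^ (N / 2)) ^ 2 = ρ ^ N := by
      rw [← Real.rpow_natCast, ← Real.rpow_mul hρ0.le]
      congr 1
      push_cast
      ring
    rw [hε2, ht, hS, div_pow, mul_pow, e1, Real.sq_sqrt hl0.le, Real.mul_rpow (by norm_num) hρ0.le]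
    field_simp
  have hεδ : ε ^ 2 * (1 + Real.log R) ≤ δ := by
    calc _ ≤ ε ^ 2 * ((4 + N / 2) * l) := by gcongr
      _ = c ^ 2 * (a₀ * 9 ^ N * (4 + N / 2)) := by
        rw [← mul_assoc (c ^ 2), ← hε3]
        ring
      _ ≤ δ := hcδ
  have hnorm : ∀ z : ℂ, ‖z₀ + t * z‖ ≤ ρ + t * ‖z‖ := fun z => by
    refine (norm_add_le _ _).trans (le_of_eq ?_)
    rw [norm_mul, Complex.norm_real, Real.norm_of_nonneg ht0.le]
  have hbdd : BddAbove ((fun z => |u z|) '' Metric.ball z₀ 1) := by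
    refine ⟨Real.exp (c₀ * (ρ + 1) ^ (1 + N / 2)), ?_⟩
    rintro _ ⟨z, hz, rfl⟩
    refine (hb z).trans ?_
    rw [Metric.mem_ball, dist_eq_norm] at hz
    have := norm_sub_norm_le z z₀
    gcongr
    linarith
  have htc : (t : ℂ) ≠ 0 := Complex.ofReal_ne_zero.2 ht0.ne'
  have hnz : ‖-(z₀ / t)‖ = R / 4 := by
    rw [norm_neg, norm_div, Complex.norm_real, Real.norm_of_nonneg ht0.le, hR]
    ring
  have key := h (fun w => u (z₀ + t * w))
    (hu.comp (contDiff_const.add (contDiff_const.mul contDiff_id))) R ε (by linarith) hε0 hεδ ?_ ?_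
    (-(z₀ / t)) (by rw [hnz]; linarith) hnz.le ?_ (sSup ((fun z => |u z|) '' Metric.ball z₀ 1)) ?_
  · refine le_trans (Real.exp_le_exp.2 (neg_le_neg ?_)) key
    have hl32 : l ^ ((3 : ℝ) / 2) = Real.sqrt l * l := by
      rw [Real.sqrt_eq_rpow, ← Real.rpow_add_one hl0.ne']
      norm_num
    calc C * (R * Real.log R) ≤ C * (R * ((4 + N / 2) * l)) := by
          gcongr
          linarith
      _ = _ := by
        rw [hl32, hRe]
        ring
  · intro z hz
    rw [Landis.planeLaplacian_comp_add_mul hu, hVu, abs_mul, abs_mul, abs_of_nonneg (sq_nonneg t),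
      hε2, ← mul_assoc]
    have : ‖z₀ + t * z‖ ≤ 9 * ρ := by
      have := hnorm z
      have : t * ‖z‖ ≤ t * (2 * R) := by gcongr
      linarith
    gcongr
    refine (hV _).trans ?_
    gcongr
  · intro z hz
    have : ‖z₀ + t * z‖ ≤ 5 * ρ := by
      have := hnorm z
      have : t * ‖z‖ ≤ t * R := by gcongr
      linarith
    refine (hb _).trans (Real.exp_le_exp.2 ?_)
    calc _ ≤ c₀ * (5 * ρ) ^ (1 + N / 2) := by gcongr
      _ = c₀ * 5 ^ (1 + N / 2) * ρ ^ (1 + N / 2) := by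
        rw [Real.mul_rpow (by norm_num) hρ0.le]
        ring
      _ ≤ _ := by gcongr
  · have : z₀ + t * -(z₀ / t) = 0 := by
      field_simp
      ring
    simp only [this, hu0]
  · intro z hz
    refine le_csSup hbdd ⟨_, ?_, rfl⟩
    rw [mem_ball_zero_iff] at hz
    rw [Metric.mem_ball, dist_eq_norm, add_sub_cancel_left, norm_mul, Complex.norm_real,
      Real.norm_of_nonneg ht0.le]
    nlinarith [norm_nonneg z]
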